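/- Let d ≥ 1, T ∈ (-∞, ∞], α ∈ (0,2), λ > 0, p ∈ (1,∞), and γ ∈ (p(α-1)_+ - 1, 2p - 1). Then there exists a constant N > 0, depending only on d, α, γ, p, such that for every smooth function u : ℝ × ℝ^d → ℝ with compact support contained in (-∞,T) × ℝ^{d-1} × (0,∞), setting f(t,x) = x_d^{-α}(u_t(t,x) + λ u(t,x)) - Δu(t,x) (so that u solves u_t + λu - x_d^α Δu = x_d^α f in Ω_T with zero boundary condition), one has ‖χ^{-α} u_t‖_{L_p(Ω_T, x_d^γ dz)} + λ‖χ^{-α} u‖_{L_p(Ω_T, x_d^γ dz)} + ‖D²u‖_{L_p(Ω_T, x_d^γ dz)} ≤ N ‖f‖_{L_p(Ω_T, x_d^γ dz)}. -/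

import Mathlib

open MeasureTheory ENNReal Set

noncomputable section

abbrev Ed (d : ℕ) : Type := EuclideanSpace ℝ (Fin d)

/-- The last coordinate `x_d` of a point `x ∈ ℝ^d` (junk value `0` if `d = 0`). -/
def xd {d : ℕ} (x : Ed d) : ℝ :=
  if h : 0 < d then x ⟨d - 1, Nat.sub_lt h one_pos⟩ else 0

/-- `Ω_T = (-∞, T) × ℝ^d_+`. -/
def OmegaT (d : ℕ) (T : EReal) : Set (ℝ × Ed d) :=
  {z | (z.1 : EReal) < T ∧ 0 < xd z.2}

/-- Time derivative `u_t`. -/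
def ut {d : ℕ} (u : ℝ × Ed d → ℝ) (z : ℝ × Ed d) : ℝ :=
  deriv (fun s => u (s, z.2)) z.1

/-- Spatial gradient `Du`. -/
def Du {d : ℕ} (u : ℝ × Ed d → ℝ) (z : ℝ × Ed d) : Ed d →L[ℝ] ℝ :=
  fderiv ℝ (fun y => u (z.1, y)) z.2

/-- Spatial Hessian `D²u`. -/
def D2u {d : ℕ} (u : ℝ × Ed d → ℝ) (z : ℝ × Ed d) : Ed d →L[ℝ] Ed d →L[ℝ] ℝ :=
  fderiv ℝ (fun y => Du u (z.1, y)) z.2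

/-- Spatial Laplacian `Δu`. -/
def lap {d : ℕ} (u : ℝ × Ed d → ℝ) (z : ℝ × Ed d) : ℝ :=
  ∑ i : Fin d, D2u u z (EuclideanSpace.single i 1) (EuclideanSpace.single i 1)

/-- Weighted Lebesgue norm `‖g‖_{L_p(Ω_T, x_d^γ dz)}`. -/
def wLp (d : ℕ) (T : EReal) (p γ : ℝ) (g : ℝ × Ed d → ℝ) : ℝ≥0∞ :=
  (∫⁻ z in OmegaT d T, ENNReal.ofReal (|g z| ^ p * xd z.2 ^ γ)) ^ (1 / p)

/-- A nested family of countable partitions into cells, those of generation `k` having common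
measure `vol k`. -/
structure Grid (G : Type*) [TopologicalSpace G] [MeasurableSpace G] (μ : Measure G) where
  ι : Type
  countable : Countable ι
  idx : ℤ → G → ι
  measurable_cell : ∀ k i, MeasurableSet {z | idx k z = i}
  nested : ∀ k z z', idx k z = idx k z' → idx (k + 1) z = idx (k + 1) z'
  vol : ℤ → ℝ≥0∞
  vol_ne_zero : ∀ k, vol k ≠ 0
  vol_ne_top : ∀ k, vol k ≠ ⊤
  measure_cell : ∀ k z, μ {z' | idx k z' = idx k z} = vol k
  ratio : ℝ≥0∞
  ratio_ne_top : ratio ≠ ⊤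
  vol_succ : ∀ k, vol (k + 1) ≤ ratio * vol k
  vol_large : ∀ C : ℝ≥0∞, C ≠ ⊤ → ∃ k₀, ∀ k ≥ k₀, C ≤ vol k
  small : ∀ z, ∀ U ∈ nhds z, ∃ k, ∀ z', idx k z' = idx k z → z' ∈ U

namespace Grid

variable {G : Type*} [TopologicalSpace G] [MeasurableSpace G] {μ : Measure G} (𝒢 : Grid G μ)

instance : Countable 𝒢.ι := 𝒢.countable

def cell (q : ℤ × 𝒢.ι) : Set G := {z | 𝒢.idx q.1 z = q.2}

/-- The average of `|f|` over the cell exceeds `s`. -/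
def Big (f : G → ℝ) (s : ℝ≥0∞) (q : ℤ × 𝒢.ι) : Prop :=
  s * 𝒢.vol q.1 < ∫⁻ z in 𝒢.cell q, ‖f z‖ₑ ∂μ

/-- The maximal cells among those on which the average of `|f|` exceeds `s`. -/
def Sel (f : G → ℝ) (s : ℝ≥0∞) : Set (ℤ × 𝒢.ι) :=
  {q | 𝒢.Big f s q ∧ ∀ k > q.1, ∀ z ∈ 𝒢.cell q, ¬ 𝒢.Big f s (k, 𝒢.idx k z)}

def bad (f : G → ℝ) (s : ℝ≥0∞) : Set G := ⋃ q : 𝒢.Sel f s, 𝒢.cell q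

lemma measurableSet_cell (q : ℤ × 𝒢.ι) : MeasurableSet (𝒢.cell q) := 𝒢.measurable_cell _ _

lemma measurableSet_bad (f : G → ℝ) (s : ℝ≥0∞) : MeasurableSet (𝒢.bad f s) :=
  MeasurableSet.iUnion fun q => 𝒢.measurableSet_cell q

lemma measure_cell_of_mem {q : ℤ × 𝒢.ι} {z : G} (hz : z ∈ 𝒢.cell q) :
    μ (𝒢.cell q) = 𝒢.vol q.1 := by
  have h : 𝒢.cell q = {z' | 𝒢.idx q.1 z' = 𝒢.idx q.1 z} := by
    ext z'; simp only [cell, mem_ofPred_eq] at hz ⊢; rw [hz]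
  rw [h, 𝒢.measure_cell]

lemma nested_le {k l : ℤ} (hkl : k ≤ l) {z z' : G} (h : 𝒢.idx k z = 𝒢.idx k z') :
    𝒢.idx l z = 𝒢.idx l z' := by
  induction l, hkl using Int.leInduction with
  | base => exact h
  | succ n _ ih => exact 𝒢.nested _ _ _ ih

lemma Big.nonempty {f : G → ℝ} {s : ℝ≥0∞} {q : ℤ × 𝒢.ι} (h : 𝒢.Big f s q) :
    (𝒢.cell q).Nonempty := by
  by_contra hne
  rw [not_nonempty_iff_eq_empty] at hne
  simp [Big, hne] at h

lemma pairwise_disjoint (f : G → ℝ) (s : ℝ≥0∞) :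
    Pairwise (Function.onFun Disjoint fun q : 𝒢.Sel f s => 𝒢.cell q) := by
  have key : ∀ q q' : 𝒢.Sel f s, ∀ z, z ∈ 𝒢.cell q → z ∈ 𝒢.cell q' → ¬ q.1.1 < q'.1.1 := by
    intro q q' z hz hz' hlt
    refine q.2.2 _ hlt z hz ?_
    have : (q'.1.1, 𝒢.idx q'.1.1 z) = q'.1 := Prod.ext rfl hz'
    rw [this]; exact q'.2.1
  intro q q' hne
  refine Set.disjoint_left.2 fun z hz hz' => hne ?_
  have h1 : q.1.1 = q'.1.1 :=
    le_antisymm (not_lt.1 (key q' q z hz' hz)) (not_lt.1 (key q q' z hz hz'))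
  refine Subtype.ext (Prod.ext h1 ?_)
  have h2 : 𝒢.idx q.1.1 z = q.1.2 := hz
  have h3 : 𝒢.idx q'.1.1 z = q'.1.2 := hz'
  rw [← h2, ← h3, h1]

lemma mem_bad_of_big {f : G → ℝ} (hf : ∫⁻ z, ‖f z‖ₑ ∂μ ≠ ⊤) {s : ℝ≥0∞} (hs : s ≠ 0)
    (hs' : s ≠ ⊤) {z : G} {k : ℤ} (hk : 𝒢.Big f s (k, 𝒢.idx k z)) : z ∈ 𝒢.bad f s := by
  classical
  obtain ⟨k₀, hk₀⟩ := 𝒢.vol_large (s⁻¹ * ∫⁻ z, ‖f z‖ₑ ∂μ)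
    (ENNReal.mul_ne_top (ENNReal.inv_ne_top.2 hs) hf)
  have hbdd : ∀ l, 𝒢.Big f s (l, 𝒢.idx l z) → l ≤ k₀ := by
    intro l hl
    by_contra hlt
    have h1 := hk₀ l (le_of_lt (not_le.1 hlt))
    have h2 : ∫⁻ z, ‖f z‖ₑ ∂μ ≤ s * 𝒢.vol l := by
      calc ∫⁻ z, ‖f z‖ₑ ∂μ = s * (s⁻¹ * ∫⁻ z, ‖f z‖ₑ ∂μ) := by
            rw [← mul_assoc, ENNReal.mul_inv_cancel hs hs', one_mul]
        _ ≤ _ := by gcongr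
    exact absurd hl (not_lt.2 ((setLIntegral_le_lintegral _ _).trans h2))
  obtain ⟨l, hl, hmax⟩ := Int.exists_greatest_of_bdd
    (P := fun l => 𝒢.Big f s (l, 𝒢.idx l z)) ⟨k₀, hbdd⟩ ⟨k, hk⟩
  refine mem_iUnion.2 ⟨⟨(l, 𝒢.idx l z), hl, ?_⟩, rfl⟩
  intro m hm z' hz' hbig
  have h1 : 𝒢.idx m z' = 𝒢.idx m z := 𝒢.nested_le (le_of_lt hm) hz'
  rw [h1] at hbig
  exact absurd (hmax m hbig) (not_le.2 hm)

lemma lintegral_cell_le {f : G → ℝ} {s : ℝ≥0∞} {q : ℤ × 𝒢.ι} (hq : q ∈ 𝒢.Sel f s) :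
    ∫⁻ z in 𝒢.cell q, ‖f z‖ₑ ∂μ ≤ s * 𝒢.ratio * μ (𝒢.cell q) := by
  obtain ⟨z, hz⟩ := Big.nonempty 𝒢 hq.1
  have h1 : 𝒢.cell q ⊆ 𝒢.cell (q.1 + 1, 𝒢.idx (q.1 + 1) z) := by
    intro z' hz'
    refine 𝒢.nested _ _ _ ?_
    have h2 : 𝒢.idx q.1 z = q.2 := hz
    have h3 : 𝒢.idx q.1 z' = q.2 := hz'
    rw [h2, h3]
  calc ∫⁻ z in 𝒢.cell q, ‖f z‖ₑ ∂μ
      ≤ ∫⁻ z in 𝒢.cell (q.1 + 1, 𝒢.idx (q.1 + 1) z), ‖f z‖ₑ ∂μ := lintegral_mono_set h1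
    _ ≤ s * 𝒢.vol (q.1 + 1) := not_lt.1 (hq.2 _ (by simp) z hz)
    _ ≤ s * (𝒢.ratio * 𝒢.vol q.1) := by gcongr; exact 𝒢.vol_succ _
    _ = _ := by rw [𝒢.measure_cell_of_mem hz, mul_assoc]

lemma enorm_le_of_notMem_bad {f : G → ℝ} (hfc : Continuous f) (hf : ∫⁻ z, ‖f z‖ₑ ∂μ ≠ ⊤)
    {s : ℝ≥0∞} (hs : s ≠ 0) (hs' : s ≠ ⊤) {z : G} (hz : z ∉ 𝒢.bad f s) : ‖f z‖ₑ ≤ s := by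
  by_contra hlt
  obtain ⟨t, ht1, ht2⟩ := exists_between (not_le.1 hlt)
  have hU : {y | t < ‖f y‖ₑ} ∈ nhds z :=
    (isOpen_lt continuous_const hfc.enorm).mem_nhds ht2
  obtain ⟨k, hk⟩ := 𝒢.small z _ hU
  refine hz (𝒢.mem_bad_of_big hf hs hs' (k := k) ?_)
  have hm : μ (𝒢.cell (k, 𝒢.idx k z)) = 𝒢.vol k := 𝒢.measure_cell_of_mem (q := (k, _)) rfl
  calc s * 𝒢.vol k < t * 𝒢.vol k :=
        (ENNReal.mul_lt_mul_iff_left (𝒢.vol_ne_zero k) (𝒢.vol_ne_top k)).2 ht1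
    _ = ∫⁻ y in 𝒢.cell (k, 𝒢.idx k z), t ∂μ := by rw [setLIntegral_const, hm]
    _ ≤ _ := setLIntegral_mono' (𝒢.measurableSet_cell _) fun y hy => (hk y hy).le

lemma lintegral_bad (f : G → ℝ) (s : ℝ≥0∞) (g : G → ℝ≥0∞) :
    ∫⁻ z in 𝒢.bad f s, g z ∂μ = ∑' q : 𝒢.Sel f s, ∫⁻ z in 𝒢.cell q, g z ∂μ :=
  lintegral_iUnion (fun _ => 𝒢.measurableSet_cell _) (𝒢.pairwise_disjoint f s) _

lemma measure_bad (f : G → ℝ) (s : ℝ≥0∞) :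
    μ (𝒢.bad f s) = ∑' q : 𝒢.Sel f s, μ (𝒢.cell q) :=
  measure_iUnion (𝒢.pairwise_disjoint f s) (fun _ => 𝒢.measurableSet_cell _)

lemma lintegral_bad_le (f : G → ℝ) (s : ℝ≥0∞) :
    ∫⁻ z in 𝒢.bad f s, ‖f z‖ₑ ∂μ ≤ s * 𝒢.ratio * μ (𝒢.bad f s) := by
  rw [lintegral_bad, measure_bad, ← ENNReal.tsum_mul_left]
  exact ENNReal.tsum_le_tsum fun q => 𝒢.lintegral_cell_le q.2

lemma le_lintegral_bad (f : G → ℝ) (s : ℝ≥0∞) :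
    s * μ (𝒢.bad f s) ≤ ∫⁻ z in 𝒢.bad f s, ‖f z‖ₑ ∂μ := by
  rw [lintegral_bad, measure_bad, ← ENNReal.tsum_mul_left]
  refine ENNReal.tsum_le_tsum fun q => ?_
  obtain ⟨z, hz⟩ := Big.nonempty 𝒢 q.2.1
  rw [𝒢.measure_cell_of_mem hz]
  exact q.2.1.le

lemma measure_bad_ne_top {f : G → ℝ} (hf : ∫⁻ z, ‖f z‖ₑ ∂μ ≠ ⊤) {s : ℝ≥0∞} (hs : s ≠ 0) :
    μ (𝒢.bad f s) ≠ ⊤ := by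
  intro h
  have h1 := (𝒢.le_lintegral_bad f s).trans (setLIntegral_le_lintegral _ _)
  rw [h, ENNReal.mul_top hs] at h1
  exact hf (top_le_iff.1 h1)

lemma measure_bad_le {f : G → ℝ} (hfc : Measurable f) (hf : ∫⁻ z, ‖f z‖ₑ ∂μ ≠ ⊤)
    {s : ℝ≥0∞} (hs : s ≠ 0) (hs' : s ≠ ⊤) :
    μ (𝒢.bad f s) ≤ 2 * s⁻¹ * ∫⁻ z in {z | s < 2 * ‖f z‖ₑ}, ‖f z‖ₑ ∂μ := by
  have hfin := 𝒢.measure_bad_ne_top hf hs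
  set L := ∫⁻ z in {z | s < 2 * ‖f z‖ₑ}, ‖f z‖ₑ ∂μ
  have hms : MeasurableSet {z | s < 2 * ‖f z‖ₑ} :=
    measurableSet_lt measurable_const (hfc.enorm.const_mul 2)
  have h1 : 2 * ∫⁻ z in 𝒢.bad f s, ‖f z‖ₑ ∂μ ≤ 2 * L + s * μ (𝒢.bad f s) := by
    calc 2 * ∫⁻ z in 𝒢.bad f s, ‖f z‖ₑ ∂μ
        = ∫⁻ z in 𝒢.bad f s, 2 * ‖f z‖ₑ ∂μ := by rw [lintegral_const_mul _ hfc.enorm]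
      _ ≤ ∫⁻ z in 𝒢.bad f s, ({z | s < 2 * ‖f z‖ₑ}.indicator (fun z => 2 * ‖f z‖ₑ) z + s) ∂μ := by
          refine lintegral_mono fun z => ?_
          by_cases h : s < 2 * ‖f z‖ₑ
          · simp [indicator, h]
          · rw [indicator_of_notMem (show z ∉ {z | s < 2 * ‖f z‖ₑ} from h), zero_add]
            exact not_lt.1 h
      _ = ∫⁻ z in 𝒢.bad f s, {z | s < 2 * ‖f z‖ₑ}.indicator (fun z => 2 * ‖f z‖ₑ) z ∂μ
          + s * μ (𝒢.bad f s) := by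
          rw [lintegral_add_right _ measurable_const, setLIntegral_const]
      _ ≤ ∫⁻ z, {z | s < 2 * ‖f z‖ₑ}.indicator (fun z => 2 * ‖f z‖ₑ) z ∂μ
          + s * μ (𝒢.bad f s) := add_le_add (setLIntegral_le_lintegral _ _) le_rfl
      _ = _ := by rw [lintegral_indicator hms, lintegral_const_mul _ hfc.enorm]
  have h2 : s * μ (𝒢.bad f s) + s * μ (𝒢.bad f s) ≤ 2 * L + s * μ (𝒢.bad f s) := by
    rw [← two_mul]
    exact (mul_le_mul_right (𝒢.le_lintegral_bad f s) 2).trans h1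
  have h3 : s * μ (𝒢.bad f s) ≤ 2 * L :=
    (ENNReal.add_le_add_iff_right (ENNReal.mul_ne_top hs' hfin)).1 h2
  calc μ (𝒢.bad f s) = s⁻¹ * (s * μ (𝒢.bad f s)) := by
        rw [← mul_assoc, ENNReal.inv_mul_cancel hs hs', one_mul]
    _ ≤ s⁻¹ * (2 * L) := by gcongr
    _ = _ := by ring

end Grid

namespace Grid

section good
variable {G : Type*} [TopologicalSpace G] [MeasurableSpace G] {μ : Measure G} (𝒢 : Grid G μ)

open Classical in
/-- The good part of the Calderón–Zygmund decomposition of `f` at level `s`. -/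
def good (f : G → ℝ) (s : ℝ≥0∞) (z : G) : ℝ :=
  if h : ∃ q : 𝒢.Sel f s, z ∈ 𝒢.cell q then ⨍ y in 𝒢.cell h.choose, f y ∂μ else f z

lemma good_of_notMem {f : G → ℝ} {s : ℝ≥0∞} {z : G} (hz : z ∉ 𝒢.bad f s) :
    𝒢.good f s z = f z := by
  rw [good, dif_neg]
  exact fun h => hz (mem_iUnion.2 h)

lemma good_of_mem {f : G → ℝ} {s : ℝ≥0∞} {z : G} (q : 𝒢.Sel f s) (hz : z ∈ 𝒢.cell q) :
    𝒢.good f s z = ⨍ y in 𝒢.cell q, f y ∂μ := by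
  have h : ∃ q : 𝒢.Sel f s, z ∈ 𝒢.cell q := ⟨q, hz⟩
  rw [good, dif_pos h]
  have : h.choose = q := by
    by_contra hne
    exact Set.disjoint_left.1 (𝒢.pairwise_disjoint f s hne) h.choose_spec hz
  rw [this]

lemma measurable_good {f : G → ℝ} (hf : Measurable f) (s : ℝ≥0∞) :
    Measurable (𝒢.good f s) := by
  intro B hB
  have : 𝒢.good f s ⁻¹' B = ((𝒢.bad f s)ᶜ ∩ f ⁻¹' B) ∪
      ⋃ q : 𝒢.Sel f s, ⋃ _ : (⨍ y in 𝒢.cell q, f y ∂μ) ∈ B, 𝒢.cell q := by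
    ext z
    simp only [mem_preimage, mem_union, mem_inter_iff, mem_compl_iff, mem_iUnion, exists_prop]
    by_cases hz : z ∈ 𝒢.bad f s
    · obtain ⟨q, hq⟩ := mem_iUnion.1 hz
      rw [𝒢.good_of_mem q hq]
      constructor
      · exact fun h => Or.inr ⟨q, h, hq⟩
      · rintro (h | ⟨q', h, hq'⟩)
        · exact absurd hz h.1
        · rwa [← 𝒢.good_of_mem q hq, 𝒢.good_of_mem q' hq']
    · rw [𝒢.good_of_notMem hz]
      constructor
      · exact fun h => Or.inl ⟨hz, h⟩
      · rintro (h | ⟨q', h, hq'⟩)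
        · exact h.2
        · exact absurd (mem_iUnion.2 ⟨q', hq'⟩) hz
  rw [this]
  refine ((𝒢.measurableSet_bad f s).compl.inter (hf hB)).union ?_
  exact MeasurableSet.iUnion fun q => MeasurableSet.iUnion fun _ => 𝒢.measurableSet_cell _

lemma measure_cell_ne_zero {f : G → ℝ} {s : ℝ≥0∞} (q : 𝒢.Sel f s) : μ (𝒢.cell q) ≠ 0 := by
  obtain ⟨z, hz⟩ := Big.nonempty 𝒢 q.2.1
  rw [𝒢.measure_cell_of_mem hz]; exact 𝒢.vol_ne_zero _

lemma measure_cell_ne_top {f : G → ℝ} {s : ℝ≥0∞} (q : 𝒢.Sel f s) : μ (𝒢.cell q) ≠ ⊤ := by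
  obtain ⟨z, hz⟩ := Big.nonempty 𝒢 q.2.1
  rw [𝒢.measure_cell_of_mem hz]; exact 𝒢.vol_ne_top _

lemma enorm_average_le {f : G → ℝ} {s : ℝ≥0∞} (q : 𝒢.Sel f s) :
    ‖⨍ y in 𝒢.cell q, f y ∂μ‖ₑ ≤ (μ (𝒢.cell q))⁻¹ * ∫⁻ y in 𝒢.cell q, ‖f y‖ₑ ∂μ := by
  rw [setAverage_eq, smul_eq_mul, enorm_mul]
  refine mul_le_mul' (le_of_eq ?_) (enorm_integral_le_lintegral_enorm _)
  have h0 := 𝒢.measure_cell_ne_zero q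
  have h1 := 𝒢.measure_cell_ne_top q
  have h2 : 0 < (μ (𝒢.cell q)).toReal := ENNReal.toReal_pos h0 h1
  rw [Measure.real, Real.enorm_eq_ofReal (by positivity), ENNReal.ofReal_inv_of_pos h2,
    ENNReal.ofReal_toReal h1]

lemma enorm_good_le {f : G → ℝ} {s : ℝ≥0∞} {z : G} (hz : z ∈ 𝒢.bad f s) :
    ‖𝒢.good f s z‖ₑ ≤ s * 𝒢.ratio := by
  obtain ⟨q, hq⟩ := mem_iUnion.1 hz
  have h0 := 𝒢.measure_cell_ne_zero q
  have h1 := 𝒢.measure_cell_ne_top q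
  rw [𝒢.good_of_mem q hq]
  calc _ ≤ (μ (𝒢.cell q))⁻¹ * ∫⁻ y in 𝒢.cell q, ‖f y‖ₑ ∂μ := 𝒢.enorm_average_le q
    _ ≤ (μ (𝒢.cell q))⁻¹ * (s * 𝒢.ratio * μ (𝒢.cell q)) := by
        gcongr; exact 𝒢.lintegral_cell_le q.2
    _ = ((μ (𝒢.cell q))⁻¹ * μ (𝒢.cell q)) * (s * 𝒢.ratio) := by ring
    _ = _ := by rw [ENNReal.inv_mul_cancel h0 h1, one_mul]

lemma abs_good_le {f : G → ℝ} {M : ℝ} (hM : ∀ z, |f z| ≤ M) (s : ℝ≥0∞) (z : G) :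
    |𝒢.good f s z| ≤ M := by
  by_cases hz : z ∈ 𝒢.bad f s
  · obtain ⟨q, hq⟩ := mem_iUnion.1 hz
    have h0 := 𝒢.measure_cell_ne_zero q
    have h1 := 𝒢.measure_cell_ne_top q
    have h2 : 0 < (μ (𝒢.cell q)).toReal := ENNReal.toReal_pos h0 h1
    rw [𝒢.good_of_mem q hq, setAverage_eq, smul_eq_mul, abs_mul, abs_of_pos (by
      rw [Measure.real]; positivity)]
    have h3 : |∫ y in 𝒢.cell q, f y ∂μ| ≤ M * (μ (𝒢.cell q)).toReal := by
      rw [← Real.norm_eq_abs]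
      exact norm_setIntegral_le_of_norm_le_const h1.lt_top fun y _ => hM y
    rw [Measure.real, inv_mul_le_iff₀ h2, mul_comm]
    exact h3
  · rw [𝒢.good_of_notMem hz]; exact hM z

lemma lintegral_enorm_good {f : G → ℝ} (hf : ∫⁻ z, ‖f z‖ₑ ∂μ ≠ ⊤)
    {s : ℝ≥0∞} (hs : s ≠ 0) (hs' : s ≠ ⊤) : ∫⁻ z, ‖𝒢.good f s z‖ₑ ∂μ < ⊤ := by
  rw [← lintegral_add_compl _ (𝒢.measurableSet_bad f s)]
  refine ENNReal.add_lt_top.2 ⟨?_, ?_⟩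
  · calc ∫⁻ z in 𝒢.bad f s, ‖𝒢.good f s z‖ₑ ∂μ ≤ ∫⁻ z in 𝒢.bad f s, s * 𝒢.ratio ∂μ :=
        setLIntegral_mono' (𝒢.measurableSet_bad f s) fun z hz => 𝒢.enorm_good_le hz
      _ = s * 𝒢.ratio * μ (𝒢.bad f s) := setLIntegral_const _ _
      _ < ⊤ := (ENNReal.mul_ne_top (ENNReal.mul_ne_top hs' 𝒢.ratio_ne_top)
            (𝒢.measure_bad_ne_top hf hs)).lt_top
  · calc ∫⁻ z in (𝒢.bad f s)ᶜ, ‖𝒢.good f s z‖ₑ ∂μ = ∫⁻ z in (𝒢.bad f s)ᶜ, ‖f z‖ₑ ∂μ :=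
        setLIntegral_congr_fun (𝒢.measurableSet_bad f s).compl fun z hz => by
          rw [𝒢.good_of_notMem hz]
      _ ≤ _ := setLIntegral_le_lintegral _ _
      _ < ⊤ := hf.lt_top

lemma lintegral_enorm_good_sq_le {f : G → ℝ}
    {s : ℝ≥0∞} (hfs : ∀ z ∉ 𝒢.bad f s, ‖f z‖ₑ ≤ s) :
    ∫⁻ z, ‖𝒢.good f s z‖ₑ ^ 2 ∂μ ≤
      (s * 𝒢.ratio) ^ 2 * μ (𝒢.bad f s) + ∫⁻ z in {z | ‖f z‖ₑ ≤ s}, ‖f z‖ₑ ^ 2 ∂μ := by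
  rw [← lintegral_add_compl _ (𝒢.measurableSet_bad f s)]
  refine add_le_add ?_ ?_
  · calc ∫⁻ z in 𝒢.bad f s, ‖𝒢.good f s z‖ₑ ^ 2 ∂μ ≤ ∫⁻ z in 𝒢.bad f s, (s * 𝒢.ratio) ^ 2 ∂μ :=
        setLIntegral_mono' (𝒢.measurableSet_bad f s) fun z hz =>
          pow_le_pow_left' (𝒢.enorm_good_le hz) 2
      _ = _ := setLIntegral_const _ _
  · calc ∫⁻ z in (𝒢.bad f s)ᶜ, ‖𝒢.good f s z‖ₑ ^ 2 ∂μ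
        = ∫⁻ z in (𝒢.bad f s)ᶜ, ‖f z‖ₑ ^ 2 ∂μ :=
        setLIntegral_congr_fun (𝒢.measurableSet_bad f s).compl fun z hz => by
          simp only [𝒢.good_of_notMem hz]
      _ ≤ _ := lintegral_mono_set fun z hz => hfs z hz

lemma setIntegral_sub_good {f : G → ℝ} (hf : Integrable f μ) {s : ℝ≥0∞}
    (q : 𝒢.Sel f s) : ∫ y in 𝒢.cell q, (f y - 𝒢.good f s y) ∂μ = 0 := by
  have h0 := 𝒢.measure_cell_ne_zero q
  have h1 := 𝒢.measure_cell_ne_top q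
  have : ∫ y in 𝒢.cell q, (f y - 𝒢.good f s y) ∂μ
      = ∫ y in 𝒢.cell q, (f y - ⨍ y in 𝒢.cell q, f y ∂μ) ∂μ :=
    setIntegral_congr_fun (𝒢.measurableSet_cell _) fun y hy => by
      simp only [𝒢.good_of_mem q hy]
  rw [this, integral_sub hf.integrableOn (integrableOn_const h1), setIntegral_const,
    setAverage_eq, smul_eq_mul, smul_eq_mul, ← mul_assoc, mul_inv_cancel₀, one_mul, sub_self]
  exact (ENNReal.toReal_pos h0 h1).ne'

lemma lintegral_enorm_sub_good_le {f : G → ℝ} (hf : Measurable f) (s : ℝ≥0∞) :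
    ∫⁻ z in 𝒢.bad f s, ‖f z - 𝒢.good f s z‖ₑ ∂μ ≤ 2 * (s * 𝒢.ratio * μ (𝒢.bad f s)) := by
  calc ∫⁻ z in 𝒢.bad f s, ‖f z - 𝒢.good f s z‖ₑ ∂μ
      ≤ ∫⁻ z in 𝒢.bad f s, (‖f z‖ₑ + s * 𝒢.ratio) ∂μ :=
        setLIntegral_mono' (𝒢.measurableSet_bad f s) fun z hz =>
          (enorm_sub_le).trans (add_le_add le_rfl (𝒢.enorm_good_le hz))
    _ = ∫⁻ z in 𝒢.bad f s, ‖f z‖ₑ ∂μ + s * 𝒢.ratio * μ (𝒢.bad f s) := by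
        rw [lintegral_add_left hf.enorm, setLIntegral_const]
    _ ≤ _ := by rw [two_mul]; exact add_le_add (𝒢.lintegral_bad_le f s) le_rfl

end good

end Grid

section CZKernel

variable {G : Type*} [NormedAddCommGroup G] [NormedSpace ℝ G] [FiniteDimensional ℝ G]
  [MeasurableSpace G] [BorelSpace G] {μ : Measure G} [μ.IsAddHaarMeasure]

/-- Convolution with the kernel `K`. -/
def cv (μ : Measure G) (K f : G → ℝ) (z : G) : ℝ := ∫ y, K (z - y) * f y ∂μ

lemma measurable_cv {K f : G → ℝ} (hK : Measurable K) (hf : Measurable f) :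
    Measurable (cv μ K f) := by
  have : StronglyMeasurable (Function.uncurry fun z y : G => K (z - y) * f y) := by
    apply Measurable.stronglyMeasurable
    exact (hK.comp (measurable_fst.sub measurable_snd)).mul (hf.comp measurable_snd)
  exact this.integral_prod_right.measurable

lemma integrable_cv_kernel {K f : G → ℝ} (hK : Integrable K μ) (hf : Measurable f) {M : ℝ}
    (hM : ∀ z, |f z| ≤ M) (z : G) : Integrable (fun y => K (z - y) * f y) μ :=
  (hK.comp_sub_left z).mul_bdd hf.aestronglyMeasurable (c := M)
    (Filter.Eventually.of_forall fun y => hM y)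

lemma cv_add {K f g : G → ℝ} (hK : Integrable K μ) (hf : Measurable f) {M : ℝ}
    (hM : ∀ z, |f z| ≤ M) (hg : Measurable g) {M' : ℝ} (hM' : ∀ z, |g z| ≤ M') (z : G) :
    cv μ K (fun y => f y + g y) z = cv μ K f z + cv μ K g z := by
  simp only [cv, mul_add]
  exact integral_add (integrable_cv_kernel hK hf hM z) (integrable_cv_kernel hK hg hM' z)

/-- Hypotheses of Calderón–Zygmund theory for an integrable kernel `K`, in quantitative form. -/
structure IsCZKernel (𝒢 : Grid G μ) (K : G → ℝ) (A : ℝ≥0∞) (star : ℤ × 𝒢.ι → Set G) : Prop where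
  measurable : Measurable K
  integrable : Integrable K μ
  l2 : ∀ g : G → ℝ, Measurable g → Integrable g μ → (∃ M, ∀ z, |g z| ≤ M) →
    ∫⁻ z, ‖cv μ K g z‖ₑ ^ 2 ∂μ ≤ A * ∫⁻ z, ‖g z‖ₑ ^ 2 ∂μ
  measurable_star : ∀ q, MeasurableSet (star q)
  measure_star : ∀ q, μ (star q) ≤ A * 𝒢.vol q.1
  hormander : ∀ q, ∀ y ∈ 𝒢.cell q, ∀ y' ∈ 𝒢.cell q,
    ∫⁻ z in (star q)ᶜ, ‖K (z - y) - K (z - y')‖ₑ ∂μ ≤ A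

variable {𝒢 : Grid G μ} {K : G → ℝ} {A : ℝ≥0∞} {star : ℤ × 𝒢.ι → Set G}

namespace IsCZKernel

lemma enorm_setIntegral_le (hK : Integrable K μ) {b : G → ℝ} {Q : Set G}
    (hb : Measurable b) {M : ℝ} (hM : ∀ z, |b z| ≤ M) (hbi : Integrable b μ)
    (hb0 : ∫ y in Q, b y ∂μ = 0) (z y' : G) :
    ‖∫ y in Q, K (z - y) * b y ∂μ‖ₑ ≤ ∫⁻ y in Q, ‖K (z - y) - K (z - y')‖ₑ * ‖b y‖ₑ ∂μ := by
  have h1 : ∫ y in Q, K (z - y) * b y ∂μ = ∫ y in Q, (K (z - y) - K (z - y')) * b y ∂μ := by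
    simp only [sub_mul]
    rw [integral_sub (integrable_cv_kernel hK hb hM z).integrableOn
      (hbi.integrableOn.const_mul _), integral_const_mul, hb0, mul_zero, sub_zero]
  rw [h1]
  refine (enorm_integral_le_lintegral_enorm _).trans (le_of_eq ?_)
  simp only [enorm_mul]

/-- The bad part is controlled away from the enlarged cells. -/
lemma lintegral_bad_part (h : IsCZKernel 𝒢 K A star) {f : G → ℝ} {s : ℝ≥0∞}
    {b : G → ℝ} (hb : Measurable b) {M : ℝ} (hM : ∀ z, |b z| ≤ M) (hbi : Integrable b μ)
    (hb0 : ∀ q : 𝒢.Sel f s, ∫ y in 𝒢.cell q, b y ∂μ = 0) (hbs : ∀ z ∉ 𝒢.bad f s, b z = 0) :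
    ∫⁻ z in (⋃ q : 𝒢.Sel f s, star q)ᶜ, ‖cv μ K b z‖ₑ ∂μ
      ≤ A * ∫⁻ y in 𝒢.bad f s, ‖b y‖ₑ ∂μ := by
  have hne : ∀ q : 𝒢.Sel f s, ∃ y, y ∈ 𝒢.cell q := fun q => Grid.Big.nonempty 𝒢 q.2.1
  choose c hc using hne
  have hmeas : ∀ q : 𝒢.Sel f s, Measurable
      (Function.uncurry fun z y => ‖K (z - y) - K (z - c q)‖ₑ * ‖b y‖ₑ) := by
    intro q
    refine Measurable.mul (Measurable.enorm ?_) (hb.comp measurable_snd).enorm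
    exact (h.measurable.comp (measurable_fst.sub measurable_snd)).sub
      (h.measurable.comp (measurable_fst.sub measurable_const))
  have h1 : ∀ z, ‖cv μ K b z‖ₑ ≤ ∑' q : 𝒢.Sel f s,
      ∫⁻ y in 𝒢.cell q, ‖K (z - y) - K (z - c q)‖ₑ * ‖b y‖ₑ ∂μ := by
    intro z
    have hint := integrable_cv_kernel h.integrable hb hM z
    have h2 : cv μ K b z = ∫ y in 𝒢.bad f s, K (z - y) * b y ∂μ := by
      rw [cv]
      refine (setIntegral_eq_integral_of_forall_compl_eq_zero fun y hy => ?_).symm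
      rw [hbs y hy, mul_zero]
    have h3 := hasSum_integral_iUnion (fun q : 𝒢.Sel f s => 𝒢.measurableSet_cell q)
      (𝒢.pairwise_disjoint f s) (f := fun y => K (z - y) * b y) hint.integrableOn
    rw [h2, Grid.bad, ← h3.tsum_eq]
    refine (enorm_tsum_le_tsum_enorm).trans (ENNReal.tsum_le_tsum fun q => ?_)
    exact enorm_setIntegral_le h.integrable hb hM hbi (hb0 q) z (c q)
  calc ∫⁻ z in (⋃ q : 𝒢.Sel f s, star q)ᶜ, ‖cv μ K b z‖ₑ ∂μ
      ≤ ∫⁻ z in (⋃ q : 𝒢.Sel f s, star q)ᶜ, ∑' q : 𝒢.Sel f s,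
        ∫⁻ y in 𝒢.cell q, ‖K (z - y) - K (z - c q)‖ₑ * ‖b y‖ₑ ∂μ ∂μ := lintegral_mono h1
    _ = ∑' q : 𝒢.Sel f s, ∫⁻ z in (⋃ q : 𝒢.Sel f s, star q)ᶜ,
        ∫⁻ y in 𝒢.cell q, ‖K (z - y) - K (z - c q)‖ₑ * ‖b y‖ₑ ∂μ ∂μ :=
        lintegral_tsum fun q => (Measurable.lintegral_prod_right' (hmeas q)).aemeasurable
    _ ≤ ∑' q : 𝒢.Sel f s, A * ∫⁻ y in 𝒢.cell q, ‖b y‖ₑ ∂μ := by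
        refine ENNReal.tsum_le_tsum fun q => ?_
        rw [lintegral_lintegral_swap (hmeas q).aemeasurable, ← lintegral_const_mul _ hb.enorm]
        refine setLIntegral_mono' (𝒢.measurableSet_cell _) fun y hy => ?_
        rw [lintegral_mul_const']
        · gcongr
          refine le_trans (lintegral_mono_set ?_) (h.hormander q y hy (c q) (hc q))
          exact compl_subset_compl.2 (subset_iUnion (fun q : 𝒢.Sel f s => star q) q)
        · exact enorm_ne_top
    _ = A * ∫⁻ y in 𝒢.bad f s, ‖b y‖ₑ ∂μ := by
        rw [ENNReal.tsum_mul_left, 𝒢.lintegral_bad]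

lemma weak_bound (h : IsCZKernel 𝒢 K A star) {f : G → ℝ} (hfc : Continuous f)
    (hfi : Integrable f μ) {M : ℝ} (hM : ∀ z, |f z| ≤ M) {s : ℝ≥0∞} (hs : s ≠ 0) (hs' : s ≠ ⊤) :
    μ {z | 2 * s < ‖cv μ K f z‖ₑ} ≤
      (A * 𝒢.ratio ^ 2 + A + 2 * A * 𝒢.ratio) * μ (𝒢.bad f s) +
      A * (s ^ 2)⁻¹ * ∫⁻ z in {z | ‖f z‖ₑ ≤ s}, ‖f z‖ₑ ^ 2 ∂μ := by
  have hff : ∫⁻ z, ‖f z‖ₑ ∂μ ≠ ⊤ := hfi.2.ne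
  set g := 𝒢.good f s with hg
  set b : G → ℝ := fun z => f z - g z with hb
  have hgm : Measurable g := 𝒢.measurable_good hfc.measurable s
  have hgi : Integrable g μ :=
    ⟨hgm.aestronglyMeasurable, 𝒢.lintegral_enorm_good hff hs hs'⟩
  have hgM : ∀ z, |g z| ≤ M := 𝒢.abs_good_le hM s
  have hbm : Measurable b := hfc.measurable.sub hgm
  have hbM : ∀ z, |b z| ≤ M + M := fun z => (abs_sub _ _).trans (add_le_add (hM z) (hgM z))
  have hsum : ∀ z, cv μ K f z = cv μ K g z + cv μ K b z := by
    intro z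
    rw [← cv_add h.integrable hgm hgM hbm hbM]
    simp [hb]
  have hS : MeasurableSet (⋃ q : 𝒢.Sel f s, star q) := MeasurableSet.iUnion fun q =>
    h.measurable_star q
  have hsub : {z | 2 * s < ‖cv μ K f z‖ₑ} ⊆ {z | s ^ 2 ≤ ‖cv μ K g z‖ₑ ^ 2} ∪
      ((⋃ q : 𝒢.Sel f s, star q) ∪
        ({z | s ≤ ‖cv μ K b z‖ₑ} ∩ (⋃ q : 𝒢.Sel f s, star q)ᶜ)) := by
    intro z hz
    by_cases h1 : s ≤ ‖cv μ K g z‖ₑ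
    · exact Or.inl (pow_le_pow_left' h1 2)
    by_cases h2 : z ∈ ⋃ q : 𝒢.Sel f s, star q
    · exact Or.inr (Or.inl h2)
    refine Or.inr (Or.inr ⟨?_, h2⟩)
    by_contra h3
    have h4 : 2 * s < ‖cv μ K f z‖ₑ := hz
    rw [hsum] at h4
    refine absurd (h4.trans_le (enorm_add_le _ _)) (not_lt.2 ?_)
    rw [two_mul]
    exact add_le_add (not_le.1 h1).le (not_le.1 h3).le
  have e1 : μ {z | s ^ 2 ≤ ‖cv μ K g z‖ₑ ^ 2} ≤ A * 𝒢.ratio ^ 2 * μ (𝒢.bad f s) +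
      A * (s ^ 2)⁻¹ * ∫⁻ z in {z | ‖f z‖ₑ ≤ s}, ‖f z‖ₑ ^ 2 ∂μ := by
    refine (meas_ge_le_lintegral_div
      ((measurable_cv h.measurable hgm).enorm.pow_const 2).aemeasurable
      (pow_ne_zero 2 hs) (ENNReal.pow_ne_top hs')).trans ?_
    rw [ENNReal.div_eq_inv_mul]
    calc (s ^ 2)⁻¹ * ∫⁻ z, ‖cv μ K g z‖ₑ ^ 2 ∂μ
        ≤ (s ^ 2)⁻¹ * (A * ((s * 𝒢.ratio) ^ 2 * μ (𝒢.bad f s) +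
          ∫⁻ z in {z | ‖f z‖ₑ ≤ s}, ‖f z‖ₑ ^ 2 ∂μ)) := by
          gcongr
          refine (h.l2 g hgm hgi ⟨M, hgM⟩).trans ?_
          gcongr
          exact 𝒢.lintegral_enorm_good_sq_le
            fun z hz => 𝒢.enorm_le_of_notMem_bad hfc hff hs hs' hz
      _ = ((s ^ 2)⁻¹ * s ^ 2) * (A * 𝒢.ratio ^ 2 * μ (𝒢.bad f s)) + A * (s ^ 2)⁻¹ *
          ∫⁻ z in {z | ‖f z‖ₑ ≤ s}, ‖f z‖ₑ ^ 2 ∂μ := by ring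
      _ = _ := by
          rw [ENNReal.inv_mul_cancel (pow_ne_zero 2 hs) (ENNReal.pow_ne_top hs'), one_mul]
  have e2 : μ (⋃ q : 𝒢.Sel f s, star q) ≤ A * μ (𝒢.bad f s) := by
    refine (measure_iUnion_le _).trans ?_
    rw [𝒢.measure_bad, ← ENNReal.tsum_mul_left]
    refine ENNReal.tsum_le_tsum fun q => (h.measure_star q).trans (le_of_eq ?_)
    obtain ⟨z, hz⟩ := Grid.Big.nonempty 𝒢 q.2.1
    rw [𝒢.measure_cell_of_mem hz]
  have e3 : μ ({z | s ≤ ‖cv μ K b z‖ₑ} ∩ (⋃ q : 𝒢.Sel f s, star q)ᶜ) ≤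
      2 * A * 𝒢.ratio * μ (𝒢.bad f s) := by
    have hm := (measurable_cv (μ := μ) h.measurable hbm).enorm
    rw [← Measure.restrict_apply (measurableSet_le measurable_const hm)]
    refine (meas_ge_le_lintegral_div hm.aemeasurable hs hs').trans ?_
    rw [ENNReal.div_eq_inv_mul]
    calc s⁻¹ * ∫⁻ z in (⋃ q : 𝒢.Sel f s, star q)ᶜ, ‖cv μ K b z‖ₑ ∂μ
        ≤ s⁻¹ * (A * (2 * (s * 𝒢.ratio * μ (𝒢.bad f s)))) := by
          gcongr
          refine (h.lintegral_bad_part hbm hbM (hfi.sub hgi)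
            (fun q => 𝒢.setIntegral_sub_good hfi q) fun z hz => ?_).trans ?_
          · simp [hb, hg, 𝒢.good_of_notMem hz]
          · gcongr
            exact 𝒢.lintegral_enorm_sub_good_le hfc.measurable s
      _ = (s⁻¹ * s) * (2 * A * 𝒢.ratio * μ (𝒢.bad f s)) := by ring
      _ = _ := by rw [ENNReal.inv_mul_cancel hs hs', one_mul]
  calc μ {z | 2 * s < ‖cv μ K f z‖ₑ} ≤ _ := measure_mono hsub
    _ ≤ _ := (measure_union_le _ _).trans (add_le_add le_rfl (measure_union_le _ _))
    _ ≤ _ := add_le_add e1 (add_le_add e2 e3)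
    _ = _ := by ring

end IsCZKernel

end CZKernel

section CZKernelBounds

lemma setLIntegral_rpow_Ioo {a c : ℝ} (ha : -1 < a) (hc : 0 ≤ c) :
    ∫⁻ t in Ioo 0 c, ENNReal.ofReal (t ^ a) = ENNReal.ofReal (c ^ (a + 1) / (a + 1)) := by
  have hI : IntegrableOn (fun t : ℝ => t ^ a) (Ioo 0 c) :=
    (intervalIntegrable_iff_integrableOn_Ioo_of_le hc).1
      (intervalIntegral.intervalIntegrable_rpow' ha)
  rw [← ofReal_integral_eq_lintegral_ofReal hI
    ((ae_restrict_iff' measurableSet_Ioo).2 (Filter.Eventually.of_forall fun t ht =>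
      Real.rpow_nonneg ht.1.le _)), ← integral_Ioc_eq_integral_Ioo,
    ← intervalIntegral.integral_of_le hc, integral_rpow (Or.inl ha),
    Real.zero_rpow (by linarith), sub_zero]

lemma setLIntegral_rpow_Ioi {a c : ℝ} (ha : a < -1) (hc : 0 < c) :
    ∫⁻ t in Ioi c, ENNReal.ofReal (t ^ a) = ENNReal.ofReal (c ^ (a + 1) / (-(a + 1))) := by
  rw [← ofReal_integral_eq_lintegral_ofReal (integrableOn_Ioi_rpow_of_lt ha hc)
    ((ae_restrict_iff' measurableSet_Ioi).2 (Filter.Eventually.of_forall fun t ht =>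
      Real.rpow_nonneg (hc.trans ht).le _)), integral_Ioi_rpow_of_lt ha hc, div_neg, neg_div]

lemma lintegral_section_swap {X Y : Type*} [MeasurableSpace X] [MeasurableSpace Y]
    {μ : Measure X} {ν : Measure Y} [SFinite μ] [SFinite ν] {S : Set (X × Y)}
    (hS : MeasurableSet S) {F : Y → ℝ≥0∞} (hF : Measurable F) {w : X → ℝ≥0∞}
    (hw : Measurable w) :
    ∫⁻ t, (∫⁻ z in {z | (t, z) ∈ S}, F z ∂ν) * w t ∂μ
      = ∫⁻ z, F z * ∫⁻ t in {t | (t, z) ∈ S}, w t ∂μ ∂ν := by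
  have hm : Measurable (Function.uncurry fun t z => S.indicator (fun q => F q.2 * w q.1) (t, z)) :=
    ((hF.comp measurable_snd).mul (hw.comp measurable_fst)).indicator hS
  have h1 : ∀ t, (∫⁻ z in {z | (t, z) ∈ S}, F z ∂ν) * w t
      = ∫⁻ z, S.indicator (fun q => F q.2 * w q.1) (t, z) ∂ν := by
    intro t
    have hSt : MeasurableSet {z | (t, z) ∈ S} := measurable_prodMk_left hS
    rw [← lintegral_mul_const _ hF, ← lintegral_indicator hSt]
    rfl
  have h2 : ∀ z, F z * ∫⁻ t in {t | (t, z) ∈ S}, w t ∂μ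
      = ∫⁻ t, S.indicator (fun q => F q.2 * w q.1) (t, z) ∂μ := by
    intro z
    have hSz : MeasurableSet {t | (t, z) ∈ S} := measurable_prodMk_right hS
    rw [← lintegral_const_mul _ hw, ← lintegral_indicator hSz]
    rfl
  simp_rw [h1, h2]
  exact lintegral_lintegral_swap hm.aemeasurable

variable {G : Type*} [NormedAddCommGroup G] [NormedSpace ℝ G] [FiniteDimensional ℝ G]
  [MeasurableSpace G] [BorelSpace G] {μ : Measure G} [μ.IsAddHaarMeasure]
  {𝒢 : Grid G μ} {K : G → ℝ} {A : ℝ≥0∞} {star : ℤ × 𝒢.ι → Set G}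

namespace IsCZKernel

/-- Constant of the weak-type estimate. -/
def weakConst (A r : ℝ≥0∞) : ℝ≥0∞ := A * r ^ 2 + A + 2 * A * r + A

lemma weakConst_ne_top {A r : ℝ≥0∞} (hA : A ≠ ⊤) (hr : r ≠ ⊤) : weakConst A r ≠ ⊤ := by
  unfold weakConst
  finiteness

lemma weak_bound_real (h : IsCZKernel 𝒢 K A star) {f : G → ℝ} (hfc : Continuous f)
    (hfi : Integrable f μ) {M : ℝ} (hM : ∀ z, |f z| ≤ M) {t : ℝ} (ht : 0 < t) :
    μ {z | t < |cv μ K f z| / 2} ≤ weakConst A 𝒢.ratio *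
      (2 * ENNReal.ofReal (t ^ (-1 : ℝ)) * ∫⁻ z in {z | t < 2 * |f z|}, ‖f z‖ₑ ∂μ +
      ENNReal.ofReal (t ^ (-2 : ℝ)) * ∫⁻ z in {z | |f z| ≤ t}, ‖f z‖ₑ ^ 2 ∂μ) := by
  have hs : ENNReal.ofReal t ≠ 0 := (ENNReal.ofReal_pos.2 ht).ne'
  have hs' : ENNReal.ofReal t ≠ ⊤ := ENNReal.ofReal_ne_top
  have h1 := h.weak_bound hfc hfi hM hs hs'
  have h2 := 𝒢.measure_bad_le hfc.measurable hfi.2.ne hs hs'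
  have e0 : ∀ x : ℝ, ‖x‖ₑ = ENNReal.ofReal |x| := fun x => by
    rw [← Real.norm_eq_abs, ofReal_norm]
  have e1 : {z | 2 * ENNReal.ofReal t < ‖cv μ K f z‖ₑ} = {z | t < |cv μ K f z| / 2} := by
    ext z
    simp only [mem_ofPred_eq]
    rw [e0, show (2 : ℝ≥0∞) = ENNReal.ofReal 2 by simp, ← ENNReal.ofReal_mul (by norm_num),
      ENNReal.ofReal_lt_ofReal_iff_of_nonneg (by positivity), lt_div_iff₀' (by norm_num)]
  have e2 : {z | ENNReal.ofReal t < 2 * ‖f z‖ₑ} = {z | t < 2 * |f z|} := by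
    ext z
    simp only [mem_ofPred_eq]
    rw [e0, show (2 : ℝ≥0∞) = ENNReal.ofReal 2 by simp, ← ENNReal.ofReal_mul (by norm_num),
      ENNReal.ofReal_lt_ofReal_iff_of_nonneg ht.le]
  have e3 : {z | ‖f z‖ₑ ≤ ENNReal.ofReal t} = {z | |f z| ≤ t} := by
    ext z
    simp only [mem_ofPred_eq]
    rw [e0, ENNReal.ofReal_le_ofReal_iff ht.le]
  have e4 : (ENNReal.ofReal t)⁻¹ = ENNReal.ofReal (t ^ (-1 : ℝ)) := by
    rw [Real.rpow_neg_one, ENNReal.ofReal_inv_of_pos ht]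
  have e5 : (ENNReal.ofReal t ^ 2)⁻¹ = ENNReal.ofReal (t ^ (-2 : ℝ)) := by
    rw [Real.rpow_neg ht.le, ENNReal.ofReal_inv_of_pos (by positivity), ← ENNReal.ofReal_pow ht.le]
    norm_num
  rw [e1, e3, e5] at h1
  rw [e2, e4] at h2
  calc _ ≤ _ := h1
    _ ≤ weakConst A 𝒢.ratio * μ (𝒢.bad f (ENNReal.ofReal t)) + weakConst A 𝒢.ratio *
        ENNReal.ofReal (t ^ (-2 : ℝ)) * ∫⁻ z in {z | |f z| ≤ t}, ‖f z‖ₑ ^ 2 ∂μ := by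
        gcongr
        · exact le_self_add
        · exact le_add_self
    _ ≤ weakConst A 𝒢.ratio *
        (2 * ENNReal.ofReal (t ^ (-1 : ℝ)) * ∫⁻ z in {z | t < 2 * |f z|}, ‖f z‖ₑ ∂μ) +
        weakConst A 𝒢.ratio *
        ENNReal.ofReal (t ^ (-2 : ℝ)) * ∫⁻ z in {z | |f z| ≤ t}, ‖f z‖ₑ ^ 2 ∂μ := by
        gcongr
    _ = _ := by ring

/-- Strong type bound for `1 < p < 2`. -/
lemma strong_bound_lt_two (h : IsCZKernel 𝒢 K A star) {f : G → ℝ} (hfc : Continuous f)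
    (hfi : Integrable f μ) {M : ℝ} (hM : ∀ z, |f z| ≤ M) {p : ℝ} (hp : 1 < p) (hp2 : p < 2) :
    ∫⁻ z, ENNReal.ofReal (|cv μ K f z| ^ p) ∂μ ≤
      ENNReal.ofReal (2 ^ p) * (ENNReal.ofReal p * (weakConst A 𝒢.ratio *
        ENNReal.ofReal (2 * (2 ^ (p - 1) / (p - 1)) + 1 / (2 - p)))) *
      ∫⁻ z, ENNReal.ofReal (|f z| ^ p) ∂μ := by
  have hcm := measurable_cv (μ := μ) h.measurable hfc.measurable
  have hfm : Measurable f := hfc.measurable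
  have hfe : Measurable fun z => ‖f z‖ₑ := hfm.enorm
  have e0 : ∀ x : ℝ, ‖x‖ₑ = ENNReal.ofReal |x| := fun x => by
    rw [← Real.norm_eq_abs, ofReal_norm]
  have hlayer := lintegral_rpow_eq_lintegral_meas_lt_mul μ
    (f := fun z => |cv μ K f z| / 2) (Filter.Eventually.of_forall fun z => by positivity)
    ((hcm.norm.div_const 2).aemeasurable) (p := p) (by linarith)
  have hhalf : ∫⁻ z, ENNReal.ofReal (|cv μ K f z| ^ p) ∂μ =
      ENNReal.ofReal (2 ^ p) * ∫⁻ z, ENNReal.ofReal ((|cv μ K f z| / 2) ^ p) ∂μ := by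
    rw [← lintegral_const_mul']
    · refine lintegral_congr fun z => ?_
      rw [← ENNReal.ofReal_mul (by positivity), ← Real.mul_rpow (by norm_num) (by positivity)]
      congr 2; ring
    · exact ENNReal.ofReal_ne_top
  have hS1 : MeasurableSet {q : ℝ × G | q.1 < 2 * |f q.2|} :=
    measurableSet_lt measurable_fst ((hfm.comp measurable_snd).norm.const_mul 2)
  have hS2 : MeasurableSet {q : ℝ × G | |f q.2| ≤ q.1} :=
    measurableSet_le ((hfm.comp measurable_snd).norm) measurable_fst
  have hw : ∀ a : ℝ, Measurable fun t : ℝ => ENNReal.ofReal (t ^ a) := fun a => by fun_prop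
  have i1 : ∫⁻ t in Ioi (0 : ℝ), (∫⁻ z in {z | t < 2 * |f z|}, ‖f z‖ₑ ∂μ) *
      ENNReal.ofReal (t ^ (p - 2)) ≤
      ENNReal.ofReal (2 ^ (p - 1) / (p - 1)) * ∫⁻ z, ENNReal.ofReal (|f z| ^ p) ∂μ := by
    rw [← lintegral_const_mul' _ _ ENNReal.ofReal_ne_top]
    refine (le_of_eq (lintegral_section_swap (μ := volume.restrict (Ioi 0)) hS1 hfe
      (hw (p - 2)))).trans (lintegral_mono fun z => ?_)
    have hset : {t : ℝ | t < 2 * |f z|} ∩ Ioi 0 = Ioo 0 (2 * |f z|) := by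
      ext t; exact and_comm
    have h2 : ∫⁻ t in {t : ℝ | (t, z) ∈ {q : ℝ × G | q.1 < 2 * |f q.2|}},
        ENNReal.ofReal (t ^ (p - 2)) ∂(volume.restrict (Ioi 0)) =
        ENNReal.ofReal ((2 * |f z|) ^ (p - 2 + 1) / (p - 2 + 1)) := by
      have hms : MeasurableSet {t : ℝ | (t, z) ∈ {q : ℝ × G | q.1 < 2 * |f q.2|}} :=
        measurable_prodMk_right hS1
      rw [Measure.restrict_restrict hms]
      rw [← setLIntegral_rpow_Ioo (by linarith) (by positivity), ← hset]
      rfl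
    rw [h2, e0, ← ENNReal.ofReal_mul (abs_nonneg _), ← ENNReal.ofReal_mul (by
      have : 0 < p - 1 := by linarith
      positivity)]
    refine ENNReal.ofReal_le_ofReal (le_of_eq ?_)
    rcases (abs_nonneg (f z)).eq_or_lt with h0 | h0
    · rw [← h0, Real.zero_rpow (by linarith)]; simp
    · rw [show p - 2 + 1 = p - 1 by ring, Real.mul_rpow (by norm_num) h0.le,
        show |f z| ^ p = |f z| * |f z| ^ (p - 1) by
          rw [mul_comm, ← Real.rpow_add_one h0.ne']; congr 1; ring]
      ring
  have i2 : ∫⁻ t in Ioi (0 : ℝ), (∫⁻ z in {z | |f z| ≤ t}, ‖f z‖ₑ ^ 2 ∂μ) *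
      ENNReal.ofReal (t ^ (p - 3)) ≤
      ENNReal.ofReal (1 / (2 - p)) * ∫⁻ z, ENNReal.ofReal (|f z| ^ p) ∂μ := by
    rw [← lintegral_const_mul' _ _ ENNReal.ofReal_ne_top]
    refine (le_of_eq (lintegral_section_swap (μ := volume.restrict (Ioi 0)) hS2
      (hfe.pow_const 2) (hw (p - 3)))).trans (lintegral_mono fun z => ?_)
    rcases (abs_nonneg (f z)).eq_or_lt with h0 | h0
    · simp [abs_eq_zero.1 h0.symm]
    have h2 : ∫⁻ t in {t : ℝ | (t, z) ∈ {q : ℝ × G | |f q.2| ≤ q.1}},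
        ENNReal.ofReal (t ^ (p - 3)) ∂(volume.restrict (Ioi 0)) =
        ENNReal.ofReal ((|f z|) ^ (p - 3 + 1) / (-(p - 3 + 1))) := by
      have hms : MeasurableSet {t : ℝ | (t, z) ∈ {q : ℝ × G | |f q.2| ≤ q.1}} :=
        measurable_prodMk_right hS2
      rw [Measure.restrict_restrict hms,
        ← setLIntegral_rpow_Ioi (by linarith) h0]
      have hset : {t : ℝ | (t, z) ∈ {q : ℝ × G | |f q.2| ≤ q.1}} ∩ Ioi 0 = Ici |f z| := by
        ext t
        exact ⟨fun h => h.1, fun h => ⟨h, lt_of_lt_of_le h0 h⟩⟩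
      rw [hset]
      exact setLIntegral_congr Ioi_ae_eq_Ici.symm
    simp only at h2 ⊢
    rw [h2, e0, ← ENNReal.ofReal_pow (abs_nonneg _), ← ENNReal.ofReal_mul (by positivity),
      ← ENNReal.ofReal_mul (by
        have : 0 < 2 - p := by linarith
        positivity)]
    refine ENNReal.ofReal_le_ofReal (le_of_eq ?_)
    rw [show p - 3 + 1 = p - 2 by ring, show |f z| ^ p = |f z| ^ 2 * |f z| ^ (p - 2) by
          rw [← Real.rpow_natCast, ← Real.rpow_add h0]; congr 1; push_cast; ring]
    rw [neg_sub]; ring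
  rw [hhalf, hlayer, mul_assoc, mul_assoc, mul_assoc]
  gcongr
  rw [ENNReal.ofReal_add (by
      have : 0 < p - 1 := by linarith
      positivity) (by
      have : 0 < 2 - p := by linarith
      positivity), ENNReal.ofReal_mul (by norm_num)]
  have mm : ∀ {S : Set (ℝ × G)} {F : G → ℝ≥0∞}, MeasurableSet S → Measurable F → ∀ a : ℝ,
      Measurable fun t : ℝ => (∫⁻ z in {z | (t, z) ∈ S}, F z ∂μ) * ENNReal.ofReal (t ^ a) := by
    intro S F hS hF a
    refine Measurable.mul ?_ (hw a)
    have : ∀ t : ℝ, ∫⁻ z in {z | (t, z) ∈ S}, F z ∂μ =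
        ∫⁻ z, S.indicator (fun q => F q.2) (t, z) ∂μ := fun t => by
      have hSt : MeasurableSet {z | (t, z) ∈ S} := measurable_prodMk_left hS
      rw [← lintegral_indicator hSt]; rfl
    simp_rw [this]
    exact Measurable.lintegral_prod_right' ((hF.comp measurable_snd).indicator hS)
  calc ∫⁻ t in Ioi 0, μ {z | t < |cv μ K f z| / 2} * ENNReal.ofReal (t ^ (p - 1))
      ≤ ∫⁻ t in Ioi 0, weakConst A 𝒢.ratio *
        (2 * ((∫⁻ z in {z | t < 2 * |f z|}, ‖f z‖ₑ ∂μ) * ENNReal.ofReal (t ^ (p - 2))) +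
        (∫⁻ z in {z | |f z| ≤ t}, ‖f z‖ₑ ^ 2 ∂μ) * ENNReal.ofReal (t ^ (p - 3))) := by
        refine setLIntegral_mono' measurableSet_Ioi fun t ht => ?_
        have ht : 0 < t := ht
        rw [show p - 2 = -1 + (p - 1) by ring, show p - 3 = -2 + (p - 1) by ring,
          Real.rpow_add ht, Real.rpow_add ht, ENNReal.ofReal_mul (by positivity),
          ENNReal.ofReal_mul (by positivity)]
        refine (mul_le_mul_left (h.weak_bound_real hfc hfi hM ht) _).trans (le_of_eq ?_)
        ring
    _ = weakConst A 𝒢.ratio * (2 * (∫⁻ t in Ioi (0 : ℝ), (∫⁻ z in {z | t < 2 * |f z|}, ‖f z‖ₑ ∂μ) *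
      ENNReal.ofReal (t ^ (p - 2))) + ∫⁻ t in Ioi (0 : ℝ), (∫⁻ z in {z | |f z| ≤ t}, ‖f z‖ₑ ^ 2 ∂μ) *
      ENNReal.ofReal (t ^ (p - 3))) := by
        have m1 : Measurable fun t : ℝ => (∫⁻ z in {z | t < 2 * |f z|}, ‖f z‖ₑ ∂μ) *
            ENNReal.ofReal (t ^ (p - 2)) := mm hS1 hfe (p - 2)
        have m2 : Measurable fun t : ℝ => (∫⁻ z in {z | |f z| ≤ t}, ‖f z‖ₑ ^ 2 ∂μ) *
            ENNReal.ofReal (t ^ (p - 3)) := mm hS2 (hfe.pow_const 2) (p - 3)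
        rw [← lintegral_const_mul _ m1, ← lintegral_add_left (m1.const_mul 2),
          ← lintegral_const_mul]
        exact (m1.const_mul 2).add m2
    _ ≤ _ := by
        refine mul_le_mul_right ((add_le_add (mul_le_mul_right i1 2) i2).trans (le_of_eq ?_)) _
        rw [show ENNReal.ofReal 2 = 2 by simp]
        ring

end IsCZKernel

end CZKernelBounds

section CZKernelDuality

variable {G : Type*} [NormedAddCommGroup G] [NormedSpace ℝ G] [FiniteDimensional ℝ G]
  [MeasurableSpace G] [BorelSpace G] {μ : Measure G} [μ.IsAddHaarMeasure]
  {𝒢 : Grid G μ} {K : G → ℝ} {A : ℝ≥0∞} {star : ℤ × 𝒢.ι → Set G}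

lemma cv_eq (K f : G → ℝ) (z : G) : cv μ K f z = ∫ y, K y * f (z - y) ∂μ := by
  rw [cv, ← integral_sub_left_eq_self _ μ z]
  simp

lemma cv_comp_neg (K f : G → ℝ) (z : G) :
    cv μ (fun x => K (-x)) f z = cv μ K (fun y => f (-y)) (-z) := by
  rw [cv_eq, cv_eq, ← integral_neg_eq_self]
  simp only [neg_neg, sub_neg_eq_add, neg_sub]
  refine integral_congr_ae (Filter.Eventually.of_forall fun y => ?_)
  simp only
  rw [add_comm z y]

lemma continuous_cv {f : G → ℝ} (hK : Integrable K μ) (hf : Continuous f) {M : ℝ}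
    (hM : ∀ z, |f z| ≤ M) : Continuous (cv μ K f) := by
  have : cv μ K f = fun z => ∫ y, K y * f (z - y) ∂μ := funext fun z => cv_eq K f z
  rw [this]
  refine continuous_of_dominated (bound := fun y => |K y| * M) (fun z => ?_) (fun z => ?_)
    (hK.norm.mul_const M) (Filter.Eventually.of_forall fun y => by fun_prop)
  · exact hK.aestronglyMeasurable.mul (by fun_prop : Continuous fun y => f (z - y)).aestronglyMeasurable
  · refine Filter.Eventually.of_forall fun y => ?_
    rw [Real.norm_eq_abs, abs_mul]
    gcongr
    exact hM _

lemma abs_cv_le {f : G → ℝ} (hK : Integrable K μ) {M : ℝ}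
    (hM : ∀ z, |f z| ≤ M) (z : G) : |cv μ K f z| ≤ (∫ y, |K y| ∂μ) * M := by
  rw [cv_eq, ← Real.norm_eq_abs, ← integral_mul_const]
  refine norm_integral_le_of_norm_le (hK.norm.mul_const M) (Filter.Eventually.of_forall fun y => ?_)
  rw [Real.norm_eq_abs, abs_mul]
  gcongr
  exact hM _

lemma integrable_prod_cv {f : G → ℝ} (hK : Integrable K μ) (hf : Integrable f μ) :
    Integrable (fun q : G × G => K (q.1 - q.2) * f q.2) (μ.prod μ) := by
  have := hf.convolution_integrand (ContinuousLinearMap.mul ℝ ℝ) hK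
  simpa [mul_comm] using this

lemma integrable_cv {f : G → ℝ} (hK : Integrable K μ) (hf : Integrable f μ) :
    Integrable (cv μ K f) μ :=
  (integrable_prod_cv hK hf).integral_prod_left

lemma integral_cv_mul {f φ : G → ℝ} (hK : Integrable K μ) (hf : Integrable f μ)
    (hφ : Measurable φ) {M : ℝ} (hM : ∀ z, |φ z| ≤ M) :
    ∫ z, cv μ K f z * φ z ∂μ = ∫ y, f y * cv μ (fun x => K (-x)) φ y ∂μ := by
  have h1 : Integrable (Function.uncurry fun z y : G => K (z - y) * f y * φ z) (μ.prod μ) :=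
    (integrable_prod_cv hK hf).mul_bdd (hφ.comp measurable_fst).aestronglyMeasurable (c := M)
      (Filter.Eventually.of_forall fun q => hM q.1)
  have h2 := integral_integral_swap h1
  simp only [cv, ← integral_mul_const, ← integral_const_mul]
  rw [h2]
  refine integral_congr_ae (Filter.Eventually.of_forall fun y => ?_)
  refine integral_congr_ae (Filter.Eventually.of_forall fun z => ?_)
  simp only [neg_sub]
  ring

namespace IsCZKernel

lemma l2_comp_neg {A : ℝ≥0∞} (h : ∀ g : G → ℝ, Measurable g → Integrable g μ → (∃ M, ∀ z, |g z| ≤ M) →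
      ∫⁻ z, ‖cv μ K g z‖ₑ ^ 2 ∂μ ≤ A * ∫⁻ z, ‖g z‖ₑ ^ 2 ∂μ)
    (g : G → ℝ) (hg : Measurable g) (hgi : Integrable g μ) (hb : ∃ M, ∀ z, |g z| ≤ M) :
    ∫⁻ z, ‖cv μ (fun x => K (-x)) g z‖ₑ ^ 2 ∂μ ≤ A * ∫⁻ z, ‖g z‖ₑ ^ 2 ∂μ := by
  obtain ⟨M, hM⟩ := hb
  have := h (fun y => g (-y)) (hg.comp measurable_neg) hgi.comp_neg ⟨M, fun z => hM _⟩
  simp only [cv_comp_neg]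
  rwa [lintegral_neg_eq_self (fun z => ‖cv μ K (fun y => g (-y)) z‖ₑ ^ 2),
    ← lintegral_neg_eq_self (fun z => ‖g z‖ₑ ^ 2)]

/-- Constant of the strong-type estimate for `1 < p < 2`. -/
def strongConst (p : ℝ) (A r : ℝ≥0∞) : ℝ≥0∞ :=
  ENNReal.ofReal (2 ^ p) * (ENNReal.ofReal p * (weakConst A r *
    ENNReal.ofReal (2 * (2 ^ (p - 1) / (p - 1)) + 1 / (2 - p))))

/-- Constant of the strong-type estimate. -/
def czConst (p : ℝ) (A r : ℝ≥0∞) : ℝ≥0∞ :=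
  strongConst p A r + A + strongConst (p / (p - 1)) A r ^ (p - 1)

lemma czConst_ne_top {p : ℝ} (hp : 1 < p) {A r : ℝ≥0∞} (hA : A ≠ ⊤) (hr : r ≠ ⊤) :
    czConst p A r ≠ ⊤ := by
  have h : ∀ p, strongConst p A r ≠ ⊤ := fun p => by
    unfold strongConst
    have := weakConst_ne_top hA hr
    finiteness
  have h1 := h p
  have h2 := ENNReal.rpow_ne_top_of_nonneg (by linarith : 0 ≤ p - 1) (h (p / (p - 1)))
  unfold czConst
  finiteness

lemma strong_bound_gt_two (h : IsCZKernel 𝒢 K A star)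
    (h' : IsCZKernel 𝒢 (fun x => K (-x)) A star) {f : G → ℝ} (hfc : Continuous f)
    (hfi : Integrable f μ) {M : ℝ} (hM : ∀ z, |f z| ≤ M) {p : ℝ} (hp : 2 < p) :
    ∫⁻ z, ENNReal.ofReal (|cv μ K f z| ^ p) ∂μ ≤
      strongConst (p / (p - 1)) A 𝒢.ratio ^ (p - 1) * ∫⁻ z, ENNReal.ofReal (|f z| ^ p) ∂μ := by
  set H := cv μ K f with hH
  set q := p / (p - 1) with hq
  have hp1 : 0 < p - 1 := by linarith
  have hq1 : 1 < q := by rw [hq, lt_div_iff₀ hp1]; linarith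
  have hq2 : q < 2 := by rw [hq, div_lt_iff₀ hp1]; linarith
  have hpq : p.HolderConjugate q := Real.HolderConjugate.conjExponent (by linarith)
  have hHc : Continuous H := continuous_cv h.integrable hfc hM
  have hHi : Integrable H μ := integrable_cv h.integrable hfi
  obtain ⟨B, hB⟩ : ∃ B, ∀ z, |H z| ≤ B := ⟨_, abs_cv_le h.integrable hM⟩
  have hB0 : 0 ≤ B := (abs_nonneg _).trans (hB 0)
  set φ : G → ℝ := fun z => |H z| ^ (p - 2) * H z with hφ
  have hφc : Continuous φ := (hHc.abs.rpow_const fun z => Or.inr (by linarith)).mul hHc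
  have hφB : ∀ z, |φ z| ≤ B ^ (p - 2) * B := fun z => by
    rw [hφ]
    simp only
    rw [abs_mul, abs_of_nonneg (Real.rpow_nonneg (abs_nonneg _) _)]
    gcongr
    · exact hB z
    · exact hB z
  have hφi : Integrable φ μ := hHi.bdd_mul (c := B ^ (p - 2))
    (hHc.abs.rpow_const fun z => Or.inr (by linarith)).aestronglyMeasurable
    (Filter.Eventually.of_forall fun z => by
      rw [Real.norm_eq_abs, abs_of_nonneg (Real.rpow_nonneg (abs_nonneg _) _)]
      gcongr
      exact hB z)
  have hHφ : ∀ z, H z * φ z = |H z| ^ p := fun z => by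
    rcases (abs_nonneg (H z)).eq_or_lt with h0 | h0
    · rw [abs_eq_zero.1 h0.symm, abs_zero, Real.zero_rpow (by linarith), zero_mul]
    · rw [hφ]
      simp only
      rw [show H z * (|H z| ^ (p - 2) * H z) = |H z| ^ (p - 2) * (H z * H z) by ring,
        ← abs_mul_abs_self, ← mul_assoc, ← Real.rpow_add_one h0.ne', ← Real.rpow_add_one h0.ne']
      congr 1; ring
  have hφq : ∀ z, |φ z| ^ q = |H z| ^ p := fun z => by
    rcases (abs_nonneg (H z)).eq_or_lt with h0 | h0
    · rw [hφ]
      simp only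
      rw [abs_eq_zero.1 h0.symm, mul_zero, abs_zero, Real.zero_rpow (by linarith),
        Real.zero_rpow (by linarith)]
    · rw [hφ]
      simp only
      rw [abs_mul, abs_of_nonneg (Real.rpow_nonneg (abs_nonneg _) _), ← Real.rpow_add_one h0.ne',
        ← Real.rpow_mul h0.le, hq]
      congr 1
      field_simp
      ring
  set I := ∫⁻ z, ENNReal.ofReal (|H z| ^ p) ∂μ with hI
  have hIint : Integrable (fun z => |H z| ^ p) μ := by
    simp only [← hHφ]
    exact hHi.mul_bdd (c := B ^ (p - 2) * B) hφc.aestronglyMeasurable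
      (Filter.Eventually.of_forall fun z => hφB z)
  have hItop : I ≠ ⊤ := by
    rw [hI, ← ofReal_integral_eq_lintegral_ofReal hIint
      (Filter.Eventually.of_forall fun z => by positivity)]
    exact ENNReal.ofReal_ne_top
  have key : I ≤ (∫⁻ z, ENNReal.ofReal (|f z| ^ p) ∂μ) ^ (1 / p) *
      (strongConst q A 𝒢.ratio * I) ^ (1 / q) := by
    have e1 : I = ENNReal.ofReal (∫ y, f y * cv μ (fun x => K (-x)) φ y ∂μ) := by
      rw [← integral_cv_mul h.integrable hfi hφc.measurable hφB, hI,
        ← ofReal_integral_eq_lintegral_ofReal hIint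
        (Filter.Eventually.of_forall fun z => by positivity)]
      simp only [hHφ, ← hH]
    have e2 := h'.strong_bound_lt_two hφc hφi hφB hq1 hq2
    simp only [hφq] at e2
    have e3 : ∀ (g : G → ℝ) (r : ℝ), 0 ≤ r → ∀ z, ‖g z‖ₑ ^ r = ENNReal.ofReal (|g z| ^ r) :=
      fun g r hr z => by
        rw [← ofReal_norm, Real.norm_eq_abs, ENNReal.ofReal_rpow_of_nonneg (abs_nonneg _) hr]
    calc I ≤ ‖∫ y, f y * cv μ (fun x => K (-x)) φ y ∂μ‖ₑ := by
            rw [e1]; exact Real.ofReal_le_enorm _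
      _ ≤ ∫⁻ y, ‖f y * cv μ (fun x => K (-x)) φ y‖ₑ ∂μ := enorm_integral_le_lintegral_enorm _
      _ = ∫⁻ y, ((fun y => ‖f y‖ₑ) * (fun y => ‖cv μ (fun x => K (-x)) φ y‖ₑ)) y ∂μ := by
            simp [enorm_mul]
      _ ≤ _ := ENNReal.lintegral_mul_le_Lp_mul_Lq μ hpq hfc.measurable.enorm.aemeasurable
          (measurable_cv h'.measurable hφc.measurable).enorm.aemeasurable
      _ ≤ _ := by
        simp only [e3 _ p (by linarith), e3 _ q (by linarith)]
        gcongr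
        exact e2
  rcases eq_or_ne I 0 with h0 | h0
  · rw [h0]; exact zero_le
  have key2 : I ^ (1 / p) ≤ (∫⁻ z, ENNReal.ofReal (|f z| ^ p) ∂μ) ^ (1 / p) *
      strongConst q A 𝒢.ratio ^ (1 / q) := by
    rw [ENNReal.mul_rpow_of_nonneg _ _ (by positivity), ← mul_assoc] at key
    have : I = I ^ (1 / p) * I ^ (1 / q) := by
      rw [← ENNReal.rpow_add _ _ h0 hItop, show 1 / p + 1 / q = 1 by
        simpa [one_div] using hpq.inv_add_inv_eq_one, ENNReal.rpow_one]
    nth_rw 1 [this] at key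
    exact (ENNReal.mul_le_mul_iff_left (by simp [ENNReal.rpow_eq_zero_iff, h0, hItop])
      (ENNReal.rpow_ne_top_of_nonneg (by positivity) hItop)).1 key
  have key3 := ENNReal.rpow_le_rpow key2 (by linarith : 0 ≤ p)
  rw [ENNReal.mul_rpow_of_nonneg _ _ (by linarith), ← ENNReal.rpow_mul, ← ENNReal.rpow_mul,
    ← ENNReal.rpow_mul, one_div_mul_cancel (by linarith), ENNReal.rpow_one, ENNReal.rpow_one,
    show 1 / q * p = p - 1 by rw [hq]; field_simp] at key3
  rwa [mul_comm] at key3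

/-- **Calderón–Zygmund theorem** for integrable kernels, with a quantitative constant. -/
theorem strong_bound (h : IsCZKernel 𝒢 K A star)
    (h' : IsCZKernel 𝒢 (fun x => K (-x)) A star) {f : G → ℝ} (hfc : Continuous f)
    (hfi : Integrable f μ) {M : ℝ} (hM : ∀ z, |f z| ≤ M) {p : ℝ} (hp : 1 < p) :
    ∫⁻ z, ENNReal.ofReal (|cv μ K f z| ^ p) ∂μ ≤
      czConst p A 𝒢.ratio * ∫⁻ z, ENNReal.ofReal (|f z| ^ p) ∂μ := by
  rcases lt_trichotomy p 2 with h2 | h2 | h2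
  · refine (h.strong_bound_lt_two hfc hfi hM hp h2).trans ?_
    gcongr
    exact le_self_add.trans le_self_add
  · have := h.l2 f hfc.measurable hfi ⟨M, hM⟩
    have e3 : ∀ x : ℝ, ‖x‖ₑ ^ 2 = ENNReal.ofReal (|x| ^ p) := fun x => by
        rw [← ofReal_norm, Real.norm_eq_abs, ← ENNReal.ofReal_pow (abs_nonneg _), h2]
        norm_cast
    simp only [e3] at this
    refine this.trans ?_
    gcongr
    exact le_add_self.trans le_self_add
  · refine (h.strong_bound_gt_two h' hfc hfi hM h2).trans ?_
    gcongr
    exact le_add_self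

end IsCZKernel

end CZKernelDuality

section Gaussian

variable {d : ℕ}

lemma integrable_exp_neg_mul_norm_sq {b : ℝ} (hb : 0 < b) :
    Integrable (fun y : Ed d => Real.exp (-b * ‖y‖ ^ 2)) := by
  refine not_imp_comm.1 integral_undef ?_
  rw [GaussianFourier.integral_rexp_neg_mul_sq_norm hb]
  positivity

/-- The normalised Gaussian `c exp(-|y|²/4)` on `ℝ^d`. -/
def gau (y : Ed d) : ℝ := (∫ x : Ed d, Real.exp (-(1 / 4) * ‖x‖ ^ 2))⁻¹ * Real.exp (-(1 / 4) * ‖y‖ ^ 2)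

lemma gau_const_pos : 0 < (∫ x : Ed d, Real.exp (-(1 / 4) * ‖x‖ ^ 2))⁻¹ := by
  rw [GaussianFourier.integral_rexp_neg_mul_sq_norm (by norm_num)]
  positivity

lemma gau_nonneg (y : Ed d) : 0 ≤ gau y := mul_nonneg gau_const_pos.le (Real.exp_pos _).le

lemma integral_gau : ∫ y : Ed d, gau y = 1 := by
  simp only [gau]
  rw [integral_const_mul]
  exact inv_mul_cancel₀ (inv_pos.1 gau_const_pos).ne'

lemma contDiff_gau : ContDiff ℝ (⊤ : ℕ∞) (gau : Ed d → ℝ) := by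
  have := contDiff_norm_sq ℝ (E := Ed d) (n := (⊤ : ℕ∞))
  unfold gau
  fun_prop

lemma fderiv_gau (y v : Ed d) : fderiv ℝ gau y v = -(inner ℝ y v / 2) * gau y := by
  have h : HasFDerivAt (gau : Ed d → ℝ) ((∫ x : Ed d, Real.exp (-(1 / 4) * ‖x‖ ^ 2))⁻¹ •
      (Real.exp (-(1 / 4) * ‖y‖ ^ 2) • ((-(1 / 4) : ℝ) • (2 • (innerSL ℝ y))))) y :=
    (((hasStrictFDerivAt_norm_sq y).hasFDerivAt.const_mul (-(1 / 4))).exp).const_mul _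
  rw [h.fderiv]
  simp only [gau, smul_apply, smul_eq_mul, nsmul_eq_mul]
  simp
  ring

lemma integrable_pow_mul_gau (m : ℕ) : Integrable (fun y : Ed d => (1 + ‖y‖) ^ m * gau y) := by
  refine Integrable.mono' (((integrable_exp_neg_mul_norm_sq (d := d) (b := 1 / 8) (by norm_num)).const_mul
    (∫ x : Ed d, Real.exp (-(1 / 4) * ‖x‖ ^ 2))⁻¹).const_mul (m.factorial * Real.exp 3)) ?_ ?_
  · have := (contDiff_gau (d := d)).continuous
    exact (by fun_prop : Continuous fun y : Ed d => (1 + ‖y‖) ^ m * gau y).aestronglyMeasurable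
  · refine Filter.Eventually.of_forall fun y => ?_
    rw [Real.norm_of_nonneg (mul_nonneg (by positivity) (gau_nonneg y)), gau]
    have h1 : (1 + ‖y‖) ^ m ≤ m.factorial * Real.exp (1 + ‖y‖) := by
      have := Real.pow_div_factorial_le_exp (1 + ‖y‖) (by positivity) m
      rwa [div_le_iff₀' (by positivity)] at this
    have h2 : Real.exp (1 + ‖y‖) ≤ Real.exp (3 + 1 / 8 * ‖y‖ ^ 2) := by
      apply Real.exp_le_exp.2
      nlinarith [sq_nonneg (‖y‖ - 4)]
    have h3 : Real.exp (3 + 1 / 8 * ‖y‖ ^ 2) * Real.exp (-(1 / 4) * ‖y‖ ^ 2) =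
        Real.exp 3 * Real.exp (-(1 / 8) * ‖y‖ ^ 2) := by
      rw [← Real.exp_add, ← Real.exp_add]; congr 1; ring
    have hc := gau_const_pos (d := d)
    calc _ ≤ m.factorial * Real.exp (3 + 1 / 8 * ‖y‖ ^ 2) *
          ((∫ x : Ed d, Real.exp (-(1 / 4) * ‖x‖ ^ 2))⁻¹ * Real.exp (-(1 / 4) * ‖y‖ ^ 2)) := by
          gcongr
          exact h1.trans (by gcongr)
      _ = _ := by linear_combination (m.factorial * (∫ x : Ed d, Real.exp (-(1 / 4) * ‖x‖ ^ 2))⁻¹) * h3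

lemma const_mul_pow_gau_le {C : ℝ} {m k : ℕ} (hmk : m ≤ k) (y : Ed d) :
    C * ((1 + ‖y‖) ^ m * gau y) ≤ |C| * ((1 + ‖y‖) ^ k * gau y) := by
  have h1 : (1 : ℝ) ≤ 1 + ‖y‖ := by linarith [norm_nonneg y]
  have hg := gau_nonneg y
  have h2 := pow_le_pow_right₀ h1 hmk
  gcongr
  exact le_abs_self _

/-- Smooth functions dominated, with their gradient, by a polynomial times a Gaussian. -/
structure IsProfile (P : Ed d → ℝ) : Prop where
  contDiff : ContDiff ℝ (⊤ : ℕ∞) P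
  bound : ∃ (C : ℝ) (m : ℕ), ∀ y, |P y| ≤ C * ((1 + ‖y‖) ^ m * gau y)
  bound_fderiv : ∃ (C : ℝ) (m : ℕ), ∀ y, ‖fderiv ℝ P y‖ ≤ C * ((1 + ‖y‖) ^ m * gau y)

namespace IsProfile

variable {P : Ed d → ℝ}

lemma integrable_pow (h : IsProfile P) (k : ℕ) : Integrable fun y => ‖y‖ ^ k * P y := by
  obtain ⟨C, m, hC⟩ := h.bound
  refine Integrable.mono' ((integrable_pow_mul_gau (m + k)).const_mul C) ?_ ?_
  · have := h.contDiff.continuous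
    exact (by fun_prop : Continuous fun y : Ed d => ‖y‖ ^ k * P y).aestronglyMeasurable
  · refine Filter.Eventually.of_forall fun y => ?_
    rw [Real.norm_eq_abs, abs_mul, abs_of_nonneg (by positivity)]
    calc ‖y‖ ^ k * |P y| ≤ (1 + ‖y‖) ^ k * (C * ((1 + ‖y‖) ^ m * gau y)) := by
          gcongr
          · linarith
          · exact hC y
      _ = _ := by rw [pow_add]; ring

lemma integrable (h : IsProfile P) : Integrable P := by simpa using h.integrable_pow 0

lemma integrable_pow_fderiv (h : IsProfile P) (k : ℕ) :
    Integrable fun y => ‖y‖ ^ k * ‖fderiv ℝ P y‖ := by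
  obtain ⟨C, m, hC⟩ := h.bound_fderiv
  refine Integrable.mono' ((integrable_pow_mul_gau (m + k)).const_mul C) ?_ ?_
  · have := h.contDiff.continuous_fderiv (by simp)
    exact (by fun_prop : Continuous fun y : Ed d => ‖y‖ ^ k * ‖fderiv ℝ P y‖).aestronglyMeasurable
  · refine Filter.Eventually.of_forall fun y => ?_
    rw [Real.norm_eq_abs, abs_of_nonneg (by positivity)]
    calc ‖y‖ ^ k * ‖fderiv ℝ P y‖ ≤ (1 + ‖y‖) ^ k * (C * ((1 + ‖y‖) ^ m * gau y)) := by
          gcongr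
          · linarith
          · exact hC y
      _ = _ := by rw [pow_add]; ring

lemma integrable_fderiv (h : IsProfile P) (v : Ed d) : Integrable fun y => fderiv ℝ P y v := by
  have h0 := (h.integrable_pow_fderiv 0).mul_const ‖v‖
  refine Integrable.mono' h0 ?_ ?_
  · have := h.contDiff.continuous_fderiv (by simp)
    exact (by fun_prop : Continuous fun y : Ed d => fderiv ℝ P y v).aestronglyMeasurable
  · refine Filter.Eventually.of_forall fun y => ?_
    simpa using (fderiv ℝ P y).le_opNorm v

end IsProfile

lemma isProfile_gau : IsProfile (gau : Ed d → ℝ) where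
  contDiff := contDiff_gau
  bound := ⟨1, 0, fun y => by simp [abs_of_nonneg (gau_nonneg y)]⟩
  bound_fderiv := ⟨1, 1, fun y => by
    refine ContinuousLinearMap.opNorm_le_bound _ ?_ fun v => ?_
    · have := gau_nonneg y
      positivity
    · rw [fderiv_gau, Real.norm_eq_abs, abs_mul, abs_of_nonneg (gau_nonneg y), abs_neg, abs_div]
      have h1 := abs_real_inner_le_norm y v
      have h2 : |inner ℝ y v| / |2| ≤ (1 + ‖y‖) * ‖v‖ := by
        rw [abs_two]; nlinarith [norm_nonneg y, norm_nonneg v, mul_nonneg (norm_nonneg y) (norm_nonneg v)]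
      calc _ ≤ ((1 + ‖y‖) * ‖v‖) * gau y := by gcongr; exact gau_nonneg y
        _ = _ := by ring⟩

/-- If `P` is a profile, so is `y ↦ ⟪y, v⟫ P y`. -/
lemma IsProfile.inner_mul {P : Ed d → ℝ} (h : IsProfile P) (v : Ed d) :
    IsProfile fun y => inner ℝ y v * P y where
  contDiff := by
    exact (contDiff_id.inner ℝ contDiff_const).mul h.contDiff
  bound := by
    obtain ⟨C, m, hC⟩ := h.bound
    refine ⟨‖v‖ * C, m + 1, fun y => ?_⟩
    rw [abs_mul]
    calc |inner ℝ y v| * |P y| ≤ ((1 + ‖y‖) * ‖v‖) * (C * ((1 + ‖y‖) ^ m * gau y)) := by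
          gcongr
          · exact (abs_real_inner_le_norm y v).trans (by gcongr; linarith)
          · exact hC y
      _ = _ := by ring
  bound_fderiv := by
    obtain ⟨C, m, hC⟩ := h.bound
    obtain ⟨C', m', hC'⟩ := h.bound_fderiv
    refine ⟨‖v‖ * |C'| + ‖v‖ * |C|, m + m' + 1, fun y => ?_⟩
    have hd : DifferentiableAt ℝ P y := h.contDiff.differentiable (by simp) y
    have e : fderiv ℝ (fun y => inner ℝ y v * P y) y =
        inner ℝ y v • fderiv ℝ P y + P y • (innerSL ℝ v) := by
      have hi : HasFDerivAt (fun y : Ed d => inner ℝ y v) (innerSL ℝ v) y := by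
        have := (innerSL ℝ v).hasFDerivAt (x := y)
        refine this.congr_of_eventuallyEq (Filter.Eventually.of_forall fun z => ?_)
        simp [real_inner_comm]
      exact (hi.mul hd.hasFDerivAt).fderiv
    rw [e]
    calc _ ≤ ‖inner ℝ y v • fderiv ℝ P y‖ + ‖P y • (innerSL ℝ v)‖ := norm_add_le _ _
      _ ≤ ((1 + ‖y‖) * ‖v‖) * (|C'| * ((1 + ‖y‖) ^ (m' + m) * gau y)) +
          (|C| * ((1 + ‖y‖) ^ (m + m' + 1) * gau y)) * ‖v‖ := by
          rw [norm_smul, norm_smul, innerSL_apply_norm, Real.norm_eq_abs, Real.norm_eq_abs]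
          gcongr
          · exact (abs_real_inner_le_norm y v).trans (by gcongr; linarith)
          · exact (hC' y).trans (const_mul_pow_gau_le (by omega) y)
          · exact (hC y).trans (const_mul_pow_gau_le (by omega) y)
      _ = _ := by ring

lemma IsProfile.add {P Q : Ed d → ℝ} (h : IsProfile P) (h' : IsProfile Q) :
    IsProfile fun y => P y + Q y where
  contDiff := h.contDiff.add h'.contDiff
  bound := by
    obtain ⟨C, m, hC⟩ := h.bound
    obtain ⟨C', m', hC'⟩ := h'.bound
    refine ⟨|C| + |C'|, m + m', fun y => ?_⟩
    refine (abs_add_le _ _).trans ((add_le_add (hC y) (hC' y)).trans ?_)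
    rw [add_mul]
    exact add_le_add (const_mul_pow_gau_le (by omega) y) (const_mul_pow_gau_le (by omega) y)
  bound_fderiv := by
    obtain ⟨C, m, hC⟩ := h.bound_fderiv
    obtain ⟨C', m', hC'⟩ := h'.bound_fderiv
    refine ⟨|C| + |C'|, m + m', fun y => ?_⟩
    have e : fderiv ℝ (fun y => P y + Q y) y = fderiv ℝ P y + fderiv ℝ Q y :=
      fderiv_add (h.contDiff.differentiable (by simp) y) (h'.contDiff.differentiable (by simp) y)
    rw [e]
    refine (norm_add_le _ _).trans ((add_le_add (hC y) (hC' y)).trans ?_)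
    rw [add_mul]
    exact add_le_add (const_mul_pow_gau_le (by omega) y) (const_mul_pow_gau_le (by omega) y)

lemma IsProfile.const_mul {P : Ed d → ℝ} (h : IsProfile P) (c : ℝ) :
    IsProfile fun y => c * P y where
  contDiff := contDiff_const.mul h.contDiff
  bound := by
    obtain ⟨C, m, hC⟩ := h.bound
    refine ⟨|c| * C, m, fun y => ?_⟩
    rw [abs_mul, mul_assoc]
    exact mul_le_mul_of_nonneg_left (hC y) (abs_nonneg c)
  bound_fderiv := by
    obtain ⟨C, m, hC⟩ := h.bound_fderiv
    refine ⟨|c| * C, m, fun y => ?_⟩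
    have e : fderiv ℝ (fun y => c * P y) y = c • fderiv ℝ P y :=
      fderiv_const_mul (h.contDiff.differentiable (by simp) y) c
    rw [e, norm_smul, mul_assoc]
    exact mul_le_mul_of_nonneg_left (hC y) (abs_nonneg c)

lemma isProfile_dgau (v : Ed d) : IsProfile fun y => fderiv ℝ gau y v := by
  have := (isProfile_gau.inner_mul v).const_mul (-(1 / 2))
  convert this using 2 with y
  rw [fderiv_gau]; ring

lemma isProfile_ddgau (v w : Ed d) :
    IsProfile fun y => fderiv ℝ (fun x => fderiv ℝ gau x v) y w := by
  have := ((isProfile_gau.const_mul (-(inner ℝ w v / 2))).add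
    (((isProfile_gau.inner_mul v).inner_mul w).const_mul (1 / 4)))
  convert this using 2 with y
  have e : (fun x : Ed d => fderiv ℝ gau x v) = fun x => (-(inner ℝ x v / 2)) * gau x :=
    funext fun x => fderiv_gau x v
  have hi : HasFDerivAt (fun y : Ed d => -(inner ℝ y v / 2)) (-((1 / 2 : ℝ) • (innerSL ℝ v))) y := by
    have := (-((1 / 2 : ℝ) • (innerSL ℝ v))).hasFDerivAt (x := y)
    refine this.congr_of_eventuallyEq (Filter.Eventually.of_forall fun z => ?_)
    simp [real_inner_comm]
    ring
  have hd : DifferentiableAt ℝ gau y := (contDiff_gau (d := d)).differentiable (by simp) y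
  have e2 : HasFDerivAt (fun x : Ed d => (-(inner ℝ x v / 2)) * gau x) _ y :=
    hi.mul hd.hasFDerivAt
  rw [e, e2.fderiv]
  simp [fderiv_gau, real_inner_comm]
  ring

end Gaussian

section HeatKernel

variable {d : ℕ}

instance : (volume : Measure (ℝ × Ed d)).IsAddHaarMeasure :=
  inferInstanceAs ((volume : Measure ℝ).prod (volume : Measure (Ed d))).IsAddHaarMeasure

lemma integral_inv_smul_scale {r : ℝ} (hr : 0 < r) (F : Ed d → ℝ) :
    ∫ y, (r⁻¹) ^ d * F (r⁻¹ • y) = ∫ y, F y := by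
  rw [integral_const_mul, Measure.integral_comp_inv_smul_of_nonneg _ _ hr.le, finrank_euclideanSpace_fin,
    smul_eq_mul, ← mul_assoc, ← mul_pow, inv_mul_cancel₀ hr.ne', one_pow, one_mul]

lemma lintegral_inv_smul_scale {r : ℝ} (hr : 0 < r) {F : Ed d → ℝ≥0∞} (hF : Measurable F) :
    ∫⁻ y, ENNReal.ofReal ((r⁻¹) ^ d) * F (r⁻¹ • y) = ∫⁻ y, F y := by
  have hm : Measurable fun y : Ed d => r⁻¹ • y := measurable_const_smul _
  have hFm : Measurable fun y : Ed d => F (r⁻¹ • y) := hF.comp hm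
  rw [lintegral_const_mul _ hFm, ← lintegral_map hF hm,
    Measure.map_addHaar_smul _ (inv_ne_zero hr.ne'), lintegral_smul_measure, smul_eq_mul,
    ← mul_assoc, ← ENNReal.ofReal_mul (by positivity), finrank_euclideanSpace_fin,
    abs_of_pos (by positivity), inv_pow, inv_inv, inv_mul_cancel₀ (by positivity)]
  simp

/-- The parabolically rescaled profile `s^{-m-d/2} P(y/√s)`, cut off to times in `[a,b)`. -/
def hker (m : ℕ) (a b : ℝ) (P : Ed d → ℝ) (z : ℝ × Ed d) : ℝ :=
  (Ico a b).indicator (fun s => (s⁻¹) ^ m) z.1 * (((√z.1)⁻¹) ^ d * P ((√z.1)⁻¹ • z.2))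

/-- Averages `∫ P(y) g(t - s, x - √s y) dy`. -/
def hav (P : Ed d → ℝ) (s : ℝ) (g : ℝ × Ed d → ℝ) (z : ℝ × Ed d) : ℝ :=
  ∫ y, P y * g (z.1 - s, z.2 - √s • y)

lemma measurable_hker {m : ℕ} {a b : ℝ} {P : Ed d → ℝ} (hP : Measurable P) :
    Measurable (hker m a b P) := by
  refine Measurable.mul ?_ (Measurable.mul (by fun_prop) (hP.comp ?_))
  · exact ((by fun_prop : Measurable fun s : ℝ => (s⁻¹) ^ m).indicator measurableSet_Ico).comp
      measurable_fst
  · exact (by fun_prop : Measurable fun z : ℝ × Ed d => (√z.1)⁻¹).smul measurable_snd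

lemma lintegral_hker_slice {m : ℕ} {a b : ℝ} (ha : 0 < a) {P : Ed d → ℝ} (hP : Measurable P) (s : ℝ)
    {w : Ed d → ℝ≥0∞} (hw : Measurable w) :
    ∫⁻ y, ‖hker m a b P (s, y)‖ₑ * w y =
      (Ico a b).indicator (fun s => ENNReal.ofReal ((s⁻¹) ^ m)) s * ∫⁻ y, ‖P y‖ₑ * w (√s • y) := by
  by_cases hs : s ∈ Ico a b
  · have hs0 : 0 < √s := Real.sqrt_pos.2 (ha.trans_le hs.1)
    have hs1 : 0 < s := ha.trans_le hs.1
    rw [indicator_of_mem hs, ← lintegral_inv_smul_scale hs0 (F := fun y => ‖P y‖ₑ * w (√s • y))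
      (hP.enorm.mul (hw.comp (measurable_const_smul _))), ← lintegral_const_mul']
    · refine lintegral_congr fun y => ?_
      simp only [hker, indicator_of_mem hs, enorm_mul, smul_inv_smul₀ hs0.ne']
      rw [Real.enorm_of_nonneg (by positivity), Real.enorm_of_nonneg (by positivity)]
      ring
    · exact ENNReal.ofReal_ne_top
  · simp [hker, hs]

lemma lintegral_hker {m : ℕ} {a b : ℝ} (ha : 0 < a) {P : Ed d → ℝ} (hP : Measurable P)
    {w : ℝ × Ed d → ℝ≥0∞} (hw : Measurable w) :
    ∫⁻ z, ‖hker m a b P z‖ₑ * w z =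
      ∫⁻ s in Ico a b, ENNReal.ofReal ((s⁻¹) ^ m) * ∫⁻ y, ‖P y‖ₑ * w (s, √s • y) := by
  have hmm : Measurable fun z => ‖hker m a b P z‖ₑ * w z := (measurable_hker hP).enorm.mul hw
  rw [Measure.volume_eq_prod, lintegral_prod _ hmm.aemeasurable,
    ← lintegral_indicator measurableSet_Ico]
  refine lintegral_congr fun s => ?_
  rw [lintegral_hker_slice ha hP s (w := fun y => w (s, y)) (hw.comp measurable_prodMk_left)]
  by_cases hs : s ∈ Ico a b <;> simp [hs]

lemma integrable_hker {m : ℕ} {a b : ℝ} (ha : 0 < a) {P : Ed d → ℝ} (hP : Measurable P)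
    (hPi : Integrable P) : Integrable (hker m a b P) := by
  refine ⟨(measurable_hker hP).aestronglyMeasurable, ?_⟩
  have := lintegral_hker (m := m) (b := b) ha hP (w := fun _ => 1) measurable_const
  simp only [mul_one] at this
  rw [HasFiniteIntegral, this]
  calc ∫⁻ s in Ico a b, ENNReal.ofReal ((s⁻¹) ^ m) * ∫⁻ y, ‖P y‖ₑ
      ≤ ∫⁻ s in Ico a b, ENNReal.ofReal ((a⁻¹) ^ m) * ∫⁻ y, ‖P y‖ₑ := by
        refine setLIntegral_mono' measurableSet_Ico fun s hs => ?_
        have := ha.trans_le hs.1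
        have h2 := hs.1
        gcongr
    _ < ⊤ := by
      have := hPi.2.ne
      simp only [lintegral_const, Measure.restrict_apply, MeasurableSet.univ, univ_inter,
        Real.volume_Ico]
      finiteness

lemma cv_hker {m : ℕ} {a b : ℝ} (ha : 0 < a) {P : Ed d → ℝ} (hP : Measurable P)
    (hPi : Integrable P) {g : ℝ × Ed d → ℝ} (hg : Measurable g) {M : ℝ} (hM : ∀ z, |g z| ≤ M)
    (z : ℝ × Ed d) :
    cv volume (hker m a b P) g z = ∫ s in Ico a b, (s⁻¹) ^ m * hav P s g z := by
  have hi : Integrable (fun y => hker m a b P y * g (z - y)) :=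
    (integrable_hker ha hP hPi).mul_bdd (c := M)
      (hg.comp (measurable_const.sub measurable_id)).aestronglyMeasurable
      (Filter.Eventually.of_forall fun y => hM _)
  rw [cv_eq, Measure.volume_eq_prod, integral_prod _ hi, ← integral_indicator measurableSet_Ico]
  refine integral_congr_ae (Filter.Eventually.of_forall fun s => ?_)
  by_cases hs : s ∈ Ico a b
  · have hs0 : 0 < √s := Real.sqrt_pos.2 (ha.trans_le hs.1)
    simp only [hker, indicator_of_mem hs, hav]
    rw [← integral_inv_smul_scale hs0 (fun y => P y * g (z.1 - s, z.2 - √s • y)),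
      ← integral_const_mul]
    refine integral_congr_ae (Filter.Eventually.of_forall fun y => ?_)
    simp only [smul_inv_smul₀ hs0.ne']
    change _ = (s⁻¹) ^ m * ((√s)⁻¹ ^ d * (P ((√s)⁻¹ • y) * g (z - (s, y))))
    ring
  · simp [hker, hs]

end HeatKernel

section TestFunctions

variable {H : Type*} [NormedAddCommGroup H] [NormedSpace ℝ H]

/-- Directional derivative. -/
def dd (v : H) (φ : H → ℝ) (z : H) : ℝ := fderiv ℝ φ z v

/-- Smooth compactly supported functions. -/
structure IsTest (φ : H → ℝ) : Prop where
  contDiff : ContDiff ℝ (⊤ : ℕ∞) φ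
  compact : HasCompactSupport φ

namespace IsTest

variable {φ ψ : H → ℝ}

lemma continuous (h : IsTest φ) : Continuous φ := h.contDiff.continuous

lemma differentiable (h : IsTest φ) : Differentiable ℝ φ := h.contDiff.differentiable (by simp)

lemma dd (h : IsTest φ) (v : H) : IsTest (dd v φ) where
  contDiff := (h.contDiff.fderiv_right (m := (⊤ : ℕ∞)) (by simp)).clm_apply contDiff_const
  compact := h.compact.fderiv_apply ℝ v

lemma add (h : IsTest φ) (h' : IsTest ψ) : IsTest fun z => φ z + ψ z :=
  ⟨h.contDiff.add h'.contDiff, h.compact.add h'.compact⟩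

lemma sub (h : IsTest φ) (h' : IsTest ψ) : IsTest fun z => φ z - ψ z :=
  ⟨h.contDiff.sub h'.contDiff, h.compact.sub h'.compact⟩

lemma zero : IsTest fun _ : H => (0 : ℝ) := ⟨contDiff_const, HasCompactSupport.zero⟩

lemma sum {ι : Type*} (s : Finset ι) {f : ι → H → ℝ} (h : ∀ i, IsTest (f i)) :
    IsTest fun z => ∑ i ∈ s, f i z := by
  classical
  induction s using Finset.induction_on with
  | empty => simpa using zero
  | insert a s ha ih => simpa [Finset.sum_insert ha] using (h a).add ih

lemma mul_left (h : IsTest φ) {η : H → ℝ} (hη : ContDiff ℝ (⊤ : ℕ∞) η) :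
    IsTest fun z => η z * φ z :=
  ⟨hη.mul h.contDiff, h.compact.mul_left⟩

lemma const_mul (h : IsTest φ) (c : ℝ) : IsTest fun z => c * φ z := h.mul_left contDiff_const

lemma bounded (h : IsTest φ) : ∃ M, 0 ≤ M ∧ ∀ z, |φ z| ≤ M := by
  obtain ⟨M, hM⟩ := h.continuous.bounded_above_of_compact_support h.compact
  exact ⟨M, (norm_nonneg _).trans (hM 0), hM⟩

lemma integrable [MeasurableSpace H] [BorelSpace H] [SecondCountableTopology H]
    {μ : Measure H} [IsFiniteMeasureOnCompacts μ]
    (h : IsTest φ) : Integrable φ μ :=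
  h.continuous.integrable_of_hasCompactSupport h.compact

lemma measurable [MeasurableSpace H] [BorelSpace H] (h : IsTest φ) : Measurable φ :=
  h.continuous.measurable

end IsTest

lemma dd_add {φ ψ : H → ℝ} (h : IsTest φ) (h' : IsTest ψ) (v z : H) :
    dd v (fun z => φ z + ψ z) z = dd v φ z + dd v ψ z := by
  simp only [dd]
  rw [fderiv_fun_add (h.differentiable z) (h'.differentiable z)]; rfl

lemma dd_sub {φ ψ : H → ℝ} (h : IsTest φ) (h' : IsTest ψ) (v z : H) :
    dd v (fun z => φ z - ψ z) z = dd v φ z - dd v ψ z := by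
  simp only [dd]
  rw [fderiv_fun_sub (h.differentiable z) (h'.differentiable z)]; rfl

lemma dd_const_mul {φ : H → ℝ} (h : IsTest φ) (c : ℝ) (v z : H) :
    dd v (fun z => c * φ z) z = c * dd v φ z := by
  simp only [dd]
  rw [fderiv_const_mul (h.differentiable z)]; rfl

lemma dd_sum {ι : Type*} (s : Finset ι) {f : ι → H → ℝ} (h : ∀ i, IsTest (f i)) (v z : H) :
    dd v (fun z => ∑ i ∈ s, f i z) z = ∑ i ∈ s, dd v (f i) z := by
  simp only [dd]
  rw [fderiv_fun_sum fun i _ => (h i).differentiable z]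
  simp

lemma dd_comm {φ : H → ℝ} (h : IsTest φ) (v w : H) : dd v (dd w φ) = dd w (dd v φ) := by
  funext z
  have hd : DifferentiableAt ℝ (fderiv ℝ φ) z :=
    (h.contDiff.fderiv_right (m := (⊤ : ℕ∞)) (by simp)).differentiable (by simp) z
  have e : ∀ v w : H, dd v (dd w φ) z = fderiv ℝ (fderiv ℝ φ) z v w := fun v w => by
    simp only [dd]
    change fderiv ℝ (fun z => fderiv ℝ φ z w) z v = _
    rw [fderiv_clm_apply hd (differentiableAt_const w)]
    simp
  rw [e, e]
  refine (h.contDiff.contDiffAt.isSymmSndFDerivAt ?_).eq _ _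
  rw [minSmoothness_of_isRCLikeNormedField]
  exact WithTop.coe_le_coe.2 le_top

end TestFunctions

section HeatFlow

variable {d : ℕ}

/-- Unit vector in the time direction. -/
def et : ℝ × Ed d := (1, 0)

/-- Space direction. -/
def ex (v : Ed d) : ℝ × Ed d := (0, v)

/-- Coordinate unit vector. -/
def eb (i : Fin d) : Ed d := EuclideanSpace.single i 1

/-- Laplacian. -/
def lapl (φ : ℝ × Ed d → ℝ) (z : ℝ × Ed d) : ℝ := ∑ i, dd (ex (eb i)) (dd (ex (eb i)) φ) z

lemma IsTest.lapl {φ : ℝ × Ed d → ℝ} (h : IsTest φ) : IsTest (lapl φ) :=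
  IsTest.sum _ fun _ => (h.dd _).dd _

lemma integrable_hav {P : Ed d → ℝ} (hPi : Integrable P) {g : ℝ × Ed d → ℝ} (hg : Measurable g)
    {M : ℝ} (hM : ∀ z, |g z| ≤ M) (s : ℝ) (z : ℝ × Ed d) :
    Integrable fun y => P y * g (z.1 - s, z.2 - √s • y) :=
  hPi.mul_bdd (c := M) (hg.comp (by fun_prop)).aestronglyMeasurable
    (Filter.Eventually.of_forall fun y => hM _)

lemma hav_sub {P : Ed d → ℝ} (hPi : Integrable P) {g g' : ℝ × Ed d → ℝ} (hg : IsTest g)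
    (hg' : IsTest g') (s : ℝ) (z : ℝ × Ed d) :
    hav P s (fun z => g z - g' z) z = hav P s g z - hav P s g' z := by
  obtain ⟨M, -, hM⟩ := hg.bounded
  obtain ⟨M', -, hM'⟩ := hg'.bounded
  simp only [hav, mul_sub]
  exact integral_sub (integrable_hav hPi hg.measurable hM s z)
    (integrable_hav hPi hg'.measurable hM' s z)

lemma hav_sum {P : Ed d → ℝ} (hPi : Integrable P) {ι : Type*} (t : Finset ι)
    {g : ι → ℝ × Ed d → ℝ} (hg : ∀ i, IsTest (g i)) (s : ℝ) (z : ℝ × Ed d) :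
    hav P s (fun z => ∑ i ∈ t, g i z) z = ∑ i ∈ t, hav P s (g i) z := by
  simp only [hav, Finset.mul_sum]
  refine integral_finsetSum _ fun i _ => ?_
  obtain ⟨M, -, hM⟩ := (hg i).bounded
  exact integrable_hav hPi (hg i).measurable hM s z

lemma hasFDerivAt_shift {g : ℝ × Ed d → ℝ} (hg : IsTest g) (s : ℝ) (z : ℝ × Ed d) (y : Ed d) :
    HasFDerivAt (fun y => g (z.1 - s, z.2 - √s • y))
      ((fderiv ℝ g (z.1 - s, z.2 - √s • y)).comp
        ((ContinuousLinearMap.inr ℝ ℝ (Ed d)).comp (-(√s • ContinuousLinearMap.id ℝ (Ed d))))) y := by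
  have h1 : HasFDerivAt (fun y : Ed d => (z.1 - s, z.2 - √s • y))
      ((ContinuousLinearMap.inr ℝ ℝ (Ed d)).comp (-(√s • ContinuousLinearMap.id ℝ (Ed d)))) y := by
    have h2 : HasFDerivAt (fun y : Ed d => z.2 - √s • y) (-(√s • ContinuousLinearMap.id ℝ (Ed d))) y :=
      ((hasFDerivAt_id y).const_smul √s).const_sub z.2
    refine ((hasFDerivAt_const (z.1 - s) y).prodMk h2).congr_fderiv ?_
    ext <;> simp
  exact (hg.differentiable _).hasFDerivAt.comp y h1

/-- Integration by parts in the averages. -/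
lemma hav_fderiv {P : Ed d → ℝ} (hP : IsProfile P) {g : ℝ × Ed d → ℝ} (hg : IsTest g) (v : Ed d)
    (s : ℝ) (z : ℝ × Ed d) :
    hav (fun y => fderiv ℝ P y v) s g z = √s * hav P s (dd (ex v) g) z := by
  obtain ⟨M, -, hM⟩ := hg.bounded
  obtain ⟨M', -, hM'⟩ := (hg.dd (ex v)).bounded
  have e : ∀ y, fderiv ℝ (fun y => g (z.1 - s, z.2 - √s • y)) y v =
      -√s * dd (ex v) g (z.1 - s, z.2 - √s • y) := fun y => by
    rw [(hasFDerivAt_shift hg s z y).fderiv]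
    simp only [dd, ex, ContinuousLinearMap.comp_apply, ContinuousLinearMap.inr_apply]
    rw [← smul_eq_mul, ← map_smul]
    simp
  have i2 := integrable_hav hP.integrable (hg.dd (ex v)).measurable hM' s z
  have := integral_mul_fderiv_eq_neg_fderiv_mul_of_integrable (μ := volume) (f := P) (v := v)
    (g := fun y => g (z.1 - s, z.2 - √s • y))
    (integrable_hav (hP.integrable_fderiv v) hg.measurable hM s z)
    (by simp only [e]; simpa [mul_left_comm] using i2.const_mul (-√s))
    (integrable_hav hP.integrable hg.measurable hM s z)
    (fun y _ => hP.contDiff.differentiable (by simp) y)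
    (fun y _ => (hasFDerivAt_shift hg s z y).differentiableAt)
  simp only [e] at this
  rw [hav, hav, ← neg_eq_iff_eq_neg.2 this, ← integral_const_mul, ← integral_neg]
  refine integral_congr_ae (Filter.Eventually.of_forall fun y => ?_)
  simp only
  ring

lemma continuous_hav {P : Ed d → ℝ} (hP : Continuous P) (hPi : Integrable P) {g : ℝ × Ed d → ℝ}
    (hg : IsTest g) (z : ℝ × Ed d) : Continuous fun s => hav P s g z := by
  obtain ⟨M, -, hM⟩ := hg.bounded
  have := hg.continuous
  refine continuous_of_dominated (bound := fun y => |P y| * M) (fun s => ?_) (fun s => ?_)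
    (hPi.norm.mul_const M) (Filter.Eventually.of_forall fun y => by fun_prop)
  · exact (by fun_prop : Continuous fun y => P y * g (z.1 - s, z.2 - √s • y)).aestronglyMeasurable
  · refine Filter.Eventually.of_forall fun y => ?_
    rw [Real.norm_eq_abs, abs_mul]
    gcongr
    exact hM _

lemma hav_zero {g : ℝ × Ed d → ℝ} (z : ℝ × Ed d) : hav gau 0 g z = g z := by
  simp [hav, integral_mul_const, integral_gau]

lemma tendsto_hav_zero {g : ℝ × Ed d → ℝ} (hg : IsTest g) (z : ℝ × Ed d) :
    Filter.Tendsto (fun s => hav gau s g z) (nhds 0) (nhds (g z)) := by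
  have := (continuous_hav contDiff_gau.continuous isProfile_gau.integrable hg z).tendsto 0
  rwa [hav_zero] at this

lemma hav_eventually_zero {g : ℝ × Ed d → ℝ} (hg : IsTest g) (z : ℝ × Ed d) (P : Ed d → ℝ) :
    ∀ᶠ s in Filter.atTop, hav P s g z = 0 := by
  obtain ⟨R, hR⟩ := hg.compact.isCompact.isBounded.subset_closedBall (0 : ℝ × Ed d)
  filter_upwards [Filter.eventually_gt_atTop (z.1 + R)] with s hs
  have : ∀ y : Ed d, g (z.1 - s, z.2 - √s • y) = 0 := fun y => by
    by_contra h
    have h1 := hR (subset_tsupport _ (Function.mem_support.2 h))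
    rw [mem_closedBall_zero_iff, Prod.norm_def] at h1
    have h2 := (le_max_left _ _).trans h1
    rw [Real.norm_eq_abs] at h2
    have := neg_abs_le (z.1 - s)
    simp only at h2
    linarith
  simp [hav, this]

lemma sum_coord_eb (y : Ed d) : y = ∑ i, y i • eb i := by
  ext j
  simp [eb, Pi.single_apply]

lemma sum_smul_ex (c : ℝ) (y : Ed d) : ∑ i, (c * y i) • ex (eb i) = ex (c • y) := by
  conv_rhs => rw [sum_coord_eb y, Finset.smul_sum]
  ext j
  · simp [Prod.fst_sum, ex]
  · simp [Prod.snd_sum, ex, mul_smul]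

lemma hasDerivAt_hav {g : ℝ × Ed d → ℝ} (hg : IsTest g) (z : ℝ × Ed d) {s : ℝ} (hs : 0 < s) :
    HasDerivAt (fun s => hav gau s g z) (-(hav gau s (fun z => dd et g z - lapl g z) z)) s := by
  obtain ⟨M, -, hM⟩ := hg.bounded
  obtain ⟨B, hB0, hB⟩ : ∃ B, 0 ≤ B ∧ ∀ z, ‖fderiv ℝ g z‖ ≤ B := by
    obtain ⟨M, hM⟩ := (hg.contDiff.continuous_fderiv (by simp)).bounded_above_of_compact_support
      (hg.compact.fderiv ℝ)
    exact ⟨M, (norm_nonneg _).trans (hM 0), hM⟩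
  have hgau := isProfile_gau (d := d)
  have hs2 : 0 < √(s / 2) := Real.sqrt_pos.2 (by positivity)
  have hmeas : ∀ s, AEStronglyMeasurable (fun y => gau y * g (z.1 - s, z.2 - √s • y)) :=
    fun s => (integrable_hav hgau.integrable hg.measurable hM s z).aestronglyMeasurable
  have hder : ∀ (y : Ed d), ∀ r ∈ Ioi (s / 2), HasDerivAt (fun r => gau y * g (z.1 - r, z.2 - √r • y))
      (gau y * fderiv ℝ g (z.1 - r, z.2 - √r • y) (-1, -((1 / (2 * √r)) • y))) r := by
    intro y r hr
    have hr0 : r ≠ 0 := by have : s / 2 < r := hr; linarith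
    have h1 : HasDerivAt (fun r : ℝ => (z.1 - r, z.2 - √r • y)) (-1, -((1 / (2 * √r)) • y)) r :=
      ((hasDerivAt_id r).const_sub z.1).prodMk
        (((Real.hasDerivAt_sqrt hr0).smul_const y).const_sub z.2)
    exact ((hg.differentiable _).hasFDerivAt.comp_hasDerivAt r h1).const_mul (gau y)
  have main := (hasDerivAt_integral_of_dominated_loc_of_deriv_le (μ := volume)
    (F := fun r y => gau y * g (z.1 - r, z.2 - √r • y))
    (F' := fun r y => gau y * fderiv ℝ g (z.1 - r, z.2 - √r • y) (-1, -((1 / (2 * √r)) • y)))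
    (x₀ := s) (s := Ioi (s / 2)) (bound := fun y => (B * (1 + 1 / (2 * √(s / 2)))) * ((1 + ‖y‖) ^ 1 * gau y))
    (Ioi_mem_nhds (by linarith)) (Filter.Eventually.of_forall hmeas)
    (integrable_hav hgau.integrable hg.measurable hM s z) ?_ ?_
    ((integrable_pow_mul_gau 1).const_mul _)
    (Filter.Eventually.of_forall hder)).2
  · refine main.congr_deriv ?_
    have hsq : 0 < √s := Real.sqrt_pos.2 hs
    have e1 : ∀ y : Ed d, gau y * fderiv ℝ g (z.1 - s, z.2 - √s • y) (-1, -((1 / (2 * √s)) • y)) =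
        -(gau y * dd et g (z.1 - s, z.2 - √s • y)) +
        ∑ i, (1 / √s) * (fderiv ℝ gau y (eb i) * dd (ex (eb i)) g (z.1 - s, z.2 - √s • y)) := by
      intro y
      have ey : ((-1, -((1 / (2 * √s)) • y)) : ℝ × Ed d) =
          -et + ∑ i, (-(1 / (2 * √s)) * y i) • ex (eb i) := by
        have := sum_smul_ex (-(1 / (2 * √s))) y
        rw [this, et, ex]
        ext <;> simp
      rw [ey, map_add, map_sum, mul_add, map_neg, mul_neg, Finset.mul_sum]
      refine congrArg₂ _ rfl (Finset.sum_congr rfl fun i _ => ?_)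
      rw [map_smul, fderiv_gau, smul_eq_mul]
      simp only [dd, eb, EuclideanSpace.inner_single_right]
      simp
      field_simp
    simp only [e1]
    have hi : ∀ i, Integrable (fun y => fderiv ℝ gau y (eb i) * dd (ex (eb i)) g (z.1 - s, z.2 - √s • y)) := by
      intro i
      obtain ⟨M', -, hM'⟩ := (hg.dd (ex (eb i))).bounded
      exact integrable_hav (hgau.integrable_fderiv _) (hg.dd _).measurable hM' s z
    obtain ⟨M', -, hM'⟩ := (hg.dd et).bounded
    have hi0 : Integrable (fun y => -(gau y * dd et g (z.1 - s, z.2 - √s • y))) :=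
      (integrable_hav hgau.integrable (hg.dd _).measurable hM' s z).neg
    rw [integral_add hi0
      (integrable_finsetSum _ fun i _ => (hi i).const_mul _), integral_neg,
      integral_finsetSum _ fun i _ => (hi i).const_mul _, hav_sub hgau.integrable (hg.dd _) hg.lapl]
    have e2 : hav gau s (lapl g) z = ∑ i, hav gau s (dd (ex (eb i)) (dd (ex (eb i)) g)) z :=
      hav_sum hgau.integrable _ (fun i => (hg.dd _).dd _) s z
    rw [e2, neg_sub, sub_eq_neg_add (∑ i, hav gau s (dd (ex (eb i)) (dd (ex (eb i)) g)) z)]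
    refine congrArg₂ _ rfl (Finset.sum_congr rfl fun i _ => ?_)
    have := hav_fderiv hgau (hg.dd (ex (eb i))) (eb i) s z
    rw [integral_const_mul]
    rw [hav] at this
    rw [this]
    field_simp
  · have h1 := hg.contDiff.continuous_fderiv (by simp)
    have h2 := contDiff_gau.continuous (𝕜 := ℝ) (E := Ed d)
    exact (by fun_prop : Continuous fun y => gau y * fderiv ℝ g (z.1 - s, z.2 - √s • y) (-1, -((1 / (2 * √s)) • y))).aestronglyMeasurable
  · refine Filter.Eventually.of_forall fun y r hr => ?_
    have hr' : √(s / 2) ≤ √r := Real.sqrt_le_sqrt (le_of_lt hr)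
    rw [Real.norm_eq_abs, abs_mul, abs_of_nonneg (gau_nonneg y)]
    have h1 : ‖((-1, -((1 / (2 * √r)) • y)) : ℝ × Ed d)‖ ≤ (1 + 1 / (2 * √(s / 2))) * (1 + ‖y‖) := by
      rw [Prod.norm_def, norm_neg, norm_neg, norm_smul, norm_one]
      have h3 : 1 / (2 * √r) ≤ 1 / (2 * √(s / 2)) := by gcongr
      have h4 : 0 ≤ 1 / (2 * √r) := by positivity
      rw [Real.norm_of_nonneg h4]
      have h5 := norm_nonneg y
      apply max_le <;> nlinarith [mul_nonneg h4 h5, mul_le_mul_of_nonneg_right h3 h5]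
    have h2 : |fderiv ℝ g (z.1 - r, z.2 - √r • y) (-1, -((1 / (2 * √r)) • y))| ≤
        B * ((1 + 1 / (2 * √(s / 2))) * (1 + ‖y‖)) :=
      ((fderiv ℝ g _).le_opNorm _).trans (by gcongr; exact hB _)
    calc _ ≤ gau y * (B * ((1 + 1 / (2 * √(s / 2))) * (1 + ‖y‖))) := by
          gcongr
          exact gau_nonneg y
      _ = _ := by ring

end HeatFlow

/-- Minkowski's integral inequality. -/
lemma lintegral_lintegral_rpow_le {X Y : Type*} [MeasurableSpace X] [MeasurableSpace Y]
    {μ : Measure X} {ν : Measure Y} [SFinite μ] [SFinite ν] {p : ℝ} (hp : 1 < p)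
    {F : X → Y → ℝ≥0∞} (hF : Measurable (Function.uncurry F)) {w : Y → ℝ≥0∞} (hw : Measurable w)
    (h : ∀ y, ∫⁻ x, F x y ^ p ∂μ ≤ w y ^ p) :
    ∫⁻ x, (∫⁻ y, F x y ∂ν) ^ p ∂μ ≤ (∫⁻ y, w y ∂ν) ^ p := by
  have hp0 : 0 < p := by linarith
  by_cases hwt : ∫⁻ y, w y ∂ν = ⊤
  · rw [hwt, ENNReal.top_rpow_of_pos hp0]; exact le_top
  have hwt' : ∀ᵐ y ∂ν, w y < ⊤ := ae_lt_top hw hwt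
  have hpq : p.HolderConjugate (p / (p - 1)) := Real.HolderConjugate.conjExponent hp
  set q := p / (p - 1) with hq
  have hq0 : 0 < q := hpq.symm.pos
  have hz : ∀ᵐ x ∂μ, ∀ᵐ y ∂ν, w y = 0 → F x y = 0 := by
    refine (Measure.ae_ae_comm ?_).2 (Filter.Eventually.of_forall fun y => ?_)
    · have h1 : MeasurableSet {z : X × Y | w z.2 = 0} :=
        measurableSet_eq_fun (hw.comp measurable_snd) measurable_const
      have h2 : MeasurableSet {z : X × Y | F z.1 z.2 = 0} := measurableSet_eq_fun hF measurable_const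
      exact (h1.compl.union h2).congr (by ext z; simp [imp_iff_not_or])
    · by_cases hy : w y = 0
      · have h1 : ∫⁻ x, F x y ^ p ∂μ = 0 := by
          have := h y
          rwa [hy, ENNReal.zero_rpow_of_pos hp0, nonpos_iff_eq_zero] at this
        have hm : Measurable fun x => F x y ^ p := (hF.comp measurable_prodMk_right).pow_const p
        filter_upwards [(lintegral_eq_zero_iff hm).1 h1] with x hx _
        exact (ENNReal.rpow_eq_zero_iff_of_pos hp0).1 hx
      · exact Filter.Eventually.of_forall fun x hx => absurd hx hy
  have hmx : ∀ x, Measurable (F x) := fun x => hF.comp measurable_prodMk_left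
  have hVm : Measurable fun y => (w y ^ (1 / q))⁻¹ := (hw.pow_const _).inv
  have key : ∀ᵐ x ∂μ, (∫⁻ y, F x y ∂ν) ^ p ≤
      (∫⁻ y, (F x y * (w y ^ (1 / q))⁻¹) ^ p ∂ν) * (∫⁻ y, w y ∂ν) ^ (p / q) := by
    filter_upwards [hz] with x hx
    have h1 : ∫⁻ y, F x y ∂ν ≤ ∫⁻ y, (fun y => F x y * (w y ^ (1 / q))⁻¹) y * (w y ^ (1 / q)) ∂ν := by
      refine lintegral_mono_ae ?_
      filter_upwards [hx, hwt'] with y hy hy'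
      by_cases h0 : w y = 0
      · rw [hy h0]; exact zero_le
      · have a1 : w y ^ (1 / q) ≠ 0 := by
          rw [Ne, ENNReal.rpow_eq_zero_iff_of_pos (by positivity)]; exact h0
        have a2 : w y ^ (1 / q) ≠ ⊤ := ENNReal.rpow_ne_top_of_nonneg (by positivity) hy'.ne
        rw [mul_assoc, ENNReal.inv_mul_cancel a1 a2, mul_one]
    have h2 := ENNReal.lintegral_mul_le_Lp_mul_Lq ν hpq
      (f := fun y => F x y * (w y ^ (1 / q))⁻¹) (g := fun y => w y ^ (1 / q))
      ((hmx x).mul hVm).aemeasurable (hw.pow_const _).aemeasurable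
    have e : ∀ y, (w y ^ (1 / q)) ^ q = w y := fun y => by
      rw [← ENNReal.rpow_mul, one_div_mul_cancel hq0.ne', ENNReal.rpow_one]
    simp only [Pi.mul_apply, e] at h2
    refine (ENNReal.rpow_le_rpow (h1.trans h2) hp0.le).trans_eq ?_
    rw [ENNReal.mul_rpow_of_nonneg _ _ hp0.le, ← ENNReal.rpow_mul, ← ENNReal.rpow_mul,
      one_div_mul_cancel hp0.ne', ENNReal.rpow_one]
    congr 2
    ring
  refine (lintegral_mono_ae key).trans ?_
  have hm2 : Measurable (Function.uncurry fun x y => (F x y * (w y ^ (1 / q))⁻¹) ^ p) :=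
    (hF.mul (hVm.comp measurable_snd)).pow_const p
  have hm3 : Measurable fun x => ∫⁻ y, (F x y * (w y ^ (1 / q))⁻¹) ^ p ∂ν :=
    hm2.lintegral_prod_right'
  rw [lintegral_mul_const _ hm3, lintegral_lintegral_swap hm2.aemeasurable]
  have hle : ∫⁻ y, ∫⁻ x, (F x y * (w y ^ (1 / q))⁻¹) ^ p ∂μ ∂ν ≤ ∫⁻ y, w y ∂ν := by
    refine lintegral_mono_ae ?_
    filter_upwards [hwt'] with y hy
    have : ∀ x, (F x y * (w y ^ (1 / q))⁻¹) ^ p = F x y ^ p * ((w y ^ (1 / q))⁻¹) ^ p :=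
      fun x => ENNReal.mul_rpow_of_nonneg _ _ hp0.le
    simp only [this]
    have hmy : Measurable fun x => F x y ^ p :=
      (show Measurable fun x => F x y from hF.comp measurable_prodMk_right).pow_const p
    rw [lintegral_mul_const _ hmy]
    refine (mul_le_mul_left (h y) _).trans ?_
    rw [← ENNReal.mul_rpow_of_nonneg _ _ hp0.le]
    by_cases h0 : w y = 0
    · simp [h0, hp0]
    · have e1 : w y = w y ^ (1 / p) * w y ^ (1 / q) := by
        rw [← ENNReal.rpow_add _ _ h0 hy.ne, one_div, one_div, hpq.inv_add_inv_eq_one, ENNReal.rpow_one]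
      have a1 : w y ^ (1 / q) ≠ 0 := by
        rw [Ne, ENNReal.rpow_eq_zero_iff_of_pos (by positivity)]; exact h0
      have a2 : w y ^ (1 / q) ≠ ⊤ := ENNReal.rpow_ne_top_of_nonneg (by positivity) hy.ne
      nth_rw 1 [e1]
      rw [mul_assoc, ENNReal.mul_inv_cancel a1 a2, mul_one, ← ENNReal.rpow_mul,
        one_div_mul_cancel hp0.ne', ENNReal.rpow_one]
  calc _ ≤ (∫⁻ y, w y ∂ν) * (∫⁻ y, w y ∂ν) ^ (p / q) := by gcongr
    _ = (∫⁻ y, w y ∂ν) ^ p := by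
      have hpq1 : p / q = p - 1 := by rw [hq]; field_simp
      nth_rw 1 [← ENNReal.rpow_one (∫⁻ y, w y ∂ν)]
      rw [hpq1, ← ENNReal.rpow_add_of_nonneg _ _ zero_le_one (by linarith)]
      congr 1; ring

/-- Averages of translates do not increase `L_p` norms beyond the mass of the weight. -/
lemma lintegral_average_rpow_le {X Y : Type*} [MeasurableSpace X] [MeasurableSpace Y]
    {μ : Measure X} {ν : Measure Y} [SFinite μ] [SFinite ν] {p : ℝ} (hp : 1 < p)
    {k : Y → ℝ≥0∞} (hk : Measurable k) {σ : X → Y → X} (hσ : Measurable (Function.uncurry σ))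
    {f : X → ℝ≥0∞} (hf : Measurable f)
    (hμ : ∀ y, ∫⁻ x, f (σ x y) ^ p ∂μ = ∫⁻ x, f x ^ p ∂μ) :
    ∫⁻ x, (∫⁻ y, k y * f (σ x y) ∂ν) ^ p ∂μ ≤ (∫⁻ y, k y ∂ν) ^ p * ∫⁻ x, f x ^ p ∂μ := by
  have hp0 : 0 < p := by linarith
  refine (lintegral_lintegral_rpow_le hp (F := fun x y => k y * f (σ x y))
    ((hk.comp measurable_snd).mul (hf.comp hσ))
    (w := fun y => k y * (∫⁻ x, f x ^ p ∂μ) ^ (1 / p)) (hk.mul_const _) fun y => ?_).trans_eq ?_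
  · rw [ENNReal.mul_rpow_of_nonneg _ _ hp0.le, ← ENNReal.rpow_mul, one_div_mul_cancel hp0.ne',
      ENNReal.rpow_one, ← hμ y]
    simp only [ENNReal.mul_rpow_of_nonneg _ _ hp0.le]
    have hm : Measurable fun x => f (σ x y) := hf.comp (hσ.comp measurable_prodMk_right)
    rw [lintegral_const_mul _ (hm.pow_const p)]
  · rw [lintegral_mul_const _ hk, ENNReal.mul_rpow_of_nonneg _ _ hp0.le, ← ENNReal.rpow_mul,
      one_div_mul_cancel hp0.ne', ENNReal.rpow_one]

section Convolution

variable {G : Type*} [NormedAddCommGroup G] [NormedSpace ℝ G] [FiniteDimensional ℝ G]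
  [MeasurableSpace G] [BorelSpace G] {μ : Measure G} [μ.IsAddHaarMeasure]

lemma lintegral_cv_rpow_le {p : ℝ} (hp : 1 < p) {K : G → ℝ} (hK : Measurable K) {f : G → ℝ}
    (hf : Measurable f) :
    ∫⁻ z, ‖cv μ K f z‖ₑ ^ p ∂μ ≤ (∫⁻ y, ‖K y‖ₑ ∂μ) ^ p * ∫⁻ z, ‖f z‖ₑ ^ p ∂μ := by
  refine le_trans (lintegral_mono fun z => ?_) (lintegral_average_rpow_le hp hK.enorm
    (σ := fun z y => z - y) (by fun_prop) hf.enorm fun y =>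
      lintegral_sub_right_eq_self (fun z => ‖f z‖ₑ ^ p) y)
  rw [cv_eq]
  gcongr
  refine (enorm_integral_le_lintegral_enorm _).trans_eq ?_
  simp only [enorm_mul]

end Convolution

lemma lintegral_hav_rpow_le {d : ℕ} {p : ℝ} (hp : 1 < p) {P : Ed d → ℝ} (hP : Measurable P)
    (s : ℝ) {g : ℝ × Ed d → ℝ} (hg : Measurable g) :
    ∫⁻ z, ‖hav P s g z‖ₑ ^ p ≤ (∫⁻ y, ‖P y‖ₑ) ^ p * ∫⁻ z, ‖g z‖ₑ ^ p := by
  refine le_trans (lintegral_mono fun z => ?_) (lintegral_average_rpow_le hp hP.enorm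
    (σ := fun z y => (z.1 - s, z.2 - √s • y)) (by fun_prop) hg.enorm fun y =>
      lintegral_sub_right_eq_self (fun z => ‖g z‖ₑ ^ p) ((s, √s • y) : ℝ × Ed d))
  rw [hav]
  gcongr
  refine (enorm_integral_le_lintegral_enorm _).trans_eq ?_
  simp only [enorm_mul]

section HeatFlow

variable {d : ℕ}

/-- The Gaussian averages solve the heat equation. -/
lemma cv_hker_heat {a b : ℝ} (ha : 0 < a) (hab : a < b) {g : ℝ × Ed d → ℝ} (hg : IsTest g)
    (z : ℝ × Ed d) :
    cv volume (hker 0 a b gau) (fun z => dd et g z - lapl g z) z = hav gau a g z - hav gau b g z := by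
  have hgau := isProfile_gau (d := d)
  have hL : IsTest fun z => dd et g z - lapl g z := (hg.dd _).sub hg.lapl
  obtain ⟨M, -, hM⟩ := hL.bounded
  rw [cv_hker ha hgau.contDiff.continuous.measurable hgau.integrable hL.measurable hM]
  simp only [pow_zero, one_mul]
  have h1 := intervalIntegral.integral_eq_sub_of_hasDerivAt (a := a) (b := b)
    (f := fun s => hav gau s g z) (fun s hs => hasDerivAt_hav hg z
      (lt_of_lt_of_le (by rw [min_eq_left hab.le]; exact ha) hs.1))
    ((continuous_hav hgau.contDiff.continuous hgau.integrable hL z).neg.intervalIntegrable _ _)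
  rw [intervalIntegral.integral_neg, intervalIntegral.integral_of_le hab.le,
    ← integral_Icc_eq_integral_Ioc, integral_Icc_eq_integral_Ico] at h1
  linarith

lemma cv_hker_ddgau {a b : ℝ} (ha : 0 < a) {g : ℝ × Ed d → ℝ} (hg : IsTest g) (v w : Ed d)
    (z : ℝ × Ed d) :
    cv volume (hker 1 a b fun y => fderiv ℝ (fun x => fderiv ℝ gau x v) y w) g z =
      cv volume (hker 0 a b gau) (dd (ex v) (dd (ex w) g)) z := by
  have hgau := isProfile_gau (d := d)
  have hdd := isProfile_ddgau (d := d) v w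
  obtain ⟨M, -, hM⟩ := hg.bounded
  obtain ⟨M', -, hM'⟩ := ((hg.dd (ex w)).dd (ex v)).bounded
  rw [cv_hker ha hdd.contDiff.continuous.measurable hdd.integrable hg.measurable hM,
    cv_hker ha hgau.contDiff.continuous.measurable hgau.integrable ((hg.dd _).dd _).measurable hM']
  refine setIntegral_congr_fun measurableSet_Ico fun s hs => ?_
  have hs0 : 0 < s := ha.trans_le hs.1
  simp only [pow_one, pow_zero, one_mul]
  rw [hav_fderiv (isProfile_dgau v) hg, hav_fderiv hgau (hg.dd _), ← mul_assoc √s,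
    Real.mul_self_sqrt hs0.le, inv_mul_cancel_left₀ hs0.ne']

section Energy

variable {k : ℝ × Ed d → ℝ}

lemma cv_const_mul (k φ : ℝ × Ed d → ℝ) (c : ℝ) (z : ℝ × Ed d) :
    cv volume k (fun z => c * φ z) z = c * cv volume k φ z := by
  simp only [cv, mul_left_comm _ c]
  exact integral_const_mul _ _

lemma cv_sub (hk : Integrable k) {φ ψ : ℝ × Ed d → ℝ} (hφ : Measurable φ) (hψ : Measurable ψ)
    {M M' : ℝ} (hM : ∀ z, |φ z| ≤ M) (hM' : ∀ z, |ψ z| ≤ M') (z : ℝ × Ed d) :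
    cv volume k (fun z => φ z - ψ z) z = cv volume k φ z - cv volume k ψ z := by
  have := cv_add (g := fun z => (-1) * ψ z) hk hφ hM (hψ.const_mul _) (M' := M')
    (fun z => by simpa using hM' z) z
  rw [cv_const_mul] at this
  simpa [sub_eq_add_neg] using this

lemma cv_sum (hk : Integrable k) {ι : Type*} (s : Finset ι) {φ : ι → ℝ × Ed d → ℝ}
    (hφ : ∀ i, IsTest (φ i)) (z : ℝ × Ed d) :
    cv volume k (fun z => ∑ i ∈ s, φ i z) z = ∑ i ∈ s, cv volume k (φ i) z := by
  simp only [cv_eq, Finset.mul_sum]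
  refine integral_finsetSum _ fun i _ => ?_
  obtain ⟨M, -, hM⟩ := (hφ i).bounded
  exact hk.mul_bdd ((hφ i).measurable.comp (by fun_prop)).aestronglyMeasurable (c := M)
      (Filter.Eventually.of_forall fun y => hM _)

lemma hasLineDerivAt_cv (hk : Integrable k) {φ : ℝ × Ed d → ℝ} (hφ : IsTest φ) (v z : ℝ × Ed d) :
    HasLineDerivAt ℝ (cv volume k φ) (cv volume k (dd v φ) z) z v := by
  obtain ⟨M, -, hM⟩ := hφ.bounded
  obtain ⟨M', -, hM'⟩ := (hφ.dd v).bounded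
  have hi : ∀ t : ℝ, Integrable fun y => k y * φ (z + t • v - y) := fun t =>
    hk.mul_bdd (hφ.measurable.comp (by fun_prop)).aestronglyMeasurable (c := M)
      (Filter.Eventually.of_forall fun y => hM _)
  have main := (hasDerivAt_integral_of_dominated_loc_of_deriv_le (μ := volume)
    (F := fun (t : ℝ) y => k y * φ (z + t • v - y))
    (F' := fun t y => k y * dd v φ (z + t • v - y))
    (x₀ := 0) (s := univ) (bound := fun y => |k y| * M')
    Filter.univ_mem (Filter.Eventually.of_forall fun t => (hi t).aestronglyMeasurable) (hi 0)
    (hk.mul_bdd ((hφ.dd v).measurable.comp (by fun_prop)).aestronglyMeasurable (c := M')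
      (Filter.Eventually.of_forall fun y => hM' _)).aestronglyMeasurable
    (Filter.Eventually.of_forall fun y t _ => ?_) (hk.norm.mul_const M')
    (Filter.Eventually.of_forall fun y t _ => ?_)).2
  · rw [HasLineDerivAt]
    simp only [cv_eq]
    simpa using main
  · rw [Real.norm_eq_abs, abs_mul]
    gcongr
    exact hM' _
  · have h1 : HasDerivAt (fun t : ℝ => z + t • v - y) v t := by
      simpa using (((hasDerivAt_id t).smul_const v).const_add z).sub_const y
    exact ((hφ.differentiable _).hasFDerivAt.comp_hasDerivAt t h1).const_mul (k y)

/-- Bilinear form. -/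
def cvForm (k φ ψ : ℝ × Ed d → ℝ) : ℝ := ∫ z, cv volume k φ z * cv volume k ψ z

lemma integrable_cvForm (hk : Integrable k) {φ ψ : ℝ × Ed d → ℝ} (hφ : IsTest φ) (hψ : IsTest ψ) :
    Integrable fun z => cv volume k φ z * cv volume k ψ z := by
  obtain ⟨M, -, hM⟩ := hψ.bounded
  exact (integrable_cv hk hφ.integrable).mul_bdd
    (integrable_cv hk hψ.integrable).aestronglyMeasurable
    (Filter.Eventually.of_forall fun z => abs_cv_le hk hM z)

lemma cvForm_comm (φ ψ : ℝ × Ed d → ℝ) : cvForm k φ ψ = cvForm k ψ φ := by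
  simp only [cvForm, mul_comm]

lemma cvForm_dd (hk : Integrable k) {φ ψ : ℝ × Ed d → ℝ} (hφ : IsTest φ) (hψ : IsTest ψ)
    (v : ℝ × Ed d) : cvForm k (dd v φ) ψ = -cvForm k φ (dd v ψ) := by
  have := integral_bilinear_hasLineDerivAt_right_eq_neg_left_of_integrable (μ := volume)
    (B := ContinuousLinearMap.mul ℝ ℝ) (f := cv volume k φ) (g := cv volume k ψ) (v := v)
    (f' := cv volume k (dd v φ)) (g' := cv volume k (dd v ψ))
    (integrable_cvForm hk (hφ.dd v) hψ) (integrable_cvForm hk hφ (hψ.dd v))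
    (integrable_cvForm hk hφ hψ) (fun z _ => hasLineDerivAt_cv hk hφ v z)
    (fun z _ => hasLineDerivAt_cv hk hψ v z)
  simp only [ContinuousLinearMap.mul_apply'] at this
  simp only [cvForm, this, neg_neg]

lemma cvForm_sum (hk : Integrable k) {ι : Type*} (s : Finset ι) {φ : ι → ℝ × Ed d → ℝ}
    (hφ : ∀ i, IsTest (φ i)) {ψ : ℝ × Ed d → ℝ} (hψ : IsTest ψ) :
    cvForm k ψ (fun z => ∑ i ∈ s, φ i z) = ∑ i ∈ s, cvForm k ψ (φ i) := by
  simp only [cvForm, cv_sum hk s hφ, Finset.mul_sum]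
  exact integral_finsetSum _ fun i _ => integrable_cvForm hk hψ (hφ i)

lemma cvForm_self_nonneg (φ : ℝ × Ed d → ℝ) : 0 ≤ cvForm k φ φ :=
  integral_nonneg fun _ => mul_self_nonneg _

lemma cvForm_dd_dd (hk : Integrable k) {g : ℝ × Ed d → ℝ} (hg : IsTest g) (v w : ℝ × Ed d) :
    cvForm k (dd v (dd w g)) (dd v (dd w g)) = cvForm k (dd w (dd w g)) (dd v (dd v g)) := by
  rw [cvForm_dd hk (hg.dd w) ((hg.dd w).dd v), dd_comm hg v w, dd_comm (hg.dd v) v w,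
    cvForm_comm, cvForm_dd hk ((hg.dd v).dd v) (hg.dd w), neg_neg, cvForm_comm]

lemma cvForm_dd_self (hk : Integrable k) {g : ℝ × Ed d → ℝ} (hg : IsTest g) (v : ℝ × Ed d) :
    cvForm k (dd v g) g = 0 := by
  have := cvForm_dd hk hg hg v
  rw [cvForm_comm g] at this
  linarith

/-- The energy estimate: `‖k * D_v D_w g‖₂ ≤ ‖k * (g_t - Δ g)‖₂`. -/
lemma cvForm_energy (hk : Integrable k) {g : ℝ × Ed d → ℝ} (hg : IsTest g) (i j : Fin d) :
    cvForm k (dd (ex (eb i)) (dd (ex (eb j)) g)) (dd (ex (eb i)) (dd (ex (eb j)) g)) ≤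
      cvForm k (fun z => dd et g z - lapl g z) (fun z => dd et g z - lapl g z) := by
  have h1 : cvForm k (lapl g) (lapl g) = ∑ i, ∑ j,
      cvForm k (dd (ex (eb i)) (dd (ex (eb j)) g)) (dd (ex (eb i)) (dd (ex (eb j)) g)) := by
    have e1 : cvForm k (lapl g) (lapl g) = ∑ i, cvForm k (lapl g) (dd (ex (eb i)) (dd (ex (eb i)) g)) :=
      cvForm_sum hk _ (fun i => (hg.dd _).dd _) hg.lapl
    rw [e1]
    refine Finset.sum_congr rfl fun i _ => ?_
    rw [cvForm_comm]
    have e2 : cvForm k (dd (ex (eb i)) (dd (ex (eb i)) g)) (lapl g) =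
      ∑ j, cvForm k (dd (ex (eb i)) (dd (ex (eb i)) g)) (dd (ex (eb j)) (dd (ex (eb j)) g)) :=
      cvForm_sum hk _ (fun i => (hg.dd _).dd _) ((hg.dd _).dd _)
    rw [e2]
    refine Finset.sum_congr rfl fun j _ => ?_
    rw [cvForm_dd_dd hk hg, cvForm_comm]
  have h2 : cvForm k (dd et g) (lapl g) = 0 := by
    have e1 : cvForm k (dd et g) (lapl g) =
        ∑ i, cvForm k (dd et g) (dd (ex (eb i)) (dd (ex (eb i)) g)) :=
      cvForm_sum hk _ (fun i => (hg.dd _).dd _) (hg.dd _)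
    rw [e1]
    refine Finset.sum_eq_zero fun i _ => ?_
    rw [cvForm_comm, cvForm_dd hk (hg.dd _) (hg.dd _), dd_comm hg, cvForm_comm,
      cvForm_dd_self hk (hg.dd _), neg_zero]
  have h3 : cvForm k (fun z => dd et g z - lapl g z) (fun z => dd et g z - lapl g z) =
      cvForm k (dd et g) (dd et g) - 2 * cvForm k (dd et g) (lapl g) + cvForm k (lapl g) (lapl g) := by
    obtain ⟨M, -, hM⟩ := (hg.dd et).bounded
    obtain ⟨M', -, hM'⟩ := hg.lapl.bounded
    have i1 := integrable_cvForm hk (hg.dd et) (hg.dd et)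
    have i2 := integrable_cvForm hk (hg.dd et) hg.lapl
    have i3 := integrable_cvForm hk hg.lapl hg.lapl
    have i4 : Integrable fun z => cv volume k (dd et g) z * cv volume k (dd et g) z -
      2 * (cv volume k (dd et g) z * cv volume k (lapl g) z) := i1.sub (i2.const_mul 2)
    simp only [cvForm, cv_sub hk (hg.dd et).measurable hg.lapl.measurable hM hM']
    rw [← integral_const_mul, ← integral_sub i1 (i2.const_mul 2),
      ← integral_add i4 i3]
    congr 1; funext z; ring
  have h4 := cvForm_self_nonneg (k := k) (dd et g)
  have h5 : cvForm k (dd (ex (eb i)) (dd (ex (eb j)) g)) (dd (ex (eb i)) (dd (ex (eb j)) g)) ≤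
      cvForm k (lapl g) (lapl g) := by
    rw [h1]
    refine le_trans ?_ (Finset.single_le_sum (f := fun i => ∑ j,
      cvForm k (dd (ex (eb i)) (dd (ex (eb j)) g)) (dd (ex (eb i)) (dd (ex (eb j)) g)))
      (fun i _ => Finset.sum_nonneg fun j _ => cvForm_self_nonneg _) (Finset.mem_univ i))
    exact Finset.single_le_sum (f := fun j =>
      cvForm k (dd (ex (eb i)) (dd (ex (eb j)) g)) (dd (ex (eb i)) (dd (ex (eb j)) g)))
      (fun j _ => cvForm_self_nonneg _) (Finset.mem_univ j)
  rw [h3, h2]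
  linarith

lemma ofReal_cvForm (hk : Integrable k) {φ : ℝ × Ed d → ℝ} (hφ : IsTest φ) :
    ENNReal.ofReal (cvForm k φ φ) = ∫⁻ z, ‖cv volume k φ z‖ₑ ^ 2 := by
  rw [cvForm, ofReal_integral_eq_lintegral_ofReal (integrable_cvForm hk hφ hφ)
    (Filter.Eventually.of_forall fun z => mul_self_nonneg _)]
  refine lintegral_congr fun z => ?_
  rw [← abs_mul_abs_self, ENNReal.ofReal_mul (abs_nonneg _), ← Real.enorm_eq_ofReal_abs, sq]

end Energy

end HeatFlow

lemma eLpNorm_rpow_eq {X : Type*} [MeasurableSpace X] {μ : Measure X} (f : X → ℝ) {p : ℝ}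
    (hp : 0 < p) : eLpNorm f (ENNReal.ofReal p) μ ^ p = ∫⁻ z, ‖f z‖ₑ ^ p ∂μ := by
  rw [eLpNorm_eq_lintegral_rpow_enorm_toReal (by simpa using hp) ENNReal.ofReal_ne_top,
    ENNReal.toReal_ofReal hp.le, ← ENNReal.rpow_mul, one_div_mul_cancel hp.ne', ENNReal.rpow_one]

lemma eLpNorm_le_of_lintegral {X Y : Type*} [MeasurableSpace X] [MeasurableSpace Y] {μ : Measure X}
    {ν : Measure Y} {f : X → ℝ} {g : Y → ℝ} {p : ℝ} (hp : 0 < p) {c : ℝ≥0∞}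
    (h : ∫⁻ z, ‖f z‖ₑ ^ p ∂μ ≤ c ^ p * ∫⁻ z, ‖g z‖ₑ ^ p ∂ν) :
    eLpNorm f (ENNReal.ofReal p) μ ≤ c * eLpNorm g (ENNReal.ofReal p) ν := by
  rw [← eLpNorm_rpow_eq f hp, ← eLpNorm_rpow_eq g hp, ← ENNReal.mul_rpow_of_nonneg _ _ hp.le] at h
  exact (ENNReal.rpow_le_rpow_iff hp).1 h

section HeatFlow

variable {d : ℕ}

lemma continuous_hav_right {P : Ed d → ℝ} (hP : Continuous P) (hPi : Integrable P)
    {g : ℝ × Ed d → ℝ} (hg : IsTest g) (s : ℝ) : Continuous (hav P s g) := by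
  obtain ⟨M, -, hM⟩ := hg.bounded
  have := hg.continuous
  refine continuous_of_dominated (bound := fun y => |P y| * M) (fun z => ?_) (fun z => ?_)
    (hPi.norm.mul_const M) (Filter.Eventually.of_forall fun y => by fun_prop)
  · exact (by fun_prop : Continuous fun y => P y * g (z.1 - s, z.2 - √s • y)).aestronglyMeasurable
  · refine Filter.Eventually.of_forall fun y => ?_
    rw [Real.norm_eq_abs, abs_mul]
    gcongr
    exact hM _

lemma lintegral_gau : ∫⁻ y : Ed d, ‖gau y‖ₑ = 1 := by
  rw [← ofReal_integral_norm_eq_lintegral_enorm isProfile_gau.integrable]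
  simp only [Real.norm_of_nonneg (gau_nonneg _), integral_gau, ENNReal.ofReal_one]

lemma eLpNorm_hav_gau_le {p : ℝ} (hp : 1 < p) (s : ℝ) {g : ℝ × Ed d → ℝ} (hg : IsTest g) :
    eLpNorm (hav gau s g) (ENNReal.ofReal p) ≤ eLpNorm g (ENNReal.ofReal p) := by
  have := lintegral_hav_rpow_le hp (isProfile_gau (d := d)).contDiff.continuous.measurable s
    hg.measurable
  rw [lintegral_gau] at this
  simpa using eLpNorm_le_of_lintegral (c := 1) (by linarith) this

/-- Second derivatives of the Gaussian. -/
def ddgau (i j : Fin d) (y : Ed d) : ℝ := fderiv ℝ (fun x => fderiv ℝ gau x (eb i)) y (eb j)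

lemma isProfile_ddgau' (i j : Fin d) : IsProfile (ddgau i j) := isProfile_ddgau _ _

/-- Truncated Calderón-Zygmund kernels of the heat operator. -/
def hcz (a b : ℝ) (i j : Fin d) : ℝ × Ed d → ℝ := hker 1 a b (ddgau i j)

lemma measurable_hcz (a b : ℝ) (i j : Fin d) : Measurable (hcz a b i j) :=
  measurable_hker (isProfile_ddgau' i j).contDiff.continuous.measurable

lemma integrable_hcz {a b : ℝ} (ha : 0 < a) (i j : Fin d) : Integrable (hcz a b i j) :=
  integrable_hker ha (isProfile_ddgau' i j).contDiff.continuous.measurable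
    (isProfile_ddgau' i j).integrable

lemma eLpNorm_hcz_test {a b : ℝ} (ha : 0 < a) (hab : a < b) (i j : Fin d) {g : ℝ × Ed d → ℝ}
    (hg : IsTest g) :
    eLpNorm (cv volume (hcz a b i j) g) (ENNReal.ofReal 2) ≤ 2 * eLpNorm g (ENNReal.ofReal 2) := by
  have hgau := isProfile_gau (d := d)
  have hk : Integrable (hker 0 a b (gau (d := d))) :=
    integrable_hker ha hgau.contDiff.continuous.measurable hgau.integrable
  have h1 := ENNReal.ofReal_le_ofReal (cvForm_energy hk hg i j)
  rw [ofReal_cvForm hk ((hg.dd _).dd _), ofReal_cvForm hk ((hg.dd _).sub hg.lapl)] at h1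
  simp only [← cv_hker_ddgau ha hg, cv_hker_heat ha hab hg] at h1
  have h2 : eLpNorm (cv volume (hcz a b i j) g) (ENNReal.ofReal 2) ≤
      1 * eLpNorm (hav gau a g - hav gau b g) (ENNReal.ofReal 2) := by
    refine eLpNorm_le_of_lintegral two_pos ?_
    simp only [ENNReal.rpow_two, one_pow, one_mul, Pi.sub_apply]
    exact h1
  rw [one_mul] at h2
  refine h2.trans ((eLpNorm_sub_le (continuous_hav_right hgau.contDiff.continuous hgau.integrable
    hg a).aestronglyMeasurable (continuous_hav_right hgau.contDiff.continuous hgau.integrable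
    hg b).aestronglyMeasurable (by simp)).trans ?_)
  rw [two_mul]
  exact add_le_add (eLpNorm_hav_gau_le one_lt_two a hg) (eLpNorm_hav_gau_le one_lt_two b hg)

lemma lintegral_hcz_sq_le {a b : ℝ} (ha : 0 < a) (hab : a < b) (i j : Fin d) {g : ℝ × Ed d → ℝ}
    (hg : Measurable g) (hgi : Integrable g) {M : ℝ} (hM : ∀ z, |g z| ≤ M) :
    ∫⁻ z, ‖cv volume (hcz a b i j) g z‖ₑ ^ 2 ≤ 4 * ∫⁻ z, ‖g z‖ₑ ^ 2 := by
  have hK := integrable_hcz (b := b) ha i j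
  have hg2 : MemLp g (ENNReal.ofReal 2) := by
    rw [ENNReal.ofReal_ofNat, memLp_two_iff_integrable_sq hg.aestronglyMeasurable]
    simp only [sq]
    exact hgi.mul_bdd (c := M) hg.aestronglyMeasurable (Filter.Eventually.of_forall hM)
  set A := ∫⁻ z, ‖hcz a b i j z‖ₑ with hA
  have hAt : A ≠ ⊤ := hK.2.ne
  have key : eLpNorm (cv volume (hcz a b i j) g) (ENNReal.ofReal 2) ≤
      2 * eLpNorm g (ENNReal.ofReal 2) := by
    have : ∀ ε : ℝ, 0 < ε → eLpNorm (cv volume (hcz a b i j) g) (ENNReal.ofReal 2) ≤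
        2 * eLpNorm g (ENNReal.ofReal 2) + (A + 2) * ENNReal.ofReal ε := by
      intro ε hε
      obtain ⟨φ, hφ1, hφ2, hφ3⟩ := hg2.exist_eLpNorm_sub_le ENNReal.ofReal_ne_top (by simp) hε
      have hφ : IsTest φ := ⟨hφ2, hφ1⟩
      obtain ⟨M', -, hM'⟩ := hφ.bounded
      have e1 : cv volume (hcz a b i j) g =
          cv volume (hcz a b i j) (fun z => g z - φ z) + cv volume (hcz a b i j) φ := by
        funext z
        rw [Pi.add_apply, cv_sub hK hg hφ.measurable hM hM']
        ring
      have hd : Integrable fun z => g z - φ z := hgi.sub hφ.integrable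
      have h1 := eLpNorm_add_le (p := ENNReal.ofReal 2) (integrable_cv hK hd).aestronglyMeasurable
        (integrable_cv hK hφ.integrable).aestronglyMeasurable (by simp)
      have h2 : eLpNorm (cv volume (hcz a b i j) (fun z => g z - φ z)) (ENNReal.ofReal 2) ≤
          A * ENNReal.ofReal ε :=
        (eLpNorm_le_of_lintegral two_pos (lintegral_cv_rpow_le one_lt_two (measurable_hcz a b i j)
          (hg.sub hφ.measurable))).trans (mul_le_mul_right hφ3 A)
      have h3 : eLpNorm φ (ENNReal.ofReal 2) ≤ eLpNorm g (ENNReal.ofReal 2) + ENNReal.ofReal ε := by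
        have : φ = g - (g - φ) := by simp
        rw [this]
        exact (eLpNorm_sub_le hg.aestronglyMeasurable
          (hg.aestronglyMeasurable.sub hφ.measurable.aestronglyMeasurable) (by simp)).trans (by gcongr)
      rw [e1]
      refine h1.trans ((add_le_add h2 ((eLpNorm_hcz_test ha hab i j hφ).trans
        (mul_le_mul_right h3 2))).trans_eq ?_)
      ring
    refine ENNReal.le_of_forall_pos_le_add fun δ hδ _ => ?_
    have hA2 : A + 2 ≠ ⊤ := by finiteness
    have hpos : 0 < (A + 2).toReal := ENNReal.toReal_pos (by simp) hA2
    refine (this (δ / (A + 2).toReal) (by positivity)).trans ?_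
    gcongr
    nth_rw 1 [← ENNReal.ofReal_toReal hA2]
    rw [← ENNReal.ofReal_mul hpos.le, mul_div_cancel₀ _ hpos.ne', ENNReal.ofReal_coe_nnreal]
  have h1 := ENNReal.rpow_le_rpow key two_pos.le
  rw [ENNReal.mul_rpow_of_nonneg _ _ two_pos.le, eLpNorm_rpow_eq _ two_pos,
    eLpNorm_rpow_eq _ two_pos] at h1
  simp only [ENNReal.rpow_two] at h1
  norm_num at h1
  exact h1

end HeatFlow

section Hormander

variable {d : ℕ}

lemma one_add_pow_mul_exp_le (n : ℕ) {t : ℝ} (ht : 0 ≤ t) :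
    (1 + t) ^ n * Real.exp (-t ^ 2 / 4) ≤ 8 ^ n * n.factorial * Real.exp 1 := by
  have h1 : (1 + t) ^ n ≤ ((1 + t) ^ 2) ^ n :=
    pow_le_pow_left₀ (by positivity) (by nlinarith) n
  have h2 : ((1 + t) ^ 2) ^ n ≤ 8 ^ n * (1 + t ^ 2 / 4) ^ n := by
    rw [← mul_pow]
    exact pow_le_pow_left₀ (by positivity) (by nlinarith [sq_nonneg (t - 1)]) n
  have h3 := Real.pow_div_factorial_le_exp (1 + t ^ 2 / 4) (by positivity) n
  rw [div_le_iff₀ (by positivity)] at h3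
  have h4 : Real.exp (1 + t ^ 2 / 4) * Real.exp (-t ^ 2 / 4) = Real.exp 1 := by
    rw [← Real.exp_add]; congr 1; ring
  calc (1 + t) ^ n * Real.exp (-t ^ 2 / 4)
      ≤ (8 ^ n * (Real.exp (1 + t ^ 2 / 4) * n.factorial)) * Real.exp (-t ^ 2 / 4) := by
        gcongr
        exact h1.trans (h2.trans (by gcongr))
    _ = 8 ^ n * n.factorial * (Real.exp (1 + t ^ 2 / 4) * Real.exp (-t ^ 2 / 4)) := by ring
    _ = _ := by rw [h4]

lemma gau_decay (m N : ℕ) : ∃ C, 0 ≤ C ∧ ∀ y : Ed d, (1 + ‖y‖) ^ m * gau y ≤ C * ((1 + ‖y‖) ^ N)⁻¹ := by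
  have h0 : gau (0 : Ed d) ≥ 0 := gau_nonneg 0
  refine ⟨gau (0 : Ed d) * (8 ^ (m + N) * (m + N).factorial * Real.exp 1), by positivity, fun y => ?_⟩
  have e : gau y = gau (0 : Ed d) * Real.exp (-‖y‖ ^ 2 / 4) := by
    simp only [gau, norm_zero]
    norm_num
    left
    ring
  rw [e, ← div_eq_mul_inv, le_div_iff₀ (by positivity)]
  have := one_add_pow_mul_exp_le (m + N) (norm_nonneg y)
  calc _ = gau (0 : Ed d) * ((1 + ‖y‖) ^ (m + N) * Real.exp (-‖y‖ ^ 2 / 4)) := by rw [pow_add]; ring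
    _ ≤ _ := by gcongr

lemma IsProfile.decay {P : Ed d → ℝ} (hP : IsProfile P) (N : ℕ) :
    ∃ C, 0 ≤ C ∧ ∀ y, |P y| ≤ C * ((1 + ‖y‖) ^ N)⁻¹ ∧ ‖fderiv ℝ P y‖ ≤ C * ((1 + ‖y‖) ^ N)⁻¹ := by
  obtain ⟨C, m, hC⟩ := hP.bound
  obtain ⟨C', m', hC'⟩ := hP.bound_fderiv
  obtain ⟨D, hD0, hD⟩ := gau_decay (d := d) m N
  obtain ⟨D', hD0', hD'⟩ := gau_decay (d := d) m' N
  refine ⟨|C| * D + |C'| * D', by positivity, fun y => ⟨?_, ?_⟩⟩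
  · have hy : 0 ≤ (1 + ‖y‖) ^ m * gau y := mul_nonneg (by positivity) (gau_nonneg y)
    calc |P y| ≤ C * ((1 + ‖y‖) ^ m * gau y) := hC y
      _ ≤ |C| * ((1 + ‖y‖) ^ m * gau y) := by gcongr; exact le_abs_self C
      _ ≤ |C| * (D * ((1 + ‖y‖) ^ N)⁻¹) := mul_le_mul_of_nonneg_left (hD y) (abs_nonneg C)
      _ ≤ _ := by
        rw [add_mul, mul_assoc]
        exact le_add_of_nonneg_right (by positivity)
  · have hy : 0 ≤ (1 + ‖y‖) ^ m' * gau y := mul_nonneg (by positivity) (gau_nonneg y)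
    calc ‖fderiv ℝ P y‖ ≤ C' * ((1 + ‖y‖) ^ m' * gau y) := hC' y
      _ ≤ |C'| * ((1 + ‖y‖) ^ m' * gau y) := by gcongr; exact le_abs_self C'
      _ ≤ |C'| * (D' * ((1 + ‖y‖) ^ N)⁻¹) := mul_le_mul_of_nonneg_left (hD' y) (abs_nonneg C')
      _ ≤ _ := by
        rw [add_mul, mul_assoc |C'|]
        exact le_add_of_nonneg_left (by positivity)

/-- Differences of dilated and translated profiles. -/
lemma IsProfile.diff_le {P : Ed d → ℝ} (hP : IsProfile P) :
    ∃ C, 0 ≤ C ∧ ∀ (r : ℝ) (η y : Ed d), |r - 1| ≤ 1 / 2 → ‖η‖ ≤ d →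
      |r ^ (d + 2) * P (r • (y + η)) - P y| ≤
        (|r - 1| + ‖η‖) * (C * ((1 + ‖y‖) ^ (d + 1))⁻¹) := by
  obtain ⟨C, hC0, hC⟩ := hP.decay (d + 2)
  set c : ℝ := (2 + 4 * d) ^ (d + 2) with hc
  have hc0 : 0 < c := by positivity
  refine ⟨C * c * ((d + 2) * 2 ^ (d + 1) + 2), by positivity, fun r η y hr hη => ?_⟩
  obtain ⟨hr1, hr2⟩ := abs_le.1 hr
  have hcomp : ∀ y' : Ed d, 1 + ‖y‖ ≤ (2 + 4 * d) * (1 + ‖y'‖) →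
      ((1 + ‖y'‖) ^ (d + 2))⁻¹ ≤ c * ((1 + ‖y‖) ^ (d + 2))⁻¹ := by
    intro y' h
    rw [← div_eq_mul_inv, inv_eq_one_div, div_le_div_iff₀ (by positivity) (by positivity), one_mul, hc, ← mul_pow]
    gcongr
  have hseg : ∀ θ ∈ Icc (0 : ℝ) 1, 1 + ‖y‖ ≤ (2 + 4 * d) * (1 + ‖y + θ • (r • (y + η) - y)‖) := by
    intro θ hθ
    have e : y + θ • (r • (y + η) - y) = (1 + θ * (r - 1)) • y + (θ * r) • η := by
      module
    have h1 : (1 / 2) * ‖y‖ ≤ ‖(1 + θ * (r - 1)) • y‖ := by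
      rw [norm_smul, Real.norm_eq_abs]
      gcongr
      have := abs_le.1 hr
      refine le_trans ?_ (le_abs_self _)
      nlinarith [hθ.1, hθ.2]
    have h2 : ‖(θ * r) • η‖ ≤ 2 * d := by
      rw [norm_smul, Real.norm_eq_abs]
      gcongr
      rw [abs_mul, abs_of_nonneg hθ.1, abs_of_nonneg (by linarith)]
      nlinarith [hθ.1, hθ.2]
    have h3 : ‖(1 + θ * (r - 1)) • y‖ ≤ ‖y + θ • (r • (y + η) - y)‖ + ‖(θ * r) • η‖ := by
      rw [e]
      simpa using norm_sub_le ((1 + θ * (r - 1)) • y + (θ * r) • η) ((θ * r) • η)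
    have h4 : (0 : ℝ) ≤ d := by positivity
    nlinarith [norm_nonneg (y + θ • (r • (y + η) - y))]
  set B : ℝ := C * (c * ((1 + ‖y‖) ^ (d + 2))⁻¹) with hB
  have hB0 : 0 ≤ B := by positivity
  have hmv : |P (r • (y + η)) - P y| ≤ B * ‖r • (y + η) - y‖ := by
    have := Convex.norm_image_sub_le_of_norm_fderiv_le (𝕜 := ℝ) (f := P) (s := segment ℝ y (r • (y + η)))
      (C := B) (x := y) (y := r • (y + η))
      (fun x _ => hP.contDiff.differentiable (by simp) x) (fun x hx => ?_) (convex_segment _ _)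
      (left_mem_segment _ _ _) (right_mem_segment _ _ _)
    · exact this
    · rw [segment_eq_image'] at hx
      obtain ⟨θ, hθ, rfl⟩ := hx
      exact (hC _).2.trans (by rw [hB]; gcongr; exact hcomp _ (hseg θ hθ))
  have hnorm : ‖r • (y + η) - y‖ ≤ (|r - 1| + ‖η‖) * (2 * (1 + ‖y‖)) := by
    have e : r • (y + η) - y = (r - 1) • y + r • η := by module
    rw [e]
    refine (norm_add_le _ _).trans ?_
    rw [norm_smul, norm_smul, Real.norm_eq_abs, Real.norm_eq_abs]
    have : |r| ≤ 2 := abs_le.2 ⟨by linarith, by linarith⟩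
    nlinarith [norm_nonneg y, norm_nonneg η, abs_nonneg (r - 1), mul_nonneg (abs_nonneg (r-1)) (norm_nonneg y),
      mul_nonneg (norm_nonneg η) (norm_nonneg y), mul_le_mul_of_nonneg_right this (norm_nonneg η)]
  have hP1 : |P (r • (y + η))| ≤ B := by
    have := hseg 1 (by simp)
    rw [one_smul, add_sub_cancel] at this
    exact (hC _).1.trans (by rw [hB]; gcongr; exact hcomp _ this)
  have hpow : |r ^ (d + 2) - 1| ≤ |r - 1| * ((d + 2) * 2 ^ (d + 1)) := by
    have := abs_pow_sub_pow_le r 1 (d + 2)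
    rw [one_pow] at this
    refine this.trans ?_
    rw [mul_assoc]
    push_cast
    gcongr
    · rw [abs_one]
      exact max_le (abs_le.2 ⟨by linarith, by linarith⟩) (by norm_num)
  have hdec : B * (1 + ‖y‖) = C * c * ((1 + ‖y‖) ^ (d + 1))⁻¹ := by
    rw [hB, pow_succ _ (d + 1)]
    have : 1 + ‖y‖ ≠ 0 := by positivity
    field_simp
  have hB1 : B ≤ C * c * ((1 + ‖y‖) ^ (d + 1))⁻¹ := by
    rw [← hdec]
    exact le_mul_of_one_le_right hB0 (by linarith [norm_nonneg y])
  calc |r ^ (d + 2) * P (r • (y + η)) - P y|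
      = |(r ^ (d + 2) - 1) * P (r • (y + η)) + (P (r • (y + η)) - P y)| := by congr 1; ring
    _ ≤ |r ^ (d + 2) - 1| * |P (r • (y + η))| + |P (r • (y + η)) - P y| := by
      rw [← abs_mul]; exact abs_add_le _ _
    _ ≤ (|r - 1| * ((d + 2) * 2 ^ (d + 1))) * B + B * ((|r - 1| + ‖η‖) * (2 * (1 + ‖y‖))) := by
      gcongr
      exact hmv.trans (by gcongr)
    _ = (|r - 1| * ((d + 2) * 2 ^ (d + 1))) * B + (|r - 1| + ‖η‖) * 2 * (B * (1 + ‖y‖)) := by ring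
    _ ≤ ((|r - 1| + ‖η‖) * ((d + 2) * 2 ^ (d + 1))) * (C * c * ((1 + ‖y‖) ^ (d + 1))⁻¹) +
        (|r - 1| + ‖η‖) * 2 * (C * c * ((1 + ‖y‖) ^ (d + 1))⁻¹) := by
      rw [hdec]
      gcongr
      simp
    _ = _ := by ring

end Hormander

section HormanderBound

variable {d : ℕ}

/-- The profile `P` at time scale `s`, with the homogeneity of second derivatives of the heat
kernel. -/
def psi (P : Ed d → ℝ) (s : ℝ) (x : Ed d) : ℝ := s⁻¹ * ((√s)⁻¹ ^ d * P ((√s)⁻¹ • x))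

lemma hker_one_eq (a b : ℝ) (P : Ed d → ℝ) (z : ℝ × Ed d) :
    hker 1 a b P z = (Ico a b).indicator 1 z.1 * psi P z.1 z.2 := by
  by_cases h : z.1 ∈ Ico a b <;> simp [hker, psi, h]

lemma measurable_psi {P : Ed d → ℝ} (hP : Measurable P) :
    Measurable fun z : ℝ × Ed d => psi P z.1 z.2 := by
  refine Measurable.mul (by fun_prop) (Measurable.mul (by fun_prop) (hP.comp ?_))
  exact (by fun_prop : Measurable fun z : ℝ × Ed d => (√z.1)⁻¹).smul measurable_snd

lemma lintegral_psi {P : Ed d → ℝ} (hP : Measurable P) {s : ℝ} (hs : 0 < s) :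
    ∫⁻ x, ‖psi P s x‖ₑ = ENNReal.ofReal s⁻¹ * ∫⁻ y, ‖P y‖ₑ := by
  have hs0 : 0 < √s := Real.sqrt_pos.2 hs
  rw [← lintegral_inv_smul_scale hs0 (F := fun y => ‖P y‖ₑ) hP.enorm, ← lintegral_const_mul']
  · refine lintegral_congr fun y => ?_
    simp only [psi, enorm_mul]
    rw [Real.enorm_of_nonneg (by positivity), Real.enorm_of_nonneg (by positivity)]
  · exact ENNReal.ofReal_ne_top

lemma lintegral_psi_sub {P : Ed d → ℝ} (hP : Measurable P) {s s' : ℝ} (hs : 0 < s) (hs' : 0 < s')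
    (η : Ed d) :
    ∫⁻ x, ‖psi P s' (x + η) - psi P s x‖ₑ = ENNReal.ofReal s⁻¹ *
      ∫⁻ y, ‖(√s / √s') ^ (d + 2) * P ((√s / √s') • (y + (√s)⁻¹ • η)) - P y‖ₑ := by
  have hs0 : 0 < √s := Real.sqrt_pos.2 hs
  have hs0' : 0 < √s' := Real.sqrt_pos.2 hs'
  have hm : Measurable fun y : Ed d =>
      ‖(√s / √s') ^ (d + 2) * P ((√s / √s') • (y + (√s)⁻¹ • η)) - P y‖ₑ := by
    have : Measurable fun y : Ed d => (√s / √s') • (y + (√s)⁻¹ • η) := by fun_prop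
    exact (((hP.comp this).const_mul _).sub hP).enorm
  rw [← lintegral_inv_smul_scale hs0 hm, ← lintegral_const_mul' _ _ ENNReal.ofReal_ne_top]
  refine lintegral_congr fun x => ?_
  have e1 : (√s / √s') • ((√s)⁻¹ • x + (√s)⁻¹ • η) = (√s')⁻¹ • (x + η) := by
    rw [← smul_add, smul_smul]
    congr 1
    field_simp
  have e2 : psi P s' (x + η) - psi P s x = s⁻¹ * ((√s)⁻¹ ^ d *
      ((√s / √s') ^ (d + 2) * P ((√s')⁻¹ • (x + η)) - P ((√s)⁻¹ • x))) := by
    have e3 : (√s / √s') ^ (d + 2) = s * s'⁻¹ * (√s * (√s')⁻¹) ^ d := by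
      rw [pow_add, div_eq_mul_inv, mul_pow _ _ 2, Real.sq_sqrt hs.le, inv_pow, Real.sq_sqrt hs'.le]
      ring
    rw [e3, psi, psi, mul_pow]
    have : (√s) ^ d * (√s)⁻¹ ^ d = 1 := by rw [← mul_pow, mul_inv_cancel₀ hs0.ne', one_pow]
    have h2 : s⁻¹ * s = 1 := inv_mul_cancel₀ hs.ne'
    linear_combination (-(s'⁻¹ * (√s')⁻¹ ^ d * P ((√s')⁻¹ • (x + η)))) * (h2 + s⁻¹ * s * this)
  rw [e1, e2, enorm_mul, enorm_mul, Real.enorm_of_nonneg (by positivity),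
    Real.enorm_of_nonneg (by positivity)]

lemma lintegral_Ici_mul_rpow {ρ : ℝ} (hρ : 0 < ρ) :
    ∫⁻ s in Ici (4 * ρ ^ 2), ENNReal.ofReal (s⁻¹ * (ρ / √s)) = 1 := by
  have h4 : 0 < 4 * ρ ^ 2 := by positivity
  rw [← setLIntegral_congr Ioi_ae_eq_Ici]
  have e : ∀ s ∈ Ioi (4 * ρ ^ 2), s⁻¹ * (ρ / √s) = ρ * s ^ (-(3 / 2) : ℝ) := by
    intro s hs
    have hs0 : 0 < s := h4.trans hs
    rw [show (-(3 / 2) : ℝ) = -1 + -(1 / 2) by norm_num, Real.rpow_add hs0, Real.rpow_neg_one,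
      Real.rpow_neg hs0.le, ← Real.sqrt_eq_rpow]
    ring
  have hi : IntegrableOn (fun s : ℝ => s⁻¹ * (ρ / √s)) (Ioi (4 * ρ ^ 2)) := by
    rw [integrableOn_congr_fun e measurableSet_Ioi]
    exact (integrableOn_Ioi_rpow_of_lt (by norm_num) h4).const_mul ρ
  rw [← ofReal_integral_eq_lintegral_ofReal hi, setIntegral_congr_fun measurableSet_Ioi e,
    integral_const_mul, integral_Ioi_rpow_of_lt (by norm_num) h4]
  · have : (4 * ρ ^ 2) ^ ((-(3 / 2) : ℝ) + 1) = (2 * ρ)⁻¹ := by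
      rw [show (4 * ρ ^ 2) = (2 * ρ) ^ (2 : ℝ) by norm_num; ring, ← Real.rpow_mul (by positivity)]
      norm_num
      rw [Real.rpow_neg_one, mul_inv]
      ring
    rw [this]
    have : ρ * (-(2 * ρ)⁻¹ / (-(3 / 2) + 1)) = 1 := by field_simp; norm_num
    rw [this, ENNReal.ofReal_one]
  · refine (ae_restrict_iff' measurableSet_Ioi).2 (Filter.Eventually.of_forall fun s hs => ?_)
    have hs0 : 0 < s := h4.trans hs
    positivity

lemma abs_sqrt_div_sqrt_sub_one_le {ρ s σ : ℝ} (hρ : 0 < ρ) (hs : 4 * ρ ^ 2 ≤ s)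
    (hσ : |σ| ≤ ρ ^ 2) : |√s / √(s + σ) - 1| ≤ ρ / √s := by
  obtain ⟨h1, h2⟩ := abs_le.1 hσ
  have hρ2 : 0 < ρ ^ 2 := by positivity
  have hs0 : 0 < s := by linarith
  have hs1 : ρ ^ 2 ≤ s + σ := by linarith
  have hr : ρ ≤ √(s + σ) := Real.le_sqrt_of_sq_le hs1
  have hr0 : 0 < √s := Real.sqrt_pos.2 hs0
  have hr1 : 0 < √(s + σ) := hρ.trans_le hr
  have e1 : √s ^ 2 = s := Real.sq_sqrt hs0.le
  have e2 : √(s + σ) ^ 2 = s + σ := Real.sq_sqrt (by linarith)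
  have e3 : √s / √(s + σ) - 1 = (-σ) / (√(s + σ) * (√s + √(s + σ))) := by
    field_simp
    nlinarith
  rw [e3, abs_div, abs_neg, abs_of_pos (by positivity : 0 < √(s + σ) * (√s + √(s + σ))),
    div_le_div_iff₀ (by positivity) hr0]
  calc |σ| * √s ≤ ρ ^ 2 * √s := by gcongr
    _ = ρ * (ρ * √s) := by ring
    _ ≤ ρ * (√(s + σ) * (√s + √(s + σ))) := by gcongr; linarith

lemma lintegral_one_add_norm_ne_top :
    ∫⁻ y : Ed d, ENNReal.ofReal (((1 + ‖y‖) ^ (d + 1))⁻¹) ≠ ⊤ := by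
  have := (integrable_one_add_norm (E := Ed d) (μ := volume) (r := d + 1) (by simp)).lintegral_lt_top.ne
  convert this using 4 with y
  rw [Real.rpow_neg (by positivity)]
  congr 1
  exact_mod_cast rfl

lemma lintegral_psi_sub_le {P : Ed d → ℝ} (hP : IsProfile P) :
    ∃ A : ℝ≥0∞, A ≠ ⊤ ∧ ∀ (ρ σ : ℝ) (η : Ed d), 0 < ρ → |σ| ≤ ρ ^ 2 → ‖η‖ ≤ d * ρ →
      ∫⁻ s in Ici (4 * ρ ^ 2), ∫⁻ x, ‖psi P (s + σ) (x + η) - psi P s x‖ₑ ≤ A := by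
  obtain ⟨C, hC0, hC⟩ := hP.diff_le
  refine ⟨ENNReal.ofReal ((d + 1) * C) * ∫⁻ y : Ed d, ENNReal.ofReal (((1 + ‖y‖) ^ (d + 1))⁻¹),
    ENNReal.mul_ne_top ENNReal.ofReal_ne_top lintegral_one_add_norm_ne_top,
    fun ρ σ η hρ hσ hη => ?_⟩
  set I := ∫⁻ y : Ed d, ENNReal.ofReal (((1 + ‖y‖) ^ (d + 1))⁻¹)
  have hρ2 : 0 < ρ ^ 2 := by positivity
  calc ∫⁻ s in Ici (4 * ρ ^ 2), ∫⁻ x, ‖psi P (s + σ) (x + η) - psi P s x‖ₑ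
      ≤ ∫⁻ s in Ici (4 * ρ ^ 2), ENNReal.ofReal (s⁻¹ * (ρ / √s)) * (ENNReal.ofReal ((d + 1) * C) * I) := by
        refine setLIntegral_mono' measurableSet_Ici fun s hs => ?_
        have hs4 : 4 * ρ ^ 2 ≤ s := hs
        have hs0 : 0 < s := by linarith
        have hs0' : 0 < s + σ := by linarith [(abs_le.1 hσ).1]
        have hq : 0 < √s := Real.sqrt_pos.2 hs0
        have hq2 : 2 * ρ ≤ √s := Real.le_sqrt_of_sq_le (by linarith)
        have hr := abs_sqrt_div_sqrt_sub_one_le hρ hs4 hσ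
        have hη' : ‖(√s)⁻¹ • η‖ ≤ d * (ρ / √s) := by
          rw [norm_smul, norm_inv, Real.norm_eq_abs, abs_of_pos hq, inv_mul_eq_div, ← mul_div_assoc]
          gcongr
        have hh : ρ / √s ≤ 1 / 2 := by rw [div_le_div_iff₀ hq (by norm_num)]; linarith
        rw [lintegral_psi_sub hP.contDiff.continuous.measurable hs0 hs0']
        calc _ ≤ ENNReal.ofReal s⁻¹ * ∫⁻ y : Ed d, ENNReal.ofReal ((ρ / √s) * ((d + 1) * C)) *
              ENNReal.ofReal (((1 + ‖y‖) ^ (d + 1))⁻¹) := by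
              gcongr with y
              rw [← ENNReal.ofReal_mul (by positivity), Real.enorm_eq_ofReal_abs]
              refine ENNReal.ofReal_le_ofReal ((hC _ _ y (hr.trans hh) (hη'.trans ?_)).trans ?_)
              · have : (0 : ℝ) ≤ d := by positivity
                nlinarith
              · rw [mul_assoc (ρ / √s), mul_assoc ((d : ℝ) + 1), ← mul_assoc (ρ / √s)]
                gcongr
                linarith
          _ = _ := by
            rw [lintegral_const_mul' _ _ ENNReal.ofReal_ne_top, ENNReal.ofReal_mul (by positivity),
              ENNReal.ofReal_mul (inv_nonneg.2 hs0.le)]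
            ring
    _ = _ := by
      rw [lintegral_mul_const, lintegral_Ici_mul_rpow hρ, one_mul]
      exact (by fun_prop : Measurable fun s : ℝ => s⁻¹ * (ρ / √s)).ennreal_ofReal

end HormanderBound

section HormanderLemma

variable {d : ℕ}

lemma volume_setOf_indicator_Ico_ne_le (a b σ : ℝ) :
    volume {s : ℝ | ¬ (s + σ ∈ Ico a b ↔ s ∈ Ico a b)} ≤ ENNReal.ofReal (4 * |σ|) := by
  have hsub : {s : ℝ | ¬ (s + σ ∈ Ico a b ↔ s ∈ Ico a b)} ⊆
      Icc (a - |σ|) (a + |σ|) ∪ Icc (b - |σ|) (b + |σ|) := by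
    intro s hs
    by_contra h
    apply hs
    simp only [mem_union, mem_Icc, not_or, not_and_or, not_le] at h
    have h1 := neg_abs_le σ
    have h2 := le_abs_self σ
    simp only [mem_Ico]
    constructor
    · rintro ⟨h3, h4⟩
      constructor
      · rcases h.1 with h | h <;> linarith
      · rcases h.2 with h | h <;> linarith
    · rintro ⟨h3, h4⟩
      constructor
      · rcases h.1 with h | h <;> linarith
      · rcases h.2 with h | h <;> linarith
  refine (measure_mono hsub).trans ((measure_union_le _ _).trans ?_)
  rw [Real.volume_Icc, Real.volume_Icc, ← ENNReal.ofReal_add (by linarith [abs_nonneg σ])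
    (by linarith [abs_nonneg σ])]
  exact ENNReal.ofReal_le_ofReal (by linarith)

lemma measurableSet_setOf_indicator_Ico_ne (a b σ : ℝ) :
    MeasurableSet {s : ℝ | ¬ (s + σ ∈ Ico a b ↔ s ∈ Ico a b)} := by
  have h1 : MeasurableSet {s : ℝ | s + σ ∈ Ico a b} :=
    (measurable_id.add_const σ) measurableSet_Ico
  have h2 : MeasurableSet {s : ℝ | s ∈ Ico a b} := measurableSet_Ico
  exact ((h1.imp h2).inter (h2.imp h1)).compl.congr (by ext s; simp [iff_def])

lemma lintegral_indicator_psi_le {P : Ed d → ℝ} (hP : Measurable P) {ρ σ : ℝ} (hρ : 0 < ρ)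
    (hσ : |σ| ≤ ρ ^ 2) (a b : ℝ) :
    ∫⁻ s in Ici (4 * ρ ^ 2) ∩ {s : ℝ | ¬ (s + σ ∈ Ico a b ↔ s ∈ Ico a b)}, ∫⁻ x, ‖psi P s x‖ₑ ≤
      ∫⁻ y, ‖P y‖ₑ := by
  have hρ2 : 0 < 4 * ρ ^ 2 := by positivity
  have hJ := measurableSet_setOf_indicator_Ico_ne a b σ
  calc _ ≤ ∫⁻ s in Ici (4 * ρ ^ 2) ∩ {s : ℝ | ¬ (s + σ ∈ Ico a b ↔ s ∈ Ico a b)},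
        ENNReal.ofReal (4 * ρ ^ 2)⁻¹ * ∫⁻ y, ‖P y‖ₑ := by
        refine setLIntegral_mono' (measurableSet_Ici.inter hJ) fun s hs => ?_
        have hs4 : 4 * ρ ^ 2 ≤ s := hs.1
        rw [lintegral_psi hP (hρ2.trans_le hs4)]
        gcongr
    _ ≤ ENNReal.ofReal (4 * ρ ^ 2)⁻¹ * (∫⁻ y, ‖P y‖ₑ) * ENNReal.ofReal (4 * ρ ^ 2) := by
        rw [setLIntegral_const]
        refine mul_le_mul_right ((measure_mono inter_subset_right).trans
          ((volume_setOf_indicator_Ico_ne_le a b σ).trans (ENNReal.ofReal_le_ofReal ?_))) _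
        linarith
    _ = ∫⁻ y, ‖P y‖ₑ := by
        rw [mul_right_comm, ← ENNReal.ofReal_mul (by positivity), inv_mul_cancel₀ hρ2.ne',
          ENNReal.ofReal_one, one_mul]

/-- The part of the kernel near time zero, away from the spatial origin. -/
lemma lintegral_hker_near_le {P : Ed d → ℝ} (hP : Measurable P) {a b ρ : ℝ} (ha : 0 < a)
    (hρ : 0 < ρ) :
    ∫⁻ z, ‖hker 1 a b P z‖ₑ * {z : ℝ × Ed d | z.1 < 5 * ρ ^ 2 ∧ ρ ≤ ‖z.2‖}.indicator 1 z ≤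
      5 * ∫⁻ y, ‖P y‖ₑ * ENNReal.ofReal (‖y‖ ^ 2) := by
  have hE : MeasurableSet {z : ℝ × Ed d | z.1 < 5 * ρ ^ 2 ∧ ρ ≤ ‖z.2‖} :=
    (measurableSet_lt measurable_fst measurable_const).inter
      (measurableSet_le measurable_const measurable_snd.norm)
  rw [lintegral_hker ha hP (measurable_one.indicator hE)]
  set I := ∫⁻ y, ‖P y‖ₑ * ENNReal.ofReal (‖y‖ ^ 2)
  have hρ2 : 0 < ρ ^ 2 := by positivity
  calc _ ≤ ∫⁻ s in Ico a b, (Ico 0 (5 * ρ ^ 2)).indicator (fun _ => ENNReal.ofReal (ρ ^ 2)⁻¹ * I) s := by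
        refine setLIntegral_mono' measurableSet_Ico fun s hs => ?_
        have hs0 : 0 < s := ha.trans_le hs.1
        by_cases h5 : s < 5 * ρ ^ 2
        · rw [indicator_of_mem (show s ∈ Ico 0 (5 * ρ ^ 2) from ⟨hs0.le, h5⟩)]
          calc _ ≤ ENNReal.ofReal (s⁻¹ ^ 1) * ∫⁻ y, ENNReal.ofReal ((ρ ^ 2)⁻¹ * s) *
                (‖P y‖ₑ * ENNReal.ofReal (‖y‖ ^ 2)) := by
                refine mul_le_mul_right (lintegral_mono fun y => ?_) _
                rw [mul_left_comm]
                refine mul_le_mul_right ?_ _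
                rw [← ENNReal.ofReal_mul (by positivity)]
                by_cases hz : (s, √s • y) ∈ {z : ℝ × Ed d | z.1 < 5 * ρ ^ 2 ∧ ρ ≤ ‖z.2‖}
                · have hy : ρ ≤ √s * ‖y‖ := by
                    have := hz.2
                    rwa [norm_smul, Real.norm_of_nonneg (Real.sqrt_nonneg s)] at this
                  have hy2 : ρ ^ 2 ≤ s * ‖y‖ ^ 2 := by
                    calc ρ ^ 2 ≤ (√s * ‖y‖) ^ 2 := by gcongr
                      _ = _ := by rw [mul_pow, Real.sq_sqrt hs0.le]
                  rw [indicator_of_mem hz, Pi.one_apply, ← ENNReal.ofReal_one]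
                  refine ENNReal.ofReal_le_ofReal ?_
                  rw [mul_assoc, inv_mul_eq_div, one_le_div hρ2]
                  exact hy2
                · rw [indicator_of_notMem hz]
                  exact zero_le
            _ = _ := by
                rw [lintegral_const_mul' _ _ ENNReal.ofReal_ne_top, ← mul_assoc,
                  ← ENNReal.ofReal_mul (by positivity)]
                congr 2
                field_simp
        · have : ∀ y : Ed d, ({z : ℝ × Ed d | z.1 < 5 * ρ ^ 2 ∧ ρ ≤ ‖z.2‖}.indicator 1 (s, √s • y) : ℝ≥0∞) = 0 :=
            fun y => indicator_of_notMem (fun h => h5 h.1) _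
          simp [this]
    _ ≤ ∫⁻ s, (Ico 0 (5 * ρ ^ 2)).indicator (fun _ => ENNReal.ofReal (ρ ^ 2)⁻¹ * I) s :=
        setLIntegral_le_lintegral _ _
    _ = 5 * I := by
        rw [lintegral_indicator measurableSet_Ico, setLIntegral_const, Real.volume_Ico, sub_zero,
          mul_right_comm, ← ENNReal.ofReal_mul (by positivity)]
        congr 1
        rw [show (ρ ^ 2)⁻¹ * (5 * ρ ^ 2) = 5 by field_simp]
        norm_num

/-- Pointwise splitting of the difference of translates of the truncated kernel. -/
lemma enorm_hker_sub_le {P : Ed d → ℝ} {a b ρ : ℝ} (ha : 0 < a) (hρ : 0 < ρ) {η : ℝ × Ed d}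
    (hη1 : |η.1| ≤ ρ ^ 2) (hη2 : ‖η.2‖ ≤ d * ρ) {w : ℝ × Ed d}
    (hw : 4 * ρ ^ 2 ≤ |w.1| ∨ (d + 1) * ρ ≤ ‖w.2‖) :
    ‖hker 1 a b P (w + η) - hker 1 a b P w‖ₑ ≤
      (Ici (4 * ρ ^ 2)).indicator (fun s => ‖psi P (s + η.1) (w.2 + η.2) - psi P s w.2‖ₑ) w.1 +
      (Ici (4 * ρ ^ 2) ∩ {s : ℝ | ¬ (s + η.1 ∈ Ico a b ↔ s ∈ Ico a b)}).indicator
        (fun s => ‖psi P s w.2‖ₑ) w.1 + 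
      (‖hker 1 a b P (w + η)‖ₑ * {z : ℝ × Ed d | z.1 < 5 * ρ ^ 2 ∧ ρ ≤ ‖z.2‖}.indicator 1 (w + η) +
      ‖hker 1 a b P w‖ₑ * {z : ℝ × Ed d | z.1 < 5 * ρ ^ 2 ∧ ρ ≤ ‖z.2‖}.indicator 1 w) := by
  by_cases hs : 4 * ρ ^ 2 ≤ w.1
  · refine le_trans ?_ (le_add_right le_rfl)
    have hs' : w.1 ∈ Ici (4 * ρ ^ 2) := hs
    rw [indicator_of_mem hs', hker_one_eq, hker_one_eq, Prod.fst_add, Prod.snd_add]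
    by_cases h1 : w.1 + η.1 ∈ Ico a b <;> by_cases h2 : w.1 ∈ Ico a b
    · simp [h1, h2]
    · rw [indicator_of_mem (show w.1 ∈ Ici (4 * ρ ^ 2) ∩ {s : ℝ | ¬ (s + η.1 ∈ Ico a b ↔ s ∈ Ico a b)} from
        ⟨hs', fun h => h2 (h.1 h1)⟩)]
      simp only [h1, h2, indicator_of_mem, not_false_eq_true, indicator_of_notMem, Pi.one_apply,
        one_mul, zero_mul, sub_zero]
      simpa using enorm_add_le (psi P (w.1 + η.1) (w.2 + η.2) - psi P w.1 w.2) (psi P w.1 w.2)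
    · rw [indicator_of_mem (show w.1 ∈ Ici (4 * ρ ^ 2) ∩ {s : ℝ | ¬ (s + η.1 ∈ Ico a b ↔ s ∈ Ico a b)} from
        ⟨hs', fun h => h1 (h.2 h2)⟩)]
      simp [h1, h2]
    · simp [h1, h2]
  · refine le_trans ?_ (le_add_left le_rfl)
    have h1 := abs_le.1 hη1
    have hρ2 : 0 < ρ ^ 2 := by positivity
    have key : (w.1 ≤ 0 ∧ (w + η).1 ≤ 0) ∨ (d + 1) * ρ ≤ ‖w.2‖ := by
      refine hw.imp_left fun h => ?_
      rcases le_abs.1 h with h | h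
      · exact absurd h hs
      · exact ⟨by linarith, by rw [Prod.fst_add]; linarith⟩
    rcases key with ⟨h2, h3⟩ | h2
    · have e : ∀ z : ℝ × Ed d, z.1 ≤ 0 → hker 1 a b P z = 0 := fun z hz => by
        rw [hker_one_eq, indicator_of_notMem (fun h => by linarith [h.1]), zero_mul]
      rw [e _ h2, e _ h3]
      simp
    · have hm : w ∈ {z : ℝ × Ed d | z.1 < 5 * ρ ^ 2 ∧ ρ ≤ ‖z.2‖} := by
        refine ⟨by linarith, ?_⟩
        have : (0 : ℝ) ≤ d * ρ := by positivity
        linarith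
      have hm' : w + η ∈ {z : ℝ × Ed d | z.1 < 5 * ρ ^ 2 ∧ ρ ≤ ‖z.2‖} := by
        refine ⟨by rw [Prod.fst_add]; linarith, ?_⟩
        have : ‖w.2‖ ≤ ‖(w + η).2‖ + ‖η.2‖ := by
          simpa using norm_sub_le (w + η).2 η.2
        linarith
      rw [indicator_of_mem hm, indicator_of_mem hm', Pi.one_apply, Pi.one_apply, mul_one, mul_one]
      exact enorm_sub_le

/-- Hörmander's condition for the truncated kernels, uniformly in the truncation. -/
lemma exists_hormander_hker {P : Ed d → ℝ} (hP : IsProfile P) :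
    ∃ A : ℝ≥0∞, A ≠ ⊤ ∧ ∀ (a b ρ : ℝ) (η : ℝ × Ed d), 0 < a → 0 < ρ → |η.1| ≤ ρ ^ 2 →
      ‖η.2‖ ≤ d * ρ →
      ∫⁻ w in {w : ℝ × Ed d | 4 * ρ ^ 2 ≤ |w.1| ∨ (d + 1) * ρ ≤ ‖w.2‖},
        ‖hker 1 a b P (w + η) - hker 1 a b P w‖ₑ ≤ A := by
  obtain ⟨A, hA, hA'⟩ := lintegral_psi_sub_le hP
  have hPm : Measurable P := hP.contDiff.continuous.measurable
  have hI2 : ∫⁻ y, ‖P y‖ₑ * ENNReal.ofReal (‖y‖ ^ 2) ≠ ⊤ := by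
    have := (hP.integrable_pow 2).2.ne
    convert this using 3 with y
    rw [enorm_mul, Real.enorm_of_nonneg (sq_nonneg ‖y‖), mul_comm]
  have hI0 : ∫⁻ y, ‖P y‖ₑ ≠ ⊤ := hP.integrable.2.ne
  set I2 := ∫⁻ y, ‖P y‖ₑ * ENNReal.ofReal (‖y‖ ^ 2)
  set I0 := ∫⁻ y, ‖P y‖ₑ
  refine ⟨A + I0 + (5 * I2 + 5 * I2), by finiteness, fun a b ρ η ha hρ h1 h2 => ?_⟩
  have hE : MeasurableSet {w : ℝ × Ed d | 4 * ρ ^ 2 ≤ |w.1| ∨ (d + 1) * ρ ≤ ‖w.2‖} :=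
    (measurableSet_le measurable_const measurable_fst.abs).union
      (measurableSet_le measurable_const measurable_snd.norm)
  set F : ℝ × Ed d → ℝ≥0∞ := fun z => ‖hker 1 a b P z‖ₑ *
    {z : ℝ × Ed d | z.1 < 5 * ρ ^ 2 ∧ ρ ≤ ‖z.2‖}.indicator 1 z with hF
  have hFm : Measurable F := by
    refine (measurable_hker hPm).enorm.mul (measurable_one.indicator ?_)
    exact (measurableSet_lt measurable_fst measurable_const).inter
      (measurableSet_le measurable_const measurable_snd.norm)
  have hFm' : Measurable fun z => F (z + η) := hFm.comp (measurable_add_const η)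
  set J := Ici (4 * ρ ^ 2) ∩ {s : ℝ | ¬ (s + η.1 ∈ Ico a b ↔ s ∈ Ico a b)}
  have hJ : MeasurableSet J :=
    measurableSet_Ici.inter (measurableSet_setOf_indicator_Ico_ne a b η.1)
  set G1 : ℝ × Ed d → ℝ≥0∞ := fun w =>
    (Ici (4 * ρ ^ 2)).indicator (fun s => ‖psi P (s + η.1) (w.2 + η.2) - psi P s w.2‖ₑ) w.1
  set G2 : ℝ × Ed d → ℝ≥0∞ := fun w => J.indicator (fun s => ‖psi P s w.2‖ₑ) w.1
  have hpm := measurable_psi hPm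
  have hG1m : Measurable G1 := by
    have hm : Measurable fun w : ℝ × Ed d => ‖psi P (w.1 + η.1) (w.2 + η.2) - psi P w.1 w.2‖ₑ :=
      ((hpm.comp (measurable_add_const η)).sub hpm).enorm
    exact hm.indicator (measurable_fst measurableSet_Ici)
  have hG2m : Measurable G2 := hpm.enorm.indicator (measurable_fst hJ)
  have hG1 : ∫⁻ w, G1 w ≤ A := by
    rw [Measure.volume_eq_prod, lintegral_prod _ hG1m.aemeasurable]
    refine le_trans (le_of_eq ?_) (hA' ρ η.1 η.2 hρ h1 h2)
    rw [← lintegral_indicator measurableSet_Ici]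
    refine lintegral_congr fun s => ?_
    by_cases hs : s ∈ Ici (4 * ρ ^ 2) <;> simp [G1, hs]
  have hG2 : ∫⁻ w, G2 w ≤ I0 := by
    rw [Measure.volume_eq_prod, lintegral_prod _ hG2m.aemeasurable]
    refine le_trans (le_of_eq ?_) (lintegral_indicator_psi_le hPm hρ h1 a b)
    rw [← lintegral_indicator hJ]
    refine lintegral_congr fun s => ?_
    by_cases hs : s ∈ J <;> simp [G2, hs]
  calc _ ≤ ∫⁻ w in {w : ℝ × Ed d | 4 * ρ ^ 2 ≤ |w.1| ∨ (d + 1) * ρ ≤ ‖w.2‖},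
        (G1 w + G2 w + (F (w + η) + F w)) :=
        setLIntegral_mono' hE fun w hw => enorm_hker_sub_le ha hρ h1 h2 hw
    _ ≤ ∫⁻ w, (G1 w + G2 w + (F (w + η) + F w)) := setLIntegral_le_lintegral _ _
    _ = (∫⁻ w, G1 w) + (∫⁻ w, G2 w) + ((∫⁻ w, F (w + η)) + ∫⁻ w, F w) := by
        have hm : Measurable fun w => G1 w + G2 w := hG1m.add hG2m
        rw [lintegral_add_left hm, lintegral_add_left hG1m, lintegral_add_left hFm']
    _ ≤ _ := by
        rw [lintegral_add_right_eq_self F η]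
        have := lintegral_hker_near_le (b := b) hPm ha hρ
        gcongr

end HormanderLemma

section ParabolicGrid

variable {d : ℕ}

lemma floor_div_eq_iff {h x : ℝ} (hh : 0 < h) (i : ℤ) :
    ⌊x / h⌋ = i ↔ x ∈ Ico (i * h) (i * h + h) := by
  rw [Int.floor_eq_iff, le_div_iff₀ hh, div_lt_iff₀ hh, mem_Ico, add_mul, one_mul]

lemma floor_div_mul_natCast (x h : ℝ) (n : ℕ) : ⌊x / (h * n)⌋ = ⌊x / h⌋ / n := by
  rw [← div_div, Int.floor_div_natCast]

/-- Index of the parabolic dyadic cell of size `2^k` containing `z`. -/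
def parIdx (d : ℕ) (k : ℤ) (z : ℝ × Ed d) : ℤ × (Fin d → ℤ) :=
  (⌊z.1 / 4 ^ k⌋, fun j => ⌊z.2 j / 2 ^ k⌋)

lemma parIdx_eq_iff (k : ℤ) (z : ℝ × Ed d) (i : ℤ × (Fin d → ℤ)) :
    parIdx d k z = i ↔ z.1 ∈ Ico (i.1 * 4 ^ k : ℝ) (i.1 * 4 ^ k + 4 ^ k) ∧
      ∀ j, z.2 j ∈ Ico (i.2 j * 2 ^ k : ℝ) (i.2 j * 2 ^ k + 2 ^ k) := by
  rw [parIdx, Prod.ext_iff, floor_div_eq_iff (by positivity), funext_iff]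
  simp only [floor_div_eq_iff (show (0 : ℝ) < 2 ^ k by positivity)]

lemma setOf_parIdx_eq (k : ℤ) (i : ℤ × (Fin d → ℤ)) :
    {z | parIdx d k z = i} = Ico (i.1 * 4 ^ k : ℝ) (i.1 * 4 ^ k + 4 ^ k) ×ˢ
      ((fun x : Ed d => x.ofLp) ⁻¹' (univ.pi fun j => Ico (i.2 j * 2 ^ k : ℝ) (i.2 j * 2 ^ k + 2 ^ k))) := by
  ext z
  simp only [mem_ofPred_eq, parIdx_eq_iff, mem_prod, mem_preimage, mem_univ_pi]

lemma measurableSet_pi_Ico (k : ℤ) (i : Fin d → ℤ) :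
    MeasurableSet (univ.pi fun j : Fin d => Ico (i j * 2 ^ k : ℝ) (i j * 2 ^ k + 2 ^ k)) :=
  MeasurableSet.univ_pi fun _ => measurableSet_Ico

lemma volume_parIdx (k : ℤ) (i : ℤ × (Fin d → ℤ)) :
    volume {z | parIdx d k z = i} = ENNReal.ofReal (4 ^ k) * ENNReal.ofReal (2 ^ k) ^ d := by
  rw [setOf_parIdx_eq, Measure.volume_eq_prod, Measure.prod_prod, Real.volume_Ico,
    (PiLp.volume_preserving_ofLp (Fin d)).measure_preimage (measurableSet_pi_Ico k i.2).nullMeasurableSet,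
    volume_pi_pi]
  simp

/-- The lower corner of a cell. -/
def corner (k : ℤ) (i : ℤ × (Fin d → ℤ)) : ℝ × Ed d :=
  (i.1 * 4 ^ k, WithLp.toLp 2 fun j => i.2 j * 2 ^ k)

lemma norm_le_card_mul {x : Ed d} {r : ℝ} (h : ∀ j, |x j| ≤ r) : ‖x‖ ≤ d * r := by
  have h1 : x = ∑ j, x j • (EuclideanSpace.single j (1 : ℝ) : Ed d) := by
    ext k
    simp [Finset.sum_apply, Pi.single_apply]
  rw [h1]
  refine (norm_sum_le _ _).trans ((Finset.sum_le_sum (g := fun _ => r) fun j _ => ?_).trans_eq (by simp))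
  rw [norm_smul]
  simpa using h j

lemma abs_sub_le_of_parIdx {k : ℤ} {y : ℝ × Ed d} {i : ℤ × (Fin d → ℤ)} {y' : ℝ × Ed d}
    (hy : parIdx d k y = i) (hy' : parIdx d k y' = i) :
    |y.1 - y'.1| ≤ 4 ^ k ∧ ‖y.2 - y'.2‖ ≤ d * 2 ^ k := by
  rw [parIdx_eq_iff] at hy hy'
  refine ⟨abs_le.2 ⟨?_, ?_⟩, norm_le_card_mul fun j => abs_le.2 ⟨?_, ?_⟩⟩
  · linarith [hy.1.1, hy'.1.2]
  · linarith [hy.1.2, hy'.1.1]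
  · have h1 := (hy.2 j).1
    have h2 := (hy'.2 j).2
    simp only [PiLp.sub_apply]
    linarith
  · have h1 := (hy.2 j).2
    have h2 := (hy'.2 j).1
    simp only [PiLp.sub_apply]
    linarith

lemma parIdx_corner (k : ℤ) (i : ℤ × (Fin d → ℤ)) : parIdx d k (corner k i) = i := by
  rw [parIdx_eq_iff]
  have h4 : (0 : ℝ) < 4 ^ k := by positivity
  have h2 : (0 : ℝ) < 2 ^ k := by positivity
  exact ⟨⟨le_rfl, lt_add_of_pos_right _ h4⟩, fun j => ⟨le_rfl, lt_add_of_pos_right _ h2⟩⟩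

/-- The parabolic dyadic grid. -/
def parGrid (d : ℕ) : Grid (ℝ × Ed d) volume where
  ι := ℤ × (Fin d → ℤ)
  countable := inferInstance
  idx := parIdx d
  measurable_cell k i := by
    rw [setOf_parIdx_eq]
    exact measurableSet_Ico.prod ((PiLp.volume_preserving_ofLp (Fin d)).measurable (measurableSet_pi_Ico k i.2))
  nested k z z' h := by
    rw [parIdx, parIdx, Prod.ext_iff, funext_iff] at *
    have e4 : (4 : ℝ) ^ (k + 1) = 4 ^ k * (4 : ℕ) := by rw [zpow_add₀ (by norm_num)]; norm_num
    have e2 : (2 : ℝ) ^ (k + 1) = 2 ^ k * (2 : ℕ) := by rw [zpow_add₀ (by norm_num)]; norm_num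
    simp only [e4, e2, floor_div_mul_natCast]
    exact ⟨congrArg (fun m : ℤ => m / (4 : ℕ)) h.1, fun j => congrArg (fun m : ℤ => m / (2 : ℕ)) (h.2 j)⟩
  vol k := ENNReal.ofReal (4 ^ k) * ENNReal.ofReal (2 ^ k) ^ d
  vol_ne_zero k := by
    have h4 : (0 : ℝ) < 4 ^ k := by positivity
    have h2 : (0 : ℝ) < 2 ^ k := by positivity
    refine mul_ne_zero ?_ (pow_ne_zero _ ?_) <;> simpa
  vol_ne_top k := by finiteness
  measure_cell k z := volume_parIdx k _
  ratio := 4 * 2 ^ d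
  ratio_ne_top := by finiteness
  vol_succ k := by
    rw [zpow_add₀ (by norm_num), zpow_add₀ (by norm_num), ENNReal.ofReal_mul (by positivity),
      ENNReal.ofReal_mul (by positivity), mul_pow]
    norm_num
    ring_nf
    exact le_rfl
  vol_large C hC := by
    obtain ⟨n, hn⟩ := pow_unbounded_of_one_lt C.toReal (by norm_num : (1 : ℝ) < 4)
    refine ⟨n, fun k hk => ?_⟩
    have h1 : (4 : ℝ) ^ n ≤ 4 ^ k := by
      rw [← zpow_natCast]
      exact zpow_le_zpow_right₀ (by norm_num) hk
    have h2 : (1 : ℝ) ≤ 2 ^ k := one_le_zpow₀ (by norm_num) (by omega)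
    calc C = ENNReal.ofReal C.toReal * 1 := by rw [ENNReal.ofReal_toReal hC, mul_one]
      _ ≤ _ := by
        gcongr
        · linarith
        · exact one_le_pow₀ (by simpa using ENNReal.ofReal_le_ofReal h2)
  small z U hU := by
    rw [Metric.mem_nhds_iff] at hU
    obtain ⟨ε, hε, hU⟩ := hU
    obtain ⟨n, hn⟩ := exists_pow_lt_of_lt_one (show 0 < ε / (d + 1) by positivity)
      (by norm_num : (1 / 2 : ℝ) < 1)
    refine ⟨-n, fun z' hz' => hU ?_⟩
    obtain ⟨h1, h2⟩ := abs_sub_le_of_parIdx hz' rfl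
    have e2 : (2 : ℝ) ^ (-n : ℤ) = (1 / 2) ^ n := by simp
    have e4 : (4 : ℝ) ^ (-n : ℤ) ≤ (1 / 2) ^ n := by
      rw [zpow_neg, zpow_natCast, ← inv_pow]
      gcongr
      norm_num
    rw [lt_div_iff₀ (by positivity)] at hn
    rw [e2] at h2
    have hd : (0 : ℝ) ≤ d * (1 / 2) ^ n := by positivity
    have h2n : (0 : ℝ) < (1 / 2) ^ n := by positivity
    rw [Metric.mem_ball, Prod.dist_eq, max_lt_iff, Real.dist_eq, dist_eq_norm]
    constructor <;> nlinarith

/-- The enlarged cell. -/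
def parStar (q : ℤ × (parGrid d).ι) : Set (ℝ × Ed d) :=
  Metric.ball (corner q.1 q.2).1 (5 * 4 ^ q.1) ×ˢ
    Metric.ball (corner (d := d) q.1 q.2).2 ((2 * d + 1) * 2 ^ q.1)

lemma measurableSet_parStar (q : ℤ × (parGrid d).ι) : MeasurableSet (parStar q) :=
  measurableSet_ball.prod measurableSet_ball

lemma volume_parStar (q : ℤ × (parGrid d).ι) :
    volume (parStar q) = 10 * volume (Metric.ball (0 : Ed d) (2 * d + 1)) * (parGrid d).vol q.1 := by
  have e : volume (parStar q) = volume (Metric.ball (corner (d := d) q.1 q.2).1 (5 * 4 ^ q.1)) *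
      volume (Metric.ball (corner (d := d) q.1 q.2).2 ((2 * d + 1) * 2 ^ q.1)) :=
    Measure.prod_prod _ _
  rw [e, Real.volume_ball, mul_comm (2 * (d : ℝ) + 1),
    Measure.addHaar_ball_mul_of_pos _ _ (by positivity), finrank_euclideanSpace_fin]
  change _ = _ * (ENNReal.ofReal (4 ^ q.1) * ENNReal.ofReal (2 ^ q.1) ^ d)
  rw [show (2 * (5 * 4 ^ q.1) : ℝ) = 10 * 4 ^ q.1 by ring, ENNReal.ofReal_mul (by norm_num),
    ENNReal.ofReal_pow (by positivity)]
  norm_num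
  ring

lemma sub_mem_of_notMem_parStar {q : ℤ × (parGrid d).ι} {y z : ℝ × Ed d}
    (hy : y ∈ (parGrid d).cell q) (hz : z ∉ parStar q) :
    4 * (2 ^ q.1) ^ 2 ≤ |(z - y).1| ∨ ((d : ℝ) + 1) * 2 ^ q.1 ≤ ‖(z - y).2‖ := by
  have h4 : (4 : ℝ) ^ q.1 = (2 ^ q.1) ^ 2 := by
    rw [← zpow_natCast, ← zpow_mul, mul_comm, zpow_mul]; norm_num
  obtain ⟨h1, h2⟩ := abs_sub_le_of_parIdx hy (parIdx_corner q.1 q.2)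
  rw [parStar, mem_prod, not_and_or, Metric.mem_ball, Metric.mem_ball, not_lt, not_lt,
    Real.dist_eq, dist_eq_norm] at hz
  rw [Prod.fst_sub, Prod.snd_sub]
  refine hz.imp (fun h => ?_) (fun h => ?_)
  · have := abs_sub_le z.1 y.1 (corner q.1 q.2).1
    rw [← h4]
    linarith
  · have := norm_sub_le_norm_sub_add_norm_sub z.2 y.2 (corner (d := d) q.1 q.2).2
    linarith

end ParabolicGrid

section ParabolicEstimate

variable {d : ℕ}

/-- Hörmander's condition relative to the parabolic grid. -/
lemma lintegral_compl_parStar_le {K : ℝ × Ed d → ℝ} {A : ℝ≥0∞}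
    (hK : ∀ (ρ : ℝ) (η : ℝ × Ed d), 0 < ρ → |η.1| ≤ ρ ^ 2 → ‖η.2‖ ≤ d * ρ →
      ∫⁻ w in {w : ℝ × Ed d | 4 * ρ ^ 2 ≤ |w.1| ∨ (d + 1) * ρ ≤ ‖w.2‖}, ‖K (w + η) - K w‖ₑ ≤ A)
    (q : ℤ × (parGrid d).ι) {y y' : ℝ × Ed d} (hy : y ∈ (parGrid d).cell q)
    (hy' : y' ∈ (parGrid d).cell q) :
    ∫⁻ z in (parStar q)ᶜ, ‖K (z - y) - K (z - y')‖ₑ ≤ A := by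
  set E := {w : ℝ × Ed d | 4 * (2 ^ q.1 : ℝ) ^ 2 ≤ |w.1| ∨ ((d : ℝ) + 1) * 2 ^ q.1 ≤ ‖w.2‖} with hE
  have hEm : MeasurableSet E :=
    (measurableSet_le measurable_const measurable_fst.abs).union
      (measurableSet_le measurable_const measurable_snd.norm)
  have h4 : (4 : ℝ) ^ q.1 = (2 ^ q.1) ^ 2 := by
    rw [← zpow_natCast, ← zpow_mul, mul_comm, zpow_mul]; norm_num
  have hd := abs_sub_le_of_parIdx hy' hy
  rw [h4] at hd
  refine le_trans ?_ (hK (2 ^ q.1) (y' - y) (by positivity) hd.1 hd.2)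
  rw [← lintegral_indicator (measurableSet_parStar q).compl, ← lintegral_indicator hEm,
    ← lintegral_sub_right_eq_self (E.indicator fun w => ‖K (w + (y' - y)) - K w‖ₑ) y']
  refine lintegral_mono fun z => ?_
  by_cases hz : z ∈ parStar q
  · rw [indicator_of_notMem (by simpa using hz)]
    exact zero_le
  · rw [indicator_of_mem (show z ∈ (parStar q)ᶜ from hz),
      indicator_of_mem (show z - y' ∈ E from sub_mem_of_notMem_parStar hy' hz)]
    rw [sub_add_sub_cancel]

lemma hormander_comp_neg {K : ℝ × Ed d → ℝ} {A : ℝ≥0∞} {ρ : ℝ} {η : ℝ × Ed d}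
    (h : ∫⁻ w in {w : ℝ × Ed d | 4 * ρ ^ 2 ≤ |w.1| ∨ (d + 1) * ρ ≤ ‖w.2‖},
      ‖K (w + -η) - K w‖ₑ ≤ A) :
    ∫⁻ w in {w : ℝ × Ed d | 4 * ρ ^ 2 ≤ |w.1| ∨ (d + 1) * ρ ≤ ‖w.2‖},
      ‖K (-(w + η)) - K (-w)‖ₑ ≤ A := by
  set E := {w : ℝ × Ed d | 4 * ρ ^ 2 ≤ |w.1| ∨ (d + 1) * ρ ≤ ‖w.2‖} with hE
  have hEm : MeasurableSet E :=
    (measurableSet_le measurable_const measurable_fst.abs).union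
      (measurableSet_le measurable_const measurable_snd.norm)
  refine le_trans (le_of_eq ?_) h
  rw [← lintegral_indicator hEm, ← lintegral_indicator hEm, ← lintegral_neg_eq_self]
  refine lintegral_congr fun w => ?_
  have : -w ∈ E ↔ w ∈ E := by simp [hE]
  by_cases hw : w ∈ E
  · rw [indicator_of_mem hw, indicator_of_mem (this.2 hw), neg_neg]
    congr 3
    abel
  · rw [indicator_of_notMem hw, indicator_of_notMem (fun h => hw (this.1 h))]

lemma exists_isCZKernel_hcz (d : ℕ) :
    ∃ A : ℝ≥0∞, A ≠ ⊤ ∧ ∀ (a b : ℝ) (i j : Fin d), 0 < a → a < b →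
      IsCZKernel (parGrid d) (hcz a b i j) A parStar ∧
      IsCZKernel (parGrid d) (fun z => hcz a b i j (-z)) A parStar := by
  choose A hA hA' using fun q : Fin d × Fin d => exists_hormander_hker (isProfile_ddgau' q.1 q.2)
  set V : ℝ≥0∞ := 10 * volume (Metric.ball (0 : Ed d) (2 * d + 1)) with hV
  have hVt : V ≠ ⊤ := ENNReal.mul_ne_top (by simp) measure_ball_lt_top.ne
  refine ⟨4 + V + ∑ q, A q, ?_, fun a b i j ha hab => ?_⟩
  · have : ∑ q, A q ≠ ⊤ := ENNReal.sum_ne_top.2 fun q _ => hA q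
    finiteness
  have hle : A (i, j) ≤ 4 + V + ∑ q, A q :=
    (Finset.single_le_sum (f := A) (fun _ _ => zero_le) (Finset.mem_univ (i, j))).trans le_add_self
  have h4 : 4 ≤ 4 + V + ∑ q, A q := le_self_add.trans le_self_add
  have hl2 : ∀ g : ℝ × Ed d → ℝ, Measurable g → Integrable g → (∃ M, ∀ z, |g z| ≤ M) →
      ∫⁻ z, ‖cv volume (hcz a b i j) g z‖ₑ ^ 2 ≤ (4 + V + ∑ q, A q) * ∫⁻ z, ‖g z‖ₑ ^ 2 := by
    rintro g hg hgi ⟨M, hM⟩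
    refine (lintegral_hcz_sq_le ha hab i j hg hgi hM).trans (by gcongr)
  have hst : ∀ q : ℤ × (parGrid d).ι, volume (parStar q) ≤ (4 + V + ∑ q, A q) * (parGrid d).vol q.1 := by
    intro q
    rw [volume_parStar]
    gcongr
    exact le_add_self.trans le_self_add
  refine ⟨⟨measurable_hcz a b i j, integrable_hcz ha i j, hl2, measurableSet_parStar, hst, ?_⟩,
    ⟨(measurable_hcz a b i j).comp measurable_neg, (integrable_hcz ha i j).comp_neg,
      IsCZKernel.l2_comp_neg hl2, measurableSet_parStar, hst, ?_⟩⟩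
  · intro q y hy y' hy'
    exact (lintegral_compl_parStar_le
      (fun ρ η h1 h2 h3 => hA' (i, j) a b ρ η ha h1 h2 h3) q hy hy').trans hle
  · intro q y hy y' hy'
    refine (lintegral_compl_parStar_le (K := fun z => hcz a b i j (-z)) (fun ρ η h1 h2 h3 => hormander_comp_neg
      (hA' (i, j) a b ρ (-η) ha h1 (by simpa using h2) (by simpa using h3))) q hy hy').trans hle

lemma cv_hcz_heat {a b : ℝ} (ha : 0 < a) (hab : a < b) (i j : Fin d) {w : ℝ × Ed d → ℝ}
    (hw : IsTest w) (z : ℝ × Ed d) :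
    cv volume (hcz a b i j) (fun z => dd et w z - lapl w z) z =
      hav gau a (dd (ex (eb i)) (dd (ex (eb j)) w)) z -
        hav gau b (dd (ex (eb i)) (dd (ex (eb j)) w)) z := by
  have hf : IsTest fun z => dd et w z - lapl w z := (hw.dd _).sub hw.lapl
  have hW : IsTest (dd (ex (eb i)) (dd (ex (eb j)) w)) := (hw.dd _).dd _
  have key : ∀ (v : ℝ × Ed d) {w : ℝ × Ed d → ℝ}, IsTest w → dd v (fun z => dd et w z - lapl w z) =
      fun z => dd et (dd v w) z - lapl (dd v w) z := by
    intro v w hw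
    funext z
    rw [dd_sub (hw.dd _) hw.lapl, dd_comm hw]
    congr 1
    change dd v (fun z => ∑ i, dd (ex (eb i)) (dd (ex (eb i)) w) z) z = _
    rw [dd_sum Finset.univ (fun i => (hw.dd _).dd _)]
    refine Finset.sum_congr rfl fun i _ => ?_
    rw [dd_comm (hw.dd _), dd_comm hw]
  have e : hcz a b i j = hker 1 a b fun y => fderiv ℝ (fun x => fderiv ℝ gau x (eb i)) y (eb j) := rfl
  rw [e, cv_hker_ddgau ha hf (eb i) (eb j), key _ hw, key _ (hw.dd _), cv_hker_heat ha hab hW]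

/-- The `L_p` estimate for the heat equation. -/
theorem exists_heat_estimate (d : ℕ) {p : ℝ} (hp : 1 < p) :
    ∃ C : ℝ≥0∞, C ≠ ⊤ ∧ ∀ w : ℝ × Ed d → ℝ, IsTest w → ∀ i j : Fin d,
      ∫⁻ z, ‖dd (ex (eb i)) (dd (ex (eb j)) w) z‖ₑ ^ p ≤
        C * ∫⁻ z, ‖dd et w z - lapl w z‖ₑ ^ p := by
  obtain ⟨A, hA, hK⟩ := exists_isCZKernel_hcz d
  refine ⟨IsCZKernel.czConst p A (parGrid d).ratio, IsCZKernel.czConst_ne_top hp hA (parGrid d).ratio_ne_top,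
    fun w hw i j => ?_⟩
  have hf : IsTest fun z => dd et w z - lapl w z := (hw.dd _).sub hw.lapl
  obtain ⟨M, -, hM⟩ := hf.bounded
  have e : ∀ x : ℝ, ENNReal.ofReal (|x| ^ p) = ‖x‖ₑ ^ p := fun x => by
    rw [Real.enorm_eq_ofReal_abs, ENNReal.ofReal_rpow_of_nonneg (abs_nonneg _) (by linarith)]
  set W := dd (ex (eb i)) (dd (ex (eb j)) w) with hW
  have hWt : IsTest W := (hw.dd _).dd _
  have hgau := isProfile_gau (d := d)
  have hlim : ∀ z, Filter.Tendsto (fun n : ℕ => ‖cv volume (hcz ((n : ℝ) + 2)⁻¹ (n + 2) i j)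
      (fun z => dd et w z - lapl w z) z‖ₑ ^ p) Filter.atTop (nhds (‖W z‖ₑ ^ p)) := by
    intro z
    have hn : Filter.Tendsto (fun n : ℕ => (n : ℝ) + 2) Filter.atTop Filter.atTop :=
      Filter.tendsto_atTop_add_const_right _ _ tendsto_natCast_atTop_atTop
    have h1 := (tendsto_hav_zero hWt z).comp (tendsto_inv_atTop_zero.comp hn)
    have h2 := hn.eventually (hav_eventually_zero hWt z gau)
    refine ((ENNReal.continuous_rpow_const (y := p)).tendsto _).comp
      ((continuous_enorm.tendsto (W z)).comp (h1.congr' ?_))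
    filter_upwards [h2] with n hn
    have h3 : (1 : ℝ) < n + 2 := by have : (0 : ℝ) ≤ n := by positivity
                                    linarith
    rw [cv_hcz_heat (by positivity) ((inv_lt_one_of_one_lt₀ h3).trans h3) i j hw z, hn, sub_zero]
    rfl
  calc ∫⁻ z, ‖W z‖ₑ ^ p = ∫⁻ z, Filter.liminf (fun n : ℕ => ‖cv volume (hcz ((n : ℝ) + 2)⁻¹ (n + 2) i j)
      (fun z => dd et w z - lapl w z) z‖ₑ ^ p) Filter.atTop :=
        lintegral_congr fun z => (hlim z).liminf_eq.symm
    _ ≤ Filter.liminf (fun n : ℕ => ∫⁻ z, ‖cv volume (hcz ((n : ℝ) + 2)⁻¹ (n + 2) i j)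
      (fun z => dd et w z - lapl w z) z‖ₑ ^ p) Filter.atTop := by
        refine lintegral_liminf_le fun n => ?_
        have := (continuous_cv (integrable_hcz (b := (n : ℝ) + 2) (show 0 < ((n : ℝ) + 2)⁻¹ by positivity) i j) hf.continuous hM).measurable
        exact this.enorm.pow_const p
    _ ≤ IsCZKernel.czConst p A (parGrid d).ratio * ∫⁻ z, ‖dd et w z - lapl w z‖ₑ ^ p := by
        refine Filter.liminf_le_of_frequently_le' (Filter.Eventually.of_forall fun n : ℕ => ?_).frequently
        have h3 : (1 : ℝ) < n + 2 := by have : (0 : ℝ) ≤ n := by positivity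
                                        linarith
        have h0 : 0 < ((n : ℝ) + 2)⁻¹ := by positivity
        obtain ⟨h1, h2⟩ := hK _ _ i j h0 ((inv_lt_one_of_one_lt₀ h3).trans h3)
        have := h1.strong_bound h2 hf.continuous hf.integrable hM hp
        simpa only [e] using this

end ParabolicEstimate

section NormKit

variable {X : Type*} [MeasurableSpace X] {μ : Measure X} {p : ℝ≥0∞}

lemma eLpNorm_const_mul_real (c : ℝ) (f : X → ℝ) :
    eLpNorm (fun z => c * f z) p μ = ENNReal.ofReal |c| * eLpNorm f p μ := by
  have := eLpNorm_const_smul c f p μ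
  rw [← Real.enorm_eq_ofReal_abs]
  simpa [Pi.smul_def] using this

lemma eLpNorm_le_sum_of_abs_le (hp : 1 ≤ p) {ι : Type*} (s : Finset ι) {c : ι → ℝ}
    (hc : ∀ i, 0 ≤ c i) {g : ι → X → ℝ} (hg : ∀ i, AEStronglyMeasurable (g i) μ) {f : X → ℝ}
    (h : ∀ᵐ z ∂μ, |f z| ≤ ∑ i ∈ s, c i * |g i z|) :
    eLpNorm f p μ ≤ ∑ i ∈ s, ENNReal.ofReal (c i) * eLpNorm (g i) p μ := by
  refine (eLpNorm_mono_ae_real (g := ∑ i ∈ s, fun z => c i * |g i z|) ?_).trans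
    ((eLpNorm_sum_le (fun i _ => ((hg i).norm.const_mul (c i))) hp).trans_eq ?_)
  · filter_upwards [h] with z hz
    simpa [Finset.sum_apply] using hz
  · refine Finset.sum_congr rfl fun i _ => ?_
    rw [eLpNorm_const_mul_real, abs_of_nonneg (hc i)]
    congr 1
    exact eLpNorm_norm (g i)

lemma eLpNorm_le_two_of_abs_le (hp : 1 ≤ p) {a b : ℝ} (ha : 0 ≤ a) (hb : 0 ≤ b)
    {f g g' : X → ℝ} (hg : AEStronglyMeasurable g μ) (hg' : AEStronglyMeasurable g' μ)
    (h : ∀ᵐ z ∂μ, |f z| ≤ a * |g z| + b * |g' z|) :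
    eLpNorm f p μ ≤ ENNReal.ofReal a * eLpNorm g p μ + ENNReal.ofReal b * eLpNorm g' p μ := by
  have := eLpNorm_le_sum_of_abs_le hp (Finset.univ : Finset (Fin 2)) (c := ![a, b])
    (by intro i; fin_cases i <;> simpa) (g := ![g, g'])
    (by intro i; fin_cases i <;> simpa) (f := f) (by simpa using h)
  simpa using this

lemma eLpNorm_le_three_of_abs_le (hp : 1 ≤ p) {a b c : ℝ} (ha : 0 ≤ a) (hb : 0 ≤ b) (hc : 0 ≤ c)
    {f g g' g'' : X → ℝ} (hg : AEStronglyMeasurable g μ) (hg' : AEStronglyMeasurable g' μ)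
    (hg'' : AEStronglyMeasurable g'' μ)
    (h : ∀ᵐ z ∂μ, |f z| ≤ a * |g z| + b * |g' z| + c * |g'' z|) :
    eLpNorm f p μ ≤ ENNReal.ofReal a * eLpNorm g p μ + ENNReal.ofReal b * eLpNorm g' p μ +
      ENNReal.ofReal c * eLpNorm g'' p μ := by
  have := eLpNorm_le_sum_of_abs_le hp (Finset.univ : Finset (Fin 3)) (c := ![a, b, c])
    (by intro i; fin_cases i <;> simpa) (g := ![g, g', g''])
    (by intro i; fin_cases i <;> simpa) (f := f) (by simpa [Fin.sum_univ_three] using h)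
  simpa [Fin.sum_univ_three] using this

end NormKit

section Taylor

variable {H : Type*} [NormedAddCommGroup H] [NormedSpace ℝ H]

lemma hasDerivAt_line {φ : H → ℝ} (h : IsTest φ) (z e : H) (s : ℝ) :
    HasDerivAt (fun s : ℝ => φ (z + s • e)) (dd e φ (z + s • e)) s := by
  have h1 : HasDerivAt (fun s : ℝ => z + s • e) e s := by
    simpa using ((hasDerivAt_id s).smul_const e).const_add z
  exact (h.differentiable _).hasFDerivAt.comp_hasDerivAt s h1

/-- A multiple of the indicator of a ball. -/
def ballFun (M ρ : ℝ) : H → ℝ := (Metric.closedBall 0 ρ).indicator fun _ => M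

lemma IsTest.eq_zero_of_large {φ : H → ℝ} (h : IsTest φ) :
    ∃ ρ : ℝ, ∀ z, ρ < ‖z‖ → φ z = 0 := by
  obtain ⟨ρ, hρ⟩ := h.compact.isCompact.isBounded.subset_closedBall 0
  refine ⟨ρ, fun z hz => image_eq_zero_of_notMem_tsupport fun hz' => ?_⟩
  have := hρ hz'
  rw [mem_closedBall_zero_iff] at this
  linarith

lemma le_ballFun_of {H : Type*} [NormedAddCommGroup H] {F : H → ℝ} {M ρ c : ℝ} (hc : 0 ≤ c) (hM : 0 ≤ M) (h : ∀ z, F z ≤ c * M)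
    (h0 : ∀ z, ρ < ‖z‖ → F z = 0) (z : H) : F z ≤ c * ballFun M ρ z := by
  rcases lt_or_ge ρ ‖z‖ with hz | hz
  · rw [h0 z hz]
    refine mul_nonneg hc ?_
    exact indicator_nonneg (fun _ _ => hM) z
  · rw [ballFun, indicator_of_mem (mem_closedBall_zero_iff.2 hz)]
    exact h z

lemma norm_lt_norm_add {e z : H} {ρ h : ℝ} (h0 : |h| ≤ 1) (hz : ρ + ‖e‖ < ‖z‖) :
    ρ < ‖z + h • e‖ := by
  have h1 : ‖z‖ ≤ ‖z + h • e‖ + ‖h • e‖ := by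
    simpa using norm_sub_le (z + h • e) (h • e)
  have h2 : ‖h • e‖ ≤ ‖e‖ := by
    rw [norm_smul, Real.norm_eq_abs]
    exact mul_le_of_le_one_left (norm_nonneg _) h0
  linarith

lemma abs_sub_le_of_bound {g g' : ℝ → ℝ} (hg : ∀ s, HasDerivAt g (g' s) s) {h C : ℝ} (hh : 0 ≤ h)
    (hb : ∀ s ∈ Ico 0 h, |g' s| ≤ C) : |g h - g 0| ≤ h * C := by
  have := norm_image_sub_le_of_norm_deriv_le_segment' (fun x _ => (hg x).hasDerivWithinAt) hb h
    (right_mem_Icc.2 hh)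
  rw [Real.norm_eq_abs, sub_zero] at this
  linarith

lemma taylor_one_aux {φ : H → ℝ} (hφ : IsTest φ) {e : H} {M : ℝ}
    (hM : ∀ z, |dd e (dd e φ) z| ≤ M) {h : ℝ} (h0 : 0 ≤ h) (z : H) :
    |φ (z + h • e) - φ z - h * dd e φ z| ≤ h ^ 2 * M := by
  have hM0 : 0 ≤ M := (abs_nonneg _).trans (hM 0)
  have h1 : ∀ s : ℝ, HasDerivAt (fun s : ℝ => φ (z + s • e) - s * dd e φ z)
      (dd e φ (z + s • e) - dd e φ z) s := fun s => by
    simpa using (hasDerivAt_line hφ z e s).fun_sub ((hasDerivAt_id s).mul_const _)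
  have := abs_sub_le_of_bound h1 (C := h * M) h0 fun s hs => by
    have := abs_sub_le_of_bound (hasDerivAt_line (hφ.dd e) z e) hs.1 fun s _ => hM _
    simp only [zero_smul, add_zero] at this
    exact this.trans (mul_le_mul_of_nonneg_right hs.2.le hM0)
  simp only [zero_smul, add_zero, zero_mul, sub_zero] at this
  calc _ = |φ (z + h • e) - h * dd e φ z - φ z| := by congr 1; ring
    _ ≤ _ := this.trans_eq (by ring)

lemma taylor_one {φ : H → ℝ} (hφ : IsTest φ) (e : H) :
    ∃ M ρ : ℝ, 0 ≤ M ∧ ∀ z h, 0 ≤ h → h ≤ 1 →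
      |φ (z + h • e) - φ z - h * dd e φ z| ≤ h ^ 2 * ballFun M ρ z := by
  obtain ⟨M, hM, hM'⟩ := ((hφ.dd e).dd e).bounded
  obtain ⟨ρ, hρ⟩ := hφ.eq_zero_of_large
  obtain ⟨ρ', hρ'⟩ := (hφ.dd e).eq_zero_of_large
  refine ⟨M, max ρ ρ' + ‖e‖, hM, fun z h h0 h1 => ?_⟩
  refine le_ballFun_of (F := fun z => |φ (z + h • e) - φ z - h * dd e φ z|) (sq_nonneg h) hM
    (fun z => taylor_one_aux hφ hM' h0 z) (fun z hz => ?_) z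
  have h2 := hρ _ (norm_lt_norm_add (h := h) (by rwa [abs_of_nonneg h0])
    ((add_le_add_left (le_max_left ρ ρ') ‖e‖).trans_lt hz))
  have h3 := norm_nonneg e
  have h4 := le_max_left ρ ρ'
  have h5 := le_max_right ρ ρ'
  rw [h2, hρ z (by linarith), hρ' z (by linarith)]
  simp

lemma dd_neg_left (v : H) (φ : H → ℝ) (z : H) : dd (-v) φ z = -dd v φ z := by simp [dd]

lemma taylor_two {φ : H → ℝ} (hφ : IsTest φ) (e : H) :
    ∃ M ρ : ℝ, 0 ≤ M ∧ ∀ z h, 0 ≤ h → h ≤ 1 →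
      |φ (z + h • e) + φ (z - h • e) - 2 * φ z - h ^ 2 * dd e (dd e φ) z| ≤
        h ^ 3 * ballFun M ρ z := by
  obtain ⟨M, hM, hM'⟩ := (((hφ.dd e).dd e).dd e).bounded
  obtain ⟨ρ, hρ⟩ := hφ.eq_zero_of_large
  obtain ⟨ρ', hρ'⟩ := ((hφ.dd e).dd e).eq_zero_of_large
  refine ⟨2 * M, max ρ ρ' + ‖e‖, by positivity, fun z h h0 h1 => ?_⟩
  refine le_ballFun_of (F := fun z => |φ (z + h • e) + φ (z - h • e) - 2 * φ z -
    h ^ 2 * dd e (dd e φ) z|) (by positivity) (by positivity) (fun z => ?_) (fun z hz => ?_) z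
  · have hneg : ∀ s : ℝ, HasDerivAt (fun s : ℝ => φ (z - s • e)) (-dd e φ (z - s • e)) s := by
      intro s
      have := hasDerivAt_line hφ z (-e) s
      simpa only [smul_neg, ← sub_eq_add_neg, dd_neg_left] using this
    have h3 : ∀ s : ℝ, HasDerivAt (fun s : ℝ => φ (z + s • e) + φ (z - s • e) -
        s ^ 2 * dd e (dd e φ) z)
        (dd e φ (z + s • e) - dd e φ (z - s • e) - 2 * s * dd e (dd e φ) z) s := fun s => by
      have := ((hasDerivAt_line hφ z e s).fun_add (hneg s)).fun_sub
        ((hasDerivAt_pow 2 s).mul_const (dd e (dd e φ) z))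
      simpa [← sub_eq_add_neg] using this
    have := abs_sub_le_of_bound h3 (C := 2 * (h ^ 2 * M)) h0 fun s hs => by
      have h4 := taylor_one_aux (hφ.dd e) hM' hs.1 z
      have h5 := taylor_one_aux (hφ.dd e) (e := -e) (M := M) (fun z => by
        have h6 : dd (-e) (dd (-e) (dd e φ)) = dd e (dd e (dd e φ)) := by
          funext z
          have h7 : dd (-e) (dd e φ) = fun z => (-1) * dd e (dd e φ) z := by
            funext z; rw [dd_neg_left]; ring
          rw [dd_neg_left, h7, dd_const_mul ((hφ.dd e).dd e)]
          ring
        rw [h6]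
        exact hM' z) hs.1 z
      rw [smul_neg, ← sub_eq_add_neg, dd_neg_left] at h5
      have h8 : s ^ 2 * M ≤ h ^ 2 * M := by
        refine mul_le_mul_of_nonneg_right ?_ hM
        exact pow_le_pow_left₀ hs.1 hs.2.le 2
      rw [abs_le] at *
      constructor <;> linarith
    simp only [zero_smul, add_zero, sub_zero] at this
    calc _ = |φ (z + h • e) + φ (z - h • e) - h ^ 2 * dd e (dd e φ) z -
          (φ z + φ z - 0 ^ 2 * dd e (dd e φ) z)| := by congr 1; ring
      _ ≤ _ := this.trans_eq (by ring)
  · have h2 := hρ _ (norm_lt_norm_add (h := h) (by rwa [abs_of_nonneg h0])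
      ((add_le_add_left (le_max_left ρ ρ') ‖e‖).trans_lt hz))
    have h2' := hρ _ (norm_lt_norm_add (h := -h) (by rwa [abs_neg, abs_of_nonneg h0])
      ((add_le_add_left (le_max_left ρ ρ') ‖e‖).trans_lt hz))
    rw [neg_smul, ← sub_eq_add_neg] at h2'
    have h3 := norm_nonneg e
    have h4 := le_max_left ρ ρ'
    have h5 := le_max_right ρ ρ'
    rw [h2, h2', hρ z (by linarith), hρ' z (by linarith)]
    simp

end Taylor

section Accretive

variable {d : ℕ} {p : ℝ≥0∞}

lemma measurable_ballFun {H : Type*} [NormedAddCommGroup H] [MeasurableSpace H] [BorelSpace H]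
    (M ρ : ℝ) : Measurable (ballFun M ρ : H → ℝ) :=
  measurable_const.indicator measurableSet_closedBall

lemma eLpNorm_ballFun_ne_top {H : Type*} [NormedAddCommGroup H] [ProperSpace H]
    [MeasurableSpace H] [BorelSpace H] {μ : Measure H} [IsFiniteMeasureOnCompacts μ] (M ρ : ℝ) :
    eLpNorm (ballFun M ρ) p μ ≠ ⊤ := by
  refine ne_top_of_le_ne_top ?_ (eLpNorm_indicator_const_le _ _)
  have := (isCompact_closedBall (0 : H) ρ).measure_lt_top (μ := μ)
  exact ENNReal.mul_ne_top (by simp) (ENNReal.rpow_ne_top_of_nonneg (by positivity) this.ne)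

/-- Discretization of the equation. -/
lemma exists_discrete_ineq {μ : Measure (ℝ × Ed d)} [IsFiniteMeasureOnCompacts μ] (hp : 1 ≤ p)
    {w f : ℝ × Ed d → ℝ} (hw : IsTest w) {a lam : ℝ} (ha : 0 ≤ a) (hl : 0 ≤ lam)
    (hf : AEStronglyMeasurable f μ)
    (hfe : ∀ᵐ z ∂μ, f z = a * (dd et w z + lam * w z) - lapl w z) :
    ∃ C : ℝ≥0∞, C ≠ ⊤ ∧ ∀ h : ℝ, 0 ≤ h → h ≤ 1 →
      ENNReal.ofReal (a + a * lam * h ^ 2 + 2 * d) * eLpNorm w p μ ≤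
        ENNReal.ofReal (h ^ 2) * eLpNorm f p μ +
        ENNReal.ofReal a * eLpNorm (fun z => w (z + h ^ 2 • -et)) p μ +
        ∑ i, (eLpNorm (fun z => w (z + h • ex (eb i))) p μ +
          eLpNorm (fun z => w (z - h • ex (eb i))) p μ) + ENNReal.ofReal (h ^ 3) * C := by
  obtain ⟨M, ρ, hM, hT⟩ := taylor_one hw (-et)
  choose M' ρ' hM' hT' using fun i : Fin d => taylor_two hw (ex (eb i))
  refine ⟨ENNReal.ofReal a * eLpNorm (ballFun M ρ) p μ +
    ∑ i, eLpNorm (ballFun (M' i) (ρ' i)) p μ, ?_, fun h h0 h1 => ?_⟩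
  · have h1 : eLpNorm (ballFun M ρ) p μ ≠ ⊤ := eLpNorm_ballFun_ne_top _ _
    have h2 : ∑ i, eLpNorm (ballFun (M' i) (ρ' i)) p μ ≠ ⊤ :=
      ENNReal.sum_ne_top.2 fun i _ => eLpNorm_ballFun_ne_top _ _
    finiteness
  have hshift : ∀ v : ℝ × Ed d, AEStronglyMeasurable (fun z => w (z + v)) μ := fun v =>
    (hw.continuous.comp (continuous_id.add continuous_const)).aestronglyMeasurable
  have hshift' : ∀ v : ℝ × Ed d, AEStronglyMeasurable (fun z => w (z - v)) μ := fun v =>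
    (hw.continuous.comp (continuous_id.sub continuous_const)).aestronglyMeasurable
  have hh2 : h ^ 2 ≤ 1 := pow_le_one₀ h0 h1
  have hball : ∀ (M ρ : ℝ) (z : ℝ × Ed d), 0 ≤ M → |ballFun M ρ z| = ballFun M ρ z :=
    fun M ρ z hM => abs_of_nonneg (indicator_nonneg (fun _ _ => hM) z)
  have key := eLpNorm_le_sum_of_abs_le (μ := μ) hp (Finset.univ : Finset (Fin 3 ⊕ (Fin d × Fin 3)))
    (c := Sum.elim ![h ^ 2, a, a * h ^ 3] (fun q => ![1, 1, h ^ 3] q.2))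
    (by rintro (i | ⟨i, j⟩)
        · fin_cases i <;> simp <;> positivity
        · fin_cases j <;> simp; positivity)
    (g := Sum.elim ![f, fun z => w (z + h ^ 2 • -et), ballFun M ρ]
      (fun q => ![fun z => w (z + h • ex (eb q.1)), fun z => w (z - h • ex (eb q.1)),
        ballFun (M' q.1) (ρ' q.1)] q.2))
    (by rintro (i | ⟨i, j⟩)
        · fin_cases i
          · exact hf
          · exact hshift _
          · exact (measurable_ballFun M ρ).aestronglyMeasurable
        · fin_cases j
          · exact hshift _
          · exact hshift' _
          · exact (measurable_ballFun _ _).aestronglyMeasurable)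
    (f := fun z => (a + a * lam * h ^ 2 + 2 * d) * w z) (by
      filter_upwards [hfe] with z hz
      simp only [Fintype.sum_sum_type, Fintype.sum_prod_type, Fin.sum_univ_three, Sum.elim_inl,
        Sum.elim_inr, Matrix.cons_val_zero, Matrix.cons_val_one, Matrix.cons_val, one_mul,
        hball _ _ _ hM, hball _ _ _ (hM' _)]
      have e1 := hT z (h ^ 2) (by positivity) hh2
      rw [dd_neg_left] at e1
      have e2 := Finset.sum_le_sum fun i (_ : i ∈ Finset.univ) => hT' i z h h0 h1
      have e3 := (Finset.abs_sum_le_sum_abs _ Finset.univ).trans e2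
      have e4 : (h ^ 2) ^ 2 * ballFun M ρ z ≤ h ^ 3 * ballFun M ρ z := by
        refine mul_le_mul_of_nonneg_right ?_ (indicator_nonneg (fun _ _ => hM) z)
        calc (h ^ 2) ^ 2 = h ^ 3 * h := by ring
          _ ≤ h ^ 3 * 1 := by gcongr
          _ = h ^ 3 := mul_one _
      have e5 := mul_le_mul_of_nonneg_left (e1.trans e4) ha
      rw [← abs_of_nonneg ha, ← abs_mul, abs_of_nonneg ha] at e5
      set A := a * (w (z + h ^ 2 • -et) - w z - h ^ 2 * -dd et w z) with hA
      set B := ∑ i, (w (z + h • ex (eb i)) + w (z - h • ex (eb i)) - 2 * w z -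
        h ^ 2 * dd (ex (eb i)) (dd (ex (eb i)) w) z) with hB
      have hB' : B = ∑ i, (w (z + h • ex (eb i)) + w (z - h • ex (eb i))) - 2 * d * w z -
          h ^ 2 * lapl w z := by
        rw [hB, Finset.sum_sub_distrib, Finset.sum_sub_distrib, ← Finset.mul_sum]
        simp only [Finset.sum_const, Finset.card_univ, Fintype.card_fin, nsmul_eq_mul, lapl,
          Finset.mul_sum]
        ring
      have e6 : (a + a * lam * h ^ 2 + 2 * d) * w z = h ^ 2 * f z + a * w (z + h ^ 2 • -et) +
          ∑ i, (w (z + h • ex (eb i)) + w (z - h • ex (eb i))) - A - B := by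
        rw [hz, hB', hA]; ring
      have e7 : |∑ i, (w (z + h • ex (eb i)) + w (z - h • ex (eb i)))| ≤
          ∑ i, (|w (z + h • ex (eb i))| + |w (z - h • ex (eb i))|) :=
        (Finset.abs_sum_le_sum_abs _ _).trans (Finset.sum_le_sum fun i _ => abs_add_le _ _)
      have e8 : |(a + a * lam * h ^ 2 + 2 * d) * w z| ≤ |h ^ 2 * f z| + |a * w (z + h ^ 2 • -et)| +
          |∑ i, (w (z + h • ex (eb i)) + w (z - h • ex (eb i)))| + |A| + |B| := by
        rw [e6]
        refine (abs_sub _ _).trans (add_le_add ((abs_sub _ _).trans (add_le_add ?_ le_rfl)) le_rfl)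
        exact (abs_add_le _ _).trans (add_le_add (abs_add_le _ _) le_rfl)
      rw [abs_mul (h ^ 2), abs_mul a, abs_of_nonneg ha, abs_of_nonneg (sq_nonneg h)] at e8
      rw [Finset.sum_add_distrib]
      linarith)
  rw [eLpNorm_const_mul_real, abs_of_nonneg (by positivity)] at key
  refine key.trans_eq ?_
  simp only [Fintype.sum_sum_type, Fintype.sum_prod_type, Fin.sum_univ_three, Sum.elim_inl,
    Sum.elim_inr, Matrix.cons_val_zero, Matrix.cons_val_one, Matrix.cons_val, one_mul,
    ENNReal.ofReal_one, ENNReal.ofReal_mul ha]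
  rw [Finset.sum_add_distrib, ← Finset.mul_sum]
  ring

lemma eLpNorm_comp_add_right {H : Type*} [NormedAddCommGroup H] [MeasurableSpace H] [BorelSpace H]
    [SecondCountableTopology H] {μ : Measure H} {g : H → ℝ} (hg : Measurable g) {v : H}
    (hv : μ.map (fun z => z + v) = μ) : eLpNorm (fun z => g (z + v)) p μ = eLpNorm g p μ :=
  eLpNorm_comp_measurePreserving (g := g) hg.aestronglyMeasurable ⟨by fun_prop, hv⟩

/-- `le_of_forall` for errors linear in a small parameter. -/
lemma le_of_forall_add_mul {a b C : ℝ≥0∞} (hC : C ≠ ⊤)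
    (h : ∀ t : ℝ, 0 < t → t ≤ 1 → a ≤ b + ENNReal.ofReal t * C) : a ≤ b := by
  have h1 : Filter.Tendsto (fun t : ℝ => b + ENNReal.ofReal t * C) (nhdsWithin 0 (Ioi 0))
      (nhds (b + ENNReal.ofReal 0 * C)) := by
    refine Filter.Tendsto.const_add _ (ENNReal.Tendsto.mul_const ?_ (Or.inr hC))
    exact (ENNReal.continuous_ofReal.tendsto 0).mono_left nhdsWithin_le_nhds
  simp only [ENNReal.ofReal_zero, zero_mul, add_zero] at h1
  refine ge_of_tendsto h1 ?_
  filter_upwards [Ioc_mem_nhdsGT (show (0 : ℝ) < 1 by norm_num)] with t ht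
  exact h t ht.1 ht.2

lemma IsTest.eLpNorm_ne_top {H : Type*} [NormedAddCommGroup H] [NormedSpace ℝ H]
    [MeasurableSpace H] [BorelSpace H] {μ : Measure H} [IsFiniteMeasureOnCompacts μ] {w : H → ℝ}
    (hw : IsTest w) : eLpNorm w p μ ≠ ⊤ :=
  (hw.continuous.memLp_of_hasCompactSupport hw.compact).2.ne

/-- Accretivity. -/
lemma eLpNorm_lam_le (hp : 1 ≤ p) {w : ℝ × Ed d → ℝ} (hw : IsTest w) {a lam : ℝ} (ha : 0 ≤ a)
    (hl : 0 ≤ lam) :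
    ENNReal.ofReal (a * lam) * eLpNorm w p volume ≤
      eLpNorm (fun z => a * (dd et w z + lam * w z) - lapl w z) p volume := by
  have hf : IsTest fun z => a * (dd et w z + lam * w z) - lapl w z :=
    (((hw.dd _).add (hw.const_mul _)).const_mul _).sub hw.lapl
  obtain ⟨C, hC, h⟩ := exists_discrete_ineq (μ := volume) hp hw ha hl
    hf.continuous.aestronglyMeasurable (Filter.Eventually.of_forall fun _ => rfl)
  refine le_of_forall_add_mul hC fun t ht ht1 => ?_
  have key := h t ht.le ht1
  have e : ∀ v : ℝ × Ed d, eLpNorm (fun z => w (z + v)) p volume = eLpNorm w p volume := fun v =>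
    eLpNorm_comp_add_right hw.measurable (map_add_right_eq_self _ _)
  have e' : ∀ v : ℝ × Ed d, eLpNorm (fun z => w (z - v)) p volume = eLpNorm w p volume := fun v => by
    simpa only [sub_eq_add_neg] using e (-v)
  simp only [e, e', Finset.sum_const, Finset.card_univ, Fintype.card_fin, nsmul_eq_mul] at key
  set W := eLpNorm w p volume
  have hW : W ≠ ⊤ := hw.eLpNorm_ne_top
  have h1 : ENNReal.ofReal (a + a * lam * t ^ 2 + 2 * d) * W =
      ENNReal.ofReal (t ^ 2) * (ENNReal.ofReal (a * lam) * W) +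
        (ENNReal.ofReal a * W + d * (W + W)) := by
    rw [add_right_comm, ENNReal.ofReal_add (by positivity) (by positivity),
      ENNReal.ofReal_add (by positivity) (by positivity), ENNReal.ofReal_mul (by positivity),
      ENNReal.ofReal_mul (by positivity), ENNReal.ofReal_natCast, ENNReal.ofReal_ofNat]
    ring
  rw [h1] at key
  have h2 : ENNReal.ofReal (t ^ 2) * (ENNReal.ofReal (a * lam) * W) ≤ ENNReal.ofReal (t ^ 2) *
      (eLpNorm (fun z => a * (dd et w z + lam * w z) - lapl w z) p volume +
        ENNReal.ofReal t * C) := by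
    have hfin : ENNReal.ofReal a * W + d * (W + W) ≠ ⊤ := by finiteness
    refine ENNReal.le_of_add_le_add_right hfin (key.trans_eq ?_)
    rw [pow_succ t 2, ENNReal.ofReal_mul (by positivity)]
    ring
  exact (ENNReal.mul_le_mul_iff_right (by simpa using ht.ne') (by simp)).1 h2

end Accretive

section Rescale

variable {d : ℕ}

lemma dd_comp_clm {H H' : Type*} [NormedAddCommGroup H] [NormedSpace ℝ H] [NormedAddCommGroup H']
    [NormedSpace ℝ H'] (L : H →L[ℝ] H') {w : H' → ℝ} (hw : IsTest w) (v z : H) :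
    dd v (fun z => w (L z)) z = dd (L v) w (L z) := by
  have := ((hw.differentiable (L z)).hasFDerivAt.comp z L.hasFDerivAt).fderiv
  simp only [dd]
  change fderiv ℝ (w ∘ L) z v = _
  rw [this]
  rfl

/-- Dilation in time. -/
def tdil (a : ℝ) : (ℝ × Ed d) →L[ℝ] (ℝ × Ed d) :=
  (a • ContinuousLinearMap.id ℝ ℝ).prodMap (ContinuousLinearMap.id ℝ (Ed d))

lemma tdil_apply (a : ℝ) (z : ℝ × Ed d) : tdil a z = (a * z.1, z.2) := by
  rfl

lemma tdil_ex (a : ℝ) (v : Ed d) : tdil a (ex v) = ex v := by simp [tdil_apply, ex]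

lemma tdil_et (a : ℝ) : tdil a (et : ℝ × Ed d) = a • et := by simp [tdil_apply, et]

lemma IsTest.tdil {a : ℝ} (ha : 0 < a) {w : ℝ × Ed d → ℝ} (hw : IsTest w) :
    IsTest fun z => w (tdil a z) where
  contDiff := hw.contDiff.comp (_root_.tdil a).contDiff
  compact := by
    let e : ℝ × Ed d ≃ₜ ℝ × Ed d := (Homeomorph.mulLeft₀ a ha.ne').prodCongr (Homeomorph.refl (Ed d))
    have h := hw.compact.comp_isClosedEmbedding e.isClosedEmbedding
    exact h

lemma lintegral_tdil {a : ℝ} (ha : 0 < a) {F : ℝ × Ed d → ℝ≥0∞} (hF : Measurable F) :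
    ∫⁻ z, F (tdil a z) = ENNReal.ofReal a⁻¹ * ∫⁻ z, F z := by
  have h1 : (volume : Measure (ℝ × Ed d)).map (fun z => tdil a z) =
      ENNReal.ofReal a⁻¹ • volume := by
    have h2 := Measure.map_prod_map (volume : Measure ℝ) (volume : Measure (Ed d))
      (f := fun x => a * x) (g := id) (by fun_prop) measurable_id
    rw [Real.map_volume_mul_left ha.ne', Measure.map_id, Measure.prod_smul_left,
      abs_of_pos (inv_pos.2 ha)] at h2
    have h3 : (fun z : ℝ × Ed d => tdil a z) = Prod.map (fun x => a * x) id := by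
      funext z; rw [tdil_apply]; rfl
    rw [h3]
    exact h2.symm
  rw [← lintegral_map hF (tdil a).continuous.measurable, h1, lintegral_smul_measure, smul_eq_mul]

/-- The `L_p` estimate for `a (∂_t + λ) - Δ`, uniformly in `a` and `λ`. -/
theorem exists_heat_estimate_lam (d : ℕ) {p : ℝ} (hp : 1 < p) :
    ∃ C : ℝ, 0 < C ∧ ∀ w : ℝ × Ed d → ℝ, IsTest w → ∀ a lam : ℝ, 0 < a → 0 ≤ lam →
      ∀ i j : Fin d,
      eLpNorm (dd (ex (eb i)) (dd (ex (eb j)) w)) (ENNReal.ofReal p) volume ≤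
        ENNReal.ofReal C * eLpNorm (fun z => a * (dd et w z + lam * w z) - lapl w z)
          (ENNReal.ofReal p) volume := by
  obtain ⟨C, hC, h⟩ := exists_heat_estimate d hp
  have hp0 : 0 < p := by linarith
  have hp1 : 1 ≤ ENNReal.ofReal p := by simpa using hp.le
  set C' := C ^ (1 / p) with hC'
  have hCt : C' ≠ ⊤ := ENNReal.rpow_ne_top_of_nonneg (by positivity) hC
  refine ⟨2 * (C'.toReal + 1), by positivity, fun w hw a lam ha hl i j => ?_⟩
  have h1 : eLpNorm (dd (ex (eb i)) (dd (ex (eb j)) w)) (ENNReal.ofReal p) volume ≤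
      C' * eLpNorm (fun z => a * dd et w z - lapl w z) (ENNReal.ofReal p) volume := by
    refine eLpNorm_le_of_lintegral hp0 ?_
    have h2 := h _ (hw.tdil ha) i j
    have e1 : ∀ (v : Ed d) {w : ℝ × Ed d → ℝ}, IsTest w →
        dd (ex v) (fun z => w (tdil a z)) = fun z => dd (ex v) w (tdil a z) := fun v w hw => by
      funext z; rw [dd_comp_clm _ hw, tdil_ex]
    have e2 : ∀ z, dd et (fun z => w (tdil a z)) z = a * dd et w (tdil a z) := fun z => by
      rw [dd_comp_clm _ hw, tdil_et]; simp [dd]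
    have e3 : ∀ z, lapl (fun z => w (tdil a z)) z = lapl w (tdil a z) := fun z => by
      simp only [lapl]
      exact Finset.sum_congr rfl fun i _ => by rw [e1 _ hw, e1 _ (hw.dd _)]
    rw [e1 _ hw, e1 _ (hw.dd _)] at h2
    simp only [e2, e3] at h2
    have hm1 : Measurable fun z => ‖dd (ex (eb i)) (dd (ex (eb j)) w) z‖ₑ ^ p :=
      ((hw.dd _).dd _).measurable.enorm.pow_const p
    have hm2 : Measurable fun z => ‖a * dd et w z - lapl w z‖ₑ ^ p :=
      (((hw.dd _).const_mul a).sub hw.lapl).measurable.enorm.pow_const p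
    rw [lintegral_tdil ha hm1, lintegral_tdil ha hm2] at h2
    have e4 : C' ^ p = C := by
      rw [hC', ← ENNReal.rpow_mul, one_div, inv_mul_cancel₀ hp0.ne', ENNReal.rpow_one]
    rw [e4]
    rw [mul_left_comm] at h2
    exact (ENNReal.mul_le_mul_iff_right (by simpa using ha) (by simp)).1 h2
  have h2 := eLpNorm_lam_le hp1 hw ha.le hl
  set F := eLpNorm (fun z => a * (dd et w z + lam * w z) - lapl w z) (ENNReal.ofReal p) volume
  have hF : IsTest fun z => a * (dd et w z + lam * w z) - lapl w z :=
    (((hw.dd _).add (hw.const_mul _)).const_mul _).sub hw.lapl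
  have h3 : eLpNorm (fun z => a * dd et w z - lapl w z) (ENNReal.ofReal p) volume ≤
      ENNReal.ofReal 1 * F + ENNReal.ofReal (a * lam) * eLpNorm w (ENNReal.ofReal p) volume := by
    refine eLpNorm_le_two_of_abs_le hp1 (by norm_num) (by positivity)
      hF.continuous.aestronglyMeasurable hw.continuous.aestronglyMeasurable
      (Filter.Eventually.of_forall fun z => ?_)
    have e : a * lam * |w z| = |a * lam * w z| := by
      rw [abs_mul (a * lam), abs_of_nonneg (show 0 ≤ a * lam by positivity)]
    rw [one_mul, e]
    refine le_trans (le_of_eq ?_) (abs_sub _ _)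
    congr 1
    ring
  calc _ ≤ C' * (2 * F) := by
        refine h1.trans (mul_le_mul_right (h3.trans ?_) _)
        rw [ENNReal.ofReal_one, one_mul, two_mul]
        gcongr
    _ = (2 * C') * F := by ring
    _ ≤ ENNReal.ofReal (2 * (C'.toReal + 1)) * F := by
        gcongr
        rw [ENNReal.ofReal_mul (by norm_num), ENNReal.ofReal_add (by positivity) (by norm_num),
          ENNReal.ofReal_toReal hCt, ENNReal.ofReal_ofNat]
        gcongr
        exact le_self_add

end Rescale

section IntegralRemainder

/-- Minkowski's inequality for the remainder of a first order expansion. -/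
lemma eLpNorm_remainder_le {X : Type*} [MeasurableSpace X] {μ : Measure X} [SFinite μ] {p : ℝ}
    (hp : 1 < p) {ψ ψ' : X → ℝ → ℝ} {c : X → ℝ} {h : ℝ} {W : ℝ≥0∞} (hh : 0 ≤ h)
    (hψ : ∀ z s, HasDerivAt (ψ z) (ψ' z s) s) (hc' : ∀ z, Continuous (ψ' z))
    (hm : Measurable (Function.uncurry ψ')) (hc : Measurable c)
    (hW : ∀ s ∈ Ioc 0 h, eLpNorm (fun z => ψ' z s - c z) (ENNReal.ofReal p) μ ≤ W) :
    eLpNorm (fun z => ψ z h - ψ z 0 - h * c z) (ENNReal.ofReal p) μ ≤ ENNReal.ofReal h * W := by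
  have hp0 : 0 < p := by linarith
  rw [← ENNReal.rpow_le_rpow_iff hp0, eLpNorm_rpow_eq _ hp0]
  set F : X → ℝ → ℝ≥0∞ := fun z s => (Ioc 0 h).indicator (fun s => ‖ψ' z s - c z‖ₑ) s with hF
  have hm1 : Measurable fun q : X × ℝ => ‖ψ' q.1 q.2 - c q.1‖ₑ :=
    (hm.sub (hc.comp measurable_fst)).enorm
  have hFm : Measurable (Function.uncurry F) := by
    have := hm1.indicator (measurableSet_Ioc.preimage (measurable_snd : Measurable (Prod.snd : X × ℝ → ℝ))) (s := Prod.snd ⁻¹' Ioc 0 h)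
    convert this using 1
    funext q
    by_cases hq : q.2 ∈ Ioc 0 h
    · rw [indicator_of_mem (show q ∈ Prod.snd ⁻¹' Ioc 0 h from hq)]
      simp only [Function.uncurry, hF]
      rw [indicator_of_mem hq]
    · rw [indicator_of_notMem (show q ∉ Prod.snd ⁻¹' Ioc 0 h from hq)]
      simp only [Function.uncurry, hF]
      rw [indicator_of_notMem hq]
  have key := lintegral_lintegral_rpow_le (μ := μ) (ν := volume) hp hFm
    (w := (Ioc 0 h).indicator fun _ => W) (measurable_const.indicator measurableSet_Ioc)
    (fun s => by
      by_cases hs : s ∈ Ioc 0 h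
      · simp only [hF, indicator_of_mem hs]
        rw [← eLpNorm_rpow_eq _ hp0]
        exact ENNReal.rpow_le_rpow (hW s hs) hp0.le
      · simp [hF, indicator_of_notMem hs, hp0])
  rw [lintegral_indicator_const measurableSet_Ioc, Real.volume_Ioc, sub_zero, mul_comm] at key
  refine le_trans (lintegral_mono fun z => ?_) key
  gcongr
  rw [lintegral_indicator measurableSet_Ioc]
  have hi : IntervalIntegrable (ψ' z) volume 0 h := (hc' z).intervalIntegrable _ _
  have e : ψ z h - ψ z 0 - h * c z = ∫ s in Ioc 0 h, (ψ' z s - c z) := by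
    rw [← intervalIntegral.integral_of_le hh, intervalIntegral.integral_sub hi (by simp),
      intervalIntegral.integral_eq_sub_of_hasDerivAt (fun s _ => hψ z s) hi]
    simp
  rw [e]
  exact enorm_integral_le_lintegral_enorm _

end IntegralRemainder

section Layers

variable {n : ℕ}

/-- The normal coordinate. -/
def xl : (ℝ × Ed (n + 1)) →L[ℝ] ℝ :=
  (EuclideanSpace.proj (Fin.last n)).comp (ContinuousLinearMap.snd ℝ ℝ (Ed (n + 1)))

lemma xl_apply (z : ℝ × Ed (n + 1)) : xl z = z.2 (Fin.last n) := rfl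

lemma xl_et : xl (et : ℝ × Ed (n + 1)) = 0 := by simp [xl_apply, et]

lemma xl_eb (i : Fin (n + 1)) : xl (ex (eb i)) = if i = Fin.last n then 1 else 0 := by
  simp only [xl_apply, ex, eb, PiLp.single_apply, eq_comm]

lemma abs_xl_eb_le (i : Fin (n + 1)) : |xl (ex (eb i))| ≤ 1 := by
  rw [xl_eb]; split <;> simp

/-- The layer of half-width `ρ` around `{x_d = c}`. -/
def lset (n : ℕ) (c ρ : ℝ) : Set (ℝ × Ed (n + 1)) := {z | |xl z - c| < ρ}

lemma isOpen_lset (c ρ : ℝ) : IsOpen (lset n c ρ) :=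
  isOpen_lt ((xl.continuous.sub continuous_const).abs) continuous_const

lemma measurableSet_lset (c ρ : ℝ) : MeasurableSet (lset n c ρ) := (isOpen_lset c ρ).measurableSet

/-- Lebesgue measure on a layer. -/
def lay (n : ℕ) (c ρ : ℝ) : Measure (ℝ × Ed (n + 1)) := volume.restrict (lset n c ρ)

instance (c ρ : ℝ) : SFinite (lay n c ρ) := by unfold lay; infer_instance

instance (c ρ : ℝ) : IsFiniteMeasureOnCompacts (lay n c ρ) := by unfold lay; infer_instance

lemma lay_mono {c ρ ρ' : ℝ} (h : ρ ≤ ρ') : lay n c ρ ≤ lay n c ρ' :=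
  Measure.restrict_mono (fun _ hz => lt_of_lt_of_le hz h) le_rfl

lemma eLpNorm_lay_shift_le {p : ℝ≥0∞} {c ρ s : ℝ} (hs : 0 ≤ s) {e : ℝ × Ed (n + 1)}
    (he : |xl e| ≤ 1) {g : ℝ × Ed (n + 1) → ℝ} (hg : Measurable g) :
    eLpNorm (fun z => g (z + s • e)) p (lay n c ρ) ≤ eLpNorm g p (lay n c (ρ + s)) := by
  have h1 : MeasurePreserving (fun z : ℝ × Ed (n + 1) => z + s • e) volume volume :=
    ⟨by fun_prop, map_add_right_eq_self _ _⟩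
  have h2 := h1.restrict_preimage (measurableSet_lset (n := n) c (ρ + s))
  refine (eLpNorm_mono_measure _ (ν := lay n c ρ)
    (μ := volume.restrict ((fun z => z + s • e) ⁻¹' lset n c (ρ + s))) ?_).trans
    (eLpNorm_comp_measurePreserving (g := g) hg.aestronglyMeasurable h2).le
  refine Measure.restrict_mono (fun z hz => ?_) le_rfl
  change |xl (z + s • e) - c| < ρ + s
  have hz' : |xl z - c| < ρ := hz
  have h3 : |s * xl e| ≤ s := by
    rw [abs_mul, abs_of_nonneg hs]; exact mul_le_of_le_one_right hs he
  rw [map_add, map_smul, smul_eq_mul, add_sub_right_comm]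
  exact (abs_add_le _ _).trans_lt (by linarith)

lemma eLpNorm_lay_diff_le {p : ℝ} (hp : 1 < p) {c ρ s : ℝ} (hs : 0 ≤ s) {e : ℝ × Ed (n + 1)}
    (he : |xl e| ≤ 1) {g : ℝ × Ed (n + 1) → ℝ} (hg : IsTest g) :
    eLpNorm (fun z => g (z + s • e) - g z) (ENNReal.ofReal p) (lay n c ρ) ≤
      ENNReal.ofReal s * eLpNorm (dd e g) (ENNReal.ofReal p) (lay n c (ρ + s)) := by
  have := eLpNorm_remainder_le (μ := lay n c ρ) hp (ψ := fun z s => g (z + s • e))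
    (ψ' := fun z s => dd e g (z + s • e)) (c := fun _ => 0) (h := s)
    (W := eLpNorm (dd e g) (ENNReal.ofReal p) (lay n c (ρ + s))) hs
    (fun z s => hasDerivAt_line hg z e s)
    (fun z => (hg.dd e).continuous.comp (by fun_prop))
    ((hg.dd e).continuous.comp (by fun_prop : Continuous fun q : (ℝ × Ed (n + 1)) × ℝ =>
      q.1 + q.2 • e)).measurable measurable_const (fun t ht => by
        simp only [sub_zero]
        refine (eLpNorm_lay_shift_le ht.1.le he (hg.dd e).measurable).trans ?_
        exact eLpNorm_mono_measure _ (lay_mono (by linarith [ht.2])))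
  simpa using this

/-- Interpolation on layers. -/
lemma eLpNorm_lay_interpolation {p : ℝ} (hp : 1 < p) {c ρ h : ℝ} (hh : 0 < h)
    {e : ℝ × Ed (n + 1)} (he : |xl e| ≤ 1) {g : ℝ × Ed (n + 1) → ℝ} (hg : IsTest g) :
    eLpNorm (dd e g) (ENNReal.ofReal p) (lay n c ρ) ≤
      ENNReal.ofReal (2 / h) * eLpNorm g (ENNReal.ofReal p) (lay n c (ρ + h)) +
      ENNReal.ofReal h * eLpNorm (dd e (dd e g)) (ENNReal.ofReal p) (lay n c (ρ + h)) := by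
  have hp1 : 1 ≤ ENNReal.ofReal p := by simpa using hp.le
  set V := eLpNorm g (ENNReal.ofReal p) (lay n c (ρ + h)) with hV
  set Y := eLpNorm (dd e (dd e g)) (ENNReal.ofReal p) (lay n c (ρ + h)) with hY
  have h1 := eLpNorm_remainder_le (μ := lay n c ρ) hp (ψ := fun z s => g (z + s • e))
    (ψ' := fun z s => dd e g (z + s • e)) (c := dd e g) (h := h)
    (W := ENNReal.ofReal h * Y) hh.le
    (fun z s => hasDerivAt_line hg z e s)
    (fun z => (hg.dd e).continuous.comp (by fun_prop))
    ((hg.dd e).continuous.comp (by fun_prop : Continuous fun q : (ℝ × Ed (n + 1)) × ℝ =>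
      q.1 + q.2 • e)).measurable (hg.dd e).measurable (fun t ht => by
        refine (eLpNorm_lay_diff_le hp ht.1.le he (hg.dd e)).trans ?_
        gcongr
        · exact ht.2
        · exact eLpNorm_mono_measure _ (lay_mono (by linarith [ht.2])))
  have hcont : Continuous fun z => g (z + h • e) := hg.continuous.comp (by fun_prop)
  have h2 := eLpNorm_le_three_of_abs_le (μ := lay n c ρ) hp1 (f := dd e g)
    (a := h⁻¹) (b := h⁻¹) (c := h⁻¹) (by positivity) (by positivity) (by positivity)
    (g := fun z => g (z + h • e)) (g' := g)
    (g'' := fun z => g (z + h • e) - g (z + (0 : ℝ) • e) - h * dd e g z)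
    hcont.aestronglyMeasurable hg.continuous.aestronglyMeasurable
    (by simp only [zero_smul, add_zero]
        exact ((hcont.sub hg.continuous).sub
          (continuous_const.mul (hg.dd e).continuous)).aestronglyMeasurable)
    (Filter.Eventually.of_forall fun z => by
      simp only [zero_smul, add_zero]
      rw [← mul_add, ← mul_add, inv_mul_eq_div, le_div_iff₀ hh, mul_comm, ← abs_of_pos hh, ← abs_mul,
        abs_of_pos hh]
      have e1 : h * dd e g z = g (z + h • e) - g z - (g (z + h • e) - g z - h * dd e g z) := by ring
      calc |h * dd e g z| = |g (z + h • e) - g z - (g (z + h • e) - g z - h * dd e g z)| := by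
            rw [← e1]
        _ ≤ |g (z + h • e)| + |g z| + |g (z + h • e) - g z - h * dd e g z| :=
            (abs_sub _ _).trans (add_le_add (abs_sub _ _) le_rfl))
  refine h2.trans ?_
  have h3 : eLpNorm (fun z => g (z + h • e)) (ENNReal.ofReal p) (lay n c ρ) ≤ V :=
    eLpNorm_lay_shift_le hh.le he hg.measurable
  have h4 : eLpNorm g (ENNReal.ofReal p) (lay n c ρ) ≤ V :=
    eLpNorm_mono_measure _ (lay_mono (by linarith))
  have e2 : ENNReal.ofReal (2 / h) = ENNReal.ofReal h⁻¹ + ENNReal.ofReal h⁻¹ := by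
    rw [← ENNReal.ofReal_add (by positivity) (by positivity)]; congr 1; ring
  have e3 : ENNReal.ofReal h⁻¹ * (ENNReal.ofReal h * (ENNReal.ofReal h * Y)) =
      ENNReal.ofReal h * Y := by
    rw [← mul_assoc, ← ENNReal.ofReal_mul (by positivity), inv_mul_cancel₀ hh.ne',
      ENNReal.ofReal_one, one_mul]
  rw [e2, add_mul, ← e3]
  gcongr

end Layers

section Cutoff

lemma exists_bound_deriv_of_const {g : ℝ → ℝ} (hg : Continuous g) (h0 : ∀ x, x < 0 → g x = 0)
    (h1 : ∀ x, 1 < x → g x = 0) : ∃ c, 0 < c ∧ ∀ x, |g x| ≤ c := by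
  have hc : HasCompactSupport g := HasCompactSupport.intro isCompact_Icc (K := Icc 0 1) fun x hx => by
    rw [mem_Icc, not_and_or, not_le, not_le] at hx
    exact hx.elim (h0 x) (h1 x)
  obtain ⟨c, hc⟩ := hg.bounded_above_of_compact_support hc
  exact ⟨|c| + 1, by positivity, fun x => (hc x).trans ((le_abs_self c).trans (by linarith))⟩

lemma deriv_eq_zero_of_eqOn {g : ℝ → ℝ} {s : Set ℝ} (hs : IsOpen s) {k : ℝ} (h : ∀ x ∈ s, g x = k) {x : ℝ}
    (hx : x ∈ s) : deriv g x = 0 := by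
  have : g =ᶠ[nhds x] fun _ => k := Filter.eventuallyEq_of_mem (hs.mem_nhds hx) h
  rw [this.deriv_eq]; simp

/-- Cutoff functions with quantitative bounds. -/
lemma exists_cutoff : ∃ c : ℝ, 0 < c ∧ ∀ x₀ s δ : ℝ, 0 < δ → ∃ ζ ζ₁ ζ₂ : ℝ → ℝ,
    ContDiff ℝ (⊤ : ℕ∞) ζ ∧ ContDiff ℝ (⊤ : ℕ∞) ζ₁ ∧ (∀ x, HasDerivAt ζ (ζ₁ x) x) ∧
    (∀ x, HasDerivAt ζ₁ (ζ₂ x) x) ∧ (∀ x, 0 ≤ ζ x) ∧ (∀ x, ζ x ≤ 1) ∧ (∀ x, |ζ₁ x| ≤ c / δ) ∧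
    (∀ x, |ζ₂ x| ≤ c / δ ^ 2) ∧ (∀ x, |x - x₀| ≤ s → ζ x = 1) ∧
    (∀ x, s + 3 / 4 * δ ≤ |x - x₀| → ζ x = 0) := by
  set S := Real.smoothTransition with hS
  have hSs : ContDiff ℝ (⊤ : ℕ∞) S := Real.smoothTransition.contDiff
  have hS1 : ContDiff ℝ (⊤ : ℕ∞) (deriv S) := by
    have := (contDiff_infty_iff_deriv (f := S) (𝕜 := ℝ)).1 hSs
    exact this.2
  have hS2 : ContDiff ℝ (⊤ : ℕ∞) (deriv (deriv S)) :=
    ((contDiff_infty_iff_deriv (f := deriv S) (𝕜 := ℝ)).1 hS1).2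
  have z0 : ∀ x, x < 0 → deriv S x = 0 := fun x hx =>
    deriv_eq_zero_of_eqOn isOpen_Iio (k := 0) (fun y hy => Real.smoothTransition.zero_of_nonpos (le_of_lt hy)) hx
  have z1 : ∀ x, 1 < x → deriv S x = 0 := fun x hx =>
    deriv_eq_zero_of_eqOn isOpen_Ioi (k := 1) (fun y hy => Real.smoothTransition.one_of_one_le (le_of_lt hy)) hx
  obtain ⟨c₁, hc₁, hb₁⟩ := exists_bound_deriv_of_const hS1.continuous z0 z1
  obtain ⟨c₂, hc₂, hb₂⟩ := exists_bound_deriv_of_const hS2.continuous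
    (fun x hx => deriv_eq_zero_of_eqOn isOpen_Iio z0 hx)
    (fun x hx => deriv_eq_zero_of_eqOn isOpen_Ioi z1 hx)
  have hd1 : ∀ x, HasDerivAt S (deriv S x) x := fun x => (hSs.differentiable (by simp) x).hasDerivAt
  have hd2 : ∀ x, HasDerivAt (deriv S) (deriv (deriv S) x) x := fun x =>
    (hS1.differentiable (by simp) x).hasDerivAt
  have n0 : ∀ x, 0 ≤ S x := Real.smoothTransition.nonneg
  have n1 : ∀ x, S x ≤ 1 := Real.smoothTransition.le_one
  refine ⟨4 * c₁ + 8 * c₂ + 8 * c₁ ^ 2, by positivity, fun x₀ s δ hδ => ?_⟩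
  set a : ℝ → ℝ := fun x => 3 / 2 + 2 / δ * (s + (x - x₀)) with ha
  set b : ℝ → ℝ := fun x => 3 / 2 + 2 / δ * (s - (x - x₀)) with hb
  have hac : ContDiff ℝ (⊤ : ℕ∞) a := by fun_prop
  have hbc : ContDiff ℝ (⊤ : ℕ∞) b := by fun_prop
  have hda : ∀ x, HasDerivAt a (2 / δ) x := fun x => by
    have h := (((hasDerivAt_id x).sub_const x₀).const_add s).const_mul (2 / δ)
    rw [mul_one] at h
    exact h.const_add (3 / 2)
  have hdb : ∀ x, HasDerivAt b (-(2 / δ)) x := fun x => by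
    have h := (((hasDerivAt_id x).sub_const x₀).const_sub s).const_mul (2 / δ)
    rw [mul_neg_one] at h
    exact h.const_add (3 / 2)
  refine ⟨fun x => S (a x) * S (b x),
    fun x => deriv S (a x) * (2 / δ) * S (b x) + S (a x) * (deriv S (b x) * (-(2 / δ))),
    fun x => (deriv (deriv S) (a x) * (2 / δ) * (2 / δ) * S (b x) +
      deriv S (a x) * (2 / δ) * (deriv S (b x) * (-(2 / δ)))) +
      (deriv S (a x) * (2 / δ) * (deriv S (b x) * (-(2 / δ))) +
      S (a x) * (deriv (deriv S) (b x) * (-(2 / δ)) * (-(2 / δ)))), ?_, ?_, ?_, ?_, ?_, ?_, ?_, ?_, ?_, ?_⟩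
  · exact (hSs.comp hac).mul (hSs.comp hbc)
  · exact (((hS1.comp hac).mul contDiff_const).mul (hSs.comp hbc)).add
      ((hSs.comp hac).mul ((hS1.comp hbc).mul contDiff_const))
  · intro x
    exact ((hd1 (a x)).comp x (hda x)).fun_mul ((hd1 (b x)).comp x (hdb x))
  · intro x
    exact ((((hd2 (a x)).comp x (hda x)).mul_const _).fun_mul ((hd1 (b x)).comp x (hdb x))).fun_add
      (((hd1 (a x)).comp x (hda x)).fun_mul (((hd2 (b x)).comp x (hdb x)).mul_const _))
  · exact fun x => mul_nonneg (n0 _) (n0 _)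
  · exact fun x => mul_le_one₀ (n1 _) (n0 _) (n1 _)
  · intro x
    have e : ∀ A A' B B' : ℝ, 0 ≤ A → A ≤ 1 → 0 ≤ B → B ≤ 1 → |A'| ≤ c₁ → |B'| ≤ c₁ →
        |A' * (2 / δ) * B + A * (B' * (-(2 / δ)))| ≤ 4 * c₁ / δ := by
      intro A A' B B' h1 h2 h3 h4 h5 h6
      have e1 : A' * (2 / δ) * B + A * (B' * (-(2 / δ))) = 2 / δ * (A' * B - A * B') := by ring
      have e2 : |A' * B| ≤ c₁ * 1 := by
        rw [abs_mul A', abs_of_nonneg h3]; exact mul_le_mul h5 h4 h3 hc₁.le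
      have e3 : |A * B'| ≤ 1 * c₁ := by
        rw [abs_mul A, abs_of_nonneg h1]; exact mul_le_mul h2 h6 (abs_nonneg _) zero_le_one
      rw [e1, abs_mul, abs_of_pos (by positivity : 0 < 2 / δ)]
      calc 2 / δ * |A' * B - A * B'| ≤ 2 / δ * (2 * c₁) := by
            gcongr; exact (abs_sub _ _).trans (by linarith)
        _ = 4 * c₁ / δ := by ring
    refine (e _ _ _ _ (n0 _) (n1 _) (n0 _) (n1 _) (hb₁ _) (hb₁ _)).trans ?_
    gcongr
    nlinarith
  · intro x
    have e : ∀ A A' A'' B B' B'' : ℝ, 0 ≤ A → A ≤ 1 → 0 ≤ B → B ≤ 1 → |A'| ≤ c₁ → |B'| ≤ c₁ →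
        |A''| ≤ c₂ → |B''| ≤ c₂ →
        |(A'' * (2 / δ) * (2 / δ) * B + A' * (2 / δ) * (B' * (-(2 / δ)))) +
          (A' * (2 / δ) * (B' * (-(2 / δ))) + A * (B'' * (-(2 / δ)) * (-(2 / δ))))| ≤
          (8 * c₂ + 8 * c₁ ^ 2) / δ ^ 2 := by
      intro A A' A'' B B' B'' h1 h2 h3 h4 h5 h6 h7 h8
      have e1 : (A'' * (2 / δ) * (2 / δ) * B + A' * (2 / δ) * (B' * (-(2 / δ)))) +
          (A' * (2 / δ) * (B' * (-(2 / δ))) + A * (B'' * (-(2 / δ)) * (-(2 / δ)))) =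
          (2 / δ) ^ 2 * (A'' * B - 2 * (A' * B') + A * B'') := by ring
      have e2 : |A'' * B| ≤ c₂ * 1 := by
        rw [abs_mul A'', abs_of_nonneg h3]; exact mul_le_mul h7 h4 h3 hc₂.le
      have e3 : |A * B''| ≤ 1 * c₂ := by
        rw [abs_mul A, abs_of_nonneg h1]; exact mul_le_mul h2 h8 (abs_nonneg _) zero_le_one
      have e4 : |A' * B'| ≤ c₁ * c₁ := by
        rw [abs_mul A' B']; exact mul_le_mul h5 h6 (abs_nonneg _) hc₁.le
      rw [e1, abs_mul, abs_of_pos (by positivity : 0 < (2 / δ) ^ 2)]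
      calc (2 / δ) ^ 2 * |A'' * B - 2 * (A' * B') + A * B''|
          ≤ (2 / δ) ^ 2 * (2 * c₂ + 2 * c₁ ^ 2) := by
            gcongr
            refine (abs_add_le _ _).trans ((add_le_add (abs_sub _ _) le_rfl).trans ?_)
            rw [abs_mul 2, abs_two]; linarith [sq c₁]
        _ = _ := by ring
    refine (e _ _ _ _ _ _ (n0 _) (n1 _) (n0 _) (n1 _) (hb₁ _) (hb₁ _) (hb₂ _) (hb₂ _)).trans ?_
    gcongr
    nlinarith
  · intro x hx
    have h1 := abs_le.1 hx
    have e1 : S (a x) = 1 := Real.smoothTransition.one_of_one_le (by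
      have : 0 ≤ 2 / δ * (s + (x - x₀)) := mul_nonneg (by positivity) (by linarith)
      simp only [ha]; linarith)
    have e2 : S (b x) = 1 := Real.smoothTransition.one_of_one_le (by
      have : 0 ≤ 2 / δ * (s - (x - x₀)) := mul_nonneg (by positivity) (by linarith)
      simp only [hb]; linarith)
    simp only [e1, e2, mul_one]
  · intro x hx
    have k : ∀ y, y ≤ -(3 / 4 * δ) → S (3 / 2 + 2 / δ * y) = 0 := fun y hy =>
      Real.smoothTransition.zero_of_nonpos (by
        have : 2 / δ * y ≤ 2 / δ * -(3 / 4 * δ) := by gcongr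
        have e : 2 / δ * -(3 / 4 * δ) = -(3 / 2) := by field_simp; norm_num
        linarith)
    rcases le_abs.1 hx with h | h
    · simp only [hb, k (s - (x - x₀)) (by linarith), mul_zero]
    · simp only [ha, k (s + (x - x₀)) (by linarith), zero_mul]

end Cutoff

section CutoffCalculus

variable {n : ℕ}

lemma dd_cutoff_mul {ζ ζ₁ : ℝ → ℝ} (hζ : ∀ x, HasDerivAt ζ (ζ₁ x) x) {w : ℝ × Ed (n + 1) → ℝ}
    (hw : IsTest w) (v z : ℝ × Ed (n + 1)) :
    dd v (fun z => ζ (xl z) * w z) z = ζ (xl z) * dd v w z + ζ₁ (xl z) * xl v * w z := by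
  have h1 : HasFDerivAt (fun z : ℝ × Ed (n + 1) => ζ (xl z)) (ζ₁ (xl z) • (xl : _ →L[ℝ] ℝ)) z :=
    (hζ (xl z)).comp_hasFDerivAt z xl.hasFDerivAt
  have h2 := (h1.fun_mul (hw.differentiable z).hasFDerivAt).fderiv
  simp only [dd]
  rw [h2]
  simp only [add_apply, smul_apply, smul_eq_mul]
  ring

lemma contDiff_cutoff {ζ : ℝ → ℝ} (hζ : ContDiff ℝ (⊤ : ℕ∞) ζ) :
    ContDiff ℝ (⊤ : ℕ∞) fun z : ℝ × Ed (n + 1) => ζ (xl z) := hζ.comp xl.contDiff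

lemma dd_dd_cutoff_mul {ζ ζ₁ ζ₂ : ℝ → ℝ} (hs : ContDiff ℝ (⊤ : ℕ∞) ζ) (hs₁ : ContDiff ℝ (⊤ : ℕ∞) ζ₁)
    (hζ : ∀ x, HasDerivAt ζ (ζ₁ x) x) (hζ₁ : ∀ x, HasDerivAt ζ₁ (ζ₂ x) x)
    {w : ℝ × Ed (n + 1) → ℝ} (hw : IsTest w) (v z : ℝ × Ed (n + 1)) :
    dd v (dd v (fun z => ζ (xl z) * w z)) z = ζ (xl z) * dd v (dd v w) z +
      2 * (ζ₁ (xl z) * xl v * dd v w z) + ζ₂ (xl z) * xl v ^ 2 * w z := by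
  have e : dd v (fun z => ζ (xl z) * w z) =
      fun z => ζ (xl z) * dd v w z + xl v * (ζ₁ (xl z) * w z) := by
    funext z; rw [dd_cutoff_mul hζ hw]; ring
  have t1 := (hw.dd v).mul_left (contDiff_cutoff (n := n) hs)
  have t2 := hw.mul_left (contDiff_cutoff (n := n) hs₁)
  rw [e, dd_add t1 (t2.const_mul _), dd_const_mul t2, dd_cutoff_mul hζ (hw.dd v),
    dd_cutoff_mul hζ₁ hw]
  ring

lemma lapl_cutoff_mul {ζ ζ₁ ζ₂ : ℝ → ℝ} (hs : ContDiff ℝ (⊤ : ℕ∞) ζ) (hs₁ : ContDiff ℝ (⊤ : ℕ∞) ζ₁)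
    (hζ : ∀ x, HasDerivAt ζ (ζ₁ x) x) (hζ₁ : ∀ x, HasDerivAt ζ₁ (ζ₂ x) x)
    {w : ℝ × Ed (n + 1) → ℝ} (hw : IsTest w) (z : ℝ × Ed (n + 1)) :
    lapl (fun z => ζ (xl z) * w z) z = ζ (xl z) * lapl w z +
      2 * (ζ₁ (xl z) * dd (ex (eb (Fin.last n))) w z) + ζ₂ (xl z) * w z := by
  simp only [lapl]
  rw [Finset.sum_congr rfl fun i _ => dd_dd_cutoff_mul hs hs₁ hζ hζ₁ hw (ex (eb i)) z]
  simp only [xl_eb, Finset.sum_add_distrib, ← Finset.mul_sum]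
  simp

lemma dd_congr_of_isOpen {H : Type*} [NormedAddCommGroup H] [NormedSpace ℝ H] {U : Set H}
    (hU : IsOpen U) {φ ψ : H → ℝ} (h : ∀ z ∈ U, φ z = ψ z) (v : H) :
    ∀ z ∈ U, dd v φ z = dd v ψ z := fun z hz => by
  have : φ =ᶠ[nhds z] ψ := Filter.eventuallyEq_of_mem (hU.mem_nhds hz) h
  simp only [dd, this.fderiv_eq]

lemma dd_zero_fun {H : Type*} [NormedAddCommGroup H] [NormedSpace ℝ H] (v z : H) :
    dd v (fun _ => (0 : ℝ)) z = 0 := by simp [dd]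

end CutoffCalculus

section InteriorStep

variable {n : ℕ}

/-- The `L_p` norm on a layer. -/
abbrev nl (p c ρ : ℝ) (g : ℝ × Ed (n + 1) → ℝ) : ℝ≥0∞ :=
  eLpNorm g (ENNReal.ofReal p) (lay n c ρ)

lemma nl_mono {p c ρ ρ' : ℝ} (h : ρ ≤ ρ') (g : ℝ × Ed (n + 1) → ℝ) : nl p c ρ g ≤ nl p c ρ' g :=
  eLpNorm_mono_measure _ (lay_mono h)

/-- Sum of the norms of all second derivatives on a layer. -/
def hessSum (p c ρ : ℝ) (v : ℝ × Ed (n + 1) → ℝ) : ℝ≥0∞ :=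
  ∑ i, ∑ j, nl p c ρ (dd (ex (eb i)) (dd (ex (eb j)) v))

lemma hessSum_mono {p c ρ ρ' : ℝ} (h : ρ ≤ ρ') (v : ℝ × Ed (n + 1) → ℝ) :
    hessSum p c ρ v ≤ hessSum p c ρ' v :=
  Finset.sum_le_sum fun _ _ => Finset.sum_le_sum fun _ _ => nl_mono h _

lemma le_hessSum (p c ρ : ℝ) (v : ℝ × Ed (n + 1) → ℝ) (i j : Fin (n + 1)) :
    nl p c ρ (dd (ex (eb i)) (dd (ex (eb j)) v)) ≤ hessSum p c ρ v :=
  (Finset.single_le_sum (f := fun j => nl p c ρ (dd (ex (eb i)) (dd (ex (eb j)) v)))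
    (fun _ _ => zero_le) (Finset.mem_univ j)).trans
  (Finset.single_le_sum (f := fun i => ∑ j, nl p c ρ (dd (ex (eb i)) (dd (ex (eb j)) v)))
    (fun _ _ => zero_le) (Finset.mem_univ i))

lemma lapl_congr_of_isOpen {U : Set (ℝ × Ed (n + 1))} (hU : IsOpen U) {φ ψ : ℝ × Ed (n + 1) → ℝ}
    (h : ∀ z ∈ U, φ z = ψ z) : ∀ z ∈ U, lapl φ z = lapl ψ z := fun z hz =>
  Finset.sum_congr rfl fun _ _ =>
    dd_congr_of_isOpen hU (dd_congr_of_isOpen hU h _) _ z hz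

/-- The operator with frozen coefficient applied to a truncated function. -/
lemma eLpNorm_frozen_cutoff_le {p α r s δ κ c lam : ℝ} (hp : 1 < p) (hr : 0 < r) (hδ : 0 < δ)
    (hκ : 0 ≤ κ) (hκ1 : κ ≤ 1) (hc : 0 < c)
    (hx : ∀ x, |x - r| < s + δ → 0 < x ∧ |(x / r) ^ α - 1| ≤ κ)
    {ζ ζ₁ ζ₂ : ℝ → ℝ} (hs : ContDiff ℝ (⊤ : ℕ∞) ζ) (hs₁ : ContDiff ℝ (⊤ : ℕ∞) ζ₁)
    (hζ : ∀ x, HasDerivAt ζ (ζ₁ x) x) (hζ₁ : ∀ x, HasDerivAt ζ₁ (ζ₂ x) x)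
    (h0 : ∀ x, 0 ≤ ζ x) (h1 : ∀ x, ζ x ≤ 1) (hb₁ : ∀ x, |ζ₁ x| ≤ c / δ)
    (hb₂ : ∀ x, |ζ₂ x| ≤ c / δ ^ 2) (hz : ∀ x, s + 3 / 4 * δ ≤ |x - r| → ζ x = 0)
    {v f : ℝ × Ed (n + 1) → ℝ} (hv : IsTest v) (hf : Measurable f)
    (hfe : ∀ z, 0 < xl z → f z = xl z ^ (-α) * (dd et v z + lam * v z) - lapl v z) :
    eLpNorm (fun z => r ^ (-α) * (dd et (fun z => ζ (xl z) * v z) z + lam * (ζ (xl z) * v z)) -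
      lapl (fun z => ζ (xl z) * v z) z) (ENNReal.ofReal p) volume ≤
    ENNReal.ofReal 2 * nl p r (s + δ) f +
      ENNReal.ofReal (2 * c / δ) * nl p r (s + δ) (dd (ex (eb (Fin.last n))) v) +
      ENNReal.ofReal (c / δ ^ 2) * nl p r (s + δ) v +
      ENNReal.ofReal κ * ∑ i, nl p r (s + δ) (dd (ex (eb i)) (dd (ex (eb i)) v)) := by
  have hp1 : 1 ≤ ENNReal.ofReal p := by simpa using hp.le
  set G := fun z => r ^ (-α) * (dd et (fun z => ζ (xl z) * v z) z + lam * (ζ (xl z) * v z)) -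
      lapl (fun z => ζ (xl z) * v z) z with hG
  have hsupp : Function.support G ⊆ lset n r (s + δ) := by
    intro z hzG
    by_contra hzn
    have hzn' : s + δ ≤ |xl z - r| := not_lt.1 hzn
    have hU : IsOpen {z : ℝ × Ed (n + 1) | s + 3 / 4 * δ < |xl z - r|} :=
      isOpen_lt continuous_const ((xl.continuous.sub continuous_const).abs)
    have hzU : z ∈ {z : ℝ × Ed (n + 1) | s + 3 / 4 * δ < |xl z - r|} := by
      change s + 3 / 4 * δ < |xl z - r|; linarith
    have hw : ∀ z ∈ {z : ℝ × Ed (n + 1) | s + 3 / 4 * δ < |xl z - r|},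
        ζ (xl z) * v z = (fun _ => (0 : ℝ)) z := fun y hy => by
      rw [hz _ (le_of_lt hy), zero_mul]
    apply hzG
    simp only [hG]
    rw [hw z hzU, dd_congr_of_isOpen hU hw _ z hzU, lapl_congr_of_isOpen hU hw z hzU, dd_zero_fun]
    have : ∀ v : ℝ × Ed (n + 1), dd v (fun _ => (0 : ℝ)) = fun _ => 0 := fun v => by
      funext z; exact dd_zero_fun v z
    simp [lapl, this]
  rw [← eLpNorm_restrict_eq_of_support_subset hsupp]
  have key := eLpNorm_le_sum_of_abs_le (μ := lay n r (s + δ)) hp1 (f := G)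
    (Finset.univ : Finset (Fin 3 ⊕ Fin (n + 1)))
    (c := Sum.elim ![2, 2 * c / δ, c / δ ^ 2] fun _ => κ)
    (g := Sum.elim ![f, dd (ex (eb (Fin.last n))) v, v] fun i => dd (ex (eb i)) (dd (ex (eb i)) v))
    (by
      rintro (i | i)
      · fin_cases i <;> simp <;> positivity
      · exact hκ)
    (by
      rintro (i | i)
      · fin_cases i
        · exact hf.aestronglyMeasurable
        · exact (hv.dd _).continuous.aestronglyMeasurable
        · exact hv.continuous.aestronglyMeasurable
      · exact ((hv.dd _).dd _).continuous.aestronglyMeasurable)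
    (by
      filter_upwards [ae_restrict_mem (measurableSet_lset r (s + δ))] with z hz
      obtain ⟨hxz, hxκ⟩ := hx (xl z) hz
      simp only [Fintype.sum_sum_type, Fin.sum_univ_three, Sum.elim_inl, Sum.elim_inr,
        Matrix.cons_val]
      have e1 : dd et v z + lam * v z = xl z ^ α * (f z + lapl v z) := by
        rw [hfe z hxz, sub_add_cancel, ← mul_assoc, ← Real.rpow_add hxz]; simp
      have e2 : r ^ (-α) * xl z ^ α = (xl z / r) ^ α := by
        rw [Real.div_rpow hxz.le hr.le, Real.rpow_neg hr.le]; ring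
      have e3 : G z = ζ (xl z) * ((xl z / r) ^ α * f z) +
          ζ (xl z) * (((xl z / r) ^ α - 1) * lapl v z) -
          2 * (ζ₁ (xl z) * dd (ex (eb (Fin.last n))) v z) - ζ₂ (xl z) * v z := by
        simp only [hG]
        rw [lapl_cutoff_mul hs hs₁ hζ hζ₁ hv, dd_cutoff_mul hζ hv, xl_et, ← e2]
        linear_combination r ^ (-α) * ζ (xl z) * e1
      have b1 : |ζ (xl z) * ((xl z / r) ^ α * f z)| ≤ 2 * |f z| := by
        rw [abs_mul (ζ _), abs_of_nonneg (h0 _), abs_mul ((xl z / r) ^ α)]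
        have : |(xl z / r) ^ α| ≤ 2 := by
          have := abs_add_le ((xl z / r) ^ α - 1) 1
          rw [sub_add_cancel, abs_one] at this
          linarith
        exact (mul_le_of_le_one_left (by positivity) (h1 _)).trans (by gcongr)
      have b2 : |ζ (xl z) * (((xl z / r) ^ α - 1) * lapl v z)| ≤
          κ * ∑ i, |dd (ex (eb i)) (dd (ex (eb i)) v) z| := by
        rw [abs_mul (ζ _), abs_of_nonneg (h0 _), abs_mul ((xl z / r) ^ α - 1)]
        refine (mul_le_of_le_one_left (by positivity) (h1 _)).trans ?_
        gcongr
        exact Finset.abs_sum_le_sum_abs _ _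
      have b3 : |2 * (ζ₁ (xl z) * dd (ex (eb (Fin.last n))) v z)| ≤
          2 * c / δ * |dd (ex (eb (Fin.last n))) v z| := by
        rw [abs_mul 2, abs_mul (ζ₁ _), abs_two, mul_div_assoc, mul_assoc]
        gcongr
        exact hb₁ _
      have b4 : |ζ₂ (xl z) * v z| ≤ c / δ ^ 2 * |v z| := by
        rw [abs_mul (ζ₂ _)]; gcongr; exact hb₂ _
      rw [e3, ← Finset.mul_sum]
      refine (abs_sub _ _).trans ?_
      refine (add_le_add ((abs_sub _ _).trans (add_le_add (abs_add_le _ _) le_rfl)) le_rfl).trans ?_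
      linarith)
  refine key.trans (le_of_eq ?_)
  simp only [Fintype.sum_sum_type, Fin.sum_univ_three, Sum.elim_inl, Sum.elim_inr,
        Matrix.cons_val, Finset.mul_sum]

/-- One step of the iteration for the second derivatives. -/
lemma hessSum_step {p α r s δ κ c τ lam C : ℝ} (hp : 1 < p) (hr : 0 < r) (hδ : 0 < δ)
    (hκ : 0 ≤ κ) (hκ1 : κ ≤ 1) (hc : 0 < c) (hτ : 0 < τ) (hτ1 : τ ≤ 1) (hlam : 0 ≤ lam) (hC : 0 < C)
    (hheat : ∀ w : ℝ × Ed (n + 1) → ℝ, IsTest w → ∀ a lam : ℝ, 0 < a → 0 ≤ lam → ∀ i j,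
      eLpNorm (dd (ex (eb i)) (dd (ex (eb j)) w)) (ENNReal.ofReal p) volume ≤ ENNReal.ofReal C *
        eLpNorm (fun z => a * (dd et w z + lam * w z) - lapl w z) (ENNReal.ofReal p) volume)
    (hcut : ∀ x₀ s δ : ℝ, 0 < δ → ∃ ζ ζ₁ ζ₂ : ℝ → ℝ,
      ContDiff ℝ (⊤ : ℕ∞) ζ ∧ ContDiff ℝ (⊤ : ℕ∞) ζ₁ ∧ (∀ x, HasDerivAt ζ (ζ₁ x) x) ∧
      (∀ x, HasDerivAt ζ₁ (ζ₂ x) x) ∧ (∀ x, 0 ≤ ζ x) ∧ (∀ x, ζ x ≤ 1) ∧ (∀ x, |ζ₁ x| ≤ c / δ) ∧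
      (∀ x, |ζ₂ x| ≤ c / δ ^ 2) ∧ (∀ x, |x - x₀| ≤ s → ζ x = 1) ∧
      (∀ x, s + 3 / 4 * δ ≤ |x - x₀| → ζ x = 0))
    (hx : ∀ x, |x - r| < s + δ → 0 < x ∧ |(x / r) ^ α - 1| ≤ κ)
    {v f : ℝ × Ed (n + 1) → ℝ} (hv : IsTest v) (hf : Measurable f)
    (hfe : ∀ z, 0 < xl z → f z = xl z ^ (-α) * (dd et v z + lam * v z) - lapl v z) :
    hessSum p r s v ≤ ENNReal.ofReal ((n + 1) ^ 2 * C * 2) * nl p r (s + 2 * δ) f +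
      ENNReal.ofReal ((n + 1) ^ 2 * C * (κ + 2 * c * τ)) * hessSum p r (s + 2 * δ) v +
      ENNReal.ofReal ((n + 1) ^ 2 * C * ((4 * c / τ + c) / δ ^ 2)) * nl p r (s + 2 * δ) v := by
  obtain ⟨ζ, ζ₁, ζ₂, hs, hs₁, hζ, hζ₁, h0, h1, hb₁, hb₂, ho, hz⟩ := hcut r s δ hδ
  set G := fun z => r ^ (-α) * (dd et (fun z => ζ (xl z) * v z) z + lam * (ζ (xl z) * v z)) -
      lapl (fun z => ζ (xl z) * v z) z with hG
  have hGle := eLpNorm_frozen_cutoff_le hp hr hδ hκ hκ1 hc hx hs hs₁ hζ hζ₁ h0 h1 hb₁ hb₂ hz hv hf hfe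
  rw [← hG] at hGle
  set g := eLpNorm G (ENNReal.ofReal p) volume with hg
  have hw : IsTest fun z => ζ (xl z) * v z := hv.mul_left (contDiff_cutoff hs)
  have hij : ∀ i j, nl p r s (dd (ex (eb i)) (dd (ex (eb j)) v)) ≤ ENNReal.ofReal C * g := by
    intro i j
    refine le_trans ?_ (hheat _ hw (r ^ (-α)) lam (Real.rpow_pos_of_pos hr _) hlam i j)
    refine le_trans (le_of_eq ?_) (eLpNorm_restrict_le _ _ _ (lset n r s))
    refine eLpNorm_congr_ae ?_
    filter_upwards [ae_restrict_mem (measurableSet_lset r s)] with z hz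
    have hU := isOpen_lset (n := n) r s
    refine dd_congr_of_isOpen hU (dd_congr_of_isOpen hU (fun y hy => ?_) _) _ z hz
    rw [ho _ (le_of_lt hy), one_mul]
  have hX : hessSum p r s v ≤ ENNReal.ofReal ((n + 1) ^ 2 * C) * g := by
    refine (Finset.sum_le_sum fun i _ => Finset.sum_le_sum fun j _ => hij i j).trans (le_of_eq ?_)
    have e : ENNReal.ofReal ((n : ℝ) + 1) = ((n : ℝ≥0∞) + 1) := by
      rw [ENNReal.ofReal_add (by positivity) zero_le_one]; simp
    simp only [Finset.sum_const, Finset.card_univ, Fintype.card_fin, nsmul_eq_mul]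
    rw [ENNReal.ofReal_mul (by positivity), ENNReal.ofReal_pow (by positivity), e]
    push_cast
    ring
  have hD : nl p r (s + δ) (dd (ex (eb (Fin.last n))) v) ≤
      ENNReal.ofReal (2 / (τ * δ)) * nl p r (s + 2 * δ) v +
        ENNReal.ofReal (τ * δ) * hessSum p r (s + 2 * δ) v := by
    have hle : s + δ + τ * δ ≤ s + 2 * δ := by nlinarith
    refine (eLpNorm_lay_interpolation hp (h := τ * δ) (by positivity) (abs_xl_eb_le _) hv).trans ?_
    gcongr
    · exact nl_mono hle _
    · exact (nl_mono hle _).trans (le_hessSum _ _ _ _ _ _)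
  have hS : ∑ i, nl p r (s + δ) (dd (ex (eb i)) (dd (ex (eb i)) v)) ≤ hessSum p r (s + 2 * δ) v :=
    Finset.sum_le_sum fun i _ => (nl_mono (by linarith) _).trans
      (Finset.single_le_sum (f := fun j => nl p r (s + 2 * δ) (dd (ex (eb i)) (dd (ex (eb j)) v)))
        (fun _ _ => zero_le) (Finset.mem_univ i))
  have hF : nl p r (s + δ) f ≤ nl p r (s + 2 * δ) f := nl_mono (by linarith) _
  have hV : nl p r (s + δ) v ≤ nl p r (s + 2 * δ) v := nl_mono (by linarith) _
  set X := hessSum p r (s + 2 * δ) v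
  set F := nl p r (s + 2 * δ) f
  set V := nl p r (s + 2 * δ) v
  calc hessSum p r s v ≤ ENNReal.ofReal ((n + 1) ^ 2 * C) * g := hX
    _ ≤ ENNReal.ofReal ((n + 1) ^ 2 * C) * (ENNReal.ofReal 2 * F + ENNReal.ofReal (2 * c / δ) *
        (ENNReal.ofReal (2 / (τ * δ)) * V + ENNReal.ofReal (τ * δ) * X) +
        ENNReal.ofReal (c / δ ^ 2) * V + ENNReal.ofReal κ * X) := by
      gcongr
      refine hGle.trans ?_
      gcongr
    _ = _ := by
      have e1 : (n + 1) ^ 2 * C * (κ + 2 * c * τ) = (n + 1) ^ 2 * C * κ +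
          (n + 1) ^ 2 * C * (2 * c / δ * (τ * δ)) := by field_simp
      have e2 : (n + 1) ^ 2 * C * ((4 * c / τ + c) / δ ^ 2) =
          (n + 1) ^ 2 * C * (2 * c / δ * (2 / (τ * δ))) + (n + 1) ^ 2 * C * (c / δ ^ 2) := by
        field_simp; ring
      rw [e1, e2, ENNReal.ofReal_add (by positivity) (by positivity),
        ENNReal.ofReal_add (by positivity) (by positivity)]
      have hm : ∀ x, 0 ≤ x → ENNReal.ofReal ((n + 1) ^ 2 * C * x) =
          ENNReal.ofReal ((n + 1) ^ 2 * C) * ENNReal.ofReal x := fun x _ =>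
        ENNReal.ofReal_mul (by positivity)
      rw [hm _ (by positivity), hm _ hκ, hm _ (by positivity), hm _ (by positivity),
        hm _ (by positivity), ENNReal.ofReal_mul (p := 2 * c / δ) (by positivity),
        ENNReal.ofReal_mul (p := 2 * c / δ) (by positivity)]
      ring

end InteriorStep

section Absorption

/-- A geometric absorption argument. -/
lemma le_of_absorb {X : ℝ → ℝ≥0∞} {M B : ℝ≥0∞} (hM : M ≠ ⊤) (hX : ∀ s < 1, X s ≤ M)
    (h : ∀ s s', 0 ≤ s → s < s' → s' < 1 →
      X s ≤ ENNReal.ofReal (1 / 8) * X s' + ENNReal.ofReal ((s' - s) ^ 2)⁻¹ * B) :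
    X (1 / 2) ≤ ENNReal.ofReal 32 * B := by
  by_cases hB : B = ⊤
  · simp [hB]
  have hfin : ∀ s < 1, X s ≠ ⊤ := fun s hs => ne_top_of_le_ne_top hM (hX s hs)
  have hr : ∀ s s', 0 ≤ s → s < s' → s' < 1 →
      (X s).toReal ≤ 1 / 8 * (X s').toReal + ((s' - s) ^ 2)⁻¹ * B.toReal := by
    intro s s' h0 h1 h2
    have h4 : ENNReal.ofReal (1 / 8) * X s' ≠ ⊤ := ENNReal.mul_ne_top ofReal_ne_top (hfin s' h2)
    have h5 : ENNReal.ofReal ((s' - s) ^ 2)⁻¹ * B ≠ ⊤ := ENNReal.mul_ne_top ofReal_ne_top hB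
    have h3 := ENNReal.toReal_mono (ENNReal.add_ne_top.2 ⟨h4, h5⟩) (h s s' h0 h1 h2)
    rwa [ENNReal.toReal_add h4 h5, ENNReal.toReal_mul, ENNReal.toReal_mul,
      ENNReal.toReal_ofReal (by norm_num), ENNReal.toReal_ofReal (by positivity)] at h3
  have hb : 0 ≤ B.toReal := toReal_nonneg
  have key : ∀ k : ℕ, (X (1 / 2)).toReal ≤
      (1 / 8) ^ k * (X (1 - (1 / 2) ^ (k + 1))).toReal + 32 * (1 - (1 / 2) ^ k) * B.toReal := by
    intro k
    induction k with
    | zero => rw [show (1 : ℝ) - (1 / 2) ^ (0 + 1) = 1 / 2 by norm_num]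
              simp only [pow_zero, one_mul, sub_self, mul_zero, zero_mul, add_zero, le_refl]
    | succ k ih =>
      have hk0 : (0 : ℝ) < (1 / 2) ^ k := by positivity
      have hk1 : ((1 : ℝ) / 2) ^ k ≤ 1 := pow_le_one₀ (by norm_num) (by norm_num)
      have := hr (1 - (1 / 2) ^ (k + 1)) (1 - (1 / 2) ^ (k + 1 + 1))
        (by rw [pow_succ]; linarith) (by rw [pow_succ _ (k + 1), pow_succ]; linarith)
        (by rw [pow_succ _ (k + 1), pow_succ]; linarith)
      have e : (((1 - (1 / 2) ^ (k + 1 + 1) - (1 - (1 / 2) ^ (k + 1))) ^ 2)⁻¹ : ℝ) =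
          16 * (4 : ℝ) ^ k := by
        have e4 : (4 : ℝ) ^ k = (((1 / 2) ^ k * (1 / 2) ^ k : ℝ))⁻¹ := by
          rw [← mul_pow, ← inv_pow]; norm_num
        have ey : ∀ y : ℝ, 0 < y → ((1 - y * (1 / 2) * (1 / 2) - (1 - y * (1 / 2))) ^ 2)⁻¹ =
            16 * (y * y)⁻¹ := fun y hy => by
          rw [show 1 - y * (1 / 2) * (1 / 2) - (1 - y * (1 / 2)) = y / 4 by ring]
          field_simp; norm_num
        rw [e4, pow_succ _ (k + 1), pow_succ _ k]
        exact ey _ hk0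
      rw [e] at this
      have h8 : (0 : ℝ) ≤ (1 / 8) ^ k := by positivity
      have h9 : ((1 : ℝ) / 8) ^ k * 4 ^ k = (1 / 2) ^ k := by rw [← mul_pow]; norm_num
      calc (X (1 / 2)).toReal ≤ _ := ih
        _ ≤ (1 / 8) ^ k * (1 / 8 * (X (1 - (1 / 2) ^ (k + 1 + 1))).toReal +
            16 * (4 : ℝ) ^ k * B.toReal) + 32 * (1 - (1 / 2) ^ k) * B.toReal := by gcongr
        _ = _ := by
          rw [pow_succ (1 / 8 : ℝ) k, pow_succ (1 / 2 : ℝ) k]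
          linear_combination 16 * B.toReal * h9
  have hlim : (X (1 / 2)).toReal ≤ 32 * B.toReal := by
    have t1 : Filter.Tendsto (fun k : ℕ => (1 / 8 : ℝ) ^ k * M.toReal + 32 * B.toReal)
        Filter.atTop (nhds (0 * M.toReal + 32 * B.toReal)) :=
      ((_root_.tendsto_pow_atTop_nhds_zero_of_lt_one (by norm_num) (by norm_num)).mul_const _).add_const _
    rw [zero_mul, zero_add] at t1
    refine ge_of_tendsto' t1 fun k => (key k).trans ?_
    have hk0 : (0 : ℝ) < (1 / 2) ^ k := by positivity
    gcongr
    · exact hX _ (by rw [pow_succ]; linarith)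
    · linarith
  rw [← ENNReal.ofReal_toReal (hfin (1 / 2) (by norm_num)), ← ENNReal.ofReal_toReal hB,
    ← ENNReal.ofReal_mul (by norm_num)]
  exact ENNReal.ofReal_le_ofReal hlim

end Absorption

section Interior

variable {n : ℕ}

set_option maxHeartbeats 2000000 in
/-- Interior estimate on the layer `{|x_d - r| < ε r}`. -/
theorem exists_interior_estimate (n : ℕ) {p : ℝ} (hp : 1 < p) (α : ℝ) :
    ∃ ε N : ℝ, 0 < ε ∧ ε ≤ 1 / 4 ∧ 0 < N ∧ ∀ r lam : ℝ, 0 < r → 0 ≤ lam →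
      ∀ v f : ℝ × Ed (n + 1) → ℝ, IsTest v → Measurable f →
      (∀ z, 0 < xl z → f z = xl z ^ (-α) * (dd et v z + lam * v z) - lapl v z) →
      (∀ i j, nl p r (ε * r) (dd (ex (eb i)) (dd (ex (eb j)) v)) ≤ ENNReal.ofReal N *
        (nl p r (2 * ε * r) f + ENNReal.ofReal (r ^ 2)⁻¹ * nl p r (2 * ε * r) v)) ∧
      nl p r (ε * r) (fun z => xl z ^ (-α) * (dd et v z + lam * v z)) ≤ ENNReal.ofReal N *
        (nl p r (2 * ε * r) f + ENNReal.ofReal (r ^ 2)⁻¹ * nl p r (2 * ε * r) v) ∧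
      ∀ j, ENNReal.ofReal r⁻¹ * nl p r (ε * r) (dd (ex (eb j)) v) ≤ ENNReal.ofReal N *
        (nl p r (2 * ε * r) f + ENNReal.ofReal (r ^ 2)⁻¹ * nl p r (2 * ε * r) v) := by
  have hp1 : 1 ≤ ENNReal.ofReal p := by simpa using hp.le
  obtain ⟨C, hC, hheat⟩ := exists_heat_estimate_lam (n + 1) hp
  obtain ⟨c, hc, hcut⟩ := exists_cutoff
  set K : ℝ := (n + 1) ^ 2 * C with hK
  have hK0 : 0 < K := by positivity
  set κ : ℝ := min 1 (1 / (16 * K)) with hκ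
  have hκ0 : 0 < κ := lt_min one_pos (by positivity)
  set τ : ℝ := min 1 (1 / (32 * c * K)) with hτ
  have hτ0 : 0 < τ := lt_min one_pos (by positivity)
  have hsmall : K * (κ + 2 * c * τ) ≤ 1 / 8 := by
    have h1 : κ ≤ 1 / (16 * K) := min_le_right _ _
    have h2 : τ ≤ 1 / (32 * c * K) := min_le_right _ _
    calc K * (κ + 2 * c * τ) ≤ K * (1 / (16 * K) + 2 * c * (1 / (32 * c * K))) := by gcongr
      _ = 1 / 8 := by field_simp; norm_num
  obtain ⟨ε₀, hε₀, hcont⟩ : ∃ ε₀ > 0, ∀ y : ℝ, |y - 1| < ε₀ → |y ^ α - 1| < κ := by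
    have : ContinuousAt (fun y : ℝ => y ^ α) 1 :=
      Real.continuousAt_rpow_const _ _ (Or.inl one_ne_zero)
    obtain ⟨ε₀, h1, h2⟩ := Metric.continuousAt_iff.1 this κ hκ0
    refine ⟨ε₀, h1, fun y hy => ?_⟩
    have := h2 (x := y) (by rwa [Real.dist_eq])
    simpa [Real.dist_eq] using this
  set ε : ℝ := min (1 / 4) (ε₀ / 2) with hε
  have hε0 : 0 < ε := lt_min (by norm_num) (by positivity)
  have hε4 : ε ≤ 1 / 4 := min_le_left _ _
  have hε2 : 2 * ε ≤ ε₀ := by linarith [min_le_right (1 / 4) (ε₀ / 2)]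
  set Q : ℝ := 2 * K + K * (4 * c / τ + c) * (4 / ε ^ 2) with hQ
  have hQ0 : 0 < Q := by positivity
  refine ⟨ε, (n + 1) * (32 * Q + 1) + (4 / ε + 16 * ε * Q), hε0, hε4, by positivity,
    fun r lam hr hlam v f hv hf hfe => ?_⟩
  set F := nl p r (2 * ε * r) f with hF
  set V := nl p r (2 * ε * r) v with hV
  set R := F + ENNReal.ofReal (r ^ 2)⁻¹ * V with hR
  have hstep : ∀ s s', 0 ≤ s → s < s' → s' < 1 → hessSum p r (ε * r * (1 + s)) v ≤
      ENNReal.ofReal (1 / 8) * hessSum p r (ε * r * (1 + s')) v +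
        ENNReal.ofReal ((s' - s) ^ 2)⁻¹ * (ENNReal.ofReal Q * R) := by
    intro s s' h0 h1 h2
    set δ : ℝ := ε * r * (s' - s) / 2 with hδ
    have hss : 0 < s' - s := by linarith
    have hεr : 0 < ε * r := by positivity
    have hδ0 : 0 < δ := by positivity
    have e1 : ε * r * (1 + s) + 2 * δ = ε * r * (1 + s') := by rw [hδ]; ring
    have hlt : ε * r * (1 + s) + δ < 2 * ε * r := by nlinarith
    have hle : ε * r * (1 + s') ≤ 2 * ε * r := by nlinarith
    have hx : ∀ x, |x - r| < ε * r * (1 + s) + δ → 0 < x ∧ |(x / r) ^ α - 1| ≤ κ := by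
      intro x hx
      have h3 : |x - r| < 2 * ε * r := hx.trans hlt
      refine ⟨?_, (hcont _ ?_).le⟩
      · have := (abs_lt.1 h3).1; nlinarith
      · rw [div_sub_one hr.ne', abs_div, abs_of_pos hr, div_lt_iff₀ hr]
        exact h3.trans_le (by gcongr)
    have := hessSum_step hp hr hδ0 hκ0.le (min_le_left _ _) hc hτ0 (min_le_left _ _) hlam hC
      hheat hcut hx hv hf hfe
    rw [← hK, e1] at this
    refine this.trans ?_
    have t1 : nl p r (ε * r * (1 + s')) f ≤ F := nl_mono hle _
    have t2 : nl p r (ε * r * (1 + s')) v ≤ V := nl_mono hle _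
    have hone : 1 ≤ ((s' - s) ^ 2)⁻¹ :=
      (one_le_inv₀ (by positivity)).2 (pow_le_one₀ hss.le (by linarith))
    have c1 : K * 2 ≤ ((s' - s) ^ 2)⁻¹ * Q := by
      calc K * 2 ≤ 1 * Q := by
            rw [hQ, one_mul]; have : 0 ≤ K * (4 * c / τ + c) * (4 / ε ^ 2) := by positivity
            linarith
        _ ≤ _ := by gcongr
    have c2 : K * ((4 * c / τ + c) / δ ^ 2) ≤ ((s' - s) ^ 2)⁻¹ * Q * (r ^ 2)⁻¹ := by
      calc K * ((4 * c / τ + c) / δ ^ 2) =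
            ((s' - s) ^ 2)⁻¹ * (K * (4 * c / τ + c) * (4 / ε ^ 2)) * (r ^ 2)⁻¹ := by
              rw [hδ]; field_simp; norm_num
        _ ≤ _ := by gcongr; rw [hQ]; linarith
    calc ENNReal.ofReal (K * 2) * nl p r (ε * r * (1 + s')) f +
          ENNReal.ofReal (K * (κ + 2 * c * τ)) * hessSum p r (ε * r * (1 + s')) v +
          ENNReal.ofReal (K * ((4 * c / τ + c) / δ ^ 2)) * nl p r (ε * r * (1 + s')) v
        ≤ ENNReal.ofReal (((s' - s) ^ 2)⁻¹ * Q) * F +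
          ENNReal.ofReal (1 / 8) * hessSum p r (ε * r * (1 + s')) v +
          ENNReal.ofReal (((s' - s) ^ 2)⁻¹ * Q * (r ^ 2)⁻¹) * V := by gcongr
      _ = _ := by
          rw [hR, ENNReal.ofReal_mul (p := ((s' - s) ^ 2)⁻¹ * Q) (by positivity),
            ENNReal.ofReal_mul (p := ((s' - s) ^ 2)⁻¹) (by positivity)]
          ring
  have hfin : hessSum p r (2 * ε * r) v ≠ ⊤ :=
    ENNReal.sum_ne_top.2 fun i _ => ENNReal.sum_ne_top.2 fun j _ =>
      ((hv.dd _).dd _).eLpNorm_ne_top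
  have hX := le_of_absorb (X := fun s => hessSum p r (ε * r * (1 + s)) v) hfin
    (fun s hs => hessSum_mono (by nlinarith [mul_pos hε0 hr]) v) hstep
  have hij : ∀ ρ, ρ ≤ ε * r * (1 + 1 / 2) → ∀ i j,
      nl p r ρ (dd (ex (eb i)) (dd (ex (eb j)) v)) ≤ ENNReal.ofReal (32 * Q) * R := by
    intro ρ hρ i j
    refine (nl_mono hρ _).trans ((le_hessSum _ _ _ _ _ _).trans (hX.trans (le_of_eq ?_)))
    rw [ENNReal.ofReal_mul (by norm_num), mul_assoc]
  have hεr : ε * r ≤ ε * r * (1 + 1 / 2) := by nlinarith [mul_pos hε0 hr]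
  have hn0 : (0 : ℝ) ≤ n := Nat.cast_nonneg n
  refine ⟨fun i j => (hij _ hεr i j).trans ?_, ?_, fun j => ?_⟩
  · gcongr
    have : 0 ≤ (4 / ε + 16 * ε * Q) := by positivity
    nlinarith
  · have key := eLpNorm_le_sum_of_abs_le (μ := lay n r (ε * r)) hp1
      (f := fun z => xl z ^ (-α) * (dd et v z + lam * v z))
      (Finset.univ : Finset (Option (Fin (n + 1)))) (c := fun _ => 1)
      (g := fun o => o.elim f fun i => dd (ex (eb i)) (dd (ex (eb i)) v))
      (fun _ => zero_le_one)
      (by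
        rintro (_ | i)
        · exact hf.aestronglyMeasurable
        · exact ((hv.dd _).dd _).continuous.aestronglyMeasurable)
      (by
        filter_upwards [ae_restrict_mem (measurableSet_lset r (ε * r))] with z hz
        have hz' : |xl z - r| < ε * r := hz
        have hz0 : 0 < xl z := by have := (abs_lt.1 hz').1; nlinarith
        simp only [Fintype.sum_option, Option.elim, one_mul]
        have : xl z ^ (-α) * (dd et v z + lam * v z) = f z + lapl v z := by rw [hfe z hz0]; ring
        rw [this]
        exact (abs_add_le _ _).trans (add_le_add le_rfl (Finset.abs_sum_le_sum_abs _ _)))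
    refine key.trans ?_
    simp only [Fintype.sum_option, Option.elim, ENNReal.ofReal_one, one_mul]
    have hF' : nl p r (ε * r) f ≤ R := by
      refine (nl_mono ?_ f).trans le_self_add
      nlinarith [mul_pos hε0 hr]
    have hsum : ∑ i, nl p r (ε * r) (dd (ex (eb i)) (dd (ex (eb i)) v)) ≤
        ENNReal.ofReal ((n + 1) * (32 * Q)) * R := by
      refine (Finset.sum_le_sum fun i _ => hij _ hεr i i).trans (le_of_eq ?_)
      rw [Finset.sum_const, Finset.card_univ, Fintype.card_fin, nsmul_eq_mul,
        ENNReal.ofReal_mul (p := (n : ℝ) + 1) (by positivity), ENNReal.ofReal_add hn0 zero_le_one]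
      push_cast; simp [mul_assoc]
    calc _ ≤ R + ENNReal.ofReal ((n + 1) * (32 * Q)) * R := add_le_add hF' hsum
      _ = ENNReal.ofReal (1 + (n + 1) * (32 * Q)) * R := by
        rw [ENNReal.ofReal_add zero_le_one (by positivity), ENNReal.ofReal_one, add_mul 1, one_mul]
      _ ≤ _ := by
        refine mul_le_mul_left (ENNReal.ofReal_le_ofReal ?_) _
        have : 0 ≤ (4 / ε + 16 * ε * Q) := by positivity
        nlinarith
  · have h1 := eLpNorm_lay_interpolation hp (c := r) (ρ := ε * r) (h := ε * r / 2) (by positivity)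
      (abs_xl_eb_le j) hv
    have e : ε * r + ε * r / 2 = ε * r * (1 + 1 / 2) := by ring
    rw [e] at h1
    have h2 : nl p r (ε * r * (1 + 1 / 2)) v ≤ V := nl_mono (by nlinarith [mul_pos hε0 hr]) _
    have h3 : ENNReal.ofReal (r ^ 2)⁻¹ * V ≤ R := le_add_self
    calc ENNReal.ofReal r⁻¹ * nl p r (ε * r) (dd (ex (eb j)) v)
        ≤ ENNReal.ofReal r⁻¹ * (ENNReal.ofReal (2 / (ε * r / 2)) * V +
          ENNReal.ofReal (ε * r / 2) * (ENNReal.ofReal (32 * Q) * R)) := by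
          gcongr
          refine h1.trans ?_
          gcongr
          exact hij _ le_rfl j j
      _ = ENNReal.ofReal (4 / ε) * (ENNReal.ofReal (r ^ 2)⁻¹ * V) +
          ENNReal.ofReal (16 * ε * Q) * R := by
          have a1 : (4 / ε) * (r ^ 2)⁻¹ = r⁻¹ * (2 / (ε * r / 2)) := by field_simp; norm_num
          have a2 : 16 * ε * Q = r⁻¹ * (ε * r / 2 * (32 * Q)) := by field_simp; norm_num
          rw [← mul_assoc (ENNReal.ofReal (4 / ε)), ← ENNReal.ofReal_mul (by positivity), a1, a2,
            ENNReal.ofReal_mul (p := r⁻¹) (by positivity), ENNReal.ofReal_mul (p := r⁻¹) (by positivity),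
            ENNReal.ofReal_mul (p := ε * r / 2) (by positivity)]
          ring
      _ ≤ ENNReal.ofReal (4 / ε) * R + ENNReal.ofReal (16 * ε * Q) * R := by gcongr
      _ = ENNReal.ofReal (4 / ε + 16 * ε * Q) * R := by
          rw [ENNReal.ofReal_add (by positivity) (by positivity), add_mul]
      _ ≤ _ := by
          refine mul_le_mul_left (ENNReal.ofReal_le_ofReal ?_) _
          have : 0 ≤ ((n : ℝ) + 1) * (32 * Q + 1) := by positivity
          linarith

end Interior

section Comparison

open intervalIntegral in
lemma second_difference_ge {G g φ : ℝ → ℝ} (hφ : Continuous φ) {A k : ℝ}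
    (hG : ∀ x, HasDerivAt G (g x) x) (hg : ∀ x, g x = (∫ y in x..A, φ y) + k) {x c δ : ℝ}
    (hc : ∀ y, |y - x| ≤ δ → c ≤ φ y) {h : ℝ} (h0 : 0 ≤ h) (hh : h ≤ δ) :
    c * h ^ 2 ≤ 2 * G x - G (x + h) - G (x - h) := by
  have hi : ∀ a b : ℝ, IntervalIntegrable φ volume a b := fun a b => hφ.intervalIntegrable a b
  set D : ℝ → ℝ := fun s => 2 * G x - G (x + s) - G (x - s) - c * s ^ 2 with hD
  have hD' : ∀ s, HasDerivAt D (- g (x + s) + g (x - s) - 2 * c * s) s := fun s => by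
    have h1 : HasDerivAt (fun s => G (x + s)) (g (x + s)) s := by
      simpa using (hG (x + s)).comp_const_add x s
    have h2 : HasDerivAt (fun s => G (x - s)) (-g (x - s)) s := by
      simpa using (hG (x - s)).comp_const_sub x s
    have h3 : HasDerivAt (fun s : ℝ => c * s ^ 2) (2 * c * s) s := by
      exact ((hasDerivAt_pow 2 s).const_mul c).congr_deriv (by norm_num; ring)
    exact ((((hasDerivAt_const s (2 * G x)).fun_sub h1).fun_sub h2).fun_sub h3).congr_deriv (by ring)
  have hmono : MonotoneOn D (Icc 0 δ) := by
    refine monotoneOn_of_deriv_nonneg (convex_Icc 0 δ)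
      (fun s _ => (hD' s).continuousAt.continuousWithinAt)
      (fun s _ => (hD' s).differentiableAt.differentiableWithinAt) fun s hs => ?_
    rw [interior_Icc] at hs
    rw [(hD' s).deriv, hg, hg]
    have e : (∫ y in (x - s)..A, φ y) = (∫ y in (x - s)..(x + s), φ y) + ∫ y in (x + s)..A, φ y :=
      (integral_add_adjacent_intervals (hi _ _) (hi _ _)).symm
    have hle : ∫ _ in (x - s)..(x + s), c ≤ ∫ y in (x - s)..(x + s), φ y :=
      integral_mono_on (by linarith [hs.1]) (by simp) (hi _ _) fun y hy =>
        hc y (abs_le.2 ⟨by linarith [hy.1, hs.2], by linarith [hy.2, hs.2]⟩)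
    rw [intervalIntegral.integral_const, smul_eq_mul] at hle
    rw [e]; nlinarith
  have := hmono ⟨le_rfl, h0.trans hh⟩ ⟨h0, hh⟩ h0
  simp only [hD] at this
  norm_num at this
  linarith

/-- Maximum principle on an interval in terms of second differences. -/
lemma le_green_of_second_difference {m F : ℝ → ℝ} (hm : Continuous m) (hF : Continuous F)
    (hF0 : ∀ x, 0 ≤ F x) (hm0 : m 0 = 0) {A : ℝ} (hA : 0 < A)
    (h : ∀ x, 0 < x → x < A → ∃ C, ∀ h, 0 < h → h ≤ 1 →
      2 * m x ≤ h ^ 2 * F x + C * h ^ 3 + m (x + h) + m (x - h)) {x : ℝ} (hx : 0 ≤ x) (hxA : x ≤ A) :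
    m x ≤ (∫ y in 0..A, min x y * F y) + x / A * m A := by
  have key : ∀ ε > 0, m x ≤ (∫ y in 0..A, min x y * (F y + ε)) + x / A * m A := by
    intro ε hε
    set φ : ℝ → ℝ := fun y => F y + ε with hφ
    have hφc : Continuous φ := by fun_prop
    have hφi : ∀ a b : ℝ, IntervalIntegrable φ volume a b := fun a b => hφc.intervalIntegrable a b
    have hyφ : Continuous fun y => y * φ y := by fun_prop
    have hyφi : ∀ a b : ℝ, IntervalIntegrable (fun y => y * φ y) volume a b := fun a b =>
      hyφ.intervalIntegrable a b
    set G : ℝ → ℝ := fun x => (∫ y in 0..x, y * φ y) + x * (∫ y in x..A, φ y) + x / A * m A with hG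
    have hd : ∀ x, HasDerivAt G ((∫ y in x..A, φ y) + m A / A) x := fun x => by
      have h1 : HasDerivAt (fun x => ∫ y in 0..x, y * φ y) (x * φ x) x :=
        intervalIntegral.integral_hasDerivAt_right (hyφi _ _)
          (hyφ.stronglyMeasurableAtFilter _ _) hyφ.continuousAt
      have h2 : HasDerivAt (fun x => ∫ y in x..A, φ y) (-φ x) x :=
        intervalIntegral.integral_hasDerivAt_left (hφi _ _)
          (hφc.stronglyMeasurableAtFilter _ _) hφc.continuousAt
      have h3 := (h1.fun_add ((hasDerivAt_id x).fun_mul h2)).fun_add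
        (((hasDerivAt_id x).div_const A).mul_const (m A))
      exact h3.congr_deriv (by simp; ring)
    have hGc : Continuous G := continuous_iff_continuousAt.2 fun x => (hd x).continuousAt
    have hGx : ∀ x, 0 ≤ x → x ≤ A → G x = (∫ y in 0..A, min x y * φ y) + x / A * m A := by
      intro x h0 h1
      have hmc : Continuous fun y => min x y * φ y := by fun_prop
      rw [← intervalIntegral.integral_add_adjacent_intervals (hmc.intervalIntegrable 0 x)
        (hmc.intervalIntegrable x A)]
      have e : ∀ a b c d e : ℝ, a = c → b = d → a + b + e = c + d + e := by
        rintro a b _ _ e rfl rfl; rfl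
      refine e _ _ _ _ _ ?_ ?_
      · refine intervalIntegral.integral_congr fun y hy => ?_
        rw [uIcc_of_le h0] at hy
        simp only [min_eq_right hy.2]
      · rw [← intervalIntegral.integral_const_mul]
        refine intervalIntegral.integral_congr fun y hy => ?_
        rw [uIcc_of_le h1] at hy
        simp only [min_eq_left hy.1]
    rw [← hGx x hx hxA]
    by_contra! hlt
    obtain ⟨y, hyI, hy⟩ := isCompact_Icc.exists_isMaxOn ⟨x, hx, hxA⟩
      ((hm.sub hGc).continuousOn (s := Icc 0 A))
    have hmax : ∀ z, 0 ≤ z → z ≤ A → m z - G z ≤ m y - G y := fun z h0 h1 => hy ⟨h0, h1⟩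
    have hpos : 0 < m y - G y := (sub_pos.2 hlt).trans_le (hmax x hx hxA)
    have hG0 : G 0 = 0 := by simp [hG]
    have hGA : m A ≤ G A := by
      simp only [hG, intervalIntegral.integral_same, div_self hA.ne', one_mul, mul_zero, add_zero]
      have : 0 ≤ ∫ y in 0..A, y * φ y :=
        intervalIntegral.integral_nonneg hA.le fun y hy => mul_nonneg hy.1 (add_nonneg (hF0 y) hε.le)
      linarith
    have hy0 : 0 < y := hyI.1.lt_of_ne fun e => by rw [← e, hm0, hG0] at hpos; simp at hpos
    have hyA : y < A := hyI.2.lt_of_ne fun e => by rw [e] at hpos; linarith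
    obtain ⟨C, hC⟩ := h y hy0 hyA
    obtain ⟨δ, hδ, hδφ⟩ : ∃ δ > 0, ∀ z, |z - y| ≤ δ → F y + ε / 2 ≤ φ z := by
      obtain ⟨δ, h1, h2⟩ := Metric.continuousAt_iff.1 (hφc.continuousAt (x := y)) (ε / 2) (by positivity)
      refine ⟨δ / 2, by positivity, fun z hz => ?_⟩
      have h3 := h2 (x := z) (by rw [Real.dist_eq]; linarith)
      rw [Real.dist_eq] at h3
      have h4 := (abs_lt.1 h3).1
      simp only [hφ] at h4 ⊢
      linarith
    set η : ℝ := min (min 1 δ) (min (min y (A - y)) (ε / (4 * (|C| + 1)))) with hη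
    have hη0 : 0 < η := by
      have : 0 < A - y := by linarith
      simp only [hη, lt_min_iff]
      refine ⟨⟨one_pos, hδ⟩, ⟨hy0, this⟩, by positivity⟩
    have l1 : η ≤ 1 := (min_le_left _ _).trans (min_le_left _ _)
    have l2 : η ≤ δ := (min_le_left _ _).trans (min_le_right _ _)
    have l3 : η ≤ y := (min_le_right _ _).trans ((min_le_left _ _).trans (min_le_left _ _))
    have l4 : η ≤ A - y := (min_le_right _ _).trans ((min_le_left _ _).trans (min_le_right _ _))
    have l5 : η ≤ ε / (4 * (|C| + 1)) := (min_le_right _ _).trans (min_le_right _ _)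
    have s1 := second_difference_ge hφc hd (fun _ => rfl) hδφ hη0.le l2
    have s2 := hC η hη0 l1
    have s3 := hmax (y + η) (by linarith) (by linarith)
    have s4 := hmax (y - η) (by linarith) (by linarith)
    rw [le_div_iff₀ (by positivity)] at l5
    have s5 : η ^ 2 * (ε / 2) ≤ η ^ 2 * (C * η) := by nlinarith
    have s6 : ε / 2 ≤ C * η := le_of_mul_le_mul_left s5 (by positivity)
    nlinarith [le_abs_self C, abs_nonneg C]
  have hlim : Filter.Tendsto
      (fun ε : ℝ => ((∫ y in 0..A, min x y * F y) + ε * ∫ y in 0..A, min x y) + x / A * m A)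
      (nhdsWithin 0 (Ioi 0))
      (nhds (((∫ y in 0..A, min x y * F y) + 0 * ∫ y in 0..A, min x y) + x / A * m A)) :=
    ((Continuous.tendsto (by fun_prop) 0)).mono_left nhdsWithin_le_nhds
  rw [zero_mul, add_zero] at hlim
  refine ge_of_tendsto hlim (Filter.eventually_of_mem self_mem_nhdsWithin fun ε hε => ?_)
  refine (key ε hε).trans (le_of_eq ?_)
  congr 1
  have c1 : Continuous fun y => min x y * F y := by fun_prop
  have c2 : Continuous fun y => min x y := by fun_prop
  rw [← intervalIntegral.integral_const_mul, ← intervalIntegral.integral_add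
    (c1.intervalIntegrable _ _) ((c2.const_mul ε).intervalIntegrable _ _)]
  refine intervalIntegral.integral_congr fun y _ => ?_
  change _ = min x y * F y + ε * min x y
  ring

end Comparison

section Slices

variable {n : ℕ}

/-- Parametrization of the hyperplane `{x_d = x}`. -/
def sl (n : ℕ) (x : ℝ) (y : ℝ × (Fin n → ℝ)) : ℝ × Ed (n + 1) :=
  (y.1, WithLp.toLp 2 (Fin.snoc (α := fun _ => ℝ) y.2 x))

/-- The surface measure on the hyperplane `{x_d = x}`. -/
def sm (n : ℕ) (x : ℝ) : Measure (ℝ × Ed (n + 1)) := Measure.map (sl n x) volume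

lemma continuous_sl_uncurry : Continuous fun q : ℝ × (ℝ × (Fin n → ℝ)) => sl n q.1 q.2 := by
  unfold sl
  refine continuous_snd.fst.prodMk ((PiLp.continuous_toLp 2 _).comp ?_)
  refine continuous_pi fun i => ?_
  refine Fin.lastCases ?_ (fun j => ?_) i
  · simpa using continuous_fst
  · simp only [Fin.snoc_castSucc]; fun_prop

lemma continuous_sl (x : ℝ) : Continuous (sl n x) :=
  continuous_sl_uncurry.comp (by fun_prop : Continuous fun y : ℝ × (Fin n → ℝ) => (x, y))

lemma xl_sl (x : ℝ) (y : ℝ × (Fin n → ℝ)) : xl (sl n x y) = x := by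
  simp [xl_apply, sl]

lemma sl_castSucc (x : ℝ) (y : ℝ × (Fin n → ℝ)) (j : Fin n) :
    (sl n x y).2 j.castSucc = y.2 j := by
  simp [sl]

lemma sl_add (x : ℝ) (y : ℝ × (Fin n → ℝ)) (v : ℝ × Ed (n + 1)) :
    sl n x y + v = sl n (x + xl v) (y + (v.1, fun j => v.2 j.castSucc)) := by
  refine Prod.ext rfl ?_
  ext i
  refine Fin.lastCases ?_ (fun j => ?_) i
  · have := xl_sl (n := n) x y
    have h2 := xl_sl (n := n) (x + xl v) (y + (v.1, fun j => v.2 j.castSucc))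
    rw [xl_apply] at this h2
    rw [h2]
    simp [this, xl_apply]
  · rw [sl_castSucc]
    simp [sl_castSucc]

lemma sm_map_add (x : ℝ) (v : ℝ × Ed (n + 1)) :
    (sm n x).map (· + v) = sm n (x + xl v) := by
  unfold sm
  rw [Measure.map_map (by fun_prop) (continuous_sl x).measurable]
  have e : (fun z => z + v) ∘ sl n x =
      sl n (x + xl v) ∘ fun y => y + (v.1, fun j => v.2 j.castSucc) := by
    funext y; exact sl_add x y v
  rw [e, ← Measure.map_map (continuous_sl _).measurable (by fun_prop)]
  congr 1
  rw [Measure.volume_eq_prod]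
  exact map_add_right_eq_self _ _

instance (x : ℝ) : SFinite (sm n x) := by unfold sm; infer_instance

lemma sm_closedBall_le (x ρ : ℝ) :
    sm n x (Metric.closedBall 0 ρ) ≤ volume (Metric.closedBall (0 : ℝ × (Fin n → ℝ)) ρ) := by
  unfold sm
  rw [Measure.map_apply (continuous_sl x).measurable Metric.isClosed_closedBall.measurableSet]
  refine measure_mono fun y hy => ?_
  simp only [mem_preimage, mem_closedBall_zero_iff] at hy ⊢
  have hρ : 0 ≤ ρ := (norm_nonneg _).trans hy
  rw [Prod.norm_def] at hy ⊢
  refine max_le ((le_max_left _ _).trans hy) ((pi_norm_le_iff_of_nonneg hρ).2 fun j => ?_)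
  rw [← sl_castSucc x y j]
  exact (PiLp.norm_apply_le _ _).trans ((le_max_right _ _).trans hy)

instance (x : ℝ) : IsFiniteMeasureOnCompacts (sm n x) := ⟨fun K hK => by
  obtain ⟨ρ, hρ⟩ := hK.isBounded.subset_closedBall 0
  exact (measure_mono hρ).trans_lt ((sm_closedBall_le x ρ).trans_lt measure_closedBall_lt_top)⟩

lemma ae_sm (x : ℝ) : ∀ᵐ z ∂sm n x, xl z = x := by
  unfold sm
  rw [ae_map_iff (continuous_sl x).measurable.aemeasurable
    (measurableSet_eq_fun xl.continuous.measurable measurable_const)]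
  exact Filter.Eventually.of_forall fun y => xl_sl x y

lemma lintegral_slice {G : ℝ × Ed (n + 1) → ℝ≥0∞} (hG : Measurable G) :
    ∫⁻ z, G z = ∫⁻ x, ∫⁻ z, G z ∂sm n x := by
  have h1 : ∀ x, ∫⁻ z, G z ∂sm n x = ∫⁻ t : ℝ, ∫⁻ y : Fin n → ℝ, G (sl n x (t, y)) := fun x => by
    unfold sm
    rw [lintegral_map hG (continuous_sl x).measurable, Measure.volume_eq_prod,
      lintegral_prod (fun y => G (sl n x y)) (hG.comp (continuous_sl x).measurable).aemeasurable]
  simp only [h1]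
  have hm : Measurable fun q : (ℝ × ℝ) × (Fin n → ℝ) => G (sl n q.1.1 (q.1.2, q.2)) :=
    hG.comp (continuous_sl_uncurry.measurable.comp (by fun_prop :
      Measurable fun q : (ℝ × ℝ) × (Fin n → ℝ) => (q.1.1, (q.1.2, q.2))))
  rw [lintegral_lintegral_swap (f := fun x t => ∫⁻ y : Fin n → ℝ, G (sl n x (t, y)))
    (Measurable.aemeasurable (by exact hm.lintegral_prod_right')), Measure.volume_eq_prod, lintegral_prod _ hG.aemeasurable]
  refine lintegral_congr fun t => ?_
  have hGt : Measurable fun w : Ed (n + 1) => G (t, w) := hG.comp (by fun_prop)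
  have hGw : Measurable fun w : Fin (n + 1) → ℝ => G (t, WithLp.toLp 2 w) :=
    hGt.comp (PiLp.volume_preserving_toLp (Fin (n + 1))).measurable
  have hP := (volume_preserving_piFinSuccAbove (fun _ : Fin (n + 1) => ℝ) (Fin.last n)).symm
  have hQ : Measurable fun a : ℝ × (Fin n → ℝ) => G (t, WithLp.toLp 2
      ((MeasurableEquiv.piFinSuccAbove (fun _ => ℝ) (Fin.last n)).symm a)) :=
    hGw.comp hP.measurable
  rw [← (PiLp.volume_preserving_toLp (Fin (n + 1))).lintegral_comp hGt, ← hP.lintegral_comp hGw,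
    Measure.volume_eq_prod]
  refine (lintegral_prod _ hQ.aemeasurable).trans ?_
  simp only [sl, ← Fin.insertNth_last']
  rfl

end Slices

section HalfSpaceTest

variable {n : ℕ}

/-- Smooth functions with compact support in the open upper half space. -/
structure IsHT (v : ℝ × Ed (n + 1) → ℝ) : Prop where
  test : IsTest v
  vanish : ∃ δ : ℝ, 0 < δ ∧ ∀ z, xl z < δ → v z = 0

namespace IsHT

variable {v w : ℝ × Ed (n + 1) → ℝ}

lemma dd (hv : IsHT v) (e : ℝ × Ed (n + 1)) : IsHT (dd e v) := by
  obtain ⟨δ, hδ, h⟩ := hv.vanish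
  refine ⟨hv.test.dd e, δ, hδ, fun z hz => ?_⟩
  rw [dd_congr_of_isOpen (U := {z | xl z < δ}) (isOpen_lt xl.continuous continuous_const)
    (ψ := fun _ => 0) h e z hz, dd_zero_fun]

lemma add (hv : IsHT v) (hw : IsHT w) : IsHT fun z => v z + w z := by
  obtain ⟨δ, hδ, h⟩ := hv.vanish
  obtain ⟨δ', hδ', h'⟩ := hw.vanish
  refine ⟨hv.test.add hw.test, min δ δ', lt_min hδ hδ', fun z hz => ?_⟩
  rw [h z (hz.trans_le (min_le_left _ _)), h' z (hz.trans_le (min_le_right _ _)), add_zero]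

lemma const_mul (hv : IsHT v) (c : ℝ) : IsHT fun z => c * v z := by
  obtain ⟨δ, hδ, h⟩ := hv.vanish
  exact ⟨hv.test.const_mul c, δ, hδ, fun z hz => by rw [h z hz, mul_zero]⟩

lemma sub (hv : IsHT v) (hw : IsHT w) : IsHT fun z => v z - w z := by
  simpa [sub_eq_add_neg] using hv.add (hw.const_mul (-1))

lemma sum {ι : Type*} (s : Finset ι) {f : ι → ℝ × Ed (n + 1) → ℝ} (h : ∀ i, IsHT (f i)) :
    IsHT fun z => ∑ i ∈ s, f i z := by
  classical
  induction s using Finset.induction_on with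
  | empty => simpa using ⟨IsTest.zero, 1, one_pos, fun _ _ => rfl⟩
  | insert a s ha ih => simpa [Finset.sum_insert ha] using (h a).add ih

lemma lapl (hv : IsHT v) : IsHT (lapl v) :=
  sum Finset.univ fun i => (hv.dd (ex (eb i))).dd (ex (eb i))

lemma rpow_mul (hv : IsHT v) (β : ℝ) : IsHT fun z => xl z ^ β * v z := by
  obtain ⟨δ, hδ, h⟩ := hv.vanish
  refine ⟨⟨contDiff_iff_contDiffAt.2 fun z => ?_, hv.test.compact.mul_left⟩, δ, hδ,
    fun z hz => by rw [h z hz, mul_zero]⟩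
  rcases lt_or_ge (xl z) δ with hz | hz
  · refine (contDiffAt_const (c := (0 : ℝ))).congr_of_eventuallyEq ?_
    refine Filter.eventuallyEq_of_mem
      ((isOpen_lt xl.continuous continuous_const : IsOpen {z | xl z < δ}).mem_nhds hz) ?_
    intro y hy
    change xl y ^ β * v y = 0
    rw [h y hy, mul_zero]
  · exact (xl.contDiff.contDiffAt.rpow_const_of_ne (hδ.trans_le hz).ne').mul
      hv.test.contDiff.contDiffAt

lemma comp_add (hv : IsHT v) {e : ℝ × Ed (n + 1)} (he : xl e = 0) : IsHT fun z => v (z + e) := by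
  obtain ⟨δ, hδ, h⟩ := hv.vanish
  refine ⟨⟨hv.test.contDiff.comp (contDiff_id.add contDiff_const),
    hv.test.compact.comp_homeomorph (Homeomorph.addRight e)⟩, δ, hδ, fun z hz => ?_⟩
  exact h _ (by rwa [map_add, he, add_zero])

end IsHT

/-- The right-hand side of the equation solved by `v`. -/
def fop (α lam : ℝ) (v : ℝ × Ed (n + 1) → ℝ) (z : ℝ × Ed (n + 1)) : ℝ :=
  xl z ^ (-α) * (dd et v z + lam * v z) - lapl v z

lemma isHT_fop {v : ℝ × Ed (n + 1) → ℝ} (hv : IsHT v) (α lam : ℝ) : IsHT (fop α lam v) :=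
  (((hv.dd et).add (hv.const_mul lam)).rpow_mul (-α)).sub hv.lapl

lemma dd_comp_add {H : Type*} [NormedAddCommGroup H] [NormedSpace ℝ H] (φ : H → ℝ) (e w z : H) :
    dd w (fun z => φ (z + e)) z = dd w φ (z + e) := by
  simp only [dd]
  rw [fderiv_comp_add_right]

lemma fop_comp_add (α lam : ℝ) (v : ℝ × Ed (n + 1) → ℝ) {e : ℝ × Ed (n + 1)} (he : xl e = 0)
    (z : ℝ × Ed (n + 1)) : fop α lam (fun z => v (z + e)) z = fop α lam v (z + e) := by
  simp only [fop, lapl, dd_comp_add, map_add, he, add_zero]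
  congr 1
  refine Finset.sum_congr rfl fun i _ => ?_
  rw [show dd (ex (eb i)) (fun z => v (z + e)) = fun z => dd (ex (eb i)) v (z + e) from
    funext fun z => dd_comp_add v e _ z, dd_comp_add]

lemma fop_sub (α lam : ℝ) {v w : ℝ × Ed (n + 1) → ℝ} (hv : IsTest v) (hw : IsTest w)
    (z : ℝ × Ed (n + 1)) :
    fop α lam (fun z => v z - w z) z = fop α lam v z - fop α lam w z := by
  simp only [fop, lapl, dd_sub hv hw]
  have : ∀ i, dd (ex (eb i)) (dd (ex (eb i)) fun z => v z - w z) z =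
      dd (ex (eb i)) (dd (ex (eb i)) v) z - dd (ex (eb i)) (dd (ex (eb i)) w) z := fun i => by
    rw [show dd (ex (eb i)) (fun z => v z - w z) = fun z => dd (ex (eb i)) v z - dd (ex (eb i)) w z
      from funext fun z => dd_sub hv hw _ z, dd_sub (hv.dd _) (hw.dd _)]
  simp only [this, Finset.sum_sub_distrib]
  ring

lemma fop_const_mul (α lam c : ℝ) {v : ℝ × Ed (n + 1) → ℝ} (hv : IsTest v)
    (z : ℝ × Ed (n + 1)) : fop α lam (fun z => c * v z) z = c * fop α lam v z := by
  simp only [fop, lapl, dd_const_mul hv]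
  have : ∀ i, dd (ex (eb i)) (dd (ex (eb i)) fun z => c * v z) z =
      c * dd (ex (eb i)) (dd (ex (eb i)) v) z := fun i => by
    rw [show dd (ex (eb i)) (fun z => c * v z) = fun z => c * dd (ex (eb i)) v z
      from funext fun z => dd_const_mul hv _ _ z, dd_const_mul (hv.dd _)]
  simp only [this, ← Finset.mul_sum]
  ring

/-- The norm on the hyperplane `{x_d = x}`. -/
abbrev ns (p x : ℝ) (g : ℝ × Ed (n + 1) → ℝ) : ℝ≥0∞ := eLpNorm g (ENNReal.ofReal p) (sm n x)

lemma ns_add (p x : ℝ) {g : ℝ × Ed (n + 1) → ℝ} (hg : Measurable g) (e : ℝ × Ed (n + 1)) :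
    ns p x (fun z => g (z + e)) = ns p (x + xl e) g := by
  unfold ns
  rw [← sm_map_add x e, eLpNorm_map_measure hg.aestronglyMeasurable (by fun_prop)]
  rfl

lemma ns_rpow {p : ℝ} (hp : 0 < p) (x : ℝ) {g : ℝ × Ed (n + 1) → ℝ} (hg : Measurable g) :
    ns p x g ^ p = ∫⁻ y, ‖g (sl n x y)‖ₑ ^ p := by
  rw [eLpNorm_rpow_eq _ hp]
  unfold sm
  rw [lintegral_map (hg.enorm.pow_const p) (continuous_sl x).measurable]

lemma measurable_ns {p : ℝ} (hp : 0 < p) {g : ℝ × Ed (n + 1) → ℝ} (hg : Measurable g) :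
    Measurable fun x => ns p x g := by
  have h : Measurable fun x => ns p x g ^ p := by
    simp only [ns_rpow hp _ hg]
    have : Measurable fun q : ℝ × (ℝ × (Fin n → ℝ)) => ‖g (sl n q.1 q.2)‖ₑ ^ p :=
      (hg.comp continuous_sl_uncurry.measurable).enorm.pow_const p
    exact this.lintegral_prod_right'
  have h2 : (fun x => ns p x g) = fun x => (ns p x g ^ p) ^ p⁻¹ := by
    funext x; rw [← ENNReal.rpow_mul, mul_inv_cancel₀ hp.ne', ENNReal.rpow_one]
  rw [h2]
  exact h.pow_const _

lemma lintegral_weight_slice {p : ℝ} (hp : 0 < p) {w : ℝ → ℝ≥0∞} (hw : Measurable w)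
    {g : ℝ × Ed (n + 1) → ℝ} (hg : Measurable g) :
    ∫⁻ z, w (xl z) * ‖g z‖ₑ ^ p = ∫⁻ x, w x * ns p x g ^ p := by
  have hm : Measurable fun z => w (xl z) * ‖g z‖ₑ ^ p :=
    (hw.comp xl.continuous.measurable).mul (hg.enorm.pow_const p)
  rw [lintegral_slice hm]
  refine lintegral_congr fun x => ?_
  rw [eLpNorm_rpow_eq _ hp, ← lintegral_const_mul _ (hg.enorm.pow_const p)]
  refine lintegral_congr_ae ?_
  filter_upwards [ae_sm x] with z hz
  rw [hz]

lemma nl_rpow {p : ℝ} (hp : 0 < p) (c ρ : ℝ) {g : ℝ × Ed (n + 1) → ℝ} (hg : Measurable g) :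
    nl p c ρ g ^ p = ∫⁻ x in {x | |x - c| < ρ}, ns p x g ^ p := by
  have hm : MeasurableSet {x : ℝ | |x - c| < ρ} :=
    measurableSet_lt (by fun_prop) measurable_const
  have := lintegral_weight_slice (n := n) hp (w := indicator {x | |x - c| < ρ} 1)
    (measurable_one.indicator hm) hg
  rw [nl, eLpNorm_rpow_eq _ hp, lay, ← lintegral_indicator (measurableSet_lset c ρ),
    ← lintegral_indicator hm]
  convert this using 1
  · refine lintegral_congr fun z => ?_
    by_cases hz : |xl z - c| < ρ
    · rw [indicator_of_mem (show z ∈ lset n c ρ from hz), indicator_of_mem (show xl z ∈ _ from hz)]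
      simp
    · rw [indicator_of_notMem (show z ∉ lset n c ρ from hz), indicator_of_notMem (show xl z ∉ _ from hz)]
      simp
  · refine lintegral_congr fun x => ?_
    by_cases hz : |x - c| < ρ
    · rw [indicator_of_mem (show x ∈ _ from hz), indicator_of_mem (show x ∈ _ from hz)]
      simp
    · rw [indicator_of_notMem (show x ∉ _ from hz), indicator_of_notMem (show x ∉ _ from hz)]
      simp

lemma IsHT.ns_eq_zero {v : ℝ × Ed (n + 1) → ℝ} (hv : IsHT v) (p : ℝ) {x : ℝ} (hx : x ≤ 0) :
    ns p x v = 0 := by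
  obtain ⟨δ, hδ, h⟩ := hv.vanish
  refine eLpNorm_eq_zero_of_ae_zero ?_
  filter_upwards [ae_sm x] with z hz
  exact h z (by rw [hz]; linarith)

lemma IsTest.continuous_ns {v : ℝ × Ed (n + 1) → ℝ} (hv : IsTest v) {p : ℝ} (hp : 0 < p) :
    Continuous fun x => (ns p x v).toReal := by
  obtain ⟨ρ, hρ⟩ := hv.compact.isCompact.isBounded.subset_closedBall 0
  have key : ∀ x, (ns p x v).toReal =
      (∫ y in Metric.closedBall (0 : ℝ × (Fin n → ℝ)) ρ, |v (sl n x y)| ^ p) ^ p⁻¹ := fun x => by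
    have h1 : ns p x v ^ p = ∫⁻ y in Metric.closedBall (0 : ℝ × (Fin n → ℝ)) ρ,
        ‖v (sl n x y)‖ₑ ^ p := by
      rw [ns_rpow hp x hv.measurable]
      refine (setLIntegral_eq_of_support_subset ?_).symm
      intro y hy
      have hy' : v (sl n x y) ≠ 0 := fun h0 => hy (by simp [h0, hp])
      have h2 := hρ (subset_tsupport _ hy')
      rw [mem_closedBall_zero_iff] at h2 ⊢
      have hρ0 : 0 ≤ ρ := (norm_nonneg _).trans h2
      rw [Prod.norm_def] at h2 ⊢
      refine max_le ((le_max_left _ _).trans h2) ((pi_norm_le_iff_of_nonneg hρ0).2 fun j => ?_)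
      rw [← sl_castSucc x y j]
      exact (PiLp.norm_apply_le _ _).trans ((le_max_right _ _).trans h2)
    rw [integral_eq_lintegral_of_nonneg_ae (Filter.Eventually.of_forall fun _ => by positivity)]
    · have h3 : ∀ y, ENNReal.ofReal (|v (sl n x y)| ^ p) = ‖v (sl n x y)‖ₑ ^ p := fun y => by
        rw [← ENNReal.ofReal_rpow_of_nonneg (abs_nonneg _) hp.le, ← Real.norm_eq_abs, ofReal_norm]
      simp only [h3]
      rw [← h1, ENNReal.toReal_rpow, ← ENNReal.rpow_mul, mul_inv_cancel₀ hp.ne', ENNReal.rpow_one]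
    · exact ((hv.continuous.comp (continuous_sl x)).abs.rpow_const
        fun _ => Or.inr hp.le).aestronglyMeasurable
  simp only [key]
  refine Continuous.rpow_const ?_ fun _ => Or.inr (by positivity)
  refine continuous_parametric_integral_of_continuous ?_ (isCompact_closedBall _ _)
  exact (hv.continuous.comp continuous_sl_uncurry).abs.rpow_const fun _ => Or.inr hp.le

end HalfSpaceTest

section Green

variable {n : ℕ} {p : ℝ}

lemma IsTest.ns_ne_top {v : ℝ × Ed (n + 1) → ℝ} (hv : IsTest v) (x : ℝ) : ns p x v ≠ ⊤ :=
  hv.eLpNorm_ne_top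

/-- Comparison of the slice norms with the Green function of `-d²/dx²` on `(0, A)`. -/
lemma ns_le_green (hp : 1 < p) (α : ℝ) {lam : ℝ} (hl : 0 ≤ lam) {v : ℝ × Ed (n + 1) → ℝ}
    (hv : IsHT v) {x A : ℝ} (hx : 0 < x) (hxA : x ≤ A) :
    ns p x v ≤ (∫⁻ y in Ioc 0 A, ENNReal.ofReal (min x y) * ns p y (fop α lam v)) +
      ENNReal.ofReal (x / A) * ns p A v := by
  have hp0 : 0 < p := by linarith
  have hp1 : 1 ≤ ENNReal.ofReal p := by simpa using hp.le
  have hA : 0 < A := hx.trans_le hxA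
  have hf := isHT_fop hv α lam
  set m : ℝ → ℝ := fun x => (ns p x v).toReal with hm
  set F : ℝ → ℝ := fun x => (ns p x (fop α lam v)).toReal with hF
  have hmo : ∀ x, ENNReal.ofReal (m x) = ns p x v := fun x => ENNReal.ofReal_toReal (hv.test.ns_ne_top x)
  have hFo : ∀ x, ENNReal.ofReal (F x) = ns p x (fop α lam v) := fun x =>
    ENNReal.ofReal_toReal (hf.test.ns_ne_top x)
  have hm0 : ∀ x, 0 ≤ m x := fun x => ENNReal.toReal_nonneg
  have hF0 : ∀ x, 0 ≤ F x := fun x => ENNReal.toReal_nonneg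
  have hFc : Continuous F := hf.test.continuous_ns hp0
  have key := le_green_of_second_difference (m := m) (F := F) (hv.test.continuous_ns hp0)
    hFc hF0 (by simp [hm, hv.ns_eq_zero p le_rfl]) hA (fun x hx0 _ => ?_) hx.le hxA
  · rw [← hmo, ← hmo, ← ENNReal.ofReal_mul (by positivity)]
    refine (ENNReal.ofReal_le_ofReal key).trans ?_
    refine ENNReal.ofReal_add_le.trans (add_le_add_left (le_of_eq ?_) _)
    rw [intervalIntegral.integral_of_le hA.le, ofReal_integral_eq_lintegral_ofReal]
    · refine setLIntegral_congr_fun measurableSet_Ioc fun y hy => ?_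
      rw [ENNReal.ofReal_mul (le_min hx.le hy.1.le), hFo]
    · refine (Continuous.integrableOn_Icc ?_).mono_set Ioc_subset_Icc_self
      fun_prop
    · refine (ae_restrict_iff' measurableSet_Ioc).2 (Filter.Eventually.of_forall fun y hy => ?_)
      exact mul_nonneg (le_min hx.le hy.1.le) (hF0 y)
  · obtain ⟨C, hC, h⟩ := exists_discrete_ineq (μ := sm n x) hp1 hv.test
      (a := x ^ (-α)) (lam := lam) (by positivity) hl hf.test.continuous.aestronglyMeasurable
      (by filter_upwards [ae_sm x] with z hz; rw [fop, hz])
    refine ⟨C.toReal, fun h' hh hh1 => ?_⟩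
    have h2 := h h' hh.le hh1
    have e1 : eLpNorm (fun z => v (z + h' ^ 2 • -et)) (ENNReal.ofReal p) (sm n x) = ns p x v := by
      rw [← ns, ns_add p x hv.test.measurable, map_smul, map_neg, xl_et]; simp
    have e2 : ∀ i : Fin n, eLpNorm (fun z => v (z + h' • ex (eb i.castSucc)))
        (ENNReal.ofReal p) (sm n x) = ns p x v := fun i => by
      rw [← ns, ns_add p x hv.test.measurable, map_smul, xl_eb]
      simp [(Fin.castSucc_lt_last i).ne]
    have e3 : ∀ i : Fin n, eLpNorm (fun z => v (z - h' • ex (eb i.castSucc)))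
        (ENNReal.ofReal p) (sm n x) = ns p x v := fun i => by
      simp only [sub_eq_add_neg]
      rw [← ns, ns_add p x hv.test.measurable, map_neg, map_smul, xl_eb]
      simp [(Fin.castSucc_lt_last i).ne]
    have e4 : eLpNorm (fun z => v (z + h' • ex (eb (Fin.last n))))
        (ENNReal.ofReal p) (sm n x) = ns p (x + h') v := by
      rw [← ns, ns_add p x hv.test.measurable, map_smul, xl_eb]; simp
    have e5 : eLpNorm (fun z => v (z - h' • ex (eb (Fin.last n))))
        (ENNReal.ofReal p) (sm n x) = ns p (x - h') v := by
      simp only [sub_eq_add_neg]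
      rw [← ns, ns_add p x hv.test.measurable, map_neg, map_smul, xl_eb]; simp
    rw [Fin.sum_univ_castSucc, e1, e4, e5] at h2
    simp only [e2, e3, Finset.sum_const, Finset.card_univ, Fintype.card_fin, nsmul_eq_mul] at h2
    have ec : (n : ℝ≥0∞) = ENNReal.ofReal n := by simp
    rw [ec, ← hmo, ← hmo, ← hmo, show eLpNorm (fop α lam v) (ENNReal.ofReal p) (sm n x) = _ from (hFo x).symm,
      show eLpNorm v (ENNReal.ofReal p) (sm n x) = _ from (hmo x).symm, ← ENNReal.ofReal_toReal hC] at h2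
    have p1 := hm0 x
    have p2 := hm0 (x + h')
    have p3 := hm0 (x - h')
    have p4 := hF0 x
    have p5 : 0 ≤ C.toReal := ENNReal.toReal_nonneg
    have p6 : 0 ≤ x ^ (-α) := by positivity
    rw [← ENNReal.ofReal_mul (by positivity), ← ENNReal.ofReal_mul (by positivity),
      ← ENNReal.ofReal_mul (by positivity), ← ENNReal.ofReal_mul (by positivity),
      ← ENNReal.ofReal_add p1 p1, ← ENNReal.ofReal_mul (by positivity),
      ← ENNReal.ofReal_add p2 p3,
      ← ENNReal.ofReal_add (by positivity) (by positivity),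
      ← ENNReal.ofReal_add (by positivity) (by positivity),
      ← ENNReal.ofReal_add (by positivity) (by positivity),
      ← ENNReal.ofReal_add (by positivity) (by positivity),
      ENNReal.ofReal_le_ofReal_iff (by positivity)] at h2
    push_cast at h2
    have p7 : 0 ≤ x ^ (-α) * lam * h' ^ 2 * m x := by positivity
    linarith

end Green

section PowerWeights

/-- The weight `x ^ γ` on the positive half line. -/
def pw (γ x : ℝ) : ℝ≥0∞ := (Ioi 0).indicator (fun x => ENNReal.ofReal (x ^ γ)) x

lemma pw_of_pos (γ : ℝ) {x : ℝ} (hx : 0 < x) : pw γ x = ENNReal.ofReal (x ^ γ) :=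
  indicator_of_mem (mem_Ioi.2 hx) _

lemma pw_of_nonpos (γ : ℝ) {x : ℝ} (hx : x ≤ 0) : pw γ x = 0 :=
  indicator_of_notMem (fun h => absurd (mem_Ioi.1 h) hx.not_gt) _

lemma measurable_pw (γ : ℝ) : Measurable (pw γ) :=
  (measurable_id.pow_const γ).ennreal_ofReal.indicator measurableSet_Ioi

lemma lintegral_comp_mul {σ : ℝ} (hσ : 0 < σ) {G : ℝ → ℝ≥0∞} (hG : Measurable G) :
    ∫⁻ r, G (σ * r) = ENNReal.ofReal σ⁻¹ * ∫⁻ r, G r := by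
  rw [← lintegral_map hG (measurable_const_mul σ), Real.map_volume_mul_left hσ.ne',
    lintegral_smul_measure, abs_of_pos (inv_pos.2 hσ), smul_eq_mul]

lemma lintegral_pw_comp_mul (γ : ℝ) {σ : ℝ} (hσ : 0 < σ) {G : ℝ → ℝ≥0∞} (hG : Measurable G) :
    ∫⁻ r, pw γ r * G (σ * r) = ENNReal.ofReal (σ ^ (-(γ + 1))) * ∫⁻ r, pw γ r * G r := by
  have h1 : ∀ r, pw γ r * G (σ * r) =
      ENNReal.ofReal (σ ^ (-γ)) * (pw γ (σ * r) * G (σ * r)) := fun r => by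
    rcases le_or_gt r 0 with hr | hr
    · rw [pw_of_nonpos γ hr, pw_of_nonpos γ (mul_nonpos_of_nonneg_of_nonpos hσ.le hr)]; simp
    · rw [pw_of_pos γ hr, pw_of_pos γ (mul_pos hσ hr), ← mul_assoc,
        ← ENNReal.ofReal_mul (by positivity), Real.mul_rpow hσ.le hr.le, ← mul_assoc,
        ← Real.rpow_add hσ, neg_add_cancel, Real.rpow_zero, one_mul]
  have hm : Measurable fun r => pw γ r * G r := (measurable_pw γ).mul hG
  have hm' : Measurable fun r => pw γ (σ * r) * G (σ * r) := hm.comp (measurable_const_mul σ)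
  simp only [h1]
  rw [lintegral_const_mul _ hm', lintegral_comp_mul (G := fun r => pw γ r * G r) hσ hm,
    ← mul_assoc, ← ENNReal.ofReal_mul (by positivity), ← Real.rpow_neg_one, ← Real.rpow_add hσ,
    show -γ + -1 = -(γ + 1) by ring]

variable {n : ℕ} {p : ℝ}

/-- The `p`-th power of the weighted norm. -/
def wn (γ p : ℝ) (g : ℝ × Ed (n + 1) → ℝ) : ℝ≥0∞ := ∫⁻ x, pw γ x * ns p x g ^ p

/-- The `x ^ (-1) dx` normalized mass of a window. -/
def wc (γ δ : ℝ) : ℝ≥0∞ := ∫⁻ r, pw (γ - 1) r * {r : ℝ | |1 - r| < δ * r}.indicator 1 r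

lemma measurableSet_window (δ : ℝ) : MeasurableSet {r : ℝ | |1 - r| < δ * r} :=
  measurableSet_lt (by fun_prop) (by fun_prop)

lemma lintegral_window (γ : ℝ) {δ : ℝ} (hδ : δ ≤ 1) (x : ℝ) :
    ∫⁻ r, pw (γ - 1) r * {r : ℝ | |x - r| < δ * r}.indicator 1 r = wc γ δ * pw γ x := by
  rcases le_or_gt x 0 with hx | hx
  · rw [pw_of_nonpos γ hx, mul_zero, lintegral_eq_zero_iff']
    · refine Filter.Eventually.of_forall fun r => ?_
      change pw (γ - 1) r * {r : ℝ | |x - r| < δ * r}.indicator 1 r = 0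
      rcases le_or_gt r 0 with hr | hr
      · simp [pw_of_nonpos _ hr]
      · rw [indicator_of_notMem]
        · simp
        · intro h
          have h' : |x - r| < δ * r := h
          rw [abs_of_nonpos (by linarith)] at h'
          nlinarith
    · exact ((measurable_pw _).mul (measurable_one.indicator
        (measurableSet_lt (by fun_prop) (by fun_prop)))).aemeasurable
  · have h1 := lintegral_pw_comp_mul (γ - 1) (inv_pos.2 hx)
      (G := {r : ℝ | |1 - r| < δ * r}.indicator 1)
      (measurable_one.indicator (measurableSet_window δ))
    have h2 : ∀ r, {r : ℝ | |1 - r| < δ * r}.indicator (1 : ℝ → ℝ≥0∞) (x⁻¹ * r) =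
        {r : ℝ | |x - r| < δ * r}.indicator 1 r := fun r => by
      have h3 : |1 - x⁻¹ * r| < δ * (x⁻¹ * r) ↔ |x - r| < δ * r := by
        have h4 : x - r = x * (1 - x⁻¹ * r) := by field_simp
        have h5 : δ * r = x * (δ * (x⁻¹ * r)) := by field_simp
        rw [h4, h5, abs_mul, abs_of_pos hx, mul_lt_mul_iff_right₀ hx]
      by_cases h : |x - r| < δ * r
      · rw [indicator_of_mem (show x⁻¹ * r ∈ {r : ℝ | |1 - r| < δ * r} from h3.2 h),
          indicator_of_mem (show r ∈ {r : ℝ | |x - r| < δ * r} from h)]; rfl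
      · rw [indicator_of_notMem (show x⁻¹ * r ∉ {r : ℝ | |1 - r| < δ * r} from fun h' => h (h3.1 h')),
          indicator_of_notMem (show r ∉ {r : ℝ | |x - r| < δ * r} from h)]
    simp only [h2] at h1
    rw [h1, pw_of_pos γ hx, mul_comm, wc]
    congr 2
    rw [sub_add_cancel, Real.inv_rpow hx.le, Real.rpow_neg hx.le, inv_inv]

lemma wc_ne_top (γ : ℝ) {δ : ℝ} (hδ : δ ≤ 1 / 2) : wc γ δ ≠ ⊤ := by
  have h : wc γ δ ≤ ∫⁻ r in Icc (1 / 2 : ℝ) 2, ENNReal.ofReal (r ^ (γ - 1)) := by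
    rw [wc, ← lintegral_indicator measurableSet_Icc]
    refine lintegral_mono fun r => ?_
    rcases le_or_gt r 0 with h0 | h0
    · simp [pw_of_nonpos _ h0]
    by_cases hr : |1 - r| < δ * r
    · have h1 := abs_lt.1 hr
      have : r ∈ Icc (1 / 2 : ℝ) 2 := ⟨by nlinarith, by nlinarith⟩
      rw [indicator_of_mem this, indicator_of_mem (show r ∈ {r : ℝ | |1 - r| < δ * r} from hr),
        pw_of_pos _ h0]
      simp
    · rw [indicator_of_notMem (show r ∉ {r : ℝ | |1 - r| < δ * r} from hr)]
      simp
  refine (h.trans_lt ?_).ne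
  have hc : ContinuousOn (fun r : ℝ => r ^ (γ - 1)) (Icc (1 / 2) 2) := fun r hr =>
    (Real.continuousAt_rpow_const _ _ (Or.inl (by linarith [hr.1] : 0 < r).ne')).continuousWithinAt
  exact (hc.integrableOn_Icc).lintegral_lt_top

lemma wc_ne_zero (γ : ℝ) {δ : ℝ} (hδ : 0 < δ) : wc γ δ ≠ 0 := by
  intro h0
  have hm : Measurable fun r => pw (γ - 1) r * {r : ℝ | |1 - r| < δ * r}.indicator 1 r :=
    (measurable_pw _).mul (measurable_one.indicator (measurableSet_window δ))
  rw [wc, lintegral_eq_zero_iff hm] at h0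
  have hO : IsOpen {r : ℝ | 0 < r ∧ |1 - r| < δ * r} :=
    (isOpen_lt continuous_const continuous_id).inter
      (isOpen_lt (continuous_const.sub continuous_id).abs (continuous_const.mul continuous_id))
  have h1 := hO.measure_pos volume ⟨1, one_pos, by simpa using hδ⟩
  refine h1.ne' (measure_mono_null (fun r hr => ?_) h0)
  obtain ⟨hr0, hr1⟩ := hr
  simp only [Pi.zero_apply, mem_compl_iff]
  intro h
  have h' : pw (γ - 1) r * {r : ℝ | |1 - r| < δ * r}.indicator 1 r = 0 := h
  rw [indicator_of_mem (show r ∈ {r : ℝ | |1 - r| < δ * r} from hr1), pw_of_pos _ hr0] at h'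
  have : 0 < r ^ (γ - 1) := by positivity
  simp [this.not_ge] at h'

lemma lintegral_pw_nl (hp : 0 < p) (γ : ℝ) {δ : ℝ} (hδ : δ ≤ 1) {g : ℝ × Ed (n + 1) → ℝ}
    (hg : Measurable g) : ∫⁻ r, pw (γ - 1) r * nl p r (δ * r) g ^ p = wc γ δ * wn γ p g := by
  have hs : MeasurableSet {q : ℝ × ℝ | |q.2 - q.1| < δ * q.1} :=
    measurableSet_lt (by fun_prop) (by fun_prop)
  have hn : Measurable fun x => ns p x g ^ p := (measurable_ns hp hg).pow_const p
  have hF : Measurable fun q : ℝ × ℝ => pw (γ - 1) q.1 *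
      ({q : ℝ × ℝ | |q.2 - q.1| < δ * q.1}.indicator 1 q * ns p q.2 g ^ p) :=
    ((measurable_pw _).comp measurable_fst).mul
      ((measurable_one.indicator hs).mul (hn.comp measurable_snd))
  have e : ∀ r x, {q : ℝ × ℝ | |q.2 - q.1| < δ * q.1}.indicator (1 : ℝ × ℝ → ℝ≥0∞) (r, x) =
      {r : ℝ | |x - r| < δ * r}.indicator 1 r := fun r x => by
    by_cases h : |x - r| < δ * r
    · rw [indicator_of_mem (show (r, x) ∈ {q : ℝ × ℝ | |q.2 - q.1| < δ * q.1} from h),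
        indicator_of_mem (show r ∈ {r : ℝ | |x - r| < δ * r} from h)]; rfl
    · rw [indicator_of_notMem (show (r, x) ∉ {q : ℝ × ℝ | |q.2 - q.1| < δ * q.1} from h),
        indicator_of_notMem (show r ∉ {r : ℝ | |x - r| < δ * r} from h)]
  calc ∫⁻ r, pw (γ - 1) r * nl p r (δ * r) g ^ p
      = ∫⁻ r, ∫⁻ x, pw (γ - 1) r *
        ({r : ℝ | |x - r| < δ * r}.indicator 1 r * ns p x g ^ p) := by
        refine lintegral_congr fun r => ?_
        have hm : MeasurableSet {x : ℝ | |x - r| < δ * r} :=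
          measurableSet_lt (by fun_prop) measurable_const
        rw [nl_rpow hp r _ hg, ← lintegral_indicator hm, ← lintegral_const_mul _ (hn.indicator hm)]
        refine lintegral_congr fun x => ?_
        congr 1
        by_cases h : |x - r| < δ * r
        · rw [indicator_of_mem (show x ∈ {x : ℝ | |x - r| < δ * r} from h),
            indicator_of_mem (show r ∈ {r : ℝ | |x - r| < δ * r} from h)]; simp
        · rw [indicator_of_notMem (show x ∉ {x : ℝ | |x - r| < δ * r} from h),
            indicator_of_notMem (show r ∉ {r : ℝ | |x - r| < δ * r} from h)]; simp
    _ = ∫⁻ x, ∫⁻ r, pw (γ - 1) r *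
        ({r : ℝ | |x - r| < δ * r}.indicator 1 r * ns p x g ^ p) := by
        refine lintegral_lintegral_swap (f := fun r x => pw (γ - 1) r *
          ({r : ℝ | |x - r| < δ * r}.indicator 1 r * ns p x g ^ p)) ?_
        simp only [e] at hF
        exact hF.aemeasurable
    _ = ∫⁻ x, wc γ δ * (pw γ x * ns p x g ^ p) := by
        refine lintegral_congr fun x => ?_
        simp only [← mul_assoc]
        have hm : Measurable fun r => pw (γ - 1) r * {r : ℝ | |x - r| < δ * r}.indicator 1 r :=
          (measurable_pw _).mul (measurable_one.indicator
            (measurableSet_lt (by fun_prop) (by fun_prop)))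
        rw [lintegral_mul_const _ hm, lintegral_window γ hδ x]
    _ = wc γ δ * wn γ p g := by
        have hm : Measurable fun x => pw γ x * ns p x g ^ p := (measurable_pw γ).mul hn
        rw [lintegral_const_mul _ hm, wn]

lemma lintegral_hardy_le (hp : 1 < p) (γ : ℝ) {k : ℝ → ℝ≥0∞} (hk : Measurable k)
    (hk0 : ∀ σ ≤ 0, k σ = 0) {F : ℝ → ℝ≥0∞} (hF : Measurable F) :
    ∫⁻ r, pw γ r * (∫⁻ σ, k σ * F (σ * r)) ^ p ≤
      (∫⁻ σ, k σ * ENNReal.ofReal (σ ^ (-(γ + 1) / p))) ^ p * ∫⁻ r, pw γ r * F r ^ p := by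
  have hp0 : 0 < p := by linarith
  set X := ∫⁻ r, pw γ r * F r ^ p with hX
  have hpw : ∀ r, pw (γ / p) r ^ p = pw γ r := fun r => by
    rcases le_or_gt r 0 with hr | hr
    · rw [pw_of_nonpos _ hr, pw_of_nonpos _ hr, ENNReal.zero_rpow_of_pos hp0]
    · rw [pw_of_pos _ hr, pw_of_pos _ hr, ENNReal.ofReal_rpow_of_nonneg (by positivity) hp0.le,
        ← Real.rpow_mul hr.le, div_mul_cancel₀ _ hp0.ne']
  have hkF : ∀ r, Measurable fun σ => k σ * F (σ * r) := fun r =>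
    hk.mul (hF.comp (by fun_prop))
  have hw : Measurable fun σ : ℝ => ENNReal.ofReal (σ ^ (-(γ + 1) / p)) :=
    (measurable_id.pow_const _).ennreal_ofReal
  have hkw : Measurable fun σ : ℝ => k σ * ENNReal.ofReal (σ ^ (-(γ + 1) / p)) := hk.mul hw
  have h := lintegral_lintegral_rpow_le (μ := (volume : Measure ℝ)) (ν := (volume : Measure ℝ)) hp
    (F := fun r σ => pw (γ / p) r * (k σ * F (σ * r)))
    (w := fun σ => k σ * ENNReal.ofReal (σ ^ (-(γ + 1) / p)) * X ^ p⁻¹)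
    (((measurable_pw _).comp measurable_fst).mul ((hk.comp measurable_snd).mul
      (hF.comp (by fun_prop : Measurable fun q : ℝ × ℝ => q.2 * q.1))))
    (hkw.mul_const _) (fun σ => ?_)
  · rw [lintegral_mul_const _ hkw, ENNReal.mul_rpow_of_nonneg _ _ hp0.le,
      ← ENNReal.rpow_mul, inv_mul_cancel₀ hp0.ne', ENNReal.rpow_one] at h
    refine le_trans (le_of_eq (lintegral_congr fun r => ?_)) h
    rw [lintegral_const_mul _ (hkF r), ENNReal.mul_rpow_of_nonneg _ _ hp0.le, hpw]
  · rcases le_or_gt σ 0 with hσ | hσ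
    · simp [hk0 σ hσ, hp0]
    · have e : ∀ r, (pw (γ / p) r * (k σ * F (σ * r))) ^ p =
          k σ ^ p * (pw γ r * F (σ * r) ^ p) := fun r => by
        rw [ENNReal.mul_rpow_of_nonneg _ _ hp0.le, ENNReal.mul_rpow_of_nonneg _ _ hp0.le, hpw]
        ring
      simp only [e]
      have hFp : Measurable fun x => F x ^ p := hF.pow_const p
      have hm : Measurable fun r => pw γ r * F (σ * r) ^ p :=
        (measurable_pw γ).mul (hFp.comp (measurable_const_mul σ))
      rw [lintegral_const_mul _ hm,
        lintegral_pw_comp_mul γ hσ (G := fun x => F x ^ p) hFp,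
        ENNReal.mul_rpow_of_nonneg _ _ hp0.le, ENNReal.mul_rpow_of_nonneg _ _ hp0.le,
        ← ENNReal.rpow_mul, inv_mul_cancel₀ hp0.ne', ENNReal.rpow_one,
        ENNReal.ofReal_rpow_of_nonneg (by positivity) hp0.le, ← Real.rpow_mul hσ.le,
        div_mul_cancel₀ _ hp0.ne', mul_assoc]

end PowerWeights

section HardyCombination

variable {n : ℕ} {p : ℝ}

lemma add_three_rpow_le (hp : 0 ≤ p) (a b c : ℝ≥0∞) :
    (a + b + c) ^ p ≤ 3 ^ p * (a ^ p + b ^ p + c ^ p) := by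
  have h1 : a + b + c ≤ 3 * max (max a b) c := by
    have e : (3 : ℝ≥0∞) = 1 + 1 + 1 := by norm_num
    rw [e, add_mul, add_mul, one_mul]
    exact add_le_add (add_le_add ((le_max_left _ _).trans (le_max_left _ _))
      ((le_max_right _ _).trans (le_max_left _ _))) (le_max_right _ _)
  refine (ENNReal.rpow_le_rpow h1 hp).trans ?_
  rw [ENNReal.mul_rpow_of_nonneg _ _ hp]
  refine mul_le_mul_right ?_ _
  rcases max_choice (max a b) c with h | h
  · rw [h]
    rcases max_choice a b with h | h
    · rw [h, add_assoc]; exact le_self_add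
    · rw [h]; exact le_add_self.trans le_self_add
  · rw [h]; exact le_add_self

/-- The Hardy kernel `min (1, σ)` on `(0, Λ]`. -/
def hk (Λ σ : ℝ) : ℝ≥0∞ := (Ioc 0 Λ).indicator (fun σ => ENNReal.ofReal (min 1 σ)) σ

lemma measurable_hk (Λ : ℝ) : Measurable (hk Λ) :=
  (measurable_const.min measurable_id).ennreal_ofReal.indicator measurableSet_Ioc

lemma hk_of_nonpos (Λ : ℝ) {σ : ℝ} (hσ : σ ≤ 0) : hk Λ σ = 0 :=
  indicator_of_notMem (fun h => absurd h.1 hσ.not_gt) _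

lemma lintegral_hk_ne_top (Λ : ℝ) {s : ℝ} (hs : -2 < s) :
    ∫⁻ σ, hk Λ σ * ENNReal.ofReal (σ ^ s) ≠ ⊤ := by
  rcases le_or_gt Λ 0 with hΛ | hΛ
  · have : ∀ σ, hk Λ σ = 0 := fun σ =>
      indicator_of_notMem (fun h => absurd (h.1.trans_le (h.2.trans hΛ)) (lt_irrefl _)) _
    simp [this]
  have h : ∫⁻ σ, hk Λ σ * ENNReal.ofReal (σ ^ s) ≤
      ∫⁻ σ in Ioc 0 Λ, ENNReal.ofReal (σ ^ (1 + s)) := by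
    rw [← lintegral_indicator measurableSet_Ioc]
    refine lintegral_mono fun σ => ?_
    by_cases hσ : σ ∈ Ioc 0 Λ
    · rw [hk, indicator_of_mem hσ, indicator_of_mem hσ, ← ENNReal.ofReal_mul (le_min zero_le_one hσ.1.le),
        Real.rpow_add hσ.1, Real.rpow_one]
      refine ENNReal.ofReal_le_ofReal (mul_le_mul_of_nonneg_right (min_le_right _ _) ?_)
      exact Real.rpow_nonneg hσ.1.le _
    · rw [hk, indicator_of_notMem hσ, zero_mul]; exact zero_le
  refine (h.trans_lt ?_).ne
  have hi := (intervalIntegral.intervalIntegrable_rpow' (a := 0) (b := Λ)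
    (by linarith : -1 < 1 + s)).1
  exact hi.lintegral_lt_top

/-- Integration of local bounds over all scales. -/
lemma wn_le_of_local (hp : 1 < p) {γ : ℝ} (hγ : γ < 2 * p - 1) {ε : ℝ} (hε : 0 < ε)
    (hε' : ε ≤ 1 / 4) (N b : ℝ) :
    ∃ C₀ : ℝ≥0∞, C₀ ≠ ⊤ ∧ ∀ Λ : ℝ, 0 < Λ → ∃ C₁ : ℝ≥0∞, C₁ ≠ ⊤ ∧
      ∀ f Q Q₀ : ℝ × Ed (n + 1) → ℝ, Measurable f → Measurable Q → Measurable Q₀ →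
        (∀ r, 0 < r → nl p r (ε * r) Q ≤ ENNReal.ofReal N * (nl p r (2 * ε * r) f +
          ENNReal.ofReal (r ^ p⁻¹) * (3 * ∫⁻ σ, hk Λ σ * ns p (σ * r) f) +
          ENNReal.ofReal (r ^ p⁻¹) * (2 * ENNReal.ofReal (Λ ^ (1 - b)) * ns p (Λ * r) Q₀))) →
        wn γ p Q ≤ C₁ * wn γ p f +
          C₀ * ENNReal.ofReal (Λ ^ (p * (1 - b) - (γ + 1))) * wn γ p Q₀ := by
  have hp0 : 0 < p := by linarith
  have hc0 := wc_ne_zero γ hε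
  have hct := wc_ne_top γ (by linarith : ε ≤ 1 / 2)
  have hct2 := wc_ne_top γ (by linarith : 2 * ε ≤ 1 / 2)
  set D : ℝ≥0∞ := (wc γ ε)⁻¹ * (ENNReal.ofReal N ^ p * 3 ^ p) with hD
  have hDt : D ≠ ⊤ := by
    refine ENNReal.mul_ne_top (ENNReal.inv_ne_top.2 hc0) (ENNReal.mul_ne_top ?_ ?_) <;>
      exact ENNReal.rpow_ne_top_of_nonneg hp0.le (by simp)
  refine ⟨D * 2 ^ p, ENNReal.mul_ne_top hDt (ENNReal.rpow_ne_top_of_nonneg hp0.le (by simp)), fun Λ hΛ => ?_⟩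
  set K := ∫⁻ σ, hk Λ σ * ENNReal.ofReal (σ ^ (-(γ + 1) / p)) with hK
  have hKt : K ≠ ⊤ := lintegral_hk_ne_top Λ (by rw [lt_div_iff₀ hp0]; linarith)
  refine ⟨D * (wc γ (2 * ε) + 3 ^ p * K ^ p), ENNReal.mul_ne_top hDt (ENNReal.add_ne_top.2
    ⟨hct2, ENNReal.mul_ne_top (ENNReal.rpow_ne_top_of_nonneg hp0.le (by simp))
      (ENNReal.rpow_ne_top_of_nonneg hp0.le hKt)⟩), fun f Q Q₀ hf hQ hQ₀ h => ?_⟩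
  have hmf := measurable_ns (n := n) hp0 hf
  have hmQ := measurable_ns (n := n) hp0 hQ₀
  set I : ℝ → ℝ≥0∞ := fun r => ∫⁻ σ, hk Λ σ * ns p (σ * r) f with hI
  have hIm : Measurable I := by
    have : Measurable fun q : ℝ × ℝ => hk Λ q.2 * ns p (q.2 * q.1) f :=
      ((measurable_hk Λ).comp measurable_snd).mul
        (hmf.comp (by fun_prop : Measurable fun q : ℝ × ℝ => q.2 * q.1))
    exact this.lintegral_prod_right'
  have hmQp : Measurable fun x => ns p x Q₀ ^ p := hmQ.pow_const p
  have hr : ∀ r, pw (γ - 1) r * nl p r (ε * r) Q ^ p ≤ (ENNReal.ofReal N ^ p * 3 ^ p) *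
      (pw (γ - 1) r * nl p r (2 * ε * r) f ^ p + 3 ^ p * (pw γ r * I r ^ p) +
        2 ^ p * ENNReal.ofReal (Λ ^ (p * (1 - b))) * (pw γ r * ns p (Λ * r) Q₀ ^ p)) := fun r => by
    rcases le_or_gt r 0 with hr | hr
    · simp [pw_of_nonpos _ hr]
    refine (mul_le_mul_right (ENNReal.rpow_le_rpow (h r hr) hp0.le) _).trans ?_
    rw [ENNReal.mul_rpow_of_nonneg _ _ hp0.le]
    refine (mul_le_mul_right (mul_le_mul_right (add_three_rpow_le hp0.le _ _ _) _) _).trans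
      (le_of_eq ?_)
    have e1 : pw γ r = pw (γ - 1) r * ENNReal.ofReal r := by
      rw [pw_of_pos _ hr, pw_of_pos _ hr, ← ENNReal.ofReal_mul (by positivity)]
      congr 1
      rw [← Real.rpow_add_one hr.ne', sub_add_cancel]
    have e2 : ENNReal.ofReal (r ^ p⁻¹) ^ p = ENNReal.ofReal r := by
      rw [ENNReal.ofReal_rpow_of_nonneg (by positivity) hp0.le, ← Real.rpow_mul hr.le,
        inv_mul_cancel₀ hp0.ne', Real.rpow_one]
    have e3 : ENNReal.ofReal (Λ ^ (1 - b)) ^ p = ENNReal.ofReal (Λ ^ (p * (1 - b))) := by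
      rw [ENNReal.ofReal_rpow_of_nonneg (by positivity) hp0.le, ← Real.rpow_mul hΛ.le, mul_comm]
    simp only [ENNReal.mul_rpow_of_nonneg _ _ hp0.le, e1, e2, e3]
    ring
  have hint : wc γ ε * wn γ p Q ≤ (ENNReal.ofReal N ^ p * 3 ^ p) *
      (wc γ (2 * ε) * wn γ p f + 3 ^ p * (K ^ p * wn γ p f) +
        2 ^ p * ENNReal.ofReal (Λ ^ (p * (1 - b))) *
          (ENNReal.ofReal (Λ ^ (-(γ + 1))) * wn γ p Q₀)) := by
    have m2 : Measurable fun r => pw γ r * I r ^ p := (measurable_pw γ).mul (hIm.pow_const p)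
    have m3 : Measurable fun r => pw γ r * ns p (Λ * r) Q₀ ^ p :=
      (measurable_pw γ).mul (hmQp.comp (measurable_const_mul Λ))
    have m2' : Measurable fun r => 3 ^ p * (pw γ r * I r ^ p) := m2.const_mul _
    have m3' : Measurable fun r => 2 ^ p * ENNReal.ofReal (Λ ^ (p * (1 - b))) *
      (pw γ r * ns p (Λ * r) Q₀ ^ p) := m3.const_mul _
    rw [← lintegral_pw_nl hp0 γ (by linarith) hQ, ← lintegral_pw_nl hp0 γ (by linarith) hf]
    refine (lintegral_mono hr).trans ?_
    rw [lintegral_const_mul' _ _ (ENNReal.mul_ne_top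
      (ENNReal.rpow_ne_top_of_nonneg hp0.le (by simp))
      (ENNReal.rpow_ne_top_of_nonneg hp0.le (by simp)))]
    refine mul_le_mul_right ?_ _
    rw [lintegral_add_right _ m3', lintegral_add_right _ m2', lintegral_const_mul _ m2,
      lintegral_const_mul _ m3]
    refine add_le_add (add_le_add le_rfl (mul_le_mul_right ?_ _)) (mul_le_mul_right ?_ _)
    · exact lintegral_hardy_le hp γ (measurable_hk Λ) (fun σ hσ => hk_of_nonpos Λ hσ) hmf
    · exact (lintegral_pw_comp_mul γ hΛ (G := fun x => ns p x Q₀ ^ p) hmQp).le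
  calc wn γ p Q = (wc γ ε)⁻¹ * (wc γ ε * wn γ p Q) := by
        rw [← mul_assoc, ENNReal.inv_mul_cancel hc0 hct, one_mul]
    _ ≤ _ := mul_le_mul_right hint _
    _ = _ := by
        rw [show p * (1 - b) - (γ + 1) = p * (1 - b) + -(γ + 1) by ring, Real.rpow_add hΛ, ENNReal.ofReal_mul (by positivity), hD]
        ring

/-- The scale-integrated bound after absorbing the remote term. -/
lemma wn_le_of_local_absorb (hp : 1 < p) {γ : ℝ} (hγ : γ < 2 * p - 1) {ε : ℝ} (hε : 0 < ε)
    (hε' : ε ≤ 1 / 4) (N : ℝ) {b : ℝ} (hb : p * (1 - b) - (γ + 1) < 0) :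
    ∃ Λ : ℝ, 2 ≤ Λ ∧ ∃ C : ℝ≥0∞, C ≠ ⊤ ∧
      ∀ f Q Q₀ : ℝ × Ed (n + 1) → ℝ, Measurable f → Measurable Q → Measurable Q₀ →
        wn γ p Q₀ ≠ ⊤ →
        (∀ G, (G = Q ∨ G = Q₀) → ∀ r, 0 < r → nl p r (ε * r) G ≤
          ENNReal.ofReal N * (nl p r (2 * ε * r) f +
          ENNReal.ofReal (r ^ p⁻¹) * (3 * ∫⁻ σ, hk Λ σ * ns p (σ * r) f) +
          ENNReal.ofReal (r ^ p⁻¹) * (2 * ENNReal.ofReal (Λ ^ (1 - b)) * ns p (Λ * r) Q₀))) →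
        wn γ p Q ≤ C * wn γ p f := by
  obtain ⟨C₀, hC₀, h⟩ := wn_le_of_local (n := n) hp hγ hε hε' N b
  obtain ⟨Λ, hΛ2, hΛ⟩ : ∃ Λ : ℝ, 2 ≤ Λ ∧
      C₀ * ENNReal.ofReal (Λ ^ (p * (1 - b) - (γ + 1))) ≤ 1 / 2 := by
    have ht : Filter.Tendsto (fun Λ : ℝ => C₀ * ENNReal.ofReal (Λ ^ (p * (1 - b) - (γ + 1))))
        Filter.atTop (nhds (C₀ * ENNReal.ofReal 0)) := by
      refine ENNReal.Tendsto.const_mul (ENNReal.tendsto_ofReal ?_) (Or.inr hC₀)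
      have := tendsto_rpow_neg_atTop (y := -(p * (1 - b) - (γ + 1))) (by linarith)
      simpa using this
    simp only [ENNReal.ofReal_zero, mul_zero] at ht
    have h2 := (ht.eventually (gt_mem_nhds (show (0 : ℝ≥0∞) < 1 / 2 by simp))).and
      (Filter.eventually_ge_atTop 2)
    obtain ⟨Λ, h3, h4⟩ := h2.exists
    exact ⟨Λ, h4, h3.le⟩
  obtain ⟨C₁, hC₁, h1⟩ := h Λ (by linarith)
  refine ⟨Λ, hΛ2, 2 * C₁, ENNReal.mul_ne_top (by simp) hC₁, fun f Q Q₀ hf hQ hQ₀ ht hl => ?_⟩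
  have hhalf : (1 / 2 : ℝ≥0∞) * 2 = 1 := by
    rw [one_div, ENNReal.inv_mul_cancel (by simp) (by simp)]
  have a0 := h1 f Q₀ Q₀ hf hQ₀ hQ₀ (hl Q₀ (Or.inr rfl))
  have a1 := h1 f Q Q₀ hf hQ hQ₀ (hl Q (Or.inl rfl))
  have b0 : wn γ p Q₀ ≤ 2 * (C₁ * wn γ p f) := by
    have h5 : wn γ p Q₀ ≤ C₁ * wn γ p f + 1 / 2 * wn γ p Q₀ :=
      a0.trans (add_le_add_right (mul_le_mul_left hΛ _) _)
    have h6 : 1 / 2 * wn γ p Q₀ ≠ ⊤ := ENNReal.mul_ne_top (by simp) ht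
    have h7 : 1 / 2 * wn γ p Q₀ + 1 / 2 * wn γ p Q₀ ≤ C₁ * wn γ p f + 1 / 2 * wn γ p Q₀ := by
      rwa [← add_mul, one_div, ENNReal.inv_two_add_inv_two, one_mul, ← one_div]
    have h8 : 1 / 2 * wn γ p Q₀ ≤ C₁ * wn γ p f := (ENNReal.add_le_add_iff_right h6).1 h7
    calc wn γ p Q₀ = 2 * (1 / 2 * wn γ p Q₀) := by rw [← mul_assoc, mul_comm 2, hhalf, one_mul]
      _ ≤ _ := mul_le_mul_right h8 _
  calc wn γ p Q ≤ C₁ * wn γ p f + 1 / 2 * (2 * (C₁ * wn γ p f)) :=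
        a1.trans (add_le_add_right ((mul_le_mul_left hΛ _).trans (mul_le_mul_right b0 _)) _)
    _ = 2 * C₁ * wn γ p f := by rw [← mul_assoc, hhalf]; ring

end HardyCombination

section TangentialDifferences

variable {n : ℕ} {p : ℝ}

/-- Difference with a damped translate. -/
def tdiff {H : Type*} [NormedAddCommGroup H] [NormedSpace ℝ H] (κ : ℝ) (e : H) (s : ℝ) (u : H → ℝ)
    (z : H) : ℝ := u z - Real.exp (-(κ * s)) * u (z + s • e)

/-- Generator of the damped translations. -/
def gen {H : Type*} [NormedAddCommGroup H] [NormedSpace ℝ H] (κ : ℝ) (e : H) (u : H → ℝ)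
    (z : H) : ℝ := κ * u z - dd e u z

section Generic

variable {H : Type*} [NormedAddCommGroup H] [NormedSpace ℝ H] {κ : ℝ} {e : H} {u : H → ℝ}

lemma IsTest.comp_add_const (hu : IsTest u) (e : H) : IsTest fun z => u (z + e) :=
  ⟨hu.contDiff.comp (contDiff_id.add contDiff_const), hu.compact.comp_homeomorph (Homeomorph.addRight e)⟩

lemma IsTest.tdiff (hu : IsTest u) (κ : ℝ) (e : H) (s : ℝ) : IsTest (tdiff κ e s u) :=
  hu.sub ((hu.comp_add_const (s • e)).const_mul _)

lemma IsTest.gen (hu : IsTest u) (κ : ℝ) (e : H) : IsTest (gen κ e u) :=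
  (hu.const_mul κ).sub (hu.dd e)

lemma dd_tdiff (hu : IsTest u) (κ : ℝ) (e : H) (s : ℝ) (w : H) :
    dd w (tdiff κ e s u) = tdiff κ e s (dd w u) := by
  funext z
  unfold tdiff
  rw [dd_sub hu ((hu.comp_add_const _).const_mul _), dd_const_mul (hu.comp_add_const _),
    dd_comp_add]

lemma gen_tdiff (hu : IsTest u) (κ : ℝ) (e : H) (s : ℝ) (z : H) :
    gen κ e (tdiff κ e s u) z = gen κ e u z - Real.exp (-(κ * s)) * gen κ e u (z + s • e) := by
  simp only [gen, dd_tdiff hu]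
  simp only [tdiff]
  ring

lemma hasDerivAt_damped (hu : IsTest u) (κ : ℝ) (e z : H) (s : ℝ) :
    HasDerivAt (fun s : ℝ => -(Real.exp (-(κ * s)) * u (z + s • e)))
      (Real.exp (-(κ * s)) * gen κ e u (z + s • e)) s := by
  have h1 : HasDerivAt (fun s : ℝ => Real.exp (-(κ * s))) (Real.exp (-(κ * s)) * -(κ * 1)) s :=
    (((hasDerivAt_id s).const_mul κ).fun_neg).exp
  exact (h1.fun_mul (hasDerivAt_line hu z e s)).fun_neg.congr_deriv (by simp [gen]; ring)

lemma continuous_damped (hu : IsTest u) (κ : ℝ) (e : H) :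
    Continuous fun q : H × ℝ => Real.exp (-(κ * q.2)) * gen κ e u (q.1 + q.2 • e) := by
  have := (hu.gen κ e).continuous
  fun_prop

variable [MeasurableSpace H] [BorelSpace H] {μ : Measure H} [SFinite μ]

lemma eLpNorm_tdiff_le (hp : 1 < p) (hu : IsTest u) {h : ℝ} (hh : 0 ≤ h) {W : ℝ≥0∞}
    (hW : ∀ s ∈ Ioc 0 h, eLpNorm (fun z => Real.exp (-(κ * s)) * gen κ e u (z + s • e))
      (ENNReal.ofReal p) μ ≤ W) :
    eLpNorm (tdiff κ e h u) (ENNReal.ofReal p) μ ≤ ENNReal.ofReal h * W := by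
  have := eLpNorm_remainder_le (μ := μ) hp
    (ψ := fun z s => -(Real.exp (-(κ * s)) * u (z + s • e)))
    (ψ' := fun z s => Real.exp (-(κ * s)) * gen κ e u (z + s • e)) (c := fun _ => 0) hh
    (fun z s => hasDerivAt_damped hu κ e z s)
    (fun z => (continuous_damped hu κ e).comp (by fun_prop : Continuous fun s : ℝ => (z, s)))
    (continuous_damped hu κ e).measurable measurable_const (by simpa using hW)
  refine le_trans (le_of_eq ?_) this
  congr 1
  funext z
  simp [tdiff]
  ring

lemma eLpNorm_gen_le (hp : 1 < p) (hu : IsTest u) {h : ℝ} (hh : 0 < h) {W V : ℝ≥0∞}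
    (hW : ∀ s ∈ Ioc 0 h, eLpNorm (gen κ e (tdiff κ e s u)) (ENNReal.ofReal p) μ ≤ W)
    (hV : ENNReal.ofReal h⁻¹ * eLpNorm (tdiff κ e h u) (ENNReal.ofReal p) μ ≤ V) :
    eLpNorm (gen κ e u) (ENNReal.ofReal p) μ ≤ W + V := by
  have hp1 : 1 ≤ ENNReal.ofReal p := by simpa using hp.le
  have h1 := eLpNorm_remainder_le (μ := μ) hp
    (ψ := fun z s => -(Real.exp (-(κ * s)) * u (z + s • e)))
    (ψ' := fun z s => Real.exp (-(κ * s)) * gen κ e u (z + s • e)) (c := gen κ e u) hh.le (W := W)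
    (fun z s => hasDerivAt_damped hu κ e z s)
    (fun z => (continuous_damped hu κ e).comp (by fun_prop : Continuous fun s : ℝ => (z, s)))
    (continuous_damped hu κ e).measurable (hu.gen κ e).measurable (fun s hs => by
      refine le_trans (le_of_eq ?_) (hW s hs)
      rw [← eLpNorm_neg]
      congr 1
      funext z
      simp [gen_tdiff hu])
  have e1 : ∀ z, -(Real.exp (-(κ * h)) * u (z + h • e)) -
      -(Real.exp (-(κ * 0)) * u (z + (0 : ℝ) • e)) - h * gen κ e u z =
      tdiff κ e h u z - h * gen κ e u z := fun z => by
    simp [tdiff]; ring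
  simp only [e1] at h1
  have hm : IsTest fun z => tdiff κ e h u z - h * gen κ e u z :=
    (hu.tdiff κ e h).sub ((hu.gen κ e).const_mul h)
  have h2 := eLpNorm_le_two_of_abs_le (μ := μ) hp1 (f := gen κ e u) (a := h⁻¹) (b := h⁻¹)
    (g := fun z => tdiff κ e h u z - h * gen κ e u z) (g' := tdiff κ e h u)
    (by positivity) (by positivity) hm.continuous.aestronglyMeasurable
    (hu.tdiff κ e h).continuous.aestronglyMeasurable (Filter.Eventually.of_forall fun z => by
      rw [← mul_add, inv_mul_eq_div, le_div_iff₀ hh, mul_comm]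
      nth_rw 1 [← abs_of_pos hh]
      rw [← abs_mul]
      have := abs_sub (tdiff κ e h u z) (tdiff κ e h u z - h * gen κ e u z)
      rw [_root_.sub_sub_cancel] at this
      linarith)
  refine h2.trans (add_le_add ?_ hV)
  refine (mul_le_mul_right h1 _).trans (le_of_eq ?_)
  rw [← mul_assoc, ← ENNReal.ofReal_mul (by positivity), inv_mul_cancel₀ hh.ne', ENNReal.ofReal_one,
    one_mul]

end Generic

variable {κ : ℝ} {e : ℝ × Ed (n + 1)} {u : ℝ × Ed (n + 1) → ℝ}

lemma IsHT.tdiff (hu : IsHT u) (κ : ℝ) (he : xl e = 0) (s : ℝ) : IsHT (tdiff κ e s u) :=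
  hu.sub ((hu.comp_add (by rw [map_smul, he, smul_zero])).const_mul _)

lemma tdiff_rpow_mul (β κ : ℝ) (he : xl e = 0) (s : ℝ) (z : ℝ × Ed (n + 1)) :
    tdiff κ e s (fun z => xl z ^ β * u z) z = xl z ^ β * tdiff κ e s u z := by
  simp only [tdiff, map_add, map_smul, he, smul_zero, add_zero]
  ring

lemma gen_rpow_mul (hu : IsHT u) (β κ : ℝ) (he : xl e = 0) (z : ℝ × Ed (n + 1)) :
    gen κ e (fun z => xl z ^ β * u z) z = xl z ^ β * gen κ e u z := by
  have h1 := hasDerivAt_line (hu.rpow_mul β).test z e 0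
  have h2 := (hasDerivAt_line hu.test z e 0).const_mul (xl z ^ β)
  simp only [map_add, map_smul, he, smul_zero, add_zero, zero_smul] at h1 h2
  rw [gen, gen, h1.unique h2]
  ring

lemma fop_tdiff (α lam : ℝ) (hu : IsHT u) (κ : ℝ) (he : xl e = 0) (s : ℝ) (z : ℝ × Ed (n + 1)) :
    fop α lam (tdiff κ e s u) z =
      fop α lam u z - Real.exp (-(κ * s)) * fop α lam u (z + s • e) := by
  have hs : xl (s • e) = 0 := by rw [map_smul, he, smul_zero]
  unfold tdiff
  rw [fop_sub _ _ hu.test ((hu.comp_add hs).const_mul _).test,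
    fop_const_mul _ _ _ (hu.comp_add hs).test, fop_comp_add _ _ _ hs]

lemma ns_damped_le (hκ : 0 ≤ κ) (he : xl e = 0) {g : ℝ × Ed (n + 1) → ℝ} (hg : Measurable g)
    {s : ℝ} (hs : 0 ≤ s) (x : ℝ) :
    ns p x (fun z => Real.exp (-(κ * s)) * g (z + s • e)) ≤ ns p x g := by
  rw [ns, eLpNorm_const_mul_real (X := ℝ × Ed (n + 1)), ← ns, ns_add p x hg, map_smul, he, smul_zero, add_zero,
    abs_of_pos (Real.exp_pos _)]
  refine mul_le_of_le_one_left' (by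
    rw [ENNReal.ofReal_le_one, Real.exp_le_one_iff]
    have := mul_nonneg hκ hs
    linarith)

lemma ns_tdiff_le (hp : 1 < p) (hu : IsTest u) (hκ : 0 ≤ κ) (he : xl e = 0) {s : ℝ} (hs : 0 ≤ s)
    (x : ℝ) : ns p x (tdiff κ e s u) ≤ ENNReal.ofReal s * ns p x (gen κ e u) :=
  eLpNorm_tdiff_le hp hu hs fun _ hs' => ns_damped_le hκ he (hu.gen κ e).measurable hs'.1.le x

lemma ns_fop_tdiff_le (hp : 1 < p) (α lam : ℝ) (hu : IsHT u) (hκ : 0 ≤ κ) (he : xl e = 0) {s : ℝ}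
    (hs : 0 ≤ s) (x : ℝ) : ns p x (fop α lam (tdiff κ e s u)) ≤ 2 * ns p x (fop α lam u) := by
  have hp1 : 1 ≤ ENNReal.ofReal p := by simpa using hp.le
  have hf := (isHT_fop hu α lam).test
  have h := eLpNorm_le_two_of_abs_le (μ := sm n x) hp1 (f := fop α lam (tdiff κ e s u)) (a := 1)
    (b := 1) (g := fop α lam u) (g' := fun z => Real.exp (-(κ * s)) * fop α lam u (z + s • e))
    zero_le_one zero_le_one hf.continuous.aestronglyMeasurable
    ((hf.comp_add_const _).const_mul _).continuous.aestronglyMeasurable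
    (Filter.Eventually.of_forall fun z => by
      rw [fop_tdiff α lam hu κ he, one_mul, one_mul]; exact abs_sub _ _)
  rw [ENNReal.ofReal_one, one_mul, one_mul] at h
  rw [two_mul]
  exact h.trans (add_le_add le_rfl (ns_damped_le hκ he hf.measurable hs x))

lemma nl_le_of_ns_le (hp : 0 < p) {c ρ : ℝ} {g g' : ℝ × Ed (n + 1) → ℝ} (hg : Measurable g)
    (hg' : Measurable g') {C : ℝ≥0∞}
    (h : ∀ x, ns p x g ≤ C * ns p x g') : nl p c ρ g ≤ C * nl p c ρ g' := by
  rw [← ENNReal.rpow_le_rpow_iff hp, ENNReal.mul_rpow_of_nonneg _ _ hp.le, nl_rpow hp c ρ hg,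
    nl_rpow hp c ρ hg', ← lintegral_const_mul _ ((measurable_ns hp hg').pow_const p)]
  refine lintegral_mono fun x => ?_
  rw [← ENNReal.mul_rpow_of_nonneg _ _ hp.le]
  exact ENNReal.rpow_le_rpow (h x) hp.le

lemma nl_le_of_ns_le_const (hp : 0 < p) {c ρ : ℝ} {g : ℝ × Ed (n + 1) → ℝ}
    (hg : Measurable g) {C : ℝ≥0∞} (h : ∀ x, |x - c| < ρ → ns p x g ≤ C) :
    nl p c ρ g ≤ ENNReal.ofReal ((2 * ρ) ^ p⁻¹) * C := by
  rcases le_or_gt ρ 0 with hρ | hρ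
  · have : {x : ℝ | |x - c| < ρ} = ∅ := by
      ext x; simp only [mem_empty_iff_false, iff_false]
      exact fun h => absurd (lt_of_le_of_lt (abs_nonneg _) (show |x - c| < ρ from h)) hρ.not_gt
    have h0 : nl p c ρ g ^ p = 0 := by rw [nl_rpow hp c ρ hg, this]; simp
    rw [ENNReal.rpow_eq_zero_iff_of_pos hp] at h0
    rw [h0]; exact zero_le
  rw [← ENNReal.rpow_le_rpow_iff hp, ENNReal.mul_rpow_of_nonneg _ _ hp.le, nl_rpow hp c ρ hg,
    ENNReal.ofReal_rpow_of_nonneg (by positivity) hp.le, ← Real.rpow_mul (by positivity),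
    inv_mul_cancel₀ hp.ne', Real.rpow_one]
  have hb : {x : ℝ | |x - c| < ρ} = Metric.ball c ρ := by
    ext x; simp [Real.dist_eq]
  have hm : MeasurableSet {x : ℝ | |x - c| < ρ} := hb ▸ measurableSet_ball
  calc ∫⁻ x in {x | |x - c| < ρ}, ns p x g ^ p ≤ ∫⁻ x in {x : ℝ | |x - c| < ρ}, C ^ p :=
        setLIntegral_mono' hm fun x hx => ENNReal.rpow_le_rpow (h x hx) hp.le
    _ = _ := by rw [setLIntegral_const, hb, Real.volume_ball, mul_comm]

lemma nl_rpow_mul_le {r ε β : ℝ} (hr : 0 < r) (hε : ε ≤ 1 / 4) (hβ : -2 ≤ β) (hβ' : β ≤ 0)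
    (g : ℝ × Ed (n + 1) → ℝ) :
    nl p r (ε * r) (fun z => xl z ^ β * g z) ≤ ENNReal.ofReal (2 * r ^ β) * nl p r (ε * r) g := by
  rw [← abs_of_pos (show 0 < 2 * r ^ β by positivity), nl, ← eLpNorm_const_mul_real]
  refine eLpNorm_mono_ae ?_
  refine (ae_restrict_iff' (measurableSet_lset r (ε * r))).2 (Filter.Eventually.of_forall fun z hz => ?_)
  have hz' : |xl z - r| < ε * r := hz
  have h1 : 3 / 4 * r ≤ xl z := by
    have := (abs_lt.1 hz').1
    nlinarith
  have h0 : 0 < xl z := lt_of_lt_of_le (by positivity) h1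
  rw [Real.norm_eq_abs, Real.norm_eq_abs, abs_mul (xl z ^ β), abs_mul (2 * r ^ β),
    abs_of_pos (show 0 < 2 * r ^ β by positivity), abs_of_pos (Real.rpow_pos_of_pos h0 β)]
  refine mul_le_mul_of_nonneg_right ?_ (abs_nonneg _)
  calc xl z ^ β ≤ (3 / 4 * r) ^ β := Real.rpow_le_rpow_of_nonpos (by positivity) h1 hβ'
    _ = (3 / 4 : ℝ) ^ β * r ^ β := Real.mul_rpow (by norm_num) hr.le
    _ ≤ 2 * r ^ β := by
        refine mul_le_mul_of_nonneg_right ?_ (by positivity)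
        calc (3 / 4 : ℝ) ^ β ≤ (3 / 4 : ℝ) ^ (-2 : ℝ) :=
              Real.rpow_le_rpow_of_exponent_ge (by norm_num) (by norm_num) hβ
          _ ≤ 2 := by
              rw [Real.rpow_neg (by norm_num)]; norm_num

end TangentialDifferences

section LocalBounds

variable {n : ℕ} {p : ℝ}

lemma ns_rpow_mul (β : ℝ) {x : ℝ} (hx : 0 < x) (g : ℝ × Ed (n + 1) → ℝ) :
    ns p x (fun z => xl z ^ β * g z) = ENNReal.ofReal (x ^ β) * ns p x g := by
  rw [← abs_of_pos (Real.rpow_pos_of_pos hx β), ns, ns, ← eLpNorm_const_mul_real]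
  refine eLpNorm_congr_ae ?_
  filter_upwards [ae_sm x] with z hz
  rw [hz]

/-- The nonlocal majorant at scale `r`. -/
def scaleBound (p Λ b r : ℝ) (f Q₀ : ℝ × Ed (n + 1) → ℝ) : ℝ≥0∞ :=
  3 * (∫⁻ σ, hk Λ σ * ns p (σ * r) f) + 2 * ENNReal.ofReal (Λ ^ (1 - b)) * ns p (Λ * r) Q₀

lemma ns_tdiff_le_scaleBound (hp : 1 < p) (α : ℝ) {lam : ℝ} (hl : 0 ≤ lam)
    {u : ℝ × Ed (n + 1) → ℝ} (hu : IsHT u) {κ : ℝ} (hκ : 0 ≤ κ) {e : ℝ × Ed (n + 1)}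
    (he : xl e = 0) {r Λ b s x : ℝ} (hr : 0 < r) (hΛ : 2 ≤ Λ) (hs : 0 ≤ s) (hsr : s ≤ r ^ b)
    (hx : |x - r| < r / 2) :
    ns p x (tdiff κ e s u) ≤ ENNReal.ofReal (r ^ 2) *
      scaleBound p Λ b r (fop α lam u) (fun z => xl z ^ (b - 2) * gen κ e u z) := by
  have hp0 : 0 < p := by linarith
  have hx' := abs_lt.1 hx
  have hx0 : 0 < x := by linarith
  have hA : 0 < Λ * r := by positivity
  have hxA : x ≤ Λ * r := by nlinarith
  have hf := (isHT_fop hu α lam).test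
  have hmf := measurable_ns (n := n) hp0 hf.measurable
  refine (ns_le_green hp α hl (hu.tdiff κ he s) hx0 hxA).trans ?_
  rw [scaleBound, mul_add]
  refine add_le_add ?_ ?_
  · have hG : Measurable fun y => (Ioc 0 (Λ * r)).indicator
        (fun y => ENNReal.ofReal (min r y) * ns p y (fop α lam u)) y :=
      ((measurable_const.min measurable_id).ennreal_ofReal.mul hmf).indicator measurableSet_Ioc
    have h1 : ∀ σ, (Ioc 0 (Λ * r)).indicator
        (fun y => ENNReal.ofReal (min r y) * ns p y (fop α lam u)) (r * σ) =
        ENNReal.ofReal r * (hk Λ σ * ns p (σ * r) (fop α lam u)) := fun σ => by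
      have hiff : r * σ ∈ Ioc 0 (Λ * r) ↔ σ ∈ Ioc 0 Λ := by
        rw [mul_comm Λ r, mem_Ioc, mem_Ioc, mul_le_mul_iff_right₀ hr, mul_pos_iff_of_pos_left hr]
      by_cases h : σ ∈ Ioc 0 Λ
      · rw [indicator_of_mem (hiff.2 h), hk, indicator_of_mem h, ← mul_assoc,
          ← ENNReal.ofReal_mul hr.le, mul_min_of_nonneg _ _ hr.le, mul_one, mul_comm r σ]
      · rw [indicator_of_notMem (fun h' => h (hiff.1 h')), hk, indicator_of_notMem h]; simp
    have h2 := lintegral_comp_mul hr hG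
    simp only [h1] at h2
    have hm : Measurable fun σ => hk Λ σ * ns p (σ * r) (fop α lam u) :=
      (measurable_hk Λ).mul (hmf.comp (measurable_mul_const r))
    rw [lintegral_const_mul _ hm] at h2
    calc ∫⁻ y in Ioc 0 (Λ * r), ENNReal.ofReal (min x y) * ns p y (fop α lam (tdiff κ e s u))
        ≤ ∫⁻ y, 3 * (Ioc 0 (Λ * r)).indicator
          (fun y => ENNReal.ofReal (min r y) * ns p y (fop α lam u)) y := by
          rw [← lintegral_indicator measurableSet_Ioc]
          refine lintegral_mono fun y => ?_
          by_cases hy : y ∈ Ioc 0 (Λ * r)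
          · rw [indicator_of_mem hy, indicator_of_mem hy]
            have h3 : ENNReal.ofReal (min x y) ≤ ENNReal.ofReal (3 / 2 * min r y) := by
              refine ENNReal.ofReal_le_ofReal ?_
              rw [mul_min_of_nonneg _ _ (by norm_num)]
              exact min_le_min (by linarith) (by linarith [hy.1])
            refine (mul_le_mul' h3 (ns_fop_tdiff_le hp α lam hu hκ he hs y)).trans (le_of_eq ?_)
            have h4 : (3 : ℝ≥0∞) = ENNReal.ofReal (3 / 2) * 2 := by
              rw [show (2 : ℝ≥0∞) = ENNReal.ofReal 2 by simp, ← ENNReal.ofReal_mul (by norm_num)]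
              norm_num
            rw [ENNReal.ofReal_mul (by norm_num), h4]
            ring
          · rw [indicator_of_notMem hy]; exact zero_le
      _ = 3 * (ENNReal.ofReal r * (ENNReal.ofReal r⁻¹ * ∫⁻ y, (Ioc 0 (Λ * r)).indicator
          (fun y => ENNReal.ofReal (min r y) * ns p y (fop α lam u)) y)) := by
          rw [lintegral_const_mul _ hG, ← mul_assoc (ENNReal.ofReal r),
            ← ENNReal.ofReal_mul hr.le, mul_inv_cancel₀ hr.ne', ENNReal.ofReal_one, one_mul]
      _ = _ := by
          rw [← h2, sq, ENNReal.ofReal_mul hr.le]; ring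
  · rw [ns_rpow_mul _ hA]
    calc ENNReal.ofReal (x / (Λ * r)) * ns p (Λ * r) (tdiff κ e s u)
        ≤ ENNReal.ofReal (2 * Λ⁻¹) *
          (ENNReal.ofReal (r ^ b) * ns p (Λ * r) (gen κ e u)) := by
          refine mul_le_mul' (ENNReal.ofReal_le_ofReal ?_)
            ((ns_tdiff_le hp hu.test hκ he hs _).trans
              (mul_le_mul_left (ENNReal.ofReal_le_ofReal hsr) _))
          rw [div_le_iff₀ hA]
          have : 2 * Λ⁻¹ * (Λ * r) = 2 * r := by field_simp
          linarith
      _ = _ := by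
          have hΛ0 : 0 < Λ := by linarith
          have e2 : (2 : ℝ≥0∞) = ENNReal.ofReal 2 := by simp
          generalize ns p (Λ * r) (gen κ e u) = Y
          rw [e2]
          simp only [← mul_assoc]
          rw [← ENNReal.ofReal_mul (by positivity), ← ENNReal.ofReal_mul (by positivity),
            ← ENNReal.ofReal_mul (by positivity), ← ENNReal.ofReal_mul (by positivity)]
          congr 2
          rw [Real.mul_rpow hΛ0.le hr.le, ← Real.rpow_neg_one Λ, ← Real.rpow_natCast r 2]
          have e3 : r ^ b = r ^ ((2 : ℕ) : ℝ) * r ^ (b - 2) := by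
            rw [← Real.rpow_add hr]; push_cast; ring_nf
          have e4 : Λ ^ (-1 : ℝ) = Λ ^ (1 - b) * Λ ^ (b - 2) := by
            rw [← Real.rpow_add hΛ0]; ring_nf
          rw [e3, e4]; ring

lemma gen_neg_et (lam : ℝ) (u : ℝ × Ed (n + 1) → ℝ) :
    gen lam (-et) u = fun z => dd et u z + lam * u z := by
  funext z; rw [gen, dd_neg_left]; ring

lemma gen_zero_neg (v : ℝ × Ed (n + 1)) (u : ℝ × Ed (n + 1) → ℝ) : gen 0 (-v) u = dd v u := by
  funext z; rw [gen, dd_neg_left]; ring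

/-- Local bounds by the nonlocal majorant. -/
lemma exists_local_bounds (n : ℕ) {p : ℝ} (hp : 1 < p) {α : ℝ} (hα : α ∈ Ioo (0 : ℝ) 2) :
    ∃ ε N : ℝ, 0 < ε ∧ ε ≤ 1 / 4 ∧ 0 < N ∧ ∀ lam : ℝ, 0 ≤ lam →
      ∀ u : ℝ × Ed (n + 1) → ℝ, IsHT u → ∀ r Λ : ℝ, 0 < r → 2 ≤ Λ →
      nl p r (ε * r) (fun z => xl z ^ (2 - α - 2) * gen lam (-et) u z) ≤ ENNReal.ofReal N *
        (nl p r (2 * ε * r) (fop α lam u) + ENNReal.ofReal (r ^ p⁻¹) *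
          scaleBound p Λ (2 - α) r (fop α lam u)
            (fun z => xl z ^ (2 - α - 2) * gen lam (-et) u z)) ∧
      ∀ i : Fin n, ∀ Q : ℝ × Ed (n + 1) → ℝ,
        ((∃ j, Q = dd (ex (eb i.castSucc)) (dd (ex (eb j)) u)) ∨
          Q = fun z => xl z ^ ((1 : ℝ) - 2) * gen 0 (-ex (eb i.castSucc)) u z) →
        nl p r (ε * r) Q ≤ ENNReal.ofReal N *
          (nl p r (2 * ε * r) (fop α lam u) + ENNReal.ofReal (r ^ p⁻¹) *
            scaleBound p Λ 1 r (fop α lam u)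
              (fun z => xl z ^ ((1 : ℝ) - 2) * gen 0 (-ex (eb i.castSucc)) u z)) := by
  have hp0 : 0 < p := by linarith
  obtain ⟨ε, N, hε, hε', hN, hint⟩ := exists_interior_estimate n hp α
  refine ⟨ε, 4 * N + 2, hε, hε', by positivity, fun lam hl u hu r Λ hr hΛ => ?_⟩
  have key : ∀ κ : ℝ, 0 ≤ κ → ∀ e : ℝ × Ed (n + 1), xl e = 0 → ∀ b s : ℝ, 0 < s → s ≤ r ^ b →
      ENNReal.ofReal (r ^ 2)⁻¹ * nl p r (2 * ε * r) (tdiff κ e s u) ≤ ENNReal.ofReal (r ^ p⁻¹) *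
        scaleBound p Λ b r (fop α lam u) (fun z => xl z ^ (b - 2) * gen κ e u z) :=
    fun κ hκ e he b s hs hsr => by
    have h1 := nl_le_of_ns_le_const (c := r) (ρ := 2 * ε * r) hp0 (hu.test.tdiff κ e s).measurable
      (fun x hx => ns_tdiff_le_scaleBound (b := b) hp α hl hu hκ he hr hΛ hs.le hsr
        (hx.trans_le (by nlinarith)))
    refine (mul_le_mul_right h1 _).trans ?_
    rw [mul_left_comm, ← mul_assoc (ENNReal.ofReal (r ^ 2)⁻¹), ← ENNReal.ofReal_mul (by positivity),
      inv_mul_cancel₀ (by positivity), ENNReal.ofReal_one, one_mul]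
    refine mul_le_mul_left (ENNReal.ofReal_le_ofReal ?_) _
    exact Real.rpow_le_rpow (by positivity) (by nlinarith) (by positivity)
  have hfop : ∀ κ : ℝ, 0 ≤ κ → ∀ e : ℝ × Ed (n + 1), xl e = 0 → ∀ s : ℝ, 0 < s →
      nl p r (2 * ε * r) (fop α lam (tdiff κ e s u)) ≤ 2 * nl p r (2 * ε * r) (fop α lam u) :=
    fun κ hκ e he s hs => nl_le_of_ns_le hp0 (isHT_fop (hu.tdiff κ he s) α lam).test.measurable
      (isHT_fop hu α lam).test.measurable fun x => ns_fop_tdiff_le hp α lam hu hκ he hs.le x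
  have hi : ∀ v, IsHT v → _ := fun v hv => hint r lam hr hl v (fop α lam v) hv.test
    (isHT_fop hv α lam).test.measurable (fun z _ => rfl)
  set a := nl p r (2 * ε * r) (fop α lam u) with ha
  have hfin : ∀ V : ℝ≥0∞, 2 * (ENNReal.ofReal N * (2 * a + V)) + 2 * V ≤
      ENNReal.ofReal (4 * N + 2) * (a + V) := fun V => by
    have e : ENNReal.ofReal (4 * N + 2) = 4 * ENNReal.ofReal N + 2 := by
      rw [ENNReal.ofReal_add (by positivity) (by norm_num), ENNReal.ofReal_mul (by norm_num)]
      simp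
    rw [e]
    calc 2 * (ENNReal.ofReal N * (2 * a + V)) + 2 * V
        ≤ 2 * (ENNReal.ofReal N * (2 * a + V)) + 2 * V + (2 * ENNReal.ofReal N * V + 2 * a) :=
          le_self_add
      _ = _ := by ring
  have hweight : ∀ b : ℝ, b ∈ Icc (0 : ℝ) 2 → ∀ (V : ℝ≥0∞) (g : ℝ × Ed (n + 1) → ℝ),
      ENNReal.ofReal (r ^ 2)⁻¹ * nl p r (2 * ε * r) g ≤ V →
      ENNReal.ofReal (r ^ b)⁻¹ * nl p r (ε * r) (fun z => xl z ^ (b - 2) * g z) ≤ 2 * V :=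
    fun b hb V g hV => by
    refine (mul_le_mul_right (nl_rpow_mul_le hr hε' (by linarith [hb.1]) (by linarith [hb.2]) g)
      _).trans ?_
    refine le_trans ?_ (mul_le_mul_right hV 2)
    rw [← mul_assoc, ← mul_assoc, ← ENNReal.ofReal_mul (by positivity)]
    refine mul_le_mul' (le_of_eq ?_) (nl_mono (by nlinarith) g)
    rw [show (2 : ℝ≥0∞) = ENNReal.ofReal 2 by simp, ← ENNReal.ofReal_mul (by norm_num)]
    congr 1
    rw [Real.rpow_sub hr, Real.rpow_two]
    field_simp
  have het : xl (-et : ℝ × Ed (n + 1)) = 0 := by rw [map_neg, xl_et, neg_zero]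
  refine ⟨?_, fun i Q hQ => ?_⟩
  · set V := ENNReal.ofReal (r ^ p⁻¹) * scaleBound p Λ (2 - α) r (fop α lam u)
      (fun z => xl z ^ (2 - α - 2) * gen lam (-et) u z) with hV
    set g : ℝ × Ed (n + 1) → ℝ := fun z => xl z ^ (2 - α - 2) * u z with hg
    have hgt : IsHT g := hu.rpow_mul _
    have e1 : (fun z => xl z ^ (2 - α - 2) * gen lam (-et) u z) = gen lam (-et) g :=
      funext fun z => (gen_rpow_mul hu _ _ het z).symm
    have hrb : 0 < r ^ (2 - α) := by positivity
    rw [e1]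
    refine (eLpNorm_gen_le (μ := lay n r (ε * r)) (W := ENNReal.ofReal N * (2 * a + V))
      (V := 2 * V) hp hgt.test hrb (fun s hs => ?_) ?_).trans (le_trans ?_ (hfin V))
    · have e2 : gen lam (-et) (tdiff lam (-et) s g) =
          fun z => xl z ^ (-α) * (dd et (tdiff lam (-et) s u) z + lam * tdiff lam (-et) s u z) := by
        funext z
        rw [show tdiff lam (-et) s g = fun z => xl z ^ (2 - α - 2) * tdiff lam (-et) s u z from
          funext fun z => tdiff_rpow_mul _ _ het s z, gen_rpow_mul (hu.tdiff lam het s) _ _ het,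
          gen_neg_et, show 2 - α - 2 = -α by ring]
      rw [e2]
      refine ((hi _ (hu.tdiff lam het s)).2.1).trans (mul_le_mul_right ?_ _)
      exact add_le_add (hfop lam hl _ het s hs.1) (key lam hl _ het _ s hs.1 hs.2)
    · rw [show tdiff lam (-et) (r ^ (2 - α)) g = fun z => xl z ^ (2 - α - 2) *
          tdiff lam (-et) (r ^ (2 - α)) u z from funext fun z => tdiff_rpow_mul _ _ het _ z]
      exact hweight (2 - α) ⟨by linarith [hα.2], by linarith [hα.1]⟩ V _
        (key lam hl _ het _ _ hrb le_rfl)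
    · exact add_le_add (le_mul_of_one_le_left' one_le_two) le_rfl
  · set E : ℝ × Ed (n + 1) := ex (eb i.castSucc) with hE
    have hE0 : xl (-E) = 0 := by
      rw [map_neg, hE, xl_eb, if_neg (Fin.castSucc_lt_last i).ne, neg_zero]
    set V := ENNReal.ofReal (r ^ p⁻¹) * scaleBound p Λ 1 r (fop α lam u)
      (fun z => xl z ^ ((1 : ℝ) - 2) * gen 0 (-E) u z) with hV
    have hW : ∀ s, 0 < s → s ≤ r → ENNReal.ofReal N *
        (nl p r (2 * ε * r) (fop α lam (tdiff 0 (-E) s u)) + ENNReal.ofReal (r ^ 2)⁻¹ *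
          nl p r (2 * ε * r) (tdiff 0 (-E) s u)) ≤ ENNReal.ofReal N * (2 * a + V) :=
      fun s hs hsr => mul_le_mul_right (add_le_add (hfop 0 le_rfl _ hE0 s hs)
        (key 0 le_rfl _ hE0 1 s hs (by rwa [Real.rpow_one]))) _
    rcases hQ with ⟨j, rfl⟩ | rfl
    · rw [← gen_zero_neg]
      refine (eLpNorm_gen_le (μ := lay n r (ε * r)) (W := ENNReal.ofReal N * (2 * a + V))
        (V := ENNReal.ofReal N * (2 * a + V)) hp (hu.test.dd _) hr (fun s hs => ?_) ?_).trans
        (le_trans ?_ (hfin V))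
      · rw [← dd_tdiff hu.test, gen_zero_neg]
        exact ((hi _ (hu.tdiff 0 hE0 s)).1 _ _).trans (hW s hs.1 hs.2)
      · rw [← dd_tdiff hu.test]
        exact ((hi _ (hu.tdiff 0 hE0 r)).2.2 _).trans (hW r hr le_rfl)
      · rw [← two_mul]; exact le_self_add
    · set g : ℝ × Ed (n + 1) → ℝ := fun z => xl z ^ ((1 : ℝ) - 2) * u z with hg
      have hgt : IsHT g := hu.rpow_mul _
      have e1 : (fun z => xl z ^ ((1 : ℝ) - 2) * gen 0 (-E) u z) = gen 0 (-E) g :=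
        funext fun z => (gen_rpow_mul hu _ _ hE0 z).symm
      rw [e1]
      have e3 : ∀ s, tdiff 0 (-E) s g = fun z => xl z ^ ((1 : ℝ) - 2) * tdiff 0 (-E) s u z :=
        fun s => funext fun z => tdiff_rpow_mul _ _ hE0 s z
      refine (eLpNorm_gen_le (μ := lay n r (ε * r)) (W := 2 * (ENNReal.ofReal N * (2 * a + V)))
        (V := 2 * V) hp hgt.test hr (fun s hs => ?_) ?_).trans (hfin V)
      · have e2 : gen 0 (-E) (tdiff 0 (-E) s g) =
            fun z => xl z ^ ((1 : ℝ) - 2) * dd E (tdiff 0 (-E) s u) z := by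
          funext z
          rw [e3, gen_rpow_mul (hu.tdiff 0 hE0 s) _ _ hE0, gen_zero_neg]
        rw [e2]
        refine (nl_rpow_mul_le hr hε' (by norm_num) (by norm_num) _).trans ?_
        have h3 := ((hi _ (hu.tdiff 0 hE0 s)).2.2 i.castSucc).trans (hW s hs.1 hs.2)
        refine le_trans (le_of_eq ?_) (mul_le_mul_right h3 2)
        have e4 : ENNReal.ofReal (2 * r ^ ((1 : ℝ) - 2)) = 2 * ENNReal.ofReal r⁻¹ := by
          rw [ENNReal.ofReal_mul (by norm_num), show (1 : ℝ) - 2 = -1 by norm_num,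
            Real.rpow_neg_one]
          simp
        rw [e4, mul_assoc]
      · rw [e3]
        have := hweight 1 ⟨by norm_num, by norm_num⟩ V _
          (key 0 le_rfl _ hE0 1 r hr (by rw [Real.rpow_one]))
        rwa [Real.rpow_one] at this

end LocalBounds

section WeightedSpace

variable {n : ℕ} {p : ℝ}

/-- The measure `x_d ^ γ dz` on the half space. -/
def wm (n : ℕ) (γ : ℝ) : Measure (ℝ × Ed (n + 1)) := volume.withDensity fun z => pw γ (xl z)

lemma measurable_pw_xl (γ : ℝ) : Measurable fun z : ℝ × Ed (n + 1) => pw γ (xl z) :=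
  (measurable_pw γ).comp xl.continuous.measurable

/-- The weighted norm on the half space. -/
abbrev wN (γ p : ℝ) (g : ℝ × Ed (n + 1) → ℝ) : ℝ≥0∞ := eLpNorm g (ENNReal.ofReal p) (wm n γ)

lemma wN_rpow_eq_lintegral (hp : 0 < p) (γ : ℝ) {g : ℝ × Ed (n + 1) → ℝ} (hg : Measurable g) :
    wN γ p g ^ p = ∫⁻ z, pw γ (xl z) * ‖g z‖ₑ ^ p := by
  rw [eLpNorm_rpow_eq _ hp, wm,
    lintegral_withDensity_eq_lintegral_mul _ (measurable_pw_xl γ) (hg.enorm.pow_const p)]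
  rfl

lemma wN_rpow (hp : 0 < p) (γ : ℝ) {g : ℝ × Ed (n + 1) → ℝ} (hg : Measurable g) :
    wN γ p g ^ p = wn γ p g := by
  rw [wN_rpow_eq_lintegral hp γ hg, lintegral_weight_slice hp (measurable_pw γ) hg, wn]

lemma IsHT.wn_ne_top (hp : 0 < p) (γ : ℝ) {g : ℝ × Ed (n + 1) → ℝ} (hg : IsHT g) :
    wn γ p g ≠ ⊤ := by
  rw [← wN_rpow hp γ hg.test.measurable, wN_rpow_eq_lintegral hp γ hg.test.measurable]
  have e : ∀ z, pw γ (xl z) * ‖g z‖ₑ ^ p = ‖xl z ^ (γ / p) * g z‖ₑ ^ p := fun z => by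
    rcases lt_or_ge 0 (xl z) with hz | hz
    · rw [pw_of_pos γ hz, enorm_mul, ENNReal.mul_rpow_of_nonneg _ _ hp.le,
        Real.enorm_eq_ofReal (Real.rpow_pos_of_pos hz _).le,
        ENNReal.ofReal_rpow_of_nonneg (Real.rpow_pos_of_pos hz _).le hp.le, ← Real.rpow_mul hz.le,
        div_mul_cancel₀ _ hp.ne']
    · obtain ⟨δ, hδ, h⟩ := hg.vanish
      simp [h z (hz.trans_lt hδ), hp]
  simp only [e]
  rw [← eLpNorm_rpow_eq (μ := volume) (fun z => xl z ^ (γ / p) * g z) hp]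
  exact ENNReal.rpow_ne_top_of_nonneg hp.le (hg.rpow_mul _).test.eLpNorm_ne_top

lemma wN_le_of_wn_le (hp : 0 < p) {γ : ℝ} {f g : ℝ × Ed (n + 1) → ℝ} (hf : Measurable f)
    (hg : Measurable g) {C : ℝ≥0∞} (h : wn γ p g ≤ C * wn γ p f) :
    wN γ p g ≤ C ^ p⁻¹ * wN γ p f := by
  rw [← ENNReal.rpow_le_rpow_iff hp, ENNReal.mul_rpow_of_nonneg _ _ hp.le, ← ENNReal.rpow_mul,
    inv_mul_cancel₀ hp.ne', ENNReal.rpow_one, wN_rpow hp γ hf, wN_rpow hp γ hg]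
  exact h

/-- Accretivity of `∂_t` on the slices. -/
lemma ns_le_ns_gen (hp : 1 < p) {lam : ℝ} (hl : 0 ≤ lam) {u : ℝ × Ed (n + 1) → ℝ} (hu : IsTest u)
    (x : ℝ) : ENNReal.ofReal lam * ns p x u ≤ ns p x (gen lam (-et) u) := by
  have het : xl (-et : ℝ × Ed (n + 1)) = 0 := by rw [map_neg, xl_et, neg_zero]
  have hA := hu.ns_ne_top (p := p) x
  have hG := (hu.gen lam (-et)).ns_ne_top (p := p) x
  refine le_of_forall_add_mul (C := ENNReal.ofReal lam * ns p x (gen lam (-et) u))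
    (ENNReal.mul_ne_top ENNReal.ofReal_ne_top hG) fun s hs _ => ?_
  have h1 := ns_tdiff_le hp hu hl het hs.le x
  have h2 : ns p x u ≤ ENNReal.ofReal 1 * ns p x (tdiff lam (-et) s u) +
      ENNReal.ofReal (Real.exp (-(lam * s))) * ns p x (fun z => u (z + s • -et)) :=
    eLpNorm_le_two_of_abs_le (by rw [← ENNReal.ofReal_one]; exact ENNReal.ofReal_le_ofReal hp.le)
      zero_le_one (Real.exp_pos _).le (hu.tdiff lam (-et) s).measurable.aestronglyMeasurable
      (hu.measurable.comp (measurable_add_const _)).aestronglyMeasurable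
      (Filter.Eventually.of_forall fun z => by
        rw [one_mul, ← abs_of_pos (Real.exp_pos (-(lam * s))), ← abs_mul]
        refine (le_of_eq ?_).trans (abs_add_le _ _)
        rw [tdiff, sub_add_cancel])
  rw [ns_add p x hu.measurable, map_smul, het, smul_zero, add_zero, ENNReal.ofReal_one,
    one_mul] at h2
  replace h2 := h2.trans (add_le_add h1 le_rfl)
  rw [← ENNReal.ofReal_toReal hA, ← ENNReal.ofReal_toReal hG] at h2 ⊢
  have hA0 : 0 ≤ (ns p x u).toReal := ENNReal.toReal_nonneg
  have hG0 : 0 ≤ (ns p x (gen lam (-et) u)).toReal := ENNReal.toReal_nonneg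
  revert h2
  generalize (ns p x u).toReal = A at hA0 ⊢
  generalize (ns p x (gen lam (-et) u)).toReal = G at hG0 ⊢
  intro h2
  have hq := Real.exp_pos (-(lam * s))
  rw [← ENNReal.ofReal_mul hs.le, ← ENNReal.ofReal_mul hq.le, ← ENNReal.ofReal_add (by positivity)
    (by positivity), ENNReal.ofReal_le_ofReal_iff (by positivity)] at h2
  rw [← ENNReal.ofReal_mul hl, ← ENNReal.ofReal_mul hl, ← ENNReal.ofReal_mul hs.le,
    ← ENNReal.ofReal_add (by positivity) (by positivity)]
  refine ENNReal.ofReal_le_ofReal ?_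
  have h3 : Real.exp (-(lam * s)) * (1 + lam * s) ≤ 1 := by
    rw [Real.exp_neg, inv_mul_le_iff₀ (Real.exp_pos _), mul_one, add_comm]
    exact Real.add_one_le_exp _
  have h4 : 0 ≤ 1 + lam * s := by positivity
  have h5 := mul_le_mul_of_nonneg_right h2 h4
  have h6 := mul_le_mul_of_nonneg_right h3 hA0
  refine le_of_mul_le_mul_left ?_ hs
  nlinarith

lemma wN_damping_le (hp : 1 < p) (γ α : ℝ) {lam : ℝ} (hl : 0 ≤ lam) {u : ℝ × Ed (n + 1) → ℝ}
    (hu : IsHT u) : ENNReal.ofReal lam * wN γ p (fun z => xl z ^ (-α) * u z) ≤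
      wN γ p (fun z => xl z ^ (-α) * (dd et u z + lam * u z)) := by
  have hp0 : 0 < p := by linarith
  have h1 := (hu.rpow_mul (-α)).test.measurable
  have h2 : Measurable fun z => xl z ^ (-α) * (dd et u z + lam * u z) :=
    (((hu.dd et).add (hu.const_mul lam)).rpow_mul (-α)).test.measurable
  rw [← abs_of_nonneg hl, ← eLpNorm_const_mul_real, abs_of_nonneg hl,
    ← ENNReal.rpow_le_rpow_iff hp0, wN_rpow hp0 γ h2, wN_rpow hp0 γ (h1.const_mul lam)]
  refine lintegral_mono fun x => ?_
  rcases lt_or_ge 0 x with hx | hx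
  · refine mul_le_mul_right (ENNReal.rpow_le_rpow ?_ hp0.le) _
    rw [ns, eLpNorm_const_mul_real, abs_of_nonneg hl]
    change ENNReal.ofReal lam * ns p x (fun z => xl z ^ (-α) * u z) ≤ _
    rw [ns_rpow_mul _ hx, ns_rpow_mul _ hx, mul_left_comm, ← gen_neg_et]
    exact mul_le_mul_right (ns_le_ns_gen hp hl hu.test x) _
  · simp [pw_of_nonpos γ hx]

/-- Weighted estimates for the time derivative and for the tangential second derivatives. -/
lemma exists_wN_le_modes (n : ℕ) (hp : 1 < p) {α γ : ℝ} (hα : α ∈ Ioo (0 : ℝ) 2)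
    (hγ₁ : p * max (α - 1) 0 - 1 < γ) (hγ₂ : γ < 2 * p - 1) :
    ∃ C : ℝ≥0∞, C ≠ ⊤ ∧ ∀ lam : ℝ, 0 ≤ lam → ∀ u : ℝ × Ed (n + 1) → ℝ, IsHT u →
      wN γ p (fun z => xl z ^ (-α) * (dd et u z + lam * u z)) ≤ C * wN γ p (fop α lam u) ∧
      ∀ (i : Fin n) (j : Fin (n + 1)),
        wN γ p (dd (ex (eb i.castSucc)) (dd (ex (eb j)) u)) ≤ C * wN γ p (fop α lam u) := by
  have hp0 : 0 < p := by linarith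
  obtain ⟨ε, N, hε, hε', hN, hloc⟩ := exists_local_bounds n hp hα
  have hγα : p * (1 - (2 - α)) - (γ + 1) < 0 := by
    have := mul_le_mul_of_nonneg_left (le_max_left (α - 1) 0) hp0.le
    linarith
  have hγ0 : p * (1 - 1) - (γ + 1) < 0 := by
    have := mul_nonneg hp0.le (le_max_right (α - 1) 0)
    linarith
  obtain ⟨Λ, hΛ, C, hC, h⟩ := wn_le_of_local_absorb (n := n) hp hγ₂ hε hε' N hγα
  obtain ⟨Λ', hΛ', C', hC', h'⟩ := wn_le_of_local_absorb (n := n) hp hγ₂ hε hε' N hγ0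
  have hpi : (0 : ℝ) ≤ p⁻¹ := by positivity
  refine ⟨C ^ p⁻¹ + C' ^ p⁻¹, ENNReal.add_ne_top.2 ⟨ENNReal.rpow_ne_top_of_nonneg hpi hC,
    ENNReal.rpow_ne_top_of_nonneg hpi hC'⟩, fun lam hl u hu => ⟨?_, fun i j => ?_⟩⟩
  · have hf := (isHT_fop hu α lam).test.measurable
    have hQ : IsHT (fun z => xl z ^ (2 - α - 2) * gen lam (-et) u z) := by
      rw [gen_neg_et]
      exact ((hu.dd et).add (hu.const_mul lam)).rpow_mul _
    have e : (fun z => xl z ^ (-α) * (dd et u z + lam * u z)) =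
        fun z => xl z ^ (2 - α - 2) * gen lam (-et) u z := by
      rw [gen_neg_et, show 2 - α - 2 = -α by ring]
    rw [e]
    refine (wN_le_of_wn_le hp0 hf hQ.test.measurable (h _ _ _ hf hQ.test.measurable
      hQ.test.measurable (hQ.wn_ne_top hp0 γ) fun G hG r hr => ?_)).trans
      (mul_le_mul_left le_self_add _)
    rw [or_self] at hG
    rw [hG, add_assoc, ← mul_add]
    exact (hloc lam hl u hu r Λ hr hΛ).1
  · have hf := (isHT_fop hu α lam).test.measurable
    have hQ₀ : IsHT (fun z => xl z ^ ((1 : ℝ) - 2) * gen 0 (-ex (eb i.castSucc)) u z) := by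
      rw [gen_zero_neg]
      exact (hu.dd _).rpow_mul _
    have hQ := (hu.dd (ex (eb j))).dd (ex (eb i.castSucc))
    refine (wN_le_of_wn_le hp0 hf hQ.test.measurable (h' _ _ _ hf hQ.test.measurable
      hQ₀.test.measurable (hQ₀.wn_ne_top hp0 γ) fun G hG r hr => ?_)).trans
      (mul_le_mul_left le_add_self _)
    rw [add_assoc, ← mul_add]
    refine (hloc lam hl u hu r Λ' hr hΛ').2 i G ?_
    rcases hG with rfl | rfl
    · exact Or.inl ⟨j, rfl⟩
    · exact Or.inr rfl

/-- The weighted a priori estimate for test functions. -/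
lemma exists_wN_le (n : ℕ) (hp : 1 < p) {α γ : ℝ} (hα : α ∈ Ioo (0 : ℝ) 2)
    (hγ₁ : p * max (α - 1) 0 - 1 < γ) (hγ₂ : γ < 2 * p - 1) :
    ∃ C : ℝ≥0∞, C ≠ ⊤ ∧ ∀ lam : ℝ, 0 ≤ lam → ∀ u : ℝ × Ed (n + 1) → ℝ, IsHT u →
      wN γ p (fun z => xl z ^ (-α) * dd et u z) +
        ENNReal.ofReal lam * wN γ p (fun z => xl z ^ (-α) * u z) +
        ∑ q : Fin (n + 1) × Fin (n + 1), wN γ p (dd (ex (eb q.1)) (dd (ex (eb q.2)) u)) ≤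
      C * wN γ p (fop α lam u) := by
  obtain ⟨C, hC, h⟩ := exists_wN_le_modes n hp hα hγ₁ hγ₂
  have hp1 : (1 : ℝ≥0∞) ≤ ENNReal.ofReal p := by
    rw [← ENNReal.ofReal_one]; exact ENNReal.ofReal_le_ofReal hp.le
  set C₁ : ℝ≥0∞ := (n + 1) * C + 1 with hC₁
  have hCC : C ≤ C₁ := by
    rw [hC₁, add_mul, one_mul]
    exact le_add_self.trans le_self_add
  have hnat : (n : ℝ≥0∞) ≠ ⊤ := ENNReal.natCast_ne_top n
  have hC₁' : C₁ ≠ ⊤ := ENNReal.add_ne_top.2 ⟨ENNReal.mul_ne_top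
    (ENNReal.add_ne_top.2 ⟨hnat, ENNReal.one_ne_top⟩) hC, ENNReal.one_ne_top⟩
  refine ⟨2 * C + C + ∑ q : Fin (n + 1) × Fin (n + 1), C₁, ?_, fun lam hl u hu => ?_⟩
  · refine ENNReal.add_ne_top.2 ⟨ENNReal.add_ne_top.2 ⟨ENNReal.mul_ne_top (by norm_num) hC, hC⟩, ?_⟩
    exact (ENNReal.sum_lt_top.2 fun _ _ => hC₁'.lt_top).ne
  obtain ⟨ht, hij⟩ := h lam hl u hu
  set F := wN γ p (fop α lam u) with hF
  have hmt : AEStronglyMeasurable (fun z => xl z ^ (-α) * (dd et u z + lam * u z)) (wm n γ) :=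
    (((hu.dd et).add (hu.const_mul lam)).rpow_mul (-α)).test.measurable.aestronglyMeasurable
  have hmu : AEStronglyMeasurable (fun z => xl z ^ (-α) * u z) (wm n γ) :=
    (hu.rpow_mul (-α)).test.measurable.aestronglyMeasurable
  have hmD : ∀ i j, AEStronglyMeasurable (dd (ex (eb i)) (dd (ex (eb j)) u)) (wm n γ) :=
    fun i j => ((hu.dd (ex (eb j))).dd (ex (eb i))).test.measurable.aestronglyMeasurable
  have hlam := (wN_damping_le hp γ α hl hu).trans ht
  have hut : wN γ p (fun z => xl z ^ (-α) * dd et u z) ≤ 2 * C * F := by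
    refine (eLpNorm_le_two_of_abs_le hp1 zero_le_one hl hmt hmu
      (Filter.Eventually.of_forall fun z => ?_)).trans ?_
    · rw [one_mul, ← abs_of_nonneg hl, ← abs_mul, abs_of_nonneg hl]
      refine (le_of_eq ?_).trans (abs_sub _ _)
      ring_nf
    · rw [ENNReal.ofReal_one, one_mul, two_mul, add_mul]
      exact add_le_add ht hlam
  have htan : ∀ i j : Fin (n + 1), (i ≠ Fin.last n ∨ j ≠ Fin.last n) →
      wN γ p (dd (ex (eb i)) (dd (ex (eb j)) u)) ≤ C * F := fun i j hne => by
    rcases hne with h1 | h1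
    · obtain ⟨i, rfl⟩ := Fin.exists_castSucc_eq.2 h1
      exact hij i j
    · obtain ⟨j, rfl⟩ := Fin.exists_castSucc_eq.2 h1
      rw [dd_comm hu.test]
      exact hij j i
  have hnn : wN γ p (dd (ex (eb (Fin.last n))) (dd (ex (eb (Fin.last n))) u)) ≤ C₁ * F := by
    have h1 : wN γ p (fun z => ∑ i : Fin n, dd (ex (eb i.castSucc)) (dd (ex (eb i.castSucc)) u) z) ≤
        ∑ i : Fin n, ENNReal.ofReal 1 *
          wN γ p (dd (ex (eb i.castSucc)) (dd (ex (eb i.castSucc)) u)) :=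
      eLpNorm_le_sum_of_abs_le hp1 Finset.univ (fun _ => zero_le_one) (fun i => hmD _ _)
        (Filter.Eventually.of_forall fun z => by
          simpa using Finset.abs_sum_le_sum_abs _ _)
    have hms : AEStronglyMeasurable (fun z => ∑ i : Fin n,
        dd (ex (eb i.castSucc)) (dd (ex (eb i.castSucc)) u) z) (wm n γ) :=
      (IsHT.sum Finset.univ fun i : Fin n => (hu.dd (ex (eb i.castSucc))).dd
        (ex (eb i.castSucc))).test.measurable.aestronglyMeasurable
    refine (eLpNorm_le_three_of_abs_le hp1 zero_le_one zero_le_one zero_le_one hmt hms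
      (isHT_fop hu α lam).test.measurable.aestronglyMeasurable
      (Filter.Eventually.of_forall fun z => ?_)).trans ?_
    · rw [one_mul, one_mul, one_mul]
      refine (le_of_eq ?_).trans ((abs_sub _ _).trans (add_le_add (abs_sub _ _) le_rfl))
      rw [fop, lapl, Fin.sum_univ_castSucc]
      ring_nf
    · rw [ENNReal.ofReal_one, one_mul, one_mul, one_mul]
      calc _ ≤ C * F + ∑ i : Fin n, C * F + F := by
            refine add_le_add (add_le_add ht (h1.trans (Finset.sum_le_sum fun i _ => ?_))) le_rfl
            rw [ENNReal.ofReal_one, one_mul]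
            exact hij i _
        _ = C₁ * F := by
            rw [Finset.sum_const, Finset.card_univ, Fintype.card_fin, nsmul_eq_mul, hC₁]
            ring
  rw [add_mul, add_mul, Finset.sum_mul]
  refine add_le_add (add_le_add hut hlam) (Finset.sum_le_sum fun q _ => ?_)
  by_cases hq : q.1 = Fin.last n ∧ q.2 = Fin.last n
  · rw [hq.1, hq.2]; exact hnn
  · exact (htan _ _ (not_and_or.1 hq)).trans (mul_le_mul_left hCC _)

end WeightedSpace

section Coordinates

variable {d n : ℕ}

lemma xd_eq_xl (z : ℝ × Ed (n + 1)) : xd z.2 = xl z := by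
  rw [xd, dif_pos n.succ_pos, xl_apply]
  rfl

lemma ut_eq_dd {u : ℝ × Ed d → ℝ} (hu : IsTest u) (z : ℝ × Ed d) : ut u z = dd et u z := by
  have h := (hu.differentiable z).hasFDerivAt.comp_hasDerivAt z.1
    ((hasDerivAt_id z.1).prodMk (hasDerivAt_const z.1 z.2))
  exact h.deriv

lemma hasFDerivAt_slice {E : Type*} [NormedAddCommGroup E] [NormedSpace ℝ E] {φ : ℝ × Ed d → E}
    (hφ : Differentiable ℝ φ) (z : ℝ × Ed d) :
    HasFDerivAt (fun y => φ (z.1, y))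
      ((fderiv ℝ φ z).comp (ContinuousLinearMap.inr ℝ ℝ (Ed d))) z.2 :=
  (hφ z).hasFDerivAt.comp z.2 (hasFDerivAt_prodMk_right z.1 z.2)

lemma Du_eq {u : ℝ × Ed d → ℝ} (hu : IsTest u) (z : ℝ × Ed d) :
    Du u z = (fderiv ℝ u z).comp (ContinuousLinearMap.inr ℝ ℝ (Ed d)) :=
  (hasFDerivAt_slice hu.differentiable z).fderiv

lemma contDiff_Du {u : ℝ × Ed d → ℝ} (hu : IsTest u) : ContDiff ℝ (⊤ : ℕ∞) (Du u) := by
  rw [show Du u = fun z => (fderiv ℝ u z).comp (ContinuousLinearMap.inr ℝ ℝ (Ed d)) from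
    funext (Du_eq hu)]
  exact (hu.contDiff.fderiv_right (m := (⊤ : ℕ∞)) (by simp)).clm_comp contDiff_const

lemma continuous_D2u {u : ℝ × Ed d → ℝ} (hu : IsTest u) : Continuous (D2u u) := by
  rw [show D2u u = fun z => (fderiv ℝ (Du u) z).comp (ContinuousLinearMap.inr ℝ ℝ (Ed d)) from
    funext fun z => (hasFDerivAt_slice ((contDiff_Du hu).differentiable (by simp)) z).fderiv]
  exact ((contDiff_Du hu).continuous_fderiv (by simp)).clm_comp continuous_const

lemma D2u_eq_dd {u : ℝ × Ed d → ℝ} (hu : IsTest u) (z : ℝ × Ed d) (v w : Ed d) :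
    D2u u z v w = dd (ex v) (dd (ex w) u) z := by
  have h1 : Differentiable ℝ (Du u) := (contDiff_Du hu).differentiable (by simp)
  have h2 : HasFDerivAt (fun y => Du u (z.1, y) w) ((D2u u z).flip w) z.2 := by
    have := (hasFDerivAt_slice h1 z).differentiableAt.hasFDerivAt.clm_apply
      (hasFDerivAt_const w z.2)
    refine this.congr_fderiv ?_
    ext v
    simp [D2u]
  have h3 := hasFDerivAt_slice (hu.dd (ex w)).differentiable z
  have h4 : (fun y => Du u (z.1, y) w) = fun y => dd (ex w) u (z.1, y) := by
    funext y; rw [Du_eq hu]; rfl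
  rw [h4] at h2
  exact congrArg (fun L : Ed d →L[ℝ] ℝ => L v) (h2.unique h3)

lemma lap_eq_lapl {u : ℝ × Ed d → ℝ} (hu : IsTest u) (z : ℝ × Ed d) : lap u z = lapl u z :=
  Finset.sum_congr rfl fun _ _ => D2u_eq_dd hu z _ _

lemma opNorm_le_sum_eb {E : Type*} [NormedAddCommGroup E] [NormedSpace ℝ E] (L : Ed d →L[ℝ] E) :
    ‖L‖ ≤ ∑ i, ‖L (eb i)‖ := by
  refine L.opNorm_le_bound (Finset.sum_nonneg fun _ _ => norm_nonneg _) fun x => ?_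
  have hx : x = ∑ i, x i • (eb i : Ed d) := by
    ext j
    simp [eb, Pi.single_apply]
  conv_lhs => rw [hx]
  rw [map_sum, Finset.sum_mul]
  refine (norm_sum_le _ _).trans (Finset.sum_le_sum fun i _ => ?_)
  rw [map_smul, norm_smul, mul_comm]
  exact mul_le_mul_of_nonneg_left (PiLp.norm_apply_le x i) (norm_nonneg _)

lemma norm_D2u_le {u : ℝ × Ed d → ℝ} (hu : IsTest u) (z : ℝ × Ed d) :
    ‖D2u u z‖ ≤ ∑ q : Fin d × Fin d, |dd (ex (eb q.1)) (dd (ex (eb q.2)) u) z| := by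
  rw [Fintype.sum_prod_type]
  refine (opNorm_le_sum_eb _).trans (Finset.sum_le_sum fun i _ => (opNorm_le_sum_eb _).trans ?_)
  exact Finset.sum_le_sum fun j _ => (congrArg norm (D2u_eq_dd hu z _ _)).le

lemma isOpen_OmegaT (T : EReal) : IsOpen (OmegaT (n + 1) T) := by
  simp only [OmegaT, xd_eq_xl]
  exact (isOpen_lt (continuous_coe_real_ereal.comp continuous_fst) continuous_const).inter
    (isOpen_lt continuous_const xl.continuous)

lemma isHT_of_tsupport_subset {T : EReal} {u : ℝ × Ed (n + 1) → ℝ}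
    (hu : IsTest u) (h : tsupport u ⊆ OmegaT (n + 1) T) : IsHT u := by
  refine ⟨hu, ?_⟩
  rcases (tsupport u).eq_empty_or_nonempty with he | hne
  · exact ⟨1, one_pos, fun z _ => image_eq_zero_of_notMem_tsupport (by simp [he])⟩
  · obtain ⟨z₀, hz₀, hmin⟩ := hu.compact.isCompact.exists_isMinOn hne xl.continuous.continuousOn
    refine ⟨xl z₀, by rw [← xd_eq_xl]; exact (h hz₀).2, fun z hz => ?_⟩
    exact image_eq_zero_of_notMem_tsupport fun hz' => (hmin hz').not_gt hz

variable {p : ℝ}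

lemma ofReal_weight_eq (hp : 0 < p) (γ : ℝ) (g : ℝ × Ed (n + 1) → ℝ) {z : ℝ × Ed (n + 1)}
    (hz : 0 < xl z) : ENNReal.ofReal (|g z| ^ p * xd z.2 ^ γ) = pw γ (xl z) * ‖g z‖ₑ ^ p := by
  rw [xd_eq_xl, ENNReal.ofReal_mul (by positivity), pw_of_pos γ hz, mul_comm,
    Real.enorm_eq_ofReal_abs, ENNReal.ofReal_rpow_of_nonneg (abs_nonneg _) hp.le]

lemma wLp_rpow_eq (hp : 0 < p) (T : EReal) (γ : ℝ) (g : ℝ × Ed (n + 1) → ℝ) :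
    wLp (n + 1) T p γ g ^ p = ∫⁻ z in OmegaT (n + 1) T, pw γ (xl z) * ‖g z‖ₑ ^ p := by
  rw [wLp, ← ENNReal.rpow_mul, one_div_mul_cancel hp.ne', ENNReal.rpow_one]
  refine setLIntegral_congr_fun (isOpen_OmegaT T).measurableSet fun z hz => ?_
  exact ofReal_weight_eq hp γ g (by rw [← xd_eq_xl]; exact hz.2)

lemma wLp_le_wN (hp : 0 < p) (T : EReal) (γ : ℝ) {g : ℝ × Ed (n + 1) → ℝ} (hg : Measurable g) :
    wLp (n + 1) T p γ g ≤ wN γ p g := by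
  rw [← ENNReal.rpow_le_rpow_iff hp, wLp_rpow_eq hp, wN_rpow_eq_lintegral hp γ hg]
  exact setLIntegral_le_lintegral _ _

lemma wN_le_wLp (hp : 0 < p) (T : EReal) (γ : ℝ) {g : ℝ × Ed (n + 1) → ℝ} (hg : Measurable g)
    (h : ∀ z ∉ OmegaT (n + 1) T, g z = 0) : wN γ p g ≤ wLp (n + 1) T p γ g := by
  rw [← ENNReal.rpow_le_rpow_iff hp, wLp_rpow_eq hp, wN_rpow_eq_lintegral hp γ hg,
    ← lintegral_indicator (isOpen_OmegaT T).measurableSet]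
  refine lintegral_mono fun z => ?_
  by_cases hz : z ∈ OmegaT (n + 1) T
  · rw [indicator_of_mem hz]
  · simp [h z hz, hp]

lemma dd_eq_zero_of_notMem_tsupport {φ : ℝ × Ed d → ℝ} {z : ℝ × Ed d} (hz : z ∉ tsupport φ)
    (v : ℝ × Ed d) : dd v φ z = 0 := by
  rw [dd, image_eq_zero_of_notMem_tsupport fun h => hz (tsupport_fderiv_subset ℝ h)]
  rfl

lemma tsupport_dd_subset (v : ℝ × Ed d) (φ : ℝ × Ed d → ℝ) : tsupport (dd v φ) ⊆ tsupport φ :=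
  closure_minimal (fun z hz => by
    by_contra h
    exact hz (dd_eq_zero_of_notMem_tsupport h v)) (isClosed_tsupport φ)

lemma fop_eq_zero_of_notMem_tsupport (α lam : ℝ) {u : ℝ × Ed (n + 1) → ℝ} {z : ℝ × Ed (n + 1)}
    (hz : z ∉ tsupport u) : fop α lam u z = 0 := by
  simp [fop, lapl, dd_eq_zero_of_notMem_tsupport hz, image_eq_zero_of_notMem_tsupport hz,
    dd_eq_zero_of_notMem_tsupport fun h => hz (tsupport_dd_subset _ u h)]

end Coordinates

/-- Prototypical a priori estimate for the model equation
`u_t + λ u - x_d^α Δ u = x_d^α f` in `Ω_T` (Theorem 1.1, estimate (1.6)). -/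
theorem stmt0 (d : ℕ) (hd : 1 ≤ d) (α p γ : ℝ)
    (hα : α ∈ Set.Ioo (0 : ℝ) 2) (hp : 1 < p)
    (hγ₁ : p * max (α - 1) 0 - 1 < γ) (hγ₂ : γ < 2 * p - 1) :
    ∃ N : ℝ, 0 < N ∧
      ∀ (T : EReal) (lam : ℝ), 0 < lam →
        ∀ u : ℝ × Ed d → ℝ, ContDiff ℝ (⊤ : ℕ∞) u → HasCompactSupport u →
          tsupport u ⊆ OmegaT d T →
          wLp d T p γ (fun z => xd z.2 ^ (-α) * ut u z)
            + ENNReal.ofReal lam * wLp d T p γ (fun z => xd z.2 ^ (-α) * u z)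
            + wLp d T p γ (fun z => ‖D2u u z‖)
          ≤ ENNReal.ofReal N *
              wLp d T p γ
                (fun z => xd z.2 ^ (-α) * (ut u z + lam * u z) - lap u z) := by
  obtain ⟨n, rfl⟩ : ∃ n, d = n + 1 := ⟨d - 1, by omega⟩
  have hp0 : 0 < p := by linarith
  have hp1 : (1 : ℝ≥0∞) ≤ ENNReal.ofReal p := by
    rw [← ENNReal.ofReal_one]; exact ENNReal.ofReal_le_ofReal hp.le
  obtain ⟨C, hC, h⟩ := exists_wN_le n hp hα hγ₁ hγ₂
  refine ⟨C.toReal + 1, by positivity, fun T lam hl u hu hc hs => ?_⟩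
  have ht : IsTest u := ⟨hu, hc⟩
  have hT := isHT_of_tsupport_subset ht hs
  simp only [xd_eq_xl, ut_eq_dd ht, lap_eq_lapl ht]
  have hCN : C ≤ ENNReal.ofReal (C.toReal + 1) := by
    rw [ENNReal.le_ofReal_iff_toReal_le hC (by positivity)]
    linarith
  have hD : Measurable fun z => ‖D2u u z‖ :=
    (Continuous.norm (E := Ed (n + 1) →L[ℝ] Ed (n + 1) →L[ℝ] ℝ) (continuous_D2u ht)).measurable
  have hD2 : wN γ p (fun z => ‖D2u u z‖) ≤
      ∑ q : Fin (n + 1) × Fin (n + 1), wN γ p (dd (ex (eb q.1)) (dd (ex (eb q.2)) u)) := by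
    have := eLpNorm_le_sum_of_abs_le (μ := wm n γ) hp1 Finset.univ
      (c := fun _ : Fin (n + 1) × Fin (n + 1) => 1)
      (g := fun q => dd (ex (eb q.1)) (dd (ex (eb q.2)) u)) (fun _ => zero_le_one)
      (fun q => ((ht.dd (ex (eb q.2))).dd (ex (eb q.1))).measurable.aestronglyMeasurable)
      (f := fun z => ‖D2u u z‖)
      (Filter.Eventually.of_forall fun z => by
        simpa [abs_of_nonneg (norm_nonneg (D2u u z))] using norm_D2u_le ht z)
    simpa using this
  refine (add_le_add (add_le_add (wLp_le_wN hp0 T γ ((hT.dd et).rpow_mul (-α)).test.measurable)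
    (mul_le_mul_right (wLp_le_wN hp0 T γ (hT.rpow_mul (-α)).test.measurable) _))
    ((wLp_le_wN hp0 T γ hD).trans hD2)).trans ((h lam hl.le u hT).trans ?_)
  exact mul_le_mul' hCN (wN_le_wLp hp0 T γ (isHT_fop hT α lam).test.measurable
    fun z hz => fop_eq_zero_of_notMem_tsupport α lam fun h => hz (hs h))
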